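/- Let η_+(t) = h_H(t) · t e^{−t²/2} with H = 200, and let x ≥ 10^{12} be a real number. Then ∑_{n=1}^∞ Λ(n) (log n) η_+²(n/x) = x · ∫_0^∞ η_+²(t) log(xt) dt + E₁ · x log x = 0.640206 x log x − 0.021095 x + E₂ · x log x, where |E₁| ≤ 1.536·10^{−15} + 310.84/√x and |E₂| ≤ 2·10^{−6} + 310.84/√x. -/

import Mathlib

open MeasureTheory Set

/-- `h(t) = t²(2-t)³ e^{t-1/2}` on `[0,2]`, and `0` elsewhere. -/
noncomputable def hcut (t : ℝ) : ℝ :=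
  if t ∈ Set.Icc (0:ℝ) 2 then t^2 * (2 - t)^3 * Real.exp (t - 1/2) else 0

/-- The kernel `F_H(y) = sin(H log y)/(π log y)`. -/
noncomputable def FH (H y : ℝ) : ℝ := Real.sin (H * Real.log y) / (Real.pi * Real.log y)

/-- `h_H = h ∗_M F_H`, the band-limited approximation to `h`. -/
noncomputable def hH (H t : ℝ) : ℝ := ∫ y in Set.Ioi (0:ℝ), hcut (t / y) * FH H y / y

/-- `η₊(t) = h_H(t) · t e^{-t²/2}`. -/
noncomputable def etaPlus (H t : ℝ) : ℝ := hH H t * (t * Real.exp (-t^2 / 2))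

open Filter Topology

/-- Zeros split off an entire function. -/
theorem hd_factor (F : ℂ → ℂ) (hF : Differentiable ℂ F) (h0 : F 0 ≠ 0) (s : Finset ℂ) :
    ∃ g : ℂ → ℂ, Differentiable ℂ g ∧
      (∀ z, F z = (∏ r ∈ s, (z - r) ^ analyticOrderNatAt F r) * g z) ∧ ∀ r ∈ s, g r ≠ 0 := by
  have han : ∀ z, AnalyticAt ℂ F z := fun z => hF.analyticAt z
  have htop : ∀ z, analyticOrderAt F z ≠ ⊤ := by
    intro z h
    rw [analyticOrderAt_eq_top] at h
    have := AnalyticOnNhd.eqOn_zero_of_preconnected_of_eventuallyEq_zero (f := F) (U := univ)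
      (fun z _ => han z) isPreconnected_univ (mem_univ z) h (mem_univ 0)
    exact h0 this
  induction s using Finset.induction_on with
  | empty => exact ⟨F, hF, by simp, by simp⟩
  | insert a s ha ih =>
    obtain ⟨g, hg, hgF, hgs⟩ := ih
    obtain ⟨k, hk, hka, hke⟩ := ((han a).analyticOrderNatAt_eq_iff (htop a)).1 rfl
    obtain ⟨m, hm⟩ : ∃ m, m = analyticOrderNatAt F a := ⟨_, rfl⟩
    rw [← hm] at hke
    set P : ℂ → ℂ := fun z => ∏ r ∈ s, (z - r) ^ analyticOrderNatAt F r with hP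
    have hPa : P a ≠ 0 := by
      simp only [hP]
      refine Finset.prod_ne_zero_iff.2 fun r hr => pow_ne_zero _ (sub_ne_zero.2 ?_)
      rintro rfl; exact ha hr
    have hPd : Differentiable ℂ P := by
      simp only [hP]; fun_prop
    set g' : ℂ → ℂ := fun z => if z = a then k a / P a else g z / (z - a) ^ m with hg'
    have hloc : g' =ᶠ[𝓝 a] fun z => k z / P z := by
      have h1 : ∀ᶠ z in 𝓝 a, P z ≠ 0 := hPd.continuous.continuousAt.eventually_ne hPa
      filter_upwards [h1, hke] with z hz hz2
      by_cases hza : z = a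
      · simp [hg', hza]
      · have h3 : (z - a) ^ m ≠ 0 := pow_ne_zero _ (sub_ne_zero.2 hza)
        simp only [hg', hza, if_false]
        rw [div_eq_div_iff h3 hz]
        have := hgF z
        rw [hz2, smul_eq_mul] at this
        linear_combination -this
    refine ⟨g', ?_, ?_, ?_⟩
    · intro z
      by_cases hza : z = a
      · subst hza
        exact hloc.differentiableAt_iff.2 (hk.differentiableAt.div (hPd z) hPa)
      · have : g' =ᶠ[𝓝 z] fun z => g z / (z - a) ^ m := by
          filter_upwards [isOpen_ne.mem_nhds hza] with w hw
          simp only [hg']; rw [if_neg hw]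
        refine this.differentiableAt_iff.2 ((hg z).div (by fun_prop) (pow_ne_zero _ (sub_ne_zero.2 hza)))
    · intro z
      rw [Finset.prod_insert ha, ← hm]
      by_cases hza : z = a
      · have h2 := hloc.self_of_nhds
        have h3 := hke.self_of_nhds
        rw [hza, h2, h3, smul_eq_mul]
        change _ = (_ * P a) * _
        field_simp
      · have h3 : (z - a) ^ m ≠ 0 := pow_ne_zero _ (sub_ne_zero.2 hza)
        simp only [hg', hza, if_false]
        rw [hgF z]; change P z * _ = ((_ * P z) * _)
        field_simp
    · intro r hr
      rcases Finset.mem_insert.1 hr with hr' | hr'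
      · rw [hr', hloc.self_of_nhds]; exact div_ne_zero hka hPa
      · have hra : r ≠ a := fun h => ha (h ▸ hr')
        simp only [hg', hra, if_false]
        exact div_ne_zero (hgs r hr') (pow_ne_zero _ (sub_ne_zero.2 hra))

theorem hd_logbound (g : ℂ → ℂ) (hg : Differentiable ℂ g) (R M : ℝ) (hR : 0 < R) (hM : 0 < M)
    (hz : ∀ z ∈ Metric.ball (0:ℂ) R, g z ≠ 0)
    (hb : ∀ z ∈ Metric.ball (0:ℂ) R, ‖g z‖ ≤ Real.exp M * ‖g 0‖) (h0 : deriv g 0 = 0)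
    (z : ℂ) (hzR : ‖z‖ < R / 4) : ‖deriv g z / g z‖ ≤ 32 * M * ‖z‖ / R ^ 2 := by
  have hd : DifferentiableOn ℂ (fun z => deriv g z / g z) (Metric.ball 0 R) := by
    intro w hw
    exact ((hg.deriv w).div (hg w) (hz w hw)).differentiableWithinAt
  obtain ⟨η, hη0, hη⟩ := hd.isExactOn_ball.with_val_at 0 0
  have g0 : g 0 ≠ 0 := hz 0 (by simpa using hR)
  have hexp : ∀ w ∈ Metric.ball (0:ℂ) R, g w * Complex.exp (-η w) = g 0 := by
    intro w hw
    have := (convex_ball (0:ℂ) R).is_const_of_fderivWithin_eq_zero (𝕜 := ℂ)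
      (f := fun w => g w * Complex.exp (-η w)) (x := w) (y := 0) ?_ ?_ hw (by simpa using hR)
    · simpa [hη0] using this
    · intro x hx
      exact ((hg x).mul ((hη x hx).differentiableAt.neg.cexp)).differentiableWithinAt
    · intro x hx
      have h1 : HasDerivAt (fun w => g w * Complex.exp (-η w)) 0 x := by
        have := ((hg x).hasDerivAt).mul ((hη x hx).neg.cexp)
        have h3 := hz x hx
        have h4 : deriv g x * Complex.exp ((-η) x) + g x * (Complex.exp ((-η) x) * -(deriv g x / g x)) = 0 := by
          field_simp; ring
        rw [h4] at this
        exact this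
      have := h1.hasFDerivAt.hasFDerivWithinAt (s := Metric.ball 0 R)
      rw [this.fderivWithin (Metric.isOpen_ball.uniqueDiffWithinAt hx)]; ext; simp
  have hre : MapsTo η (Metric.ball 0 R) {z | z.re ≤ M} := by
    intro w hw
    have h1 := congrArg norm (hexp w hw)
    rw [norm_mul, Complex.norm_exp, Complex.neg_re] at h1
    have h2 := hb w hw
    rw [← h1] at h2
    have h3 : 0 < ‖g w‖ := norm_pos_iff.2 (hz w hw)
    have h4 : 1 ≤ Real.exp (M - (η w).re) := by
      rw [sub_eq_add_neg, Real.exp_add]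
      have : ‖g w‖ * 1 ≤ ‖g w‖ * (Real.exp M * Real.exp (-(η w).re)) := by linarith
      exact le_of_mul_le_mul_left this h3
    have := Real.one_le_exp_iff.1 h4
    simpa using by linarith
  have hηd : DifferentiableOn ℂ η (Metric.ball 0 R) := fun w hw =>
    (hη w hw).differentiableAt.differentiableWithinAt
  have hB : ∀ w, ‖w‖ ≤ R / 2 → ‖η w‖ ≤ 2 * M := by
    intro w hw
    have h1 := Complex.borelCaratheodory_zero hM hηd hre hR (z := w)
      (by simp; linarith) hη0
    refine h1.trans ?_
    rw [div_le_iff₀ (by linarith)]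
    nlinarith [norm_nonneg w]
  have hq : ∀ w, ‖w‖ < R / 4 → ‖deriv g w / g w‖ ≤ 8 * M / R := by
    intro w hw
    have hwR : w ∈ Metric.ball (0:ℂ) R := by simp; linarith
    rw [← (hη w hwR).deriv]
    have := Complex.norm_deriv_le_of_forall_mem_sphere_norm_le (c := w) (R := R / 4) (C := 2 * M)
      (f := η) (by linarith) ?_ ?_
    · refine this.trans (le_of_eq ?_); field_simp; ring
    · refine (hηd.mono ?_).diffContOnCl
      refine (Metric.closure_ball_subset_closedBall).trans fun y hy => ?_
      have : ‖y - w‖ ≤ R / 4 := by simpa [dist_eq_norm] using hy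
      have h2 := norm_le_norm_sub_add y w
      simp; linarith
    · intro y hy
      have : ‖y - w‖ = R / 4 := by simpa [dist_eq_norm] using hy
      have h2 := norm_le_norm_sub_add y w
      exact hB y (by linarith)
  have hS := Complex.dist_le_div_mul_dist_of_mapsTo_ball (f := fun z => deriv g z / g z) (c := 0) (R₁ := R / 4)
    (R₂ := 8 * M / R) (z := z) (hd.mono (Metric.ball_subset_ball (by linarith))) ?_ (by simpa using hzR)
  · simp only [h0, zero_div, dist_zero_right] at hS
    refine hS.trans (le_of_eq ?_)
    field_simp; ring
  · intro w hw
    simp only [h0, zero_div, Metric.mem_closedBall, dist_zero_right]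
    exact hq w (by simpa using hw)

theorem hd_zeros_finite (F : ℂ → ℂ) (hF : Differentiable ℂ F) (h0 : F 0 ≠ 0) (R : ℝ) :
    {z : ℂ | ‖z‖ ≤ R ∧ F z = 0}.Finite := by
  by_contra hinf
  have hinf : {z : ℂ | ‖z‖ ≤ R ∧ F z = 0}.Infinite := hinf
  obtain ⟨z, hz, hacc⟩ := hinf.exists_accPt_of_subset_isCompact (isCompact_closedBall (0:ℂ) R)
    (fun z hz => by simpa using hz.1)
  have han : AnalyticOnNhd ℂ F univ := fun z _ => hF.analyticAt z
  have hfr : ∃ᶠ w in 𝓝[≠] z, F w = 0 := by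
    rw [accPt_iff_frequently_nhdsNE] at hacc
    exact hacc.mono fun w hw => hw.2
  exact h0 (han.eqOn_zero_of_preconnected_of_frequently_eq_zero isPreconnected_univ (mem_univ z) hfr
    (mem_univ 0))

noncomputable def hdZ (F : ℂ → ℂ) (hF : Differentiable ℂ F) (h0 : F 0 ≠ 0) (R : ℝ) : Finset ℂ :=
  (hd_zeros_finite F hF h0 R).toFinset

theorem hd_order_neg (F : ℂ → ℂ) (hF : Differentiable ℂ F) (hev : ∀ z, F (-z) = F z) (r : ℂ) :
    analyticOrderNatAt F (-r) = analyticOrderNatAt F r := by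
  have h1 : analyticOrderAt (F ∘ fun z => -z) r = analyticOrderAt F (-r) := by
    have := analyticOrderAt_comp_of_deriv_ne_zero (f := F) (g := fun z : ℂ => -z) (z₀ := r) (by fun_prop) (by simp)
    simpa using this
  have h2 : (F ∘ fun z => -z) = F := by ext z; simp [hev]
  rw [h2] at h1
  simp [analyticOrderNatAt, h1]

theorem hd_tendsto (F : ℂ → ℂ) (hF : Differentiable ℂ F) (h0 : F 0 ≠ 0) (hev : ∀ z, F (-z) = F z)
    (M : ℝ → ℝ) (hMpos : ∀ R, 0 < M R)
    (hM : ∀ R, 1 ≤ R → ∀ z, ‖z‖ = 2 * R → ‖F z‖ ≤ Real.exp (M R) * ‖F 0‖)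
    (hMt : Tendsto (fun R => M R / R ^ 2) atTop (𝓝 0)) (z : ℂ) (hz : F z ≠ 0) :
    Tendsto (fun R => ∑ r ∈ hdZ F hF h0 R, (analyticOrderNatAt F r : ℂ) * (1 / (z - r))) atTop
      (𝓝 (deriv F z / F z)) := by
  rw [tendsto_iff_norm_sub_tendsto_zero]
  have hlim : Tendsto (fun R => 32 * ‖z‖ * (M R / R ^ 2)) atTop (𝓝 0) := by
    simpa using hMt.const_mul (32 * ‖z‖)
  refine squeeze_zero' (Eventually.of_forall fun R => norm_nonneg _) ?_ hlim
  filter_upwards [eventually_ge_atTop 1, eventually_gt_atTop (4 * ‖z‖)] with R hR1 hR2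
  set Z := hdZ F hF h0 R with hZ
  have hmem : ∀ w, w ∈ Z ↔ ‖w‖ ≤ R ∧ F w = 0 := by intro w; simp [hZ, hdZ]
  obtain ⟨g, hg, hgF, hgZ⟩ := hd_factor F hF h0 Z
  have hR : 0 < R := by linarith
  have hZneg : ∀ w, w ∈ Z → -w ∈ Z := by
    intro w hw; rw [hmem] at hw ⊢; simpa [hev] using hw
  have hgz : ∀ w ∈ Metric.ball (0:ℂ) R, g w ≠ 0 := by
    intro w hw h
    by_cases hFw : F w = 0
    · exact hgZ w ((hmem w).2 ⟨by simpa using (le_of_lt (by simpa using hw)), hFw⟩) h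
    · apply hFw; rw [hgF w, h, mul_zero]
  -- logarithmic derivative
  have hlog : ∀ w, F w ≠ 0 → deriv F w / F w =
      (∑ r ∈ Z, (analyticOrderNatAt F r : ℂ) * (1 / (w - r))) + deriv g w / g w := by
    intro w hw
    have hP : ∏ r ∈ Z, (w - r) ^ analyticOrderNatAt F r ≠ 0 := by
      intro h; apply hw; rw [hgF w, h, zero_mul]
    have hgw : g w ≠ 0 := by
      intro h; apply hw; rw [hgF w, h, mul_zero]
    have e : F = fun w => (∏ r ∈ Z, (w - r) ^ analyticOrderNatAt F r) * g w := funext hgF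
    have h1 : logDeriv F w = logDeriv (fun w => ∏ r ∈ Z, (w - r) ^ analyticOrderNatAt F r) w + logDeriv g w := by
      conv_lhs => rw [e]
      exact logDeriv_mul w hP hgw (by fun_prop) (hg w)
    have h2 : logDeriv (fun w => ∏ r ∈ Z, (w - r) ^ analyticOrderNatAt F r) w =
        ∑ r ∈ Z, (analyticOrderNatAt F r : ℂ) * (1 / (w - r)) := by
      rw [logDeriv_prod]
      · refine Finset.sum_congr rfl fun r hr => ?_
        rw [logDeriv_fun_pow (by fun_prop)]
        simp [logDeriv_apply]
      · exact fun r hr => Finset.prod_ne_zero_iff.1 hP r hr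
      · intro r hr; fun_prop
    rw [← logDeriv_apply, h1, h2, logDeriv_apply]
  -- symmetry
  have hsym : ∑ r ∈ Z, (analyticOrderNatAt F r : ℂ) * (1 / (0 - r)) = 0 := by
    have h1 : ∑ r ∈ Z, (analyticOrderNatAt F r : ℂ) * (1 / (0 - r)) =
        ∑ r ∈ Z, (analyticOrderNatAt F (-r) : ℂ) * (1 / (0 - (-r))) := by
      refine Finset.sum_nbij' (fun r => -r) (fun r => -r) hZneg hZneg (by simp) (by simp) ?_
      intro r _; simp
    have h2 : ∑ r ∈ Z, (analyticOrderNatAt F (-r) : ℂ) * (1 / (0 - (-r))) =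
        - ∑ r ∈ Z, (analyticOrderNatAt F r : ℂ) * (1 / (0 - r)) := by
      rw [← Finset.sum_neg_distrib]
      refine Finset.sum_congr rfl fun r _ => ?_
      rw [hd_order_neg F hF hev]; simp
    rw [h2] at h1
    exact self_eq_neg.1 h1
  have hF0 : deriv F 0 = 0 := by
    have h1 : deriv (fun z => F (-z)) 0 = - deriv F (-0) := deriv_comp_neg F 0
    rw [show (fun z => F (-z)) = F from funext hev, neg_zero] at h1
    exact self_eq_neg.1 h1
  have g0 : g 0 ≠ 0 := hgz 0 (by simpa using hR)
  have hdg0 : deriv g 0 = 0 := by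
    have := hlog 0 h0
    rw [hF0, zero_div, hsym, zero_add] at this
    have := this.symm
    rw [div_eq_zero_iff] at this
    exact this.resolve_right g0
  have hb : ∀ w ∈ Metric.ball (0:ℂ) R, ‖g w‖ ≤ Real.exp (M R) * ‖g 0‖ := by
    intro w hw
    have hcl : w ∈ closure (Metric.ball (0:ℂ) (2 * R)) :=
      subset_closure (Metric.ball_subset_ball (by linarith) hw)
    refine Complex.norm_le_of_forall_mem_frontier_norm_le (U := Metric.ball (0:ℂ) (2 * R))
      Metric.isBounded_ball hg.diffContOnCl ?_ hcl
    intro y hy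
    rw [frontier_ball (0:ℂ) (by linarith : 2 * R ≠ 0)] at hy
    have hy : ‖y‖ = 2 * R := by simpa using hy
    have h1 := hM R hR1 y hy
    rw [hgF y, hgF 0, norm_mul, norm_mul] at h1
    have h2 : ‖∏ r ∈ Z, (0 - r) ^ analyticOrderNatAt F r‖ ≤ ‖∏ r ∈ Z, (y - r) ^ analyticOrderNatAt F r‖ := by
      rw [norm_prod, norm_prod]
      refine Finset.prod_le_prod (fun r _ => norm_nonneg _) fun r hr => ?_
      rw [norm_pow, norm_pow]
      refine pow_le_pow_left₀ (norm_nonneg _) ?_ _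
      have h3 := ((hmem r).1 hr).1
      have h4 := norm_sub_norm_le y r
      rw [zero_sub, norm_neg]; linarith
    have h5 : 0 < ‖∏ r ∈ Z, (0 - r) ^ analyticOrderNatAt F r‖ := by
      rw [norm_pos_iff]; intro h; apply h0; rw [hgF 0, h, zero_mul]
    have h6 : ‖∏ r ∈ Z, (0 - r) ^ analyticOrderNatAt F r‖ * ‖g y‖ ≤
        ‖∏ r ∈ Z, (0 - r) ^ analyticOrderNatAt F r‖ * (Real.exp (M R) * ‖g 0‖) := by
      calc _ ≤ ‖∏ r ∈ Z, (y - r) ^ analyticOrderNatAt F r‖ * ‖g y‖ :=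
            mul_le_mul_of_nonneg_right h2 (norm_nonneg _)
        _ ≤ _ := by rw [mul_left_comm]; exact h1
    exact le_of_mul_le_mul_left h6 h5
  have := hd_logbound g hg R (M R) hR (hMpos R) hgz hb hdg0 z (by linarith)
  rw [hlog z hz, norm_sub_rev, add_sub_cancel_left]
  refine this.trans (le_of_eq ?_); ring

theorem hd_sum_tendsto {E : Type*} [NormedAddCommGroup E] [NormedSpace ℝ E] [CompleteSpace E]
    (F : ℂ → ℂ) (hF : Differentiable ℂ F) (h0 : F 0 ≠ 0) (f : ℂ → E) (hf : ∀ r, F r ≠ 0 → f r = 0)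
    (b : ℂ → ℝ) (hb : Summable b) (hfb : ∀ r, ‖f r‖ ≤ b r) :
    Tendsto (fun R => ∑ r ∈ hdZ F hF h0 R, f r) atTop (𝓝 (∑' r, f r)) := by
  have h1 : ∀ R, ∑ r ∈ hdZ F hF h0 R, f r = ∑' r, (hdZ F hF h0 R : Set ℂ).indicator f r := by
    intro R
    rw [tsum_eq_sum (s := hdZ F hF h0 R)]
    · exact (Finset.sum_congr rfl fun r hr => by rw [indicator_of_mem (by simpa using hr)])
    · intro r hr; exact indicator_of_notMem (by simpa using hr) _
  simp_rw [h1]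
  refine tendsto_tsum_of_dominated_convergence hb (fun r => ?_) (Eventually.of_forall fun R r => ?_)
  · by_cases hr : F r = 0
    · refine tendsto_const_nhds.congr' ?_
      filter_upwards [eventually_ge_atTop ‖r‖] with R hR
      rw [indicator_of_mem]; simp [hdZ, hr, hR]
    · have := hf r hr
      simp [indicator, this]
  · exact (norm_indicator_le_norm_self _ _).trans (hfb r)

theorem hd_order_zero (F : ℂ → ℂ) (hF : Differentiable ℂ F) (r : ℂ) (h : F r ≠ 0) :
    analyticOrderNatAt F r = 0 := by
  rw [analyticOrderNatAt, (hF.analyticAt r).analyticOrderAt_eq_zero.2 h]; rfl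

theorem hd_natmul_re (n : ℕ) (z : ℂ) : ((n : ℂ) * z).re = n * z.re := by simp

theorem hd_re (z r : ℂ) : (1 / (z - r)).re = (z.re - r.re) / ‖z - r‖ ^ 2 := by
  rw [one_div, Complex.inv_re, Complex.normSq_eq_norm_sq, Complex.sub_re]

theorem hd_cmp (z r : ℂ) (hz : 1 / 2 < z.re) (hr : |r.re| ≤ 1 / 2) :
    ‖1 - r‖ ≤ (1 + ‖1 - z‖ / (z.re - 1 / 2)) * ‖z - r‖ := by
  have h1 : ‖1 - r‖ ≤ ‖1 - z‖ + ‖z - r‖ := by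
    have := norm_add_le (1 - z) (z - r); simpa using this
  have h2 : z.re - 1 / 2 ≤ ‖z - r‖ := by
    have := Complex.re_le_norm (z - r)
    rw [Complex.sub_re] at this; have := abs_le.1 hr; linarith
  have h3 : ‖1 - z‖ ≤ ‖1 - z‖ / (z.re - 1 / 2) * ‖z - r‖ := by
    rw [div_mul_eq_mul_div, le_div_iff₀ (by linarith)]
    exact mul_le_mul_of_nonneg_left h2 (norm_nonneg _)
  linarith

theorem hd_summable (F : ℂ → ℂ) (hF : Differentiable ℂ F) (h0 : F 0 ≠ 0) (hev : ∀ z, F (-z) = F z)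
    (M : ℝ → ℝ) (hMpos : ∀ R, 0 < M R)
    (hM : ∀ R, 1 ≤ R → ∀ z, ‖z‖ = 2 * R → ‖F z‖ ≤ Real.exp (M R) * ‖F 0‖)
    (hMt : Tendsto (fun R => M R / R ^ 2) atTop (𝓝 0)) (hre : ∀ r, F r = 0 → |r.re| ≤ 1 / 2) :
    Summable (fun r : ℂ => (analyticOrderNatAt F r : ℝ) / ‖1 - r‖ ^ 2) := by
  have hF1 : F 1 ≠ 0 := fun h => by have := hre 1 h; norm_num at this
  have ht := hd_tendsto F hF h0 hev M hMpos hM hMt 1 hF1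
  have ht' := (Complex.continuous_re.tendsto _).comp ht
  obtain ⟨B, hB⟩ : ∃ B : ℝ, ∀ᶠ R in atTop, (∑ r ∈ hdZ F hF h0 R, (analyticOrderNatAt F r : ℂ) * (1 / (1 - r))).re ≤ B := by
    refine ⟨_, ht'.eventually (eventually_le_nhds (lt_add_one _))⟩
  refine summable_of_sum_le (c := 2 * B) (fun r => by positivity) fun s => ?_
  obtain ⟨R, hR, hRs⟩ := (hB.and (eventually_ge_atTop (∑ r ∈ s, ‖r‖))).exists
  have h1 : ∑ r ∈ s, (analyticOrderNatAt F r : ℝ) / ‖1 - r‖ ^ 2 ≤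
      ∑ r ∈ hdZ F hF h0 R, (analyticOrderNatAt F r : ℝ) / ‖1 - r‖ ^ 2 := by
    classical
    rw [← Finset.sum_filter_add_sum_filter_not s (fun r => F r = 0)]
    rw [Finset.sum_eq_zero (s := s.filter fun r => ¬ F r = 0), add_zero]
    · refine Finset.sum_le_sum_of_subset_of_nonneg ?_ (fun r _ _ => by positivity)
      intro r hr
      rw [Finset.mem_filter] at hr
      simp only [hdZ, Finite.mem_toFinset, mem_ofPred_eq]
      exact ⟨(Finset.single_le_sum (f := fun r : ℂ => ‖r‖) (fun r _ => norm_nonneg r) hr.1).trans hRs, hr.2⟩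
    · intro r hr
      rw [Finset.mem_filter] at hr
      rw [hd_order_zero F hF r hr.2]; simp
  refine h1.trans ?_
  have h2 : ∑ r ∈ hdZ F hF h0 R, (analyticOrderNatAt F r : ℝ) / ‖1 - r‖ ^ 2 ≤
     2 * (∑ r ∈ hdZ F hF h0 R, (analyticOrderNatAt F r : ℂ) * (1 / (1 - r))).re := by
    rw [Complex.re_sum, Finset.mul_sum]
    refine Finset.sum_le_sum fun r hr => ?_
    have hr : F r = 0 := by simp only [hdZ, Finite.mem_toFinset, mem_ofPred_eq] at hr; exact hr.2
    have := abs_le.1 (hre r hr)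
    rw [hd_natmul_re, hd_re, Complex.one_re, mul_div_assoc', mul_div_assoc']
    gcongr
    nlinarith [Nat.cast_nonneg (α := ℝ) (analyticOrderNatAt F r)]
  linarith

theorem hd_hasSum (F : ℂ → ℂ) (hF : Differentiable ℂ F) (h0 : F 0 ≠ 0) (hev : ∀ z, F (-z) = F z)
    (M : ℝ → ℝ) (hMpos : ∀ R, 0 < M R)
    (hM : ∀ R, 1 ≤ R → ∀ z, ‖z‖ = 2 * R → ‖F z‖ ≤ Real.exp (M R) * ‖F 0‖)
    (hMt : Tendsto (fun R => M R / R ^ 2) atTop (𝓝 0)) (hre : ∀ r, F r = 0 → |r.re| ≤ 1 / 2)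
    (z : ℂ) (hz : 1 / 2 < z.re) :
    HasSum (fun r : ℂ => (analyticOrderNatAt F r : ℝ) * (1 / (z - r)).re) (deriv F z / F z).re ∧
    HasSum (fun r : ℂ => (analyticOrderNatAt F r : ℂ) * (z / (z ^ 2 - r ^ 2))) (deriv F z / F z) := by
  have hFz : F z ≠ 0 := fun h => by have := abs_le.1 (hre z h); linarith
  have hs := hd_summable F hF h0 hev M hMpos hM hMt hre
  have ht := hd_tendsto F hF h0 hev M hMpos hM hMt z hFz
  set K := 1 + ‖1 - z‖ / (z.re - 1 / 2) with hK
  have hK0 : 0 ≤ K := by have : 0 ≤ z.re - 1 / 2 := by linarith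
                         positivity
  have key : ∀ r : ℂ, |r.re| ≤ 1 / 2 → 0 < ‖1 - r‖ ∧ 0 < ‖z - r‖ ∧ ‖1 - r‖ ≤ K * ‖z - r‖ := by
    intro r hr
    have := abs_le.1 hr
    refine ⟨?_, ?_, hd_cmp z r hz hr⟩ <;>
    · rw [norm_pos_iff]; intro h; have := congrArg Complex.re h; simp at this; linarith
  constructor
  · have hbd : ∀ r : ℂ, ‖(analyticOrderNatAt F r : ℝ) * (1 / (z - r)).re‖ ≤
        ((z.re + 1 / 2) * K ^ 2) * ((analyticOrderNatAt F r : ℝ) / ‖1 - r‖ ^ 2) := by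
      intro r
      by_cases hr : F r = 0
      · obtain ⟨h1, h2, h3⟩ := key r (hre r hr)
        have h5 := abs_le.1 (hre r hr)
        rw [hd_re, Real.norm_of_nonneg (mul_nonneg (by positivity) (div_nonneg (by linarith) (by positivity)))]
        have h4 : (z.re - r.re) / ‖z - r‖ ^ 2 ≤ (z.re + 1 / 2) * K ^ 2 / ‖1 - r‖ ^ 2 := by
          rw [div_le_div_iff₀ (by positivity) (by positivity)]
          have h6 : ‖1 - r‖ ^ 2 ≤ K ^ 2 * ‖z - r‖ ^ 2 := by
            rw [← mul_pow]; exact pow_le_pow_left₀ h1.le h3 2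
          rw [mul_assoc]
          exact mul_le_mul (by linarith) h6 (by positivity) (by linarith)
        calc _ ≤ (analyticOrderNatAt F r : ℝ) * ((z.re + 1 / 2) * K ^ 2 / ‖1 - r‖ ^ 2) := by gcongr
          _ = _ := by ring
      · rw [hd_order_zero F hF r hr]; simp
    have hsum := (hs.mul_left ((z.re + 1 / 2) * K ^ 2))
    have h2 := hd_sum_tendsto F hF h0 _ (fun r hr => by rw [hd_order_zero F hF r hr]; simp) _ hsum hbd
    have h3 := (Complex.continuous_re.tendsto _).comp ht
    have h4 := tendsto_nhds_unique h2 (h3.congr fun R => by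
      simp only [Function.comp, Complex.re_sum, hd_natmul_re])
    rw [← h4]
    exact (Summable.of_norm_bounded hsum hbd).hasSum
  · have hbd : ∀ r : ℂ, ‖(analyticOrderNatAt F r : ℂ) * (z / (z ^ 2 - r ^ 2))‖ ≤
        (3 * ‖z‖ * K ^ 2) * ((analyticOrderNatAt F r : ℝ) / ‖1 - r‖ ^ 2) := by
      intro r
      by_cases hr : F r = 0
      · obtain ⟨h1, h2, h3⟩ := key r (hre r hr)
        obtain ⟨h1', h2', h3'⟩ := key (-r) (by simpa using hre r hr)
        have h5 : ‖1 - r‖ ≤ 3 * ‖1 - -r‖ := by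
          have := hd_cmp (1 : ℂ) (-r) (by norm_num) (by simpa using hre r hr)
          have h6 : ‖1 - r‖ ≤ ‖1 - -r‖ + 2 * |r.re| := by
            have e : 1 - r = (starRingEnd ℂ) (1 - -r) - ((2 * r.re : ℝ) : ℂ) := by
              apply Complex.ext <;> simp; ring
            rw [e]
            refine (norm_sub_le _ _).trans ?_
            rw [RCLike.norm_conj, Complex.norm_real, Real.norm_eq_abs, abs_mul, abs_two]
          have h7 := Complex.re_le_norm (1 - -r)
          simp at h7
          have h8 := abs_le.1 (hre r hr)
          have h9 := hre r hr
          simp only [sub_neg_eq_add] at *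
          linarith
        rw [norm_mul, Complex.norm_natCast, norm_div, show z ^ 2 - r ^ 2 = (z - r) * (z - -r) by ring, norm_mul]
        have h4 : ‖z‖ / (‖z - r‖ * ‖z - -r‖) ≤ 3 * ‖z‖ * K ^ 2 / ‖1 - r‖ ^ 2 := by
          rw [div_le_div_iff₀ (by positivity) (by positivity)]
          have h6 : ‖1 - r‖ ^ 2 ≤ (K * ‖z - r‖) * (3 * (K * ‖z - -r‖)) := by
            rw [sq]; exact mul_le_mul h3 (by linarith) h1.le (by positivity)
          nlinarith [norm_nonneg z]
        calc _ ≤ (analyticOrderNatAt F r : ℝ) * (3 * ‖z‖ * K ^ 2 / ‖1 - r‖ ^ 2) := by gcongr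
          _ = _ := by ring
      · rw [hd_order_zero F hF r hr]; simp
    have hsum := (hs.mul_left (3 * ‖z‖ * K ^ 2))
    have h2 := hd_sum_tendsto F hF h0 _ (fun r hr => by rw [hd_order_zero F hF r hr]; simp) _ hsum hbd
    have h4 := tendsto_nhds_unique h2 (ht.congr fun R => ?_)
    · rw [← h4]
      exact (Summable.of_norm_bounded hsum hbd).hasSum
    · have hZ0 : ∀ w, w ∈ hdZ F hF h0 R → F w = 0 := fun w hw => by
        simp only [hdZ, Finite.mem_toFinset, mem_ofPred_eq] at hw; exact hw.2
      have hZneg : ∀ w, w ∈ hdZ F hF h0 R → -w ∈ hdZ F hF h0 R := by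
        intro w hw; simpa [hdZ, hev] using hw
      have e1 : ∑ r ∈ hdZ F hF h0 R, (analyticOrderNatAt F r : ℂ) * (1 / (z - r)) =
          ∑ r ∈ hdZ F hF h0 R, (analyticOrderNatAt F r : ℂ) * (1 / (z + r)) := by
        refine Finset.sum_nbij' (fun r => -r) (fun r => -r) hZneg hZneg (by simp) (by simp) ?_
        intro r _; rw [hd_order_neg F hF hev, sub_eq_add_neg]
      have e2 : ∑ r ∈ hdZ F hF h0 R, (analyticOrderNatAt F r : ℂ) * (z / (z ^ 2 - r ^ 2)) =
        (1 / 2) * (∑ r ∈ hdZ F hF h0 R, (analyticOrderNatAt F r : ℂ) * (1 / (z - r)) +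
          ∑ r ∈ hdZ F hF h0 R, (analyticOrderNatAt F r : ℂ) * (1 / (z + r))) := by
        rw [← Finset.sum_add_distrib, Finset.mul_sum]
        refine Finset.sum_congr rfl fun r hr => ?_
        have hr := hre r (hZ0 r hr)
        have h1 : z - r ≠ 0 := norm_pos_iff.1 (key r hr).2.1
        have h2 : z + r ≠ 0 := by simpa using norm_pos_iff.1 (key (-r) (by simpa using hr)).2.1
        have h3 : z ^ 2 - r ^ 2 ≠ 0 := by
          rw [show z ^ 2 - r ^ 2 = (z - r) * (z + r) by ring]; exact mul_ne_zero h1 h2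
        field_simp; ring
      rw [e2, ← e1]; ring

noncomputable def zfr (t : ℝ) : ℂ := (Ioi (1:ℝ)).indicator (fun t => ((Int.fract t : ℝ) : ℂ)) t

theorem zfr_meas : Measurable zfr :=
  (Complex.measurable_ofReal.comp measurable_fract).indicator measurableSet_Ioi

theorem zfr_le (t : ℝ) : ‖zfr t‖ ≤ 1 := by
  unfold zfr
  refine (norm_indicator_le_norm_self _ _).trans ?_
  rw [Complex.norm_real, Real.norm_of_nonneg (Int.fract_nonneg t)]
  exact (Int.fract_lt_one t).le

theorem zfr_diff (s : ℂ) (hs : 0 < s.re) : DifferentiableAt ℂ (fun s => mellin zfr (-s)) s := by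
  have : DifferentiableAt ℂ (mellin zfr) (-s) := by
    refine mellin_differentiableAt_of_isBigO_rpow (a := 0) (b := (-s).re - 1) ?_ ?_ (by simpa using hs) ?_ (by linarith)
    · refine (LocallyIntegrable.mono (g := zfr) (f := fun _ : ℝ => (1:ℝ)) (locallyIntegrable_const 1) zfr_meas.aestronglyMeasurable
        (Eventually.of_forall fun t => ?_)).locallyIntegrableOn _
      simpa using zfr_le t
    · refine Asymptotics.IsBigO.of_bound 1 (Eventually.of_forall fun t => ?_)
      simpa using zfr_le t
    · refine Asymptotics.IsBigO.of_bound 1 ?_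
      filter_upwards [Ioo_mem_nhdsGT (zero_lt_one)] with t ht
      have : zfr t = 0 := by unfold zfr; exact indicator_of_notMem (by simpa using ht.2.le) _
      rw [this]; simp
  exact DifferentiableAt.comp (g := mellin zfr) (f := fun s : ℂ => -s) s this (by fun_prop)

theorem zfr_mellin (s : ℂ) : mellin zfr (-s) = ∫ t in Ioi (1:ℝ), (t:ℂ) ^ (-s - 1) * ((Int.fract t : ℝ) : ℂ) := by
  unfold mellin zfr
  simp_rw [smul_eq_mul]
  rw [← integral_indicator measurableSet_Ioi, ← integral_indicator measurableSet_Ioi]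
  congr 1; ext t
  by_cases h1 : t ∈ Ioi (1:ℝ)
  · have h0 : t ∈ Ioi (0:ℝ) := lt_trans zero_lt_one (mem_Ioi.1 h1)
    rw [indicator_of_mem h1, indicator_of_mem h0, indicator_of_mem h1]
  · rw [indicator_of_notMem h1]
    by_cases h0 : t ∈ Ioi (0:ℝ)
    · rw [indicator_of_mem h0, indicator_of_notMem h1, mul_zero]
    · rw [indicator_of_notMem h0]

theorem zfr_bound (s : ℂ) (hs : 0 < s.re) : ‖mellin zfr (-s)‖ ≤ 1 / s.re := by
  rw [zfr_mellin]
  have h1 : ∫ t in Ioi (1:ℝ), t ^ (-s.re - 1) = 1 / s.re := by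
    rw [integral_Ioi_rpow_of_lt (by linarith) zero_lt_one]; simp
  rw [← h1]
  refine norm_integral_le_of_norm_le (integrableOn_Ioi_rpow_of_lt (by linarith) zero_lt_one) ?_
  refine (ae_restrict_mem measurableSet_Ioi).mono fun t ht => ?_
  have ht0 : (0:ℝ) < t := lt_trans zero_lt_one ht
  rw [norm_mul, Complex.norm_cpow_eq_rpow_re_of_pos ht0, Complex.norm_real,
    Real.norm_of_nonneg (Int.fract_nonneg t)]
  have := (Int.fract_lt_one t).le
  have h3 : 0 ≤ t ^ (-s.re - 1) := by positivity
  simpa using mul_le_mul_of_nonneg_left this h3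

theorem zfr_gt (s : ℂ) (hs : 1 < s.re) : riemannZeta₁ s = s - s * (s - 1) * mellin zfr (-s) := by
  have hs1 : s ≠ 1 := by rintro rfl; simp at hs
  have h1 := LSeries_eq_mul_integral (fun _ => (1:ℂ)) zero_le_one hs (LSeriesSummable_one_iff.2 hs) (by
    simp; refine Asymptotics.IsBigO.of_bound 1 (Eventually.of_forall fun n => by simp))
  have h2 : LSeries (fun _ => (1:ℂ)) s = riemannZeta s := LSeries_one_eq_riemannZeta hs
  rw [h2] at h1
  have hre : (-s).re < -1 := by simpa using hs
  have hi1 : IntegrableOn (fun t : ℝ => (t:ℂ) ^ (-s)) (Ioi 1) :=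
    integrableOn_Ioi_cpow_of_lt hre zero_lt_one
  have hi2 : IntegrableOn (fun t : ℝ => (t:ℂ) ^ (-s - 1) * ((Int.fract t : ℝ) : ℂ)) (Ioi 1) := by
    have := integrableOn_Ioi_rpow_of_lt (a := -s.re - 1) (by linarith) zero_lt_one
    refine Integrable.mono' this ?_ ?_
    · refine AEStronglyMeasurable.mul ?_ (Complex.measurable_ofReal.comp measurable_fract).aestronglyMeasurable
      refine ContinuousOn.aestronglyMeasurable (fun t ht => ?_) measurableSet_Ioi
      exact (Complex.continuousAt_ofReal_cpow_const t _ (Or.inr (lt_trans zero_lt_one ht).ne')).continuousWithinAt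
    · refine (ae_restrict_mem measurableSet_Ioi).mono fun t ht => ?_
      have ht0 : (0:ℝ) < t := lt_trans zero_lt_one ht
      rw [norm_mul, Complex.norm_cpow_eq_rpow_re_of_pos ht0, Complex.norm_real,
        Real.norm_of_nonneg (Int.fract_nonneg t)]
      have := (Int.fract_lt_one t).le
      have h3 : 0 ≤ t ^ (-s.re - 1) := by positivity
      simpa using mul_le_mul_of_nonneg_left this h3
  have h3 : ∫ t in Ioi (1:ℝ), (∑ k ∈ Finset.Icc 1 ⌊t⌋₊, (1:ℂ)) * (t:ℂ) ^ (-(s + 1)) =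
      (∫ t in Ioi (1:ℝ), (t:ℂ) ^ (-s)) - mellin zfr (-s) := by
    rw [zfr_mellin, ← integral_sub hi1 hi2]
    refine setIntegral_congr_fun measurableSet_Ioi fun t ht => ?_
    have ht0 : (0:ℝ) < t := lt_trans zero_lt_one ht
    have e : (t:ℂ) ^ (-s) = t * (t:ℂ) ^ (-s - 1) := by
      rw [Complex.cpow_sub _ _ (by exact_mod_cast ht0.ne'), Complex.cpow_one]
      have : (t:ℂ) ≠ 0 := by exact_mod_cast ht0.ne'
      field_simp
    have e2 : ((⌊t⌋₊ : ℕ) : ℂ) = t - (Int.fract t : ℝ) := by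
      have : ((⌊t⌋₊ : ℕ) : ℝ) = t - Int.fract t := by
        rw [natCast_floor_eq_intCast_floor ht0.le]
        have := Int.floor_add_fract t; linarith
      rw [← Complex.ofReal_sub, ← this]; simp
    simp only [Finset.sum_const, Nat.card_Icc, add_tsub_cancel_right, nsmul_eq_mul, mul_one]
    rw [e, e2, show -(s+1) = -s - 1 by ring]; ring
  rw [h3, integral_Ioi_cpow_of_lt hre zero_lt_one] at h1
  have h4 : riemannZeta₁ s = (s - 1) * riemannZeta s := by
    rw [riemannZeta_eq_inv_sub_mul hs1, mul_inv_cancel_left₀ (sub_ne_zero.2 hs1)]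
  have h5 : s - 1 ≠ 0 := sub_ne_zero.2 hs1
  have h6 : -s + 1 ≠ 0 := by intro h; apply h5; linear_combination -h
  rw [h4, h1]
  simp only [Complex.ofReal_one, Complex.one_cpow]
  field_simp; ring

theorem zeta1_eq (s : ℂ) (hs : 0 < s.re) : riemannZeta₁ s = s - s * (s - 1) * mellin zfr (-s) := by
  have hU : IsOpen {s : ℂ | 0 < s.re} := isOpen_lt continuous_const Complex.continuous_re
  have hc : IsPreconnected {s : ℂ | 0 < s.re} := (convex_halfSpace_re_gt 0).isPreconnected
  have hf : AnalyticOnNhd ℂ riemannZeta₁ {s : ℂ | 0 < s.re} :=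
    DifferentiableOn.analyticOnNhd differentiable_riemannZeta₁.differentiableOn hU
  have hg : AnalyticOnNhd ℂ (fun s => s - s * (s - 1) * mellin zfr (-s)) {s : ℂ | 0 < s.re} := by
    refine DifferentiableOn.analyticOnNhd (fun s hs => DifferentiableAt.differentiableWithinAt ?_) hU
    have := zfr_diff s hs
    fun_prop
  refine hf.eqOn_of_preconnected_of_eventuallyEq hg hc (z₀ := 2) (by simp) ?_ hs
  filter_upwards [(isOpen_lt continuous_const Complex.continuous_re).mem_nhds (show (1:ℝ) < (2:ℂ).re by simp)] with s hs
  exact zfr_gt s hs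

theorem zeta1_norm (s : ℂ) (hs : 0 < s.re) : ‖riemannZeta₁ s‖ ≤ ‖s‖ * (1 + ‖s - 1‖ / s.re) := by
  rw [zeta1_eq s hs]
  refine (norm_sub_le _ _).trans ?_
  rw [norm_mul, norm_mul]
  have := mul_le_mul_of_nonneg_left (zfr_bound s hs) (show 0 ≤ ‖s‖ * ‖s - 1‖ by positivity)
  refine (add_le_add_right this _).trans (le_of_eq ?_)
  ring

theorem zeta1_half : riemannZeta₁ (1 / 2) ≠ 0 := by
  have h := zeta1_eq (1/2) (by norm_num)
  have h2 : 0 ≤ (mellin zfr (-(1/2))).re := by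
    rw [zfr_mellin]
    have : ∫ t in Ioi (1:ℝ), (t:ℂ) ^ (-(1/2:ℂ) - 1) * ((Int.fract t : ℝ) : ℂ) =
      ((∫ t in Ioi (1:ℝ), t ^ (-(1/2:ℝ) - 1) * Int.fract t : ℝ) : ℂ) := by
      rw [← integral_complex_ofReal]
      refine setIntegral_congr_fun measurableSet_Ioi fun t ht => ?_
      have ht0 : (0:ℝ) < t := lt_trans zero_lt_one ht
      rw [Complex.ofReal_mul, Complex.ofReal_cpow ht0.le]; simp
    rw [this, Complex.ofReal_re]
    refine setIntegral_nonneg measurableSet_Ioi fun t ht => ?_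
    have ht0 : (0:ℝ) < t := lt_trans zero_lt_one ht
    exact mul_nonneg (by positivity) (Int.fract_nonneg t)
  intro h0
  rw [h0] at h
  have e : (1 / 2 : ℂ) * (1 / 2 - 1) * mellin zfr (-(1/2)) = ((-1/4 : ℝ) : ℂ) * mellin zfr (-(1/2)) := by
    push_cast; ring
  rw [e] at h
  have := congrArg Complex.re h
  rw [Complex.sub_re, Complex.re_ofReal_mul] at this
  norm_num at this
  norm_num at h2
  linarith

noncomputable def xi (z : ℂ) : ℂ := (1 / 2 + z) * (z - 1 / 2) * completedRiemannZeta₀ (1 / 2 + z) + 1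

theorem xi_diff : Differentiable ℂ xi := by
  unfold xi
  have := differentiable_completedZeta₀
  fun_prop

theorem xi_even (z : ℂ) : xi (-z) = xi z := by
  unfold xi
  rw [← completedRiemannZeta₀_one_sub (1 / 2 + z), show (1:ℂ) - (1 / 2 + z) = 1 / 2 + -z by ring]
  ring

theorem xi_eq' (s : ℂ) (h0 : s ≠ 0) (h1 : s ≠ 1) : xi (s - 1 / 2) = s * (s - 1) * completedRiemannZeta s := by
  unfold xi
  rw [completedRiemannZeta_eq, show 1 / 2 + (s - 1 / 2) = s by ring]
  have h2 : s - 1 ≠ 0 := sub_ne_zero.2 h1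
  have h3 : 1 - s ≠ 0 := sub_ne_zero.2 h1.symm
  field_simp
  ring

theorem xi_eq (s : ℂ) (hs : 0 < s.re) : xi (s - 1 / 2) = s * riemannZeta₁ s * Complex.Gammaℝ s := by
  have h0 : s ≠ 0 := by rintro rfl; simp at hs
  by_cases h1 : s = 1
  · subst h1; simp [xi, Complex.Gammaℝ_one]; norm_num
  · rw [xi_eq' s h0 h1]
    have h2 := riemannZeta_def_of_ne_zero h0
    have h3 := Complex.Gammaℝ_ne_zero_of_re_pos hs
    rw [riemannZeta_eq_inv_sub_mul h1] at h2
    have h4 : s - 1 ≠ 0 := sub_ne_zero.2 h1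
    field_simp at h2
    rw [mul_assoc s, ← h2]; ring

theorem xi_ne (z : ℂ) (hz : 1 / 2 ≤ z.re) : xi z ≠ 0 := by
  have hs : 0 < (z + 1 / 2).re := by norm_num; linarith
  have := xi_eq (z + 1 / 2) hs
  rw [add_sub_cancel_right] at this
  rw [this]
  have h0 : z + 1 / 2 ≠ 0 := by intro h; rw [h] at hs; simp at hs
  refine mul_ne_zero (mul_ne_zero h0 ?_) (Complex.Gammaℝ_ne_zero_of_re_pos hs)
  by_cases h1 : z + 1 / 2 = 1
  · rw [h1]; simp
  · have h2 := riemannZeta_ne_zero_of_one_le_re (s := z + 1 / 2) (by norm_num; linarith)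
    rw [riemannZeta_eq_inv_sub_mul h1] at h2
    exact right_ne_zero_of_mul h2

theorem xi_zero_re (r : ℂ) (hr : xi r = 0) : |r.re| < 1 / 2 := by
  rw [abs_lt]
  constructor
  · by_contra h
    refine xi_ne (-r) (by simp; linarith) (by rw [xi_even]; exact hr)
  · by_contra h
    exact xi_ne r (by linarith) hr

theorem xi_at_zero : xi 0 ≠ 0 := by
  have := xi_eq (1 / 2) (by norm_num)
  rw [sub_self] at this
  rw [this]
  exact mul_ne_zero (mul_ne_zero (by norm_num) zeta1_half) (Complex.Gammaℝ_ne_zero_of_re_pos (by norm_num))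

theorem gamma_norm_le (s : ℂ) (hs : 0 < s.re) : ‖Complex.Gamma s‖ ≤ Real.Gamma s.re := by
  rw [Complex.Gamma_eq_integral hs, Real.Gamma_eq_integral hs, Complex.GammaIntegral]
  refine norm_integral_le_of_norm_le (Real.GammaIntegral_convergent hs) ?_
  refine (ae_restrict_mem measurableSet_Ioi).mono fun t ht => ?_
  rw [norm_mul, Complex.norm_cpow_eq_rpow_re_of_pos ht, Complex.norm_real, Real.norm_of_nonneg (Real.exp_pos _).le]
  simp

theorem real_gamma_le (y : ℝ) (n : ℕ) (hn : 1 ≤ n) (h1 : 1 ≤ y) (h2 : y ≤ n + 1) : Real.Gamma y ≤ (n : ℝ) ^ n := by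
  have hc := Real.convexOn_Gamma
  have hseg : y ∈ segment ℝ (1:ℝ) (n + 1) := by
    rw [segment_eq_Icc (by linarith)]; exact ⟨h1, h2⟩
  have := hc.le_on_segment (x := 1) (y := (n:ℝ) + 1) (by simp) (by simp; positivity) hseg
  rw [Real.Gamma_one, Real.Gamma_nat_eq_factorial] at this
  have h3 : (1:ℝ) ≤ n.factorial := by exact_mod_cast Nat.factorial_pos n
  rw [max_eq_right h3] at this
  refine this.trans ?_
  exact_mod_cast Nat.factorial_le_pow n

noncomputable def xiM (R : ℝ) : ℝ :=
  (1 + |Real.log ‖xi 0‖| + Real.log 252) + (3 * |R| + |3 * R * Real.log (3 * R)|)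

theorem xiM_pos (R : ℝ) : 0 < xiM R := by
  unfold xiM
  have : 0 ≤ Real.log 252 := Real.log_nonneg (by norm_num)
  positivity

theorem xiM_tendsto : Tendsto (fun R => xiM R / R ^ 2) atTop (𝓝 0) := by
  have hl : Tendsto (fun x : ℝ => Real.log x / x) atTop (𝓝 0) := by
    have := Real.tendsto_pow_log_div_mul_add_atTop 1 0 1 one_ne_zero
    simpa using this
  have hl3 : Tendsto (fun R : ℝ => Real.log (3 * R) / (3 * R)) atTop (𝓝 0) :=
    hl.comp (tendsto_id.const_mul_atTop (by norm_num))
  have hi : Tendsto (fun R : ℝ => R⁻¹) atTop (𝓝 0) := tendsto_inv_atTop_zero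
  set K := 1 + |Real.log ‖xi 0‖| + Real.log 252
  have h : Tendsto (fun R : ℝ => K * (R⁻¹ * R⁻¹) + (3 * R⁻¹ + 9 * (Real.log (3 * R) / (3 * R)))) atTop (𝓝 0) := by
    have := ((hi.mul hi).const_mul K).add ((hi.const_mul 3).add (hl3.const_mul 9))
    simpa using this
  refine h.congr' ?_
  filter_upwards [eventually_ge_atTop 1] with R hR
  unfold xiM
  rw [abs_of_nonneg (by linarith : 0 ≤ R), abs_of_nonneg (mul_nonneg (by linarith) (Real.log_nonneg (by linarith)))]
  field_simp
  ring

theorem xi_growth_pos (R : ℝ) (hR : 1 ≤ R) (z : ℂ) (hz : ‖z‖ = 2 * R) (hz0 : 0 ≤ z.re) :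
    ‖xi z‖ ≤ Real.exp (xiM R) * ‖xi 0‖ := by
  set s := z + 1 / 2 with hs
  have hre : s.re = z.re + 1 / 2 := by simp [hs]
  have hspos : 0 < s.re := by rw [hre]; linarith
  have hzr : z.re ≤ 2 * R := by rw [← hz]; exact Complex.re_le_norm z
  have hn1 : ‖s‖ ≤ 3 * R := by
    refine (norm_add_le _ _).trans ?_
    rw [hz]; norm_num; linarith
  have hn2 : ‖s - 1‖ ≤ 3 * R := by
    rw [hs, show z + 1 / 2 - 1 = z - 1 / 2 by ring]
    refine (norm_sub_le _ _).trans ?_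
    rw [hz]; norm_num; linarith
  have e := xi_eq s hspos
  rw [hs, add_sub_cancel_right, ← hs] at e
  have hG : ‖Complex.Gammaℝ s‖ ≤ 4 * (3 * R) ^ (3 * R) := by
    rw [Complex.Gammaℝ_def, norm_mul]
    have h1 : ‖(Real.pi : ℂ) ^ (-s / 2)‖ ≤ 1 := by
      rw [Complex.norm_cpow_eq_rpow_re_of_pos Real.pi_pos]
      refine Real.rpow_le_one_of_one_le_of_nonpos (by linarith [Real.pi_gt_three]) ?_
      have : (-s / 2).re = -s.re / 2 := by
        rw [show -s / 2 = -s / ((2:ℝ):ℂ) by norm_num, Complex.div_ofReal_re, Complex.neg_re]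
      rw [this]; linarith
    have hs2 : (s / 2).re = s.re / 2 := by
        rw [show s / 2 = s / ((2:ℝ):ℂ) by norm_num, Complex.div_ofReal_re]
    have h2 : ‖Complex.Gamma (s / 2)‖ ≤ 4 * (3 * R) ^ (3 * R) := by
      refine (gamma_norm_le _ (by rw [hs2]; linarith)).trans ?_
      rw [hs2]
      have h3 := Real.Gamma_add_one (s := s.re / 2) (by linarith)
      have h4 := real_gamma_le (s.re / 2 + 1) (⌈R⌉₊ + 1) (by omega) (by linarith)
        (by push_cast; have := Nat.le_ceil R; linarith)
      have h5 : ((⌈R⌉₊ + 1 : ℕ) : ℝ) ^ (⌈R⌉₊ + 1) ≤ (3 * R) ^ (3 * R) := by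
        rw [← Real.rpow_natCast]
        have h6 : ((⌈R⌉₊ + 1 : ℕ) : ℝ) ≤ 3 * R := by
          push_cast; have := Nat.ceil_lt_add_one (by linarith : 0 ≤ R); linarith
        calc _ ≤ (3 * R) ^ (((⌈R⌉₊ + 1 : ℕ)) : ℝ) := by gcongr
          _ ≤ _ := Real.rpow_le_rpow_of_exponent_le (by linarith) h6
      have hgp : 0 < Real.Gamma (s.re / 2) := Real.Gamma_pos_of_pos (by linarith)
      have : Real.Gamma (s.re / 2) ≤ 4 * Real.Gamma (s.re / 2 + 1) := by
        rw [h3]; nlinarith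
      linarith
    calc _ ≤ 1 * (4 * (3 * R) ^ (3 * R)) := mul_le_mul h1 h2 (norm_nonneg _) zero_le_one
      _ = _ := one_mul _
  have hZ : ‖riemannZeta₁ s‖ ≤ 3 * R * (7 * R) := by
    refine (zeta1_norm s hspos).trans ?_
    have : ‖s - 1‖ / s.re ≤ 6 * R := by
      rw [div_le_iff₀ hspos]; nlinarith
    gcongr; linarith
  have hmain : ‖xi z‖ ≤ 252 * R ^ 3 * (3 * R) ^ (3 * R) := by
    rw [e, norm_mul, norm_mul]
    calc _ ≤ (3 * R * (3 * R * (7 * R))) * (4 * (3 * R) ^ (3 * R)) := by gcongr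
      _ = _ := by ring
  refine hmain.trans ?_
  have hx0 : 0 < ‖xi 0‖ := norm_pos_iff.2 xi_at_zero
  have hexp : Real.exp (Real.log 252 + (3 * R + 3 * R * Real.log (3 * R)) + -Real.log ‖xi 0‖) * ‖xi 0‖ ≤ Real.exp (xiM R) * ‖xi 0‖ := by
    gcongr
    unfold xiM
    have h1 := neg_abs_le (Real.log ‖xi 0‖)
    have h2 := le_abs_self (3 * R * Real.log (3 * R))
    have h3 := le_abs_self R
    linarith
  refine le_trans ?_ hexp
  rw [Real.exp_add, Real.exp_neg, Real.exp_log hx0, inv_mul_cancel_right₀ hx0.ne', Real.exp_add, Real.exp_add,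
    Real.exp_log (by norm_num), ← mul_assoc]
  have h7 : (3 * R) ^ (3 * R) = Real.exp (3 * R * Real.log (3 * R)) := by
    rw [Real.rpow_def_of_pos (by linarith), mul_comm]
  rw [h7]
  gcongr
  have : R ≤ Real.exp R := by have := Real.add_one_le_exp R; linarith
  calc R ^ 3 ≤ (Real.exp R) ^ 3 := by gcongr
    _ = _ := by rw [← Real.exp_nat_mul]; norm_num

theorem xi_growth (R : ℝ) (hR : 1 ≤ R) (z : ℂ) (hz : ‖z‖ = 2 * R) :
    ‖xi z‖ ≤ Real.exp (xiM R) * ‖xi 0‖ := by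
  rcases le_total 0 z.re with h | h
  · exact xi_growth_pos R hR z hz h
  · rw [← xi_even]; exact xi_growth_pos R hR (-z) (by simpa using hz) (by simpa using h)

noncomputable def xm (r : ℂ) : ℕ := analyticOrderNatAt xi r

theorem xi_summable : Summable (fun r : ℂ => (xm r : ℝ) / ‖1 - r‖ ^ 2) :=
  hd_summable xi xi_diff xi_at_zero xi_even xiM xiM_pos xi_growth xiM_tendsto fun r hr => (xi_zero_re r hr).le

theorem xi_hasSum (z : ℂ) (hz : 1 / 2 < z.re) :
    HasSum (fun r : ℂ => (xm r : ℝ) * (1 / (z - r)).re) (deriv xi z / xi z).re ∧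
    HasSum (fun r : ℂ => (xm r : ℂ) * (z / (z ^ 2 - r ^ 2))) (deriv xi z / xi z) :=
  hd_hasSum xi xi_diff xi_at_zero xi_even xiM xiM_pos xi_growth xiM_tendsto (fun r hr => (xi_zero_re r hr).le) z hz

theorem xm_zero (r : ℂ) (h : xi r ≠ 0) : xm r = 0 := hd_order_zero xi xi_diff r h
theorem xm_neg (r : ℂ) : xm (-r) = xm r := hd_order_neg xi xi_diff xi_even r
theorem xm_pos (r : ℂ) (h : xi r = 0) : 1 ≤ xm r := by
  rw [Nat.one_le_iff_ne_zero]
  intro h0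
  have htop : analyticOrderAt xi r ≠ ⊤ := by
    intro h
    rw [analyticOrderAt_eq_top] at h
    exact xi_at_zero (AnalyticOnNhd.eqOn_zero_of_preconnected_of_eventuallyEq_zero (f := xi) (U := univ)
      (fun z _ => xi_diff.analyticAt z) isPreconnected_univ (mem_univ r) h (mem_univ 0))
  have h1 : analyticOrderAt xi r = 0 := by
    rw [← Nat.cast_analyticOrderNatAt htop]; exact_mod_cast h0
  exact (xi_diff.analyticAt r).analyticOrderAt_eq_zero.1 h1 h

theorem gs_bound (s : ℂ) (hs : 0 < s.re) (n : ℕ) (hn : n ≠ 0) : ‖Complex.GammaSeq s n‖ ≤ Real.Gamma s.re := by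
  rw [Complex.GammaSeq_eq_approx_Gamma_integral hs hn, Real.Gamma_eq_integral hs,
    intervalIntegral.integral_of_le (by positivity)]
  have h2 : ∫ x in Ioc (0:ℝ) n, Real.exp (-x) * x ^ (s.re - 1) ≤ ∫ x in Ioi (0:ℝ), Real.exp (-x) * x ^ (s.re - 1) := by
    refine setIntegral_mono_set (Real.GammaIntegral_convergent hs) ?_ (Ioc_subset_Ioi_self.eventuallyLE)
    refine (ae_restrict_mem measurableSet_Ioi).mono fun t ht => ?_
    have : (0:ℝ) < t := ht
    simp only [Pi.zero_apply]; positivity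
  refine le_trans ?_ h2
  refine norm_integral_le_of_norm_le ((Real.GammaIntegral_convergent hs).mono_set Ioc_subset_Ioi_self) ?_
  refine (ae_restrict_mem measurableSet_Ioc).mono fun t ht => ?_
  rw [norm_mul, Complex.norm_cpow_eq_rpow_re_of_pos ht.1]
  have h3 : ‖((1 - t / n : ℝ) : ℂ) ^ n‖ ≤ Real.exp (-t) := by
    have : t / n ≤ 1 := by rw [div_le_one (by positivity)]; exact ht.2
    rw [norm_pow, Complex.norm_real, Real.norm_of_nonneg (by linarith)]
    exact Real.one_sub_div_pow_le_exp_neg ht.2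
  have h4 : 0 ≤ t ^ (s.re - 1) := Real.rpow_nonneg ht.1.le _
  have := mul_le_mul_of_nonneg_right h3 h4
  simpa using this

theorem gs_diff (n : ℕ) (hn : n ≠ 0) : DifferentiableOn ℂ (fun s => Complex.GammaSeq s n) {s : ℂ | 0 < s.re} := by
  intro s hs
  refine DifferentiableAt.differentiableWithinAt ?_
  unfold Complex.GammaSeq
  refine DifferentiableAt.div ?_ (by fun_prop) ?_
  · refine DifferentiableAt.mul_const ?_ _
    exact DifferentiableAt.const_cpow differentiableAt_id (Or.inl (by exact_mod_cast hn))
  · refine Finset.prod_ne_zero_iff.2 fun j _ h => ?_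
    have := congrArg Complex.re h
    simp at this
    have h2 : (0:ℝ) < s.re := hs
    have : (0:ℝ) ≤ j := by positivity
    linarith

theorem gs_deriv (w : ℂ) (hw : 0 < w.re) :
    Tendsto (fun n : ℕ => deriv (fun s => Complex.GammaSeq s n) w) atTop (𝓝 (deriv Complex.Gamma w)) := by
  have hU : IsOpen {s : ℂ | 0 < s.re} := isOpen_lt continuous_const Complex.continuous_re
  have hr : 0 < w.re / 2 := by linarith
  have hsub : Metric.closedBall w (w.re / 2) ⊆ {s : ℂ | 0 < s.re} := by
    intro s hs
    have h1 : ‖s - w‖ ≤ w.re / 2 := by simpa [dist_eq_norm] using hs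
    have h2 := (abs_le.1 ((Complex.abs_re_le_norm (s - w)).trans h1)).1
    rw [Complex.sub_re] at h2
    show 0 < s.re
    linarith
  have hGd : DifferentiableOn ℂ Complex.Gamma {s : ℂ | 0 < s.re} := fun s hs =>
    (Complex.differentiableAt_Gamma s fun m h => by
      have := congrArg Complex.re h
      simp at this
      have h2 : (0:ℝ) < s.re := hs
      have : (0:ℝ) ≤ m := by positivity
      linarith).differentiableWithinAt
  rw [← Complex.cderiv_eq_deriv hU hGd hr hsub]
  have h1 : ∀ᶠ n : ℕ in atTop, Complex.cderiv (w.re / 2) (fun s => Complex.GammaSeq s n) w = deriv (fun s => Complex.GammaSeq s n) w := by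
    filter_upwards [eventually_ne_atTop 0] with n hn
    exact Complex.cderiv_eq_deriv hU (gs_diff n hn) hr hsub
  refine Tendsto.congr' h1 ?_
  unfold Complex.cderiv
  refine Tendsto.const_smul ?_ _
  unfold circleIntegral
  have hsph : ∀ θ, circleMap w (w.re / 2) θ ∈ Metric.closedBall w (w.re / 2) := fun θ =>
    Metric.sphere_subset_closedBall (circleMap_mem_sphere w hr.le θ)
  obtain ⟨B, hB⟩ := (isCompact_closedBall w (w.re / 2)).exists_bound_of_continuousOn (f := fun s : ℂ => Real.Gamma s.re) (by
    intro s hs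
    have h2 : 0 < s.re := hsub hs
    exact ((Real.differentiableAt_Gamma (fun m h => by
      have : (0:ℝ) ≤ m := by positivity
      linarith)).continuousAt.comp Complex.continuous_re.continuousAt).continuousWithinAt)
  have hkc : Continuous fun θ => ‖deriv (circleMap w (w.re / 2)) θ‖ * ‖((circleMap w (w.re / 2) θ - w) ^ 2)⁻¹‖ := by
    refine Continuous.mul ?_ ?_
    · have := (contDiff_circleMap w (w.re / 2)).continuous_deriv (n := 1) le_rfl
      exact this.norm
    · refine (Continuous.inv₀ (by fun_prop) fun θ => ?_).norm
      have : circleMap w (w.re / 2) θ - w ≠ 0 := sub_ne_zero.2 (circleMap_ne_center hr.ne')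
      exact pow_ne_zero _ this
  refine intervalIntegral.tendsto_integral_filter_of_dominated_convergence
    (fun θ => ‖deriv (circleMap w (w.re / 2)) θ‖ * ‖((circleMap w (w.re / 2) θ - w) ^ 2)⁻¹‖ * B) ?_ ?_ ?_ ?_
  · filter_upwards [eventually_ne_atTop 0] with n hn
    refine Continuous.aestronglyMeasurable ?_
    refine Continuous.fun_smul ((contDiff_circleMap w (w.re / 2)).continuous_deriv (n := 1) le_rfl) (Continuous.fun_smul ?_ ?_)
    · refine Continuous.inv₀ (by fun_prop) fun θ => ?_
      have : circleMap w (w.re / 2) θ - w ≠ 0 := sub_ne_zero.2 (circleMap_ne_center hr.ne')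
      exact pow_ne_zero _ this
    · exact (gs_diff n hn).continuousOn.comp_continuous (continuous_circleMap w _) fun θ => hsub (hsph θ)
  · filter_upwards [eventually_ne_atTop 0] with n hn
    refine Eventually.of_forall fun θ _ => ?_
    rw [norm_smul, norm_smul, ← mul_assoc]
    gcongr
    exact (gs_bound _ (hsub (hsph θ)) n hn).trans ((le_abs_self _).trans (hB _ (hsph θ)))
  · exact (hkc.mul continuous_const).intervalIntegrable _ _
  · refine Eventually.of_forall fun θ _ => ?_
    exact ((Complex.GammaSeq_tendsto_Gamma _).const_smul _).const_smul _

theorem gs_logDeriv (w : ℂ) (hw : 0 < w.re) (n : ℕ) (hn : n ≠ 0) :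
    logDeriv (fun s => Complex.GammaSeq s n) w = Real.log n - ∑ j ∈ Finset.range (n + 1), 1 / (w + j) := by
  have hne : ∀ j : ℕ, w + j ≠ 0 := fun j h => by
    have := congrArg Complex.re h
    simp at this
    have : (0:ℝ) ≤ j := by positivity
    linarith
  have hn' : (n:ℂ) ≠ 0 := by exact_mod_cast hn
  have hd : HasDerivAt (fun s : ℂ => (n:ℂ) ^ s) ((n:ℂ) ^ w * Complex.log n) w := by
    simpa using (hasDerivAt_id w).const_cpow (c := (n:ℂ)) (Or.inl hn')
  unfold Complex.GammaSeq
  rw [logDeriv_div]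
  · rw [logDeriv_mul_const, logDeriv_prod]
    · congr 1
      · rw [logDeriv_apply, hd.deriv, mul_div_cancel_left₀]
        · simp
        · simp [Complex.cpow_eq_zero_iff, hn']
      · refine Finset.sum_congr rfl fun j _ => ?_
        simp [logDeriv_apply]
    · exact fun j _ => hne j
    · intro j _; fun_prop
    · exact_mod_cast n.factorial_ne_zero
  · refine mul_ne_zero ?_ (by exact_mod_cast n.factorial_ne_zero)
    simp [Complex.cpow_eq_zero_iff, hn']
  · exact Finset.prod_ne_zero_iff.2 fun j _ => hne j
  · exact hd.differentiableAt.mul_const _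
  · fun_prop

theorem digamma_tendsto (w : ℂ) (hw : 0 < w.re) :
    Tendsto (fun n : ℕ => (Real.log n : ℂ) - ∑ j ∈ Finset.range (n + 1), 1 / (w + j)) atTop (𝓝 (Complex.digamma w)) := by
  have h := (gs_deriv w hw).div (Complex.GammaSeq_tendsto_Gamma w) (Complex.Gamma_ne_zero_of_re_pos hw)
  rw [Complex.digamma_def, logDeriv_apply]
  refine h.congr' ?_
  filter_upwards [eventually_ne_atTop 0] with n hn
  rw [← gs_logDeriv w hw n hn, logDeriv_apply]; rfl

theorem xi_logDeriv (s : ℂ) (hs : 1 < s.re) :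
    deriv xi (s - 1 / 2) / xi (s - 1 / 2) = 1 / (s - 1) + deriv riemannZeta s / riemannZeta s
      - Real.log Real.pi / 2 + 1 / 2 * Complex.digamma (s / 2 + 1) := by
  have hs1 : s ≠ 1 := by rintro rfl; simp at hs
  have hs1' : s - 1 ≠ 0 := sub_ne_zero.2 hs1
  have hw : 0 < (s / 2 + 1).re := by
    rw [Complex.add_re, show s / 2 = s / ((2:ℝ):ℂ) by norm_num, Complex.div_ofReal_re, Complex.one_re]; linarith
  have hev : (fun s => xi (s - 1 / 2)) =ᶠ[𝓝 s] fun s => 2 * ((s - 1) * riemannZeta s * ((Real.pi : ℂ) ^ (-s / 2) * Complex.Gamma (s / 2 + 1))) := by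
    filter_upwards [(isOpen_lt continuous_const Complex.continuous_re).mem_nhds hs] with u hu
    have hu : 1 < u.re := hu
    have hu1 : u ≠ 1 := by rintro rfl; simp at hu
    have hu0 : u ≠ 0 := by rintro rfl; simp at hu; linarith
    rw [xi_eq u (by linarith), Complex.Gammaℝ_def, riemannZeta_eq_inv_sub_mul hu1, Complex.Gamma_add_one _ (by simpa using hu0)]
    have : u - 1 ≠ 0 := sub_ne_zero.2 hu1
    field_simp
  have h1 : deriv xi (s - 1 / 2) / xi (s - 1 / 2) = logDeriv (fun s => xi (s - 1 / 2)) s := by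
    rw [logDeriv_apply, deriv_comp_sub_const]
  have hpi : (Real.pi : ℂ) ≠ 0 := by exact_mod_cast Real.pi_ne_zero
  have hd : HasDerivAt (fun s : ℂ => (Real.pi:ℂ) ^ (-s / 2)) ((Real.pi:ℂ) ^ (-s / 2) * Complex.log Real.pi * (-1 / 2)) s := by
    exact ((hasDerivAt_id s).neg.div_const 2).const_cpow (c := (Real.pi:ℂ)) (Or.inl hpi)
  have hGd : DifferentiableAt ℂ Complex.Gamma (s / 2 + 1) := Complex.differentiableAt_Gamma _ fun m h => by
      rw [h] at hw
      simp at hw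
      have : (0:ℝ) ≤ m := by positivity
      linarith
  have hGd' : DifferentiableAt ℂ (fun s => Complex.Gamma (s / 2 + 1)) s :=
    DifferentiableAt.comp (g := Complex.Gamma) (f := fun s => s / 2 + 1) s hGd (by fun_prop)
  have hG0 := Complex.Gamma_ne_zero_of_re_pos hw
  have hp0 : (Real.pi : ℂ) ^ (-s / 2) ≠ 0 := by simp [Complex.cpow_eq_zero_iff, hpi]
  have hz0 := riemannZeta_ne_zero_of_one_lt_re hs
  have hzd := differentiableAt_riemannZeta hs1
  have h2 : logDeriv (fun s => xi (s - 1 / 2)) s = logDeriv (fun s => 2 * ((s - 1) * riemannZeta s * ((Real.pi : ℂ) ^ (-s / 2) * Complex.Gamma (s / 2 + 1)))) s := by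
    rw [logDeriv_apply, logDeriv_apply, hev.deriv_eq]
    congr 1
    exact hev.self_of_nhds
  rw [h1, h2,
    logDeriv_const_mul _ _ two_ne_zero,
    logDeriv_mul (f := fun s => (s - 1) * riemannZeta s) (g := fun s => (Real.pi : ℂ) ^ (-s / 2) * Complex.Gamma (s / 2 + 1)) _ (mul_ne_zero hs1' hz0) (mul_ne_zero hp0 hG0) (by fun_prop) (hd.differentiableAt.mul hGd'),
    logDeriv_mul (f := fun s => s - 1) (g := riemannZeta) _ hs1' hz0 (by fun_prop) hzd, logDeriv_mul (f := fun s => (Real.pi : ℂ) ^ (-s / 2)) (g := fun s => Complex.Gamma (s / 2 + 1)) _ hp0 hG0 hd.differentiableAt hGd']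
  have e1 : logDeriv (fun s : ℂ => s - 1) s = 1 / (s - 1) := by simp [logDeriv_apply]
  have e2 : logDeriv (fun s : ℂ => (Real.pi : ℂ) ^ (-s / 2)) s = -(Real.log Real.pi / 2) := by
    rw [logDeriv_apply, hd.deriv, mul_assoc, mul_div_cancel_left₀ _ hp0, Complex.ofReal_log Real.pi_pos.le]; ring
  have e3 : logDeriv (fun s : ℂ => Complex.Gamma (s / 2 + 1)) s = 1 / 2 * Complex.digamma (s / 2 + 1) := by
    have : HasDerivAt (fun s : ℂ => Complex.Gamma (s / 2 + 1)) (deriv Complex.Gamma (s / 2 + 1) * (1 / 2)) s :=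
      HasDerivAt.comp (h₂ := Complex.Gamma) (h := fun s => s / 2 + 1) s hGd.hasDerivAt (((hasDerivAt_id s).div_const 2).add_const 1)
    rw [logDeriv_apply, this.deriv, Complex.digamma_def, logDeriv_apply]; ring
  rw [e1, e2, e3, logDeriv_apply]; ring

theorem dig_step (w : ℂ) (hw : 0 < w.re) :
    Real.log ‖w + 1‖ - Real.log ‖w‖ ≤ (1 / w).re + 1 / 2 * (1 / ‖w‖ ^ 2) := by
  have hn : 0 < ‖w‖ := norm_pos_iff.2 fun h => by simp [h] at hw
  have hn1 : 0 < ‖w + 1‖ := norm_pos_iff.2 fun h => by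
    have := congrArg Complex.re h
    simp at this; linarith
  have e : ‖w + 1‖ ^ 2 / ‖w‖ ^ 2 = 1 + (2 * (w.re / ‖w‖ ^ 2) + 1 / ‖w‖ ^ 2) := by
    rw [div_eq_iff (by positivity)]
    field_simp
    rw [Complex.sq_norm, Complex.sq_norm, Complex.normSq_apply, Complex.normSq_apply]
    simp; ring
  have h1 : (1 / w).re = w.re / ‖w‖ ^ 2 := by
    have := hd_re w 0
    simpa using this
  have h2 := Real.log_le_sub_one_of_pos (x := ‖w + 1‖ ^ 2 / ‖w‖ ^ 2) (by positivity)
  rw [Real.log_div (by positivity) (by positivity), Real.log_pow, Real.log_pow, e] at h2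
  rw [h1]
  push_cast at h2
  linarith

theorem dig_re_le (w : ℂ) (hw : 0 < w.re) (B : ℝ) (hB : ∀ n : ℕ, ∑ j ∈ Finset.range n, 1 / ‖w + j‖ ^ 2 ≤ B) :
    (Complex.digamma w).re ≤ Real.log ‖w‖ + B / 2 := by
  have h := (Complex.continuous_re.tendsto _).comp (digamma_tendsto w hw)
  refine le_of_tendsto h ?_
  filter_upwards [eventually_ge_atTop 1] with n hn
  have h1 : ∀ m : ℕ, Real.log ‖w + m‖ - Real.log ‖w‖ ≤ ∑ j ∈ Finset.range m, ((1 / (w + j)).re + 1 / 2 * (1 / ‖w + j‖ ^ 2)) := by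
    intro m
    induction m with
    | zero => simp
    | succ m ih =>
      rw [Finset.sum_range_succ]
      have := dig_step (w + m) (by simp; positivity)
      push_cast
      rw [← add_assoc]
      linarith
  have h2 := h1 (n + 1)
  rw [Finset.sum_add_distrib, ← Finset.mul_sum] at h2
  have h3 := hB (n + 1)
  have h4 : Real.log n ≤ Real.log ‖w + (n + 1 : ℕ)‖ := by
    apply Real.log_le_log (by positivity)
    refine le_trans ?_ (Complex.re_le_norm _)
    simp; linarith
  simp only [Function.comp, Complex.sub_re, Complex.ofReal_re, Complex.re_sum]
  linarith

theorem dig_B (w : ℂ) (hw : 1 / 2 < w.re) (hq : 0 ≤ w.im) (n : ℕ) :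
    ∑ j ∈ Finset.range n, 1 / ‖w + j‖ ^ 2 ≤ 2 / (w.re + w.im - 1 / 2) := by
  suffices h : ∑ j ∈ Finset.range n, 1 / ‖w + j‖ ^ 2 ≤ 2 / (w.re + w.im - 1 / 2) - 2 / (w.re + w.im - 1 / 2 + n) by
    have : 0 ≤ 2 / (w.re + w.im - 1 / 2 + n) := by
      have : 0 < w.re + w.im - 1 / 2 := by linarith
      positivity
    linarith
  induction n with
  | zero => simp
  | succ n ih =>
    rw [Finset.sum_range_succ]
    have h0 : 0 < w.re + w.im - 1 / 2 + n := by
      have : 0 < w.re + w.im - 1 / 2 := by linarith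
      positivity
    have : 1 / ‖w + n‖ ^ 2 ≤ 2 / (w.re + w.im - 1 / 2 + n) - 2 / (w.re + w.im - 1 / 2 + (n + 1 : ℕ)) := by
      have h5 : 0 < w.re + n := by
        have : (0:ℝ) ≤ n := by positivity
        linarith
      have hh : ‖w + n‖ ^ 2 = (w.re + n) ^ 2 + w.im ^ 2 := by
        rw [Complex.sq_norm, Complex.normSq_apply]; simp; ring
      rw [hh, div_sub_div _ _ h0.ne' (by push_cast; linarith), div_le_div_iff₀ (by positivity) (by push_cast; nlinarith)]
      push_cast
      nlinarith [sq_nonneg (w.re + n - w.im)]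
    linarith

theorem zeta_ld_le (s : ℂ) (hs : s.re = 9 / 2) : ‖deriv riemannZeta s / riemannZeta s‖ ≤ 0.0824 := by
  have h1 : 1 < s.re := by rw [hs]; norm_num
  have h := ArithmeticFunction.LSeries_vonMangoldt_eq_deriv_riemannZeta_div h1
  have h2 : ‖deriv riemannZeta s / riemannZeta s‖ = ‖LSeries (fun n => (ArithmeticFunction.vonMangoldt n : ℂ)) s‖ := by
    rw [h, neg_div, norm_neg]
  rw [h2, LSeries]
  have h4 := hasSum_zeta_four
  have h5 : HasSum (fun n : ℕ => (1:ℝ) / (n:ℝ) ^ 4 - if n = 1 then 1 else 0) (Real.pi ^ 4 / 90 - 1) :=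
    h4.sub (hasSum_ite_eq 1 1)
  refine (tsum_of_norm_bounded h5 ?_).trans ?_
  · intro n
    rcases Nat.eq_zero_or_pos n with rfl | hn
    · simp
    rcases Nat.eq_or_lt_of_le hn with rfl | hn
    · simp
    rw [LSeries.norm_term_eq, if_neg (by omega), if_neg (by omega), Complex.norm_real, Real.norm_of_nonneg ArithmeticFunction.vonMangoldt_nonneg, hs, sub_zero]
    have hn0 : (0:ℝ) < n := by positivity
    have hl : ArithmeticFunction.vonMangoldt n ≤ (n:ℝ) ^ (1 / 2 : ℝ) := by
      refine ArithmeticFunction.vonMangoldt_le_log.trans ?_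
      have := Real.add_one_le_exp (Real.log n / 2 - 1)
      have h7 : Real.exp (Real.log n / 2 - 1) = (n:ℝ) ^ (1 / 2 : ℝ) / Real.exp 1 := by
        rw [Real.exp_sub, Real.rpow_def_of_pos hn0]; congr 2; ring
      rw [h7] at this
      have h8 : (n:ℝ) ^ (1 / 2 : ℝ) / Real.exp 1 ≤ (n:ℝ) ^ (1 / 2 : ℝ) / 2 := by
        gcongr
        have := Real.add_one_le_exp 1
        linarith
      linarith
    have h9 : (n:ℝ) ^ (9 / 2 : ℝ) = (n:ℝ) ^ (1 / 2 : ℝ) * (n:ℝ) ^ 4 := by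
      rw [← Real.rpow_natCast, ← Real.rpow_add hn0]; norm_num
    rw [h9, div_le_div_iff₀ (by positivity) (by positivity)]
    nlinarith [pow_pos hn0 4]
  · have : Real.pi ^ 4 ≤ 3.1416 ^ 4 := by
      gcongr
      exact Real.pi_lt_d4.le
    norm_num at this ⊢
    linarith

theorem log_k (y : ℝ) (k : ℕ) (hy : 0 < y) (h : y ^ 2 ≤ (1.05:ℝ) ^ (2 * k)) : Real.log y ≤ 0.049 * k := by
  have h1 : Real.log (y ^ 2) ≤ Real.log ((1.05:ℝ) ^ (2 * k)) := Real.log_le_log (by positivity) h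
  rw [Real.log_pow, Real.log_pow] at h1
  have h2 : Real.log 1.05 ≤ 0.049 := by
    rw [Real.log_le_iff_le_exp (by norm_num)]
    refine le_trans ?_ (Real.quadratic_le_exp_of_nonneg (by norm_num))
    norm_num
  push_cast at h1
  have : (0:ℝ) ≤ k := by positivity
  nlinarith

theorem logpi_ge : 1.14 ≤ Real.log Real.pi := by
  rw [Real.le_log_iff_exp_le Real.pi_pos]
  have h := Real.exp_one_lt_d9
  have h3 : Real.exp 1.14 = Real.exp 1 * Real.exp 0.14 := by rw [← Real.exp_add]; norm_num
  have h4 : Real.exp 0.14 ≤ 1.1503 := by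
    have := Real.exp_bound' (x := 0.14) (by norm_num) (by norm_num) (n := 4) (by norm_num)
    refine this.trans ?_
    norm_num [Finset.sum_range_succ, Nat.factorial]
  rw [h3]
  have := Real.pi_gt_d4
  have := Real.exp_pos 0.14
  nlinarith

theorem xi_re_le (t : ℝ) (ht : 0 ≤ t) (k : ℕ) (hk : (13 / 4 : ℝ) ^ 2 + (t / 2) ^ 2 ≤ (1.05:ℝ) ^ (2 * k)) :
    (deriv xi (4 + t * Complex.I) / xi (4 + t * Complex.I)).re ≤
      (7 / 2) / (49 / 4 + t ^ 2) + 0.0245 * k + 2 / (2 * t + 11) - 0.57 + 0.0824 := by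
  set s : ℂ := 9 / 2 + t * Complex.I with hs
  have hre : s.re = 9 / 2 := by simp [hs]
  have him : s.im = t := by simp [hs]
  have h1 := xi_logDeriv s (by rw [hre]; norm_num)
  have e : s - 1 / 2 = 4 + t * Complex.I := by rw [hs]; ring
  rw [e] at h1
  rw [h1]
  set w := s / 2 + 1 with hw
  have hwre : w.re = 13 / 4 := by simp [hw, hs]; norm_num
  have hwim : w.im = t / 2 := by simp [hw, hs]
  have h2 := dig_re_le w (by rw [hwre]; norm_num) _ (dig_B w (by rw [hwre]; norm_num) (by rw [hwim]; positivity))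
  have h3 := (Complex.re_le_norm _).trans (zeta_ld_le s hre)
  have hn : ‖w‖ ^ 2 = (13 / 4 : ℝ) ^ 2 + (t / 2) ^ 2 := by
    rw [Complex.sq_norm, Complex.normSq_apply, hwre, hwim]; ring
  have h4 := log_k ‖w‖ k (by apply norm_pos_iff.2; intro h; simp [h] at hwre; norm_num at hwre) (by rw [hn]; exact hk)
  have h5 : (1 / (s - 1)).re = (7 / 2) / (49 / 4 + t ^ 2) := by
    have h6 := hd_re s 1
    rw [h6, hre, Complex.sq_norm, Complex.normSq_apply]
    simp [hre, him]
    norm_num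
    ring_nf
  have h7 : (1 / 2 * Complex.digamma w).re = 1 / 2 * (Complex.digamma w).re := by
    simp [Complex.mul_re]
  have h8 : ((Real.log Real.pi : ℂ) / 2).re = Real.log Real.pi / 2 := by
    rw [← Complex.ofReal_ofNat, ← Complex.ofReal_div, Complex.ofReal_re]
  rw [Complex.add_re, Complex.sub_re, Complex.add_re, h5, h7, h8]
  rw [hwre, hwim] at h2
  have h9 : 2 / (13 / 4 + t / 2 - 1 / 2) = 8 / (2 * t + 11) := by
    rw [div_eq_div_iff (by linarith) (by positivity)]; ring
  rw [h9] at h2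
  have := logpi_ge
  have h10 : 2 / (2 * t + 11) = 8 / (2 * t + 11) / 4 := by ring
  rw [h10]
  linarith

def zlist : List ℕ := [141, 210, 250, 304, 329, 375, 409, 433, 480, 497, 529, 564, 593, 608, 651, 670, 695, 720, 757, 771, 793, 829, 847, 874, 888, 924, 946, 958, 988, 1013,
1037, 1054, 1071, 1110, 1118, 1143, 1162, 1187, 1213, 1229, 1242, 1275, 1295, 1310, 1334, 1347, 1381, 1397, 1411, 1431, 1460, 1474, 1500, 1509, 1530,
1561, 1575, 1588, 1611, 1630, 1655, 1671, 1690, 1699, 1734, 1747, 1764, 1783, 1799, 1822, 1848, 1855, 1872, 1894, 1920, 1930, 1952, 1968, 1980, 2012,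
2024, 2041, 2053, 2079, 2095, 2116, 2133, 2145, 2161, 2190, 2207, 2214, 2240, 2249, 2274, 2293, 2312, 2319, 2336, 2365, 2377, 2395, 2410, 2428, 2440,
2471, 2481, 2495, 2510, 2530, 2553, 2563, 2586, 2598, 2608, 2635, 2655, 2666, 2679, 2699, 2714, 2734, 2755, 2764, 2782, 2792, 2824, 2832, 2848, 2866,
2879, 2895, 2918, 2935, 2949, 2955, 2979, 2998, 3016, 3026, 3048, 3057, 3072, 3101, 3111, 3124, 3139, 3154, 3177, 3188, 3211, 3221, 3234, 3248, 3274,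
3290, 3299, 3314, 3336, 3342, 3368, 3383, 3398, 3410, 3420, 3446, 3463, 3472, 3493, 3504, 3518, 3534, 3560, 3571, 3579, 3597, 3612, 3633, 3647, 3662,
3679, 3689, 3700, 3730, 3738, 3758, 3763, 3784, 3798, 3814, 3834, 3849, 3858, 3872, 3888, 3914, 3922, 3934, 3955, 3963, 3979, 3999, 4018, 4028, 4042,
4051, 4075, 4089, 4105, 4119, 4132, 4150, 4154, 4183, 4198, 4206, 4220, 4237, 4250, 4272, 4281, 4303, 4313, 4321, 4338, 4361, 4375, 4386, 4399, 4416,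
4429, 4443, 4468, 4474, 4491, 4501, 4514, 4539, 4549, 4563, 4579, 4595, 4600, 4620, 4640, 4656, 4665, 4674, 4695, 4707, 4727, 4738, 4756, 4767, 4780,
4789, 4818, 4828, 4838, 4855, 4865, 4883, 4896, 4913, 4933, 4939, 4953]

def zterm (T m : ℕ) : ℕ := 40000000000 / (160000 + (T - (10 * m + 5) + (10 * m + 5 - T) + 7) ^ 2)
  + 40000000000 / (160000 + (T + 10 * m + 12) ^ 2)

def zlow (L : List ℕ) (T : ℕ) : ℕ := List.rec 0 (fun m _ ih => zterm T m + ih) L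

set_option maxRecDepth 100000 in
theorem rh_check : ∀ τ < 235, ∃ k < 120, (169 + 16 * τ ^ 2) * 20 ^ (2 * k) ≤ 16 * 21 ^ (2 * k) ∧
    14000000 / (49 + 16 * τ ^ 2) + 24500 * k + 2000000 / (4 * τ + 11) + 82402 < zlow zlist (200 * τ) + 1040588 := by
  decide +kernel

set_option maxRecDepth 100000 in
theorem zlist_sep : zlist.Pairwise (fun a b => a + 2 ≤ b) := by decide +kernel
set_option maxRecDepth 100000 in
theorem zlist_lb : ∀ m ∈ zlist, 141 ≤ m := by decide +kernel

theorem xi_zeta (r : ℂ) (h1 : -(1 / 2) < r.re) (h2 : r.re < 1 / 2) : xi r = 0 ↔ riemannZeta (r + 1 / 2) = 0 := by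
  have hs : 0 < (r + 1 / 2).re := by norm_num; linarith
  have h := xi_eq (r + 1 / 2) hs
  rw [add_sub_cancel_right] at h
  have h0 : r + 1 / 2 ≠ 0 := by intro h; rw [h] at hs; simp at hs
  have h1 : r + 1 / 2 ≠ 1 := fun h => by
    have := congrArg Complex.re h
    norm_num at this; linarith
  rw [h, riemannZeta_eq_inv_sub_mul h1]
  simp [h0, Complex.Gammaℝ_ne_zero_of_re_pos hs, sub_eq_zero, -one_div, h1]

theorem xi_conj0 (r : ℂ) (hr : xi r = 0) : xi ((starRingEnd ℂ) r) = 0 := by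
  obtain ⟨h1, h2⟩ := abs_lt.1 (xi_zero_re r hr)
  rw [xi_zeta _ (by simpa using h1) (by simpa using h2)]
  have h3 := (xi_zeta r h1 h2).1 hr
  have : (starRingEnd ℂ) r + 1 / 2 = (starRingEnd ℂ) (r + 1 / 2) := by
    rw [map_add, map_div₀, map_one, Complex.conj_ofNat]
  rw [this, riemannZeta_conj, h3, map_zero]

theorem zlow_le (T : ℕ) (g : ℕ → ℝ) (L : List ℕ) (hg : ∀ m ∈ L, |100 * g m - 10 * m - 5| ≤ 7 ∧ 0 ≤ g m) :
    ((List.rec 0 (fun m _ ih => zterm T m + ih) L : ℕ) : ℝ) ≤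
      1000000 * (L.map fun m => 4 / (16 + ((T:ℝ) / 100 - g m) ^ 2) + 4 / (16 + ((T:ℝ) / 100 + g m) ^ 2)).sum := by
  induction L with
  | nil => simp
  | cons m L ih =>
    have h1 := ih fun m hm => hg m (List.mem_cons_of_mem _ hm)
    obtain ⟨h2, h3⟩ := hg m List.mem_cons_self
    simp only [List.map_cons, List.sum_cons]
    push_cast
    have key : ∀ (D : ℕ) (y : ℝ), |100 * y| ≤ D → ((40000000000 / (160000 + D ^ 2) : ℕ) : ℝ) ≤ 1000000 * (4 / (16 + y ^ 2)) := by
      intro D y hy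
      refine Nat.cast_div_le.trans ?_
      push_cast
      rw [mul_div_assoc', div_le_div_iff₀ (by positivity) (by positivity)]
      have := sq_le_sq' (neg_le_of_abs_le hy) (le_of_abs_le hy)
      nlinarith
    have h4 : ((zterm T m : ℕ) : ℝ) ≤ 1000000 * (4 / (16 + ((T:ℝ) / 100 - g m) ^ 2)) + 1000000 * (4 / (16 + ((T:ℝ) / 100 + g m) ^ 2)) := by
      unfold zterm
      push_cast
      have hk := abs_le.1 h2
      refine add_le_add ?_ ?_
      · have := key (T - (10 * m + 5) + (10 * m + 5 - T) + 7) (T / 100 - g m) ?_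
        · simpa using this
        rcases le_total T (10 * m + 5) with h | h
        · rw [Nat.sub_eq_zero_of_le h]
          have h' : (T:ℝ) ≤ 10 * m + 5 := by exact_mod_cast h
          push_cast [Nat.cast_sub h]
          rw [abs_le]
          constructor <;> linarith
        · rw [Nat.sub_eq_zero_of_le h]
          have h' : 10 * m + 5 ≤ (T:ℝ) := by exact_mod_cast h
          push_cast [Nat.cast_sub h]
          rw [abs_le]
          constructor <;> linarith
      · have := key (T + 10 * m + 12) (T / 100 + g m) ?_
        · simpa using this
        push_cast
        rw [abs_of_nonneg (by positivity)]
        linarith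
    nlinarith

theorem pair_lb (b d : ℝ) (hb : |b| < 1 / 2) (hd : |d| ≤ 1) :
    8 / 17 ≤ (4 - b) / ((4 - b) ^ 2 + d ^ 2) + (4 + b) / ((4 + b) ^ 2 + d ^ 2) := by
  obtain ⟨h1, h2⟩ := abs_lt.1 hb
  have hd2 : d ^ 2 ≤ 1 := by rw [← sq_abs]; nlinarith [abs_nonneg d]
  have h3 : (4 - b) / ((4 - b) ^ 2 + 1) ≤ (4 - b) / ((4 - b) ^ 2 + d ^ 2) := by
    gcongr <;> nlinarith
  have h4 : (4 + b) / ((4 + b) ^ 2 + 1) ≤ (4 + b) / ((4 + b) ^ 2 + d ^ 2) := by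
    gcongr <;> nlinarith
  refine le_trans ?_ (add_le_add h3 h4)
  rw [div_add_div _ _ (by positivity) (by positivity), div_le_div_iff₀ (by positivity) (by positivity)]
  have : b ^ 2 ≤ 1 / 4 := by nlinarith
  nlinarith [sq_nonneg b]

/-- RH up to height 469, given the listed zeros. -/
theorem rh_of_list' (zlist : List ℕ) (rh_check : ∀ τ < 235, ∃ k < 120, (169 + 16 * τ ^ 2) * 20 ^ (2 * k) ≤ 16 * 21 ^ (2 * k) ∧
    14000000 / (49 + 16 * τ ^ 2) + 24500 * k + 2000000 / (4 * τ + 11) + 82402 < zlow zlist (200 * τ) + 1040588)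
    (zlist_sep : zlist.Pairwise (fun a b => a + 2 ≤ b)) (zlist_lb : ∀ m ∈ zlist, 141 ≤ m)
    (g : ℕ → ℝ) (hg : ∀ m ∈ zlist, |100 * g m - 10 * m - 5| ≤ 7 ∧ xi (g m * Complex.I) = 0)
    (r : ℂ) (hr : xi r = 0) (him0 : 0 ≤ r.im) (him : r.im < 469) : r.re = 0 := by
  by_contra hne
  obtain ⟨τ, hτ, hd⟩ : ∃ τ : ℕ, τ < 235 ∧ |2 * (τ:ℝ) - r.im| ≤ 1 := by
    refine ⟨⌊(r.im + 1) / 2⌋₊, ?_, ?_⟩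
    · rw [Nat.floor_lt (by positivity)]; push_cast; linarith
    · have h1 := Nat.floor_le (a := (r.im + 1) / 2) (by positivity)
      have h2 := Nat.lt_floor_add_one ((r.im + 1) / 2)
      rw [abs_le]; constructor <;> linarith
  obtain ⟨k, -, hk, hck⟩ := rh_check τ hτ
  have hck' : ((14000000 / (49 + 16 * τ ^ 2) : ℕ):ℝ) + 24500 * k + ((2000000 / (4 * τ + 11) : ℕ) : ℝ) + 82402 < zlow zlist (200 * τ) + 1040588 := by
    exact_mod_cast hck
  have hk' : ((169 + 16 * (τ:ℝ) ^ 2) * 20 ^ (2 * k)) ≤ 16 * 21 ^ (2 * k) := by exact_mod_cast hk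
  clear hk hck rh_check
  set t : ℝ := 2 * τ with ht
  have hup := xi_re_le t (by positivity) k (by
    have e : (1.05:ℝ) ^ (2 * k) = 21 ^ (2 * k) / 20 ^ (2 * k) := by rw [← div_pow]; norm_num
    rw [e, le_div_iff₀ (by positivity), ht]
    nlinarith)
  have hgp : ∀ m ∈ zlist, 0 < g m := by
    intro m hm
    have h1 := abs_le.1 (hg m hm).1
    have h2 : (141:ℝ) ≤ m := by exact_mod_cast zlist_lb m hm
    linarith
  have hlow := zlow_le (200 * τ) g zlist fun m hm => ⟨(hg m hm).1, (hgp m hm).le⟩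
  set z : ℂ := 4 + t * Complex.I with hz
  have hzre : z.re = 4 := by simp [hz]
  have hzim : z.im = t := by simp [hz]
  have hS := (xi_hasSum z (by rw [hzre]; norm_num)).1
  have hterm : ∀ q : ℂ, xi q = 0 → (4 - q.re) / ((4 - q.re) ^ 2 + (t - q.im) ^ 2) ≤ (xm q : ℝ) * (1 / (z - q)).re := by
    intro q hq
    have h1 : (1 / (z - q)).re = (4 - q.re) / ((4 - q.re) ^ 2 + (t - q.im) ^ 2) := by
      rw [hd_re, Complex.sq_norm, Complex.normSq_apply, hzre]
      simp [hzre, hzim]; ring_nf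
    have h2 : (1:ℝ) ≤ xm q := by exact_mod_cast xm_pos q hq
    have h3 := abs_lt.1 (xi_zero_re q hq)
    have h4 : 0 ≤ (4 - q.re) / ((4 - q.re) ^ 2 + (t - q.im) ^ 2) := by
      apply div_nonneg <;> nlinarith
    rw [h1]; nlinarith
  have hpos : ∀ q : ℂ, 0 ≤ (xm q : ℝ) * (1 / (z - q)).re := by
    intro q
    by_cases hq : xi q = 0
    · refine le_trans ?_ (hterm q hq)
      have h3 := abs_lt.1 (xi_zero_re q hq)
      apply div_nonneg <;> nlinarith
    · rw [xm_zero q hq]; simp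
  have hnd : zlist.Nodup := zlist_sep.imp fun h => by omega
  set Z : Finset ℕ := zlist.toFinset with hZ
  have hinj : ∀ a ∈ Z, ∀ b ∈ Z, g a = g b → a = b := by
    intro a ha b hb hab
    by_contra hne'
    rw [hZ, List.mem_toFinset] at ha hb
    have hs : a + 2 ≤ b ∨ b + 2 ≤ a := by
      have h2 : zlist.Pairwise (fun a b => a = b ∨ a + 2 ≤ b ∨ b + 2 ≤ a) := zlist_sep.imp fun h => Or.inr (Or.inl h)
      have : Std.Symm (fun a b : ℕ => a = b ∨ a + 2 ≤ b ∨ b + 2 ≤ a) := ⟨fun x y h => by omega⟩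
      have h3 := List.Pairwise.forall_of_forall (R := fun a b : ℕ => a = b ∨ a + 2 ≤ b ∨ b + 2 ≤ a) (fun x _ => Or.inl rfl) h2 ha hb
      tauto
    have h1 := abs_le.1 (hg a ha).1
    have h2 := abs_le.1 (hg b hb).1
    rw [hab] at h1
    rcases hs with hs | hs
    · have : (a:ℝ) + 2 ≤ b := by exact_mod_cast hs
      linarith
    · have : (b:ℝ) + 2 ≤ a := by exact_mod_cast hs
      linarith
  have hmem : ∀ m ∈ Z, m ∈ zlist := fun m hm => List.mem_toFinset.1 hm
  set r1 : ℂ := -(starRingEnd ℂ) r with hr1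
  have hr1z : xi r1 = 0 := by
    rw [hr1, xi_even]; exact xi_conj0 r hr
  have hr1re : r1.re = -r.re := by simp [hr1]
  have hr1im : r1.im = r.im := by simp [hr1]
  let P : Finset ℂ := Z.image fun m => (g m : ℂ) * Complex.I
  let N : Finset ℂ := Z.image fun m => -((g m : ℂ) * Complex.I)
  have hPsum : ∑ q ∈ P, (xm q : ℝ) * (1 / (z - q)).re = ∑ m ∈ Z, (xm ((g m : ℂ) * Complex.I) : ℝ) * (1 / (z - (g m : ℂ) * Complex.I)).re :=
    Finset.sum_image fun a ha b hb h => hinj a ha b hb (by simpa using h)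
  have hNsum : ∑ q ∈ N, (xm q : ℝ) * (1 / (z - q)).re = ∑ m ∈ Z, (xm (-((g m : ℂ) * Complex.I)) : ℝ) * (1 / (z - -((g m : ℂ) * Complex.I))).re :=
    Finset.sum_image fun a ha b hb h => hinj a ha b hb (by simpa using h)
  have hPre : ∀ q ∈ P, q.re = 0 ∧ 0 < q.im := by
    intro q hq
    obtain ⟨m, hm, rfl⟩ := Finset.mem_image.1 hq
    simpa using hgp m (hmem m hm)
  have hNre : ∀ q ∈ N, q.re = 0 ∧ q.im < 0 := by
    intro q hq
    obtain ⟨m, hm, rfl⟩ := Finset.mem_image.1 hq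
    simpa using hgp m (hmem m hm)
  have hd1 : Disjoint P N := Finset.disjoint_left.2 fun q h1 h2 => by
    have := (hPre q h1).2; have := (hNre q h2).2; linarith
  have hrr : r ≠ r1 := fun h => hne (by
    have := congrArg Complex.re h
    rw [hr1re] at this; linarith)
  have hd2 : Disjoint (P ∪ N) {r, r1} := Finset.disjoint_left.2 fun q h1 h2 => by
    have h3 : q.re = 0 := by
      rcases Finset.mem_union.1 h1 with h | h
      · exact (hPre q h).1
      · exact (hNre q h).1
    rcases Finset.mem_insert.1 h2 with h | h
    · exact hne (h ▸ h3)
    · rw [Finset.mem_singleton.1 h, hr1re] at h3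
      exact hne (by linarith)
  have hfin := sum_le_hasSum ((P ∪ N) ∪ {r, r1}) (fun q _ => hpos q) hS
  rw [Finset.sum_union hd2, Finset.sum_union hd1, hPsum, hNsum, Finset.sum_pair hrr] at hfin
  have hA := hterm r hr
  have hB := hterm r1 hr1z
  rw [hr1re, hr1im] at hB
  have hpl := pair_lb r.re (t - r.im) (xi_zero_re r hr) hd
  rw [sub_neg_eq_add] at hB
  have hC : (zlist.map fun m => 4 / (16 + ((200 * τ : ℕ) / 100 - g m) ^ 2) + 4 / (16 + (((200 * τ : ℕ):ℝ) / 100 + g m) ^ 2)).sum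
      ≤ ∑ m ∈ Z, (xm ((g m : ℂ) * Complex.I) : ℝ) * (1 / (z - (g m : ℂ) * Complex.I)).re + ∑ m ∈ Z, (xm (-((g m : ℂ) * Complex.I)) : ℝ) * (1 / (z - -((g m : ℂ) * Complex.I))).re := by
    rw [← List.sum_toFinset _ hnd, ← Finset.sum_add_distrib]
    refine Finset.sum_le_sum fun m hm => ?_
    have e : ((200 * τ : ℕ):ℝ) / 100 = t := by push_cast; rw [ht]; ring
    have h1 := hterm _ (hg m (hmem m hm)).2
    have h2 := hterm (-((g m : ℂ) * Complex.I)) (by rw [xi_even]; exact (hg m (hmem m hm)).2)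
    rw [e]
    refine add_le_add (le_trans (le_of_eq ?_) h1) (le_trans (le_of_eq ?_) h2)
    · simp; norm_num
    · simp; norm_num
  have hn1 := Nat.lt_floor_add_one ((14000000:ℝ) / ((49 + 16 * τ ^ 2 : ℕ):ℝ))
  have hn2 := Nat.lt_floor_add_one ((2000000:ℝ) / ((4 * τ + 11 : ℕ) : ℝ))
  have e1 := Nat.floor_div_eq_div (K := ℝ) 14000000 (49 + 16 * τ ^ 2)
  have e2 := Nat.floor_div_eq_div (K := ℝ) 2000000 (4 * τ + 11)
  push_cast at e1 e2 hn1 hn2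
  rw [e1] at hn1
  rw [e2] at hn2
  have f1 : (7 / 2) / (49 / 4 + t ^ 2) = 14000000 / (49 + 16 * (τ:ℝ) ^ 2) / 1000000 := by
    rw [ht]; field_simp; ring
  have f2 : 2 / (2 * t + 11) = 2000000 / (4 * (τ:ℝ) + 11) / 1000000 := by
    rw [ht]; field_simp; ring
  rw [f1, f2] at hup
  unfold zlow at hck'
  push_cast at hck' hlow hC hn1 hn2
  linarith

theorem rh_of_list (g : ℕ → ℝ) (hg : ∀ m ∈ zlist, |100 * g m - 10 * m - 5| ≤ 7 ∧ xi (g m * Complex.I) = 0)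
    (r : ℂ) (hr : xi r = 0) (him0 : 0 ≤ r.im) (him : r.im < 469) : r.re = 0 :=
  rh_of_list' zlist rh_check zlist_sep zlist_lb g hg r hr him0 him

def frc (k : ℕ → ℕ) (n : ℕ) : ℕ := Nat.rec (k 0) (fun m _ => k (m + 1)) n

/-- fixed point one, 640 bits -/
def gOne : ℕ := 2 ^ 640
def gAt (x : ℕ) (K : ℕ) : ℕ := Nat.rec 0 (fun k ih => (gOne / (x ^ (4 * k + 1) * (4 * k + 1)) - gOne / (x ^ (4 * k + 3) * (4 * k + 3))) + ih) K
def gPi : ℕ := 4 * (4 * gAt 5 75 - gAt 239 24)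
def gHor (w : ℕ) (k : ℕ) : ℕ → ℕ := Nat.rec (fun a => a) (fun k ih a => frc ih (gOne - w * a / ((k + 1) * gOne))) k
def gSq (r : ℕ) : ℕ → ℕ := Nat.rec (fun a => a) (fun _ ih a => frc ih (a * a / gOne)) r
def gTh (q2 : ℕ) (n : ℕ) : ℕ → ℕ → ℕ → ℕ :=
  Nat.rec (fun s _ _ => s) (fun _ ih s t p => frc (fun t' => frc (fun p' => frc (fun s' => ih s' t' p') (s + t)) (p * q2 / gOne)) (t * p / gOne)) n
def gA (π j : ℕ) : ℕ :=
  frc (fun q => frc (fun q2 => gTh q2 11 0 q (q * q2 / gOne)) (q * q / gOne))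
    (gSq 24 (gHor (π * 341 ^ (4 * j) / (340 ^ (4 * j) * 2 ^ 24)) 36 gOne)) * 2 * 341 ^ j / 340 ^ j
/-- Kronecker packing of the coefficients, `X = 2^9088`, scale `2^20` -/
def gPack (π n : ℕ) : ℕ → (ℕ → ℕ) → ℕ :=
  Nat.rec (fun N k => k N) (fun j ih N k => frc (fun N' => ih N' k) (N + gA π j * 2 ^ (20 * (420 - j) + 9088 * j))) n
def gX : ℕ := 2 ^ 9088
def gCos (x2 k : ℕ) : ℕ → ℕ := Nat.rec (fun a => a) (fun k ih a => frc ih (2 ^ 40 - x2 * a / ((2 * k + 1) * (2 * k + 2) * 2 ^ 40))) k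
/-- 2^21 (1 + cos θ) -/
def gY (m : ℕ) : ℕ := frc (fun a => a * a / 2 ^ 58) (gCos (m * m * 189669 / 2) 10 (2 ^ 40))
def gCmp (X Y : ℕ) : ℕ := cond (Nat.ble (Y + 2 ^ 8470) X) 1 (cond (Nat.ble (X + 2 ^ 8470) Y) 2 0)
def gFin (a0 Y u v : ℕ) : ℕ :=
  gCmp (u * Y + 2 ^ 20 * gX + 2 * v) (gX / 2 * Y + 2 ^ 21 * u + gX + 2 ^ 8400 * (a0 + 681 * gOne * 2 ^ 21 / (463761 * 2 ^ 21 - 231880 * Y)))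
def gSgn (N a0 m : ℕ) : ℕ :=
  frc (fun Y => frc (fun r => gFin a0 Y (r / gX) (r % gX)) (N % (gX * gX + 2 ^ 21 * gX + 2 ^ 40 - Y * gX))) (gY m)
def gAll (N : ℕ) (a0 : ℕ) (l : List ℕ) : ℕ :=
  List.rec 1 (fun m _ ih => cond (Nat.beq (gSgn N a0 m * gSgn N a0 (m + 1)) 2) ih 0) l
set_option maxRecDepth 100000 in
theorem gCheck : (frc (fun π => frc (fun a0 => gPack π 420 (gX * gX / 2 + gX / 2) (fun N => gAll N a0 zlist)) (gA π 0)) gPi) = 1 := by decide +kernel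

theorem int_pow_exp (s c : ℝ) (hs : 0 < s) (hc : 0 < c) :
    IntegrableOn (fun t : ℝ => t ^ (s - 1) * Real.exp (-(c * t))) (Ioi 0) := by
  have h := integrableOn_rpow_mul_exp_neg_mul_rpow (p := 1) (s := s - 1) (b := c) (by linarith) one_pos hc
  simpa using h

theorem gamma_rot (a r : ℂ) (ha : 0 < a.re) (hr : 0 < r.re) :
    ∫ t : ℝ in Ioi 0, (t:ℂ) ^ (a - 1) * Complex.exp (-(r * t)) = (1 / r) ^ a * Complex.Gamma a := by
  have hmeas : ∀ a r : ℂ, AEStronglyMeasurable (fun t : ℝ => (t:ℂ) ^ (a - 1) * Complex.exp (-(r * t))) (volume.restrict (Ioi 0)) := by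
    intro a r
    refine ContinuousOn.aestronglyMeasurable (fun t ht => ContinuousAt.continuousWithinAt ?_) measurableSet_Ioi
    refine ContinuousAt.mul ?_ (by fun_prop)
    exact (continuousAt_cpow_const (Or.inl (by simpa using ht))).comp Complex.continuous_ofReal.continuousAt
  have hn : ∀ a r : ℂ, ∀ t ∈ Ioi (0:ℝ), ‖(t:ℂ) ^ (a - 1) * Complex.exp (-(r * t))‖ = t ^ (a.re - 1) * Real.exp (-(r.re * t)) := by
    intro a r t ht
    rw [norm_mul, Complex.norm_cpow_eq_rpow_re_of_pos ht, Complex.norm_exp]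
    simp
  have hd : DifferentiableOn ℂ (fun r : ℂ => ∫ t : ℝ in Ioi 0, (t:ℂ) ^ (a - 1) * Complex.exp (-(r * t))) {r | 0 < r.re} := by
    intro r hr
    refine DifferentiableAt.differentiableWithinAt ?_
    have hr' : 0 < r.re := hr
    refine (hasDerivAt_integral_of_dominated_loc_of_deriv_le (F' := fun r (t : ℝ) => (t:ℂ) ^ (a - 1) * (Complex.exp (-(r * t)) * (-t)))
      (s := Metric.ball r (r.re / 2)) (bound := fun t : ℝ => t ^ (a.re + 1 - 1) * Real.exp (-(r.re / 2 * t)))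
      (Metric.ball_mem_nhds r (by linarith)) (Eventually.of_forall fun r => hmeas a r) ?_ ?_ ?_ (int_pow_exp _ _ (by linarith) (by linarith)) ?_).2.differentiableAt
    · refine (int_pow_exp a.re r.re ha hr').mono' (hmeas a r) ?_
      exact (ae_restrict_iff' measurableSet_Ioi).2 (Eventually.of_forall fun t ht => (hn a r t ht).le)
    · have := (hmeas a r).mul (f := fun t : ℝ => (t:ℂ) ^ (a - 1) * Complex.exp (-(r * t))) (g := fun t : ℝ => (-(t:ℂ))) (by
        exact (Complex.continuous_ofReal.neg).aestronglyMeasurable)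
      refine this.congr (Eventually.of_forall fun t => ?_)
      simp only [Pi.mul_apply]; ring
    · refine (ae_restrict_iff' measurableSet_Ioi).2 (Eventually.of_forall fun t ht z hz => ?_)
      have ht' : (0:ℝ) < t := ht
      rw [← mul_assoc, norm_mul, hn a z t ht, norm_neg, Complex.norm_real, Real.norm_of_nonneg ht'.le,
        show a.re + 1 - 1 = (a.re - 1) + 1 by ring, Real.rpow_add_one ht'.ne', mul_right_comm]
      gcongr
      have : |(z - r).re| < r.re / 2 := (Complex.abs_re_le_norm _).trans_lt (by simpa [dist_eq_norm] using hz)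
      rw [Complex.sub_re] at this
      linarith [(abs_lt.1 this).1]
    · refine (ae_restrict_iff' measurableSet_Ioi).2 (Eventually.of_forall fun t ht z hz => ?_)
      refine HasDerivAt.const_mul _ ?_
      have : HasDerivAt (fun z : ℂ => -(z * (t:ℂ))) (-(t:ℂ)) z := by
        have h := ((hasDerivAt_id z).mul_const (t:ℂ)).fun_neg
        rw [one_mul] at h; exact h
      exact this.cexp
  have ho : IsOpen {r : ℂ | 0 < r.re} := isOpen_lt continuous_const Complex.continuous_re
  have hd2 : DifferentiableOn ℂ (fun r : ℂ => (1 / r) ^ a * Complex.Gamma a) {r | 0 < r.re} := by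
    intro z hz
    have hz' : 0 < z.re := hz
    have hz0 : z ≠ 0 := fun h => by rw [h] at hz'; simp at hz'
    refine DifferentiableAt.differentiableWithinAt ?_
    refine DifferentiableAt.mul_const ?_ _
    refine DifferentiableAt.cpow (by fun_prop (disch := assumption)) (by fun_prop) (Or.inl ?_)
    rw [one_div, Complex.inv_re]
    exact div_pos hz' (Complex.normSq_pos.2 hz0)
  have hpre : IsPreconnected {r : ℂ | 0 < r.re} := (convex_halfSpace_re_gt 0).isPreconnected
  refine (hd.analyticOnNhd ho).eqOn_of_preconnected_of_frequently_eq (hd2.analyticOnNhd ho) hpre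
    (z₀ := 1) (by simp) ?_ hr
  have ht : Tendsto (fun n : ℕ => ((1 + 1 / ((n:ℝ) + 1) : ℝ) : ℂ)) atTop (𝓝[≠] 1) := by
    refine tendsto_nhdsWithin_iff.2 ⟨?_, Eventually.of_forall fun n => ?_⟩
    · have := (tendsto_const_nhds (x := (1:ℝ))).add (tendsto_one_div_add_atTop_nhds_zero_nat (𝕜 := ℝ))
      rw [add_zero] at this
      exact (Complex.continuous_ofReal.tendsto 1).comp this
    · simp only [mem_compl_iff, mem_singleton_iff]
      intro h
      have h1 : (1 + 1 / ((n:ℝ) + 1) : ℝ) = 1 := by exact_mod_cast h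
      have : 0 < 1 / ((n:ℝ) + 1) := by positivity
      linarith
  refine ht.frequently (Frequently.of_forall fun n => ?_)
  exact Complex.integral_cpow_mul_exp_neg_mul_Ioi ha (by positivity)

theorem gamma_dec (σ v α : ℝ) (hσ : 0 < σ) (hα : |α| < Real.pi / 2) :
    ‖Complex.Gamma (σ + v * Complex.I)‖ ≤ Real.exp (α * v) * (Real.Gamma σ * (Real.cos α) ^ (-σ)) := by
  have hc : 0 < Real.cos α := Real.cos_pos_of_mem_Ioo ⟨by linarith [(abs_lt.1 hα).1], (abs_lt.1 hα).2⟩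
  have hr : Complex.exp (-(α * Complex.I)) = (Real.cos α : ℂ) - Real.sin α * Complex.I := by
    rw [← neg_mul, Complex.exp_mul_I]; push_cast; rw [Complex.cos_neg, Complex.sin_neg]; ring
  have hre : (Complex.exp (-(α * Complex.I))).re = Real.cos α := by
    rw [hr, Complex.sub_re, Complex.ofReal_re, Complex.re_ofReal_mul, Complex.I_re]; ring
  have h := gamma_rot (σ + v * Complex.I) (Complex.exp (-(α * Complex.I)))
    (by simpa using hσ) (by rw [hre]; exact hc)
  have hp : (1 / Complex.exp (-(α * Complex.I))) ^ ((σ:ℂ) + v * Complex.I) = Complex.exp (α * Complex.I * (σ + v * Complex.I)) := by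
    rw [one_div, ← Complex.exp_neg, neg_neg, Complex.cpow_def_of_ne_zero (Complex.exp_ne_zero _), Complex.log_exp]
    · simp; linarith [(abs_lt.1 hα).1, Real.pi_pos]
    · simp; linarith [(abs_lt.1 hα).2, Real.pi_pos]
  rw [hp] at h
  have h2 : ‖Complex.exp (α * Complex.I * (σ + v * Complex.I))‖ = Real.exp (-(α * v)) := by
    rw [Complex.norm_exp]; congr 1; simp
  have h3 : ‖∫ t : ℝ in Ioi 0, (t:ℂ) ^ ((σ:ℂ) + v * Complex.I - 1) * Complex.exp (-(Complex.exp (-(α * Complex.I)) * t))‖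
      ≤ ∫ t : ℝ in Ioi 0, t ^ (σ - 1) * Real.exp (-(Real.cos α * t)) := by
    refine (norm_integral_le_integral_norm _).trans (le_of_eq ?_)
    refine setIntegral_congr_fun measurableSet_Ioi fun t ht => ?_
    rw [norm_mul, Complex.norm_cpow_eq_rpow_re_of_pos ht, Complex.norm_exp]
    congr 2
    · simp
    · rw [Complex.neg_re, Complex.re_mul_ofReal, hre]
  rw [h, norm_mul, h2, Real.integral_rpow_mul_exp_neg_mul_Ioi hσ hc] at h3
  have h4 : (1 / Real.cos α) ^ σ = Real.cos α ^ (-σ) := by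
    rw [one_div, Real.inv_rpow hc.le, Real.rpow_neg hc.le]
  rw [h4, Real.exp_neg, inv_mul_le_iff₀ (Real.exp_pos _)] at h3
  linarith

theorem cos_15 : (0.07 : ℝ) ≤ Real.cos 1.5 := by
  have h := Real.sin_gt_sub_cube (x := Real.pi / 2 - 1.5) (by linarith [Real.pi_gt_d4])
  rw [Real.sin_pi_div_two_sub] at h
  have h1 := Real.pi_gt_d4
  have h2 := Real.pi_lt_d4
  have : (Real.pi / 2 - 1.5) ^ 3 ≤ 0.001 := by
    calc (Real.pi / 2 - 1.5) ^ 3 ≤ 0.1 ^ 3 := by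
          apply pow_le_pow_left₀ <;> linarith
      _ = 0.001 := by norm_num
  linarith

theorem lam_dec (τ : ℝ) : ‖completedRiemannZeta (1 / 2 + τ * Complex.I)‖ ≤ 1600 * Real.exp (-0.74 * |τ|) := by
  set s : ℂ := 1 / 2 + τ * Complex.I with hs
  have hre : s.re = 1 / 2 := by simp [hs]
  have hs0 : s ≠ 0 := fun h => by rw [h] at hre; norm_num at hre
  have hs1 : s ≠ 1 := fun h => by rw [h] at hre; norm_num at hre
  have hG := Complex.Gammaℝ_ne_zero_of_re_pos (s := s) (by rw [hre]; norm_num)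
  have e1 : completedRiemannZeta s = riemannZeta s * Complex.Gammaℝ s := by
    rw [riemannZeta_def_of_ne_zero hs0]; field_simp
  have e2 : ‖riemannZeta s‖ ≤ 2 + 2 * |τ| := by
    have h := zeta1_norm s (by rw [hre]; norm_num)
    rw [riemannZeta_eq_inv_sub_mul hs1, norm_mul, norm_inv]
    have h1 : ‖s - 1‖ = ‖s‖ := by
      have : s - 1 = -(starRingEnd ℂ) s := by
        apply Complex.ext <;> simp [hs]; norm_num
      rw [this, norm_neg, Complex.norm_conj]
    have h2 : ‖s‖ ≤ 1 / 2 + |τ| := by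
      refine (norm_add_le _ _).trans ?_
      rw [norm_mul, Complex.norm_I, Complex.norm_real, Real.norm_eq_abs]; norm_num
    have h3 : 0 < ‖s‖ := norm_pos_iff.2 hs0
    rw [h1, inv_mul_le_iff₀ h3]
    rw [h1, hre] at h
    have : 1 + ‖s‖ / (1 / 2) ≤ 2 + 2 * |τ| := by linarith
    exact h.trans (by gcongr)
  have e3 : ‖Complex.Gammaℝ s‖ ≤ 8 * Real.exp (-0.75 * |τ|) := by
    rw [Complex.Gammaℝ_def, norm_mul]
    have h1 : ‖(Real.pi : ℂ) ^ (-s / 2)‖ ≤ 1 := by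
      rw [Complex.norm_cpow_eq_rpow_re_of_pos Real.pi_pos]
      apply Real.rpow_le_one_of_one_le_of_nonpos (by linarith [Real.pi_gt_three])
      simp [hs]; norm_num
    have h2 : ‖Complex.Gamma (s / 2)‖ ≤ 8 * Real.exp (-0.75 * |τ|) := by
      have : s / 2 = ((1 / 4 : ℝ) : ℂ) + ((τ / 2 : ℝ) : ℂ) * Complex.I := by
        rw [hs]; push_cast; ring
      rw [this]
      have hq : ∀ α : ℝ, |α| = 1.5 → α * (τ / 2) = -0.75 * |τ| → ‖Complex.Gamma (((1 / 4 : ℝ) : ℂ) + ((τ / 2 : ℝ) : ℂ) * Complex.I)‖ ≤ 8 * Real.exp (-0.75 * |τ|) := by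
        intro α h1 h2
        have h := gamma_dec (1 / 4) (τ / 2) α (by norm_num) (by rw [h1]; linarith [Real.pi_gt_d4])
        rw [h2, ← Real.cos_abs, h1] at h
        refine h.trans ?_
        rw [mul_comm]
        refine mul_le_mul_of_nonneg_right ?_ (Real.exp_pos _).le
        have g1 : Real.Gamma (1 / 4) ≤ 4 := by
          have := Real.Gamma_add_one (s := 1 / 4) (by norm_num)
          have g2 : Real.Gamma (1 / 4 + 1) ≤ 1 := by
            have hcv := Real.convexOn_Gamma.2 (mem_Ioi.2 (one_pos : (0:ℝ) < 1)) (mem_Ioi.2 (two_pos : (0:ℝ) < 2)) (by norm_num : (0:ℝ) ≤ 3 / 4) (by norm_num : (0:ℝ) ≤ 1 / 4) (by norm_num)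
            rw [Real.Gamma_one, Real.Gamma_two] at hcv
            norm_num at hcv ⊢
            exact hcv
          linarith
        have g2 : Real.cos 1.5 ^ (-(1 / 4) : ℝ) ≤ 2 := by
          rw [Real.rpow_neg (by linarith [cos_15]), inv_le_comm₀ (by have := cos_15; positivity) (by norm_num)]
          have : ((1/2:ℝ) ^ (4:ℝ)) ^ (1 / 4 : ℝ) = (2:ℝ)⁻¹ := by
            rw [← Real.rpow_mul (by norm_num)]; norm_num
          rw [← this]
          apply Real.rpow_le_rpow (by positivity) _ (by norm_num)
          refine le_trans ?_ cos_15
          norm_num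
        calc Real.Gamma (1 / 4) * Real.cos 1.5 ^ (-(1 / 4) : ℝ) ≤ 4 * 2 := by
              apply mul_le_mul g1 g2 (Real.rpow_nonneg (by linarith [cos_15]) _) (by norm_num)
          _ = 8 := by norm_num
      rcases le_total 0 τ with h | h
      · exact hq (-1.5) (by norm_num) (by rw [abs_of_nonneg h]; ring)
      · exact hq 1.5 (by norm_num) (by rw [abs_of_nonpos h]; ring)
    calc _ ≤ 1 * (8 * Real.exp (-0.75 * |τ|)) := mul_le_mul h1 h2 (norm_nonneg _) (by norm_num)
      _ = _ := one_mul _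
  rw [e1, norm_mul]
  have e4 : 2 + 2 * |τ| ≤ 200 * Real.exp (0.01 * |τ|) := by
    have := Real.add_one_le_exp (0.01 * |τ|)
    linarith
  calc _ ≤ (200 * Real.exp (0.01 * |τ|)) * (8 * Real.exp (-0.75 * |τ|)) :=
        mul_le_mul (e2.trans e4) e3 (norm_nonneg _) (by positivity)
    _ = 1600 * (Real.exp (0.01 * |τ|) * Real.exp (-0.75 * |τ|)) := by ring
    _ = _ := by rw [← Real.exp_add]; congr 2; ring

/-- `θ(x) - 1` -/
noncomputable def ck (x : ℝ) : ℝ := HurwitzZeta.cosKernel 0 x - 1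

theorem ck_hasSum (x : ℝ) (hx : 0 < x) : HasSum (fun n : ℕ => 2 * Real.exp (-Real.pi * (n + 1) ^ 2 * x)) (ck x) := by
  have := HurwitzZeta.hasSum_nat_cosKernel₀ 0 hx
  simpa [ck] using this

theorem ck_bd (x : ℝ) (hx : 1 ≤ x) : 0 ≤ ck x ∧ ck x ≤ 3 * Real.exp (-Real.pi * x) := by
  have h := ck_hasSum x (by linarith)
  refine ⟨h.nonneg fun n => by positivity, ?_⟩
  have hq : Real.exp (-Real.pi * x) ≤ 1 / 4 := by
    have h1 : Real.pi * x ≥ 3 := by nlinarith [Real.pi_gt_three]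
    have := Real.add_one_le_exp (Real.pi * x)
    rw [neg_mul, Real.exp_neg]
    rw [inv_le_comm₀ (Real.exp_pos _) (by norm_num)]; linarith
  set q := Real.exp (-Real.pi * x) with hqd
  have hq0 : 0 < q := Real.exp_pos _
  have hg := (hasSum_geometric_of_lt_one hq0.le (by linarith : q < 1)).mul_left (2 * q)
  have h2 : ck x ≤ 2 * q * (1 - q)⁻¹ := by
    refine hasSum_le (fun n => ?_) h hg
    rw [mul_assoc 2 q, ← pow_succ', hqd, ← Real.exp_nat_mul]
    gcongr 2 * Real.exp ?_
    push_cast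
    have : (0:ℝ) ≤ n := n.cast_nonneg
    have : ((n:ℝ) + 1) ≤ (n + 1) ^ 2 := by nlinarith
    have h5 : 0 < Real.pi * x := by have := Real.pi_pos; positivity
    nlinarith
  refine h2.trans ?_
  rw [← div_eq_mul_inv, div_le_iff₀ (by linarith)]
  nlinarith

noncomputable def Phi (u : ℝ) : ℝ := Real.exp (|u| / 4) * ck (Real.exp |u|) - Real.exp (-(|u| / 4))

theorem Phi1_bd (u : ℝ) (hu : 0 ≤ u) : Real.exp (u / 4) * ck (Real.exp u) ≤ 3 * Real.exp (-2 * u) := by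
  have h := (ck_bd (Real.exp u) (by linarith [Real.add_one_le_exp u])).2
  calc _ ≤ Real.exp (u / 4) * (3 * Real.exp (-Real.pi * Real.exp u)) := by gcongr
    _ = 3 * Real.exp (u / 4 + -Real.pi * Real.exp u) := by rw [Real.exp_add]; ring
    _ ≤ _ := by
      gcongr
      have := Real.add_one_le_exp u
      nlinarith [Real.pi_gt_three]

theorem Phi_cont1 : Continuous fun u : ℝ => Real.exp (|u| / 4) * ck (Real.exp |u|) := by
  refine Continuous.mul (by fun_prop) ?_
  unfold ck
  refine Continuous.sub ?_ continuous_const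
  exact (HurwitzZeta.continuousOn_cosKernel 0).comp_continuous (by fun_prop) fun u => Real.exp_pos _

theorem Phi_bd (u : ℝ) : |Phi u| ≤ 4 * Real.exp (-(|u| / 4)) := by
  have h := Phi1_bd |u| (abs_nonneg u)
  have h0 : 0 ≤ Real.exp (|u| / 4) * ck (Real.exp |u|) := mul_nonneg (Real.exp_pos _).le (ck_bd _ (by linarith [Real.add_one_le_exp |u|, abs_nonneg u])).1
  have h1 : Real.exp (-2 * |u|) ≤ Real.exp (-(|u| / 4)) := by
    gcongr; linarith [abs_nonneg u]
  unfold Phi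
  have := Real.exp_pos (-(|u| / 4))
  rw [abs_le]; constructor <;> linarith

theorem int_exp_abs (c : ℝ) (hc : 0 < c) : Integrable fun u : ℝ => Real.exp (-(|u| * c)) := by
  rw [← integrableOn_univ, ← Iic_union_Ioi (a := (0:ℝ))]
  refine IntegrableOn.union ?_ ?_
  · refine (integrableOn_exp_mul_Iic hc 0).congr_fun (fun u hu => ?_) measurableSet_Iic
    simp only; rw [abs_of_nonpos hu]; congr 1; ring
  · refine (integrableOn_exp_mul_Ioi (a := -c) (by linarith) 0).congr_fun (fun u hu => ?_) measurableSet_Ioi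
    simp only; rw [abs_of_pos hu]; congr 1; ring

theorem ft_exp_abs (w : ℝ) : ∫ u : ℝ, Complex.exp (-(w * u * Complex.I)) * ((Real.exp (-(|u| / 4)) : ℝ) : ℂ) = 1 / (2 * (1 / 16 + w ^ 2)) := by
  have hI : Integrable fun u : ℝ => Complex.exp (-(w * u * Complex.I)) * ((Real.exp (-(|u| / 4)) : ℝ) : ℂ) := by
    refine (int_exp_abs (1 / 4) (by norm_num)).mono' (by fun_prop) (Eventually.of_forall fun u => ?_)
    rw [norm_mul, Complex.norm_exp, Complex.norm_real, Real.norm_of_nonneg (Real.exp_pos _).le]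
    simp [div_eq_mul_inv]
  rw [← intervalIntegral.integral_Iic_add_Ioi (b := 0) hI.integrableOn hI.integrableOn]
  have e1 : ∫ u : ℝ in Iic 0, Complex.exp (-(w * u * Complex.I)) * ((Real.exp (-(|u| / 4)) : ℝ) : ℂ)
      = ∫ u : ℝ in Iic 0, Complex.exp ((1 / 4 - w * Complex.I) * u) := by
    refine setIntegral_congr_fun measurableSet_Iic fun u hu => ?_
    rw [abs_of_nonpos hu, Complex.ofReal_exp, ← Complex.exp_add]
    congr 1; push_cast; ring
  have e2 : ∫ u : ℝ in Ioi 0, Complex.exp (-(w * u * Complex.I)) * ((Real.exp (-(|u| / 4)) : ℝ) : ℂ)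
      = ∫ u : ℝ in Ioi 0, Complex.exp ((-1 / 4 - w * Complex.I) * u) := by
    refine setIntegral_congr_fun measurableSet_Ioi fun u hu => ?_
    rw [abs_of_pos hu, Complex.ofReal_exp, ← Complex.exp_add]
    congr 1; push_cast; ring
  rw [e1, e2, integral_exp_mul_complex_Iic (by simp) 0, integral_exp_mul_complex_Ioi (by simp; norm_num) 0]
  simp only [Complex.ofReal_zero, mul_zero, Complex.exp_zero]
  have h1 : (1 / 4 - w * Complex.I : ℂ) ≠ 0 := fun h => by
    have := congrArg Complex.re h; norm_num at this
  have h2 : (-1 / 4 - w * Complex.I : ℂ) ≠ 0 := fun h => by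
    have := congrArg Complex.re h; norm_num at this
  have h3 : (1 / 16 + w ^ 2 : ℂ) ≠ 0 := fun h => by
    have h4 : (1 / 16 + w ^ 2 : ℝ) = 0 := by
      rw [← Complex.ofReal_inj]; push_cast; exact h
    have : 0 ≤ w ^ 2 := sq_nonneg w
    linarith
  rw [div_add_div _ _ h1 h2, div_eq_div_iff (mul_ne_zero h1 h2) (mul_ne_zero two_ne_zero h3)]
  ring_nf
  rw [Complex.I_sq]; ring

theorem lam_ft (w : ℝ) : ∫ u : ℝ, Complex.exp (-(w * u * Complex.I)) * (Phi u : ℂ) = 2 * completedRiemannZeta (1 / 2 + 2 * w * Complex.I) := by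
  set s : ℂ := 1 / 2 + 2 * w * Complex.I with hs
  have hsr : (s / 2).re = 1 / 4 := by
    have : s / 2 = ((1 / 4 : ℝ) : ℂ) + (w : ℂ) * Complex.I := by rw [hs]; push_cast; ring
    rw [this]; simp
  have hsi : (s / 2).im = w := by
    have : s / 2 = ((1 / 4 : ℝ) : ℂ) + (w : ℂ) * Complex.I := by rw [hs]; push_cast; ring
    rw [this]; simp
  have h1 : completedRiemannZeta₀ s = mellin (HurwitzZeta.hurwitzEvenFEPair 0).f_modif (s / 2) / 2 := rfl
  have h2 : completedRiemannZeta s = completedRiemannZeta₀ s - 1 / s - 1 / (1 - s) := completedRiemannZeta_eq s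
  have hnorm : ∀ u : ℝ, ‖Complex.exp (-(w * u * Complex.I))‖ = 1 := fun u => by
    rw [Complex.norm_exp]; simp
  have hm : mellin (HurwitzZeta.hurwitzEvenFEPair 0).f_modif (s / 2) =
      ∫ u : ℝ, Complex.exp (-(w * u * Complex.I)) * ((Real.exp (|u| / 4) * ck (Real.exp |u|) : ℝ) : ℂ) := by
    rw [mellin_eq_fourier, Real.fourier_eq', hsr, hsi]
    refine integral_congr_ae ?_
    have : ∀ᵐ u : ℝ, u ≠ 0 := by
      rw [ae_iff]; simp
    filter_upwards [this] with u hu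
    rw [smul_eq_mul]
    congr 1
    · congr 1
      have := Real.pi_pos.ne'
      simp only [RCLike.inner_apply, conj_trivial]
      push_cast
      have : (Real.pi : ℂ) ≠ 0 := by exact_mod_cast this
      field_simp
    · rw [WeakFEPair.f_modif, Pi.add_apply]
      rcases lt_or_gt_of_ne hu with h | h
      · have h3 : 1 < Real.exp (-u) := Real.one_lt_exp_iff.2 (by linarith)
        rw [indicator_of_mem (mem_Ioi.2 h3), indicator_of_notMem (fun h => absurd h.2 (not_lt.2 h3.le)), add_zero, abs_of_neg h]
        simp only [HurwitzZeta.hurwitzEvenFEPair, Function.comp_apply, HurwitzZeta.evenKernel_eq_cosKernel_of_zero, ck, if_true,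
          Complex.real_smul]
        push_cast
        congr 2; ring
      · have h3 : Real.exp (-u) < 1 := Real.exp_lt_one_iff.2 (by linarith)
        rw [indicator_of_notMem (fun h : _ ∈ Ioi _ => absurd (mem_Ioi.1 h) (not_lt.2 h3.le)), indicator_of_mem (mem_Ioo.2 ⟨Real.exp_pos _, h3⟩), zero_add, abs_of_pos h]
        simp only [HurwitzZeta.hurwitzEvenFEPair, Function.comp_apply, ck, Complex.real_smul, HurwitzZeta.evenKernel_functional_equation, smul_eq_mul, one_mul, mul_one]
        rw [← Complex.ofReal_sub, ← Complex.ofReal_mul]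
        congr 1
        rw [one_div (Real.exp (-u)), ← Real.exp_neg, neg_neg, Real.rpow_neg (Real.exp_pos _).le, ← one_div, ← mul_sub_one, ← mul_assoc]
        congr 1
        rw [← Real.exp_mul, one_div (Real.exp _), ← Real.exp_neg, ← Real.exp_add]
        congr 1; ring
  have hi2 : Integrable fun u : ℝ => Complex.exp (-(w * u * Complex.I)) * ((Real.exp (-(|u| / 4)) : ℝ) : ℂ) := by
    refine (int_exp_abs (1 / 4) (by norm_num)).mono' (by fun_prop) (Eventually.of_forall fun u => ?_)
    rw [norm_mul, hnorm, Complex.norm_real, Real.norm_of_nonneg (Real.exp_pos _).le]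
    simp [div_eq_mul_inv]
  have hi1 : Integrable fun u : ℝ => Complex.exp (-(w * u * Complex.I)) * ((Real.exp (|u| / 4) * ck (Real.exp |u|) : ℝ) : ℂ) := by
    refine ((int_exp_abs 2 (by norm_num)).const_mul 3).mono' ?_ (Eventually.of_forall fun u => ?_)
    · refine Continuous.aestronglyMeasurable (Continuous.mul (by fun_prop) ?_)
      exact Complex.continuous_ofReal.comp Phi_cont1
    · rw [norm_mul, hnorm, Complex.norm_real, one_mul, Real.norm_of_nonneg]
      · refine (Phi1_bd |u| (abs_nonneg u)).trans (le_of_eq ?_)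
        congr 2; ring
      · exact mul_nonneg (Real.exp_pos _).le (ck_bd _ (by linarith [Real.add_one_le_exp |u|, abs_nonneg u])).1
  have h5 : ∫ u : ℝ, Complex.exp (-(w * u * Complex.I)) * (Phi u : ℂ) =
      mellin (HurwitzZeta.hurwitzEvenFEPair 0).f_modif (s / 2) - 1 / (2 * (1 / 16 + w ^ 2)) := by
    rw [hm, ← ft_exp_abs, ← integral_sub hi1 hi2]
    congr 1; ext u
    rw [Phi]; push_cast; ring
  have h7 : (1 / 16 + w ^ 2 : ℂ) ≠ 0 := fun h => by
    have h4 : (1 / 16 + w ^ 2 : ℝ) = 0 := by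
      rw [← Complex.ofReal_inj]; push_cast; exact h
    have : 0 ≤ w ^ 2 := sq_nonneg w
    linarith
  have hs0 : s ≠ 0 := fun h => by rw [h] at hsr; norm_num at hsr
  have hs1 : 1 - s ≠ 0 := fun h => by
    have : s = 1 := by linear_combination -h
    rw [this] at hsr; norm_num at hsr
  have h8 : s * (1 - s) = 4 * (1 / 16 + w ^ 2) := by
    rw [hs]; ring_nf; rw [Complex.I_sq]; ring
  have h9 : 1 / s + 1 / (1 - s) = 1 / (4 * (1 / 16 + w ^ 2)) := by
    rw [← h8]; field_simp; ring
  rw [h5, h2, h1, sub_sub, h9]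
  field_simp; ring

theorem exp_neg_le_sq (y : ℝ) (hy : 0 < y) : Real.exp (-y) ≤ 2 / y ^ 2 := by
  have := Real.quadratic_le_exp_of_nonneg hy.le
  rw [Real.exp_neg, inv_le_comm₀ (Real.exp_pos _) (by positivity), inv_div]
  linarith

theorem summable_exp_abs_int (c : ℝ) (hc : 0 < c) : Summable fun n : ℤ => Real.exp (-(c * |(n:ℝ)|)) := by
  have h : Summable fun n : ℕ => Real.exp (-(c * n)) := by
    have := Real.summable_exp_nat_mul_iff.2 (by linarith : -c < 0)
    refine this.congr fun n => ?_
    congr 1; ring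
  refine Summable.of_nat_of_neg ?_ ?_ <;> simpa using h

open FourierTransform in
theorem phi_poisson (H θ : ℝ) (hH : 0 < H) :
    Summable (fun n : ℤ => completedRiemannZeta (1 / 2 + ((2 * (2 * Real.pi * n - θ) / H : ℝ) : ℂ) * Complex.I)) ∧
    ∑' j : ℤ, (Phi (j * H) : ℂ) * Complex.exp (j * θ * Complex.I) =
      2 / H * ∑' n : ℤ, completedRiemannZeta (1 / 2 + ((2 * (2 * Real.pi * n - θ) / H : ℝ) : ℂ) * Complex.I) := by
  set f : ℝ → ℂ := fun v => (Phi (v * H) : ℂ) * Complex.exp (v * θ * Complex.I) with hf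
  have hcont : Continuous Phi := by
    unfold Phi; exact Phi_cont1.sub (by fun_prop)
  have hc : Continuous f := (Complex.continuous_ofReal.comp (hcont.comp (by fun_prop))).mul (by fun_prop)
  have hHC : (H : ℂ) ≠ 0 := by exact_mod_cast hH.ne'
  have hF : ∀ n : ℤ, 𝓕 f (n : ℝ) = 2 / H * completedRiemannZeta (1 / 2 + ((2 * (2 * Real.pi * n - θ) / H : ℝ) : ℂ) * Complex.I) := by
    intro n
    have h1 := lam_ft ((2 * Real.pi * n - θ) / H)
    have h2 := Measure.integral_comp_mul_right (fun u : ℝ => Complex.exp (-(((2 * Real.pi * n - θ) / H : ℝ) * u * Complex.I)) * (Phi u : ℂ)) H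
    rw [h1, abs_of_pos (inv_pos.2 hH), Complex.real_smul] at h2
    rw [Real.fourier_eq']
    have h3 : ∀ v : ℝ, Complex.exp ((-2 * Real.pi * inner ℝ v (n:ℝ) : ℝ) * Complex.I) • f v =
        Complex.exp (-(((2 * Real.pi * n - θ) / H : ℝ) * ((v * H : ℝ) : ℂ) * Complex.I)) * (Phi (v * H) : ℂ) := by
      intro v
      rw [hf, smul_eq_mul]
      simp only [RCLike.inner_apply, conj_trivial]
      rw [mul_comm (Phi (v * H) : ℂ), ← mul_assoc, ← Complex.exp_add]
      congr 2
      push_cast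
      field_simp
      ring
    simp_rw [h3]
    rw [h2]
    push_cast
    rw [← mul_assoc]
    congr 1
    · field_simp
    · congr 3; ring
  have hsum : Summable (fun n : ℤ => completedRiemannZeta (1 / 2 + ((2 * (2 * Real.pi * n - θ) / H : ℝ) : ℂ) * Complex.I)) := by
    refine Summable.of_norm_bounded (g := fun n : ℤ => 1600 * Real.exp (0.74 * (2 * |θ| / H)) * Real.exp (-(0.74 * (4 * Real.pi / H) * |(n:ℝ)|)))
      ((summable_exp_abs_int _ (by have := Real.pi_pos; positivity)).mul_left _) fun n => ?_
    refine (lam_dec _).trans ?_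
    rw [mul_assoc 1600, ← Real.exp_add]
    gcongr
    rw [abs_div, abs_mul, abs_of_pos hH, abs_two]
    have h1 : |2 * Real.pi * n| - |θ| ≤ |2 * Real.pi * n - θ| := abs_sub_abs_le_abs_sub _ _
    rw [abs_mul, abs_of_pos Real.two_pi_pos] at h1
    have h2 : 2 * (2 * Real.pi * |(n:ℝ)| - |θ|) / H ≤ 2 * |2 * Real.pi * n - θ| / H := by gcongr
    have h3 : 2 * (2 * Real.pi * |(n:ℝ)| - |θ|) / H = 4 * Real.pi / H * |(n:ℝ)| - 2 * |θ| / H := by ring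
    rw [h3] at h2
    linarith
  refine ⟨hsum, ?_⟩
  have hdec : f =O[cocompact ℝ] fun x : ℝ => |x| ^ (-2 : ℝ) := by
    refine Asymptotics.IsBigO.of_bound (128 / H ^ 2) ?_
    have : ∀ᶠ v : ℝ in cocompact ℝ, v ≠ 0 := by
      have := (isCompact_singleton (x := (0:ℝ))).compl_mem_cocompact
      filter_upwards [this] with v hv using hv
    filter_upwards [this] with v hv
    have hv' : 0 < |v| := abs_pos.2 hv
    have e1 : ‖f v‖ = |Phi (v * H)| := by
      rw [hf]; simp only
      rw [norm_mul, Complex.norm_exp, Complex.norm_real, Real.norm_eq_abs]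
      simp
    rw [e1, Real.norm_of_nonneg (by positivity), Real.rpow_neg hv'.le, Real.rpow_two]
    refine (Phi_bd _).trans ?_
    have := exp_neg_le_sq (|v * H| / 4) (by positivity)
    calc _ ≤ 4 * (2 / (|v * H| / 4) ^ 2) := by gcongr
      _ = _ := by rw [abs_mul, abs_of_pos hH]; field_simp; norm_num
  have hP := Real.tsum_eq_tsum_fourier_of_rpow_decay_of_summable hc one_lt_two hdec (by
    simp_rw [hF]; exact hsum.mul_left _) 0
  simp only [zero_add, QuotientAddGroup.mk_zero, fourier_eval_zero, mul_one, hF] at hP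
  rw [tsum_mul_left] at hP
  rw [← hP]
  refine tsum_congr fun j => ?_
  rw [hf]; push_cast; rfl

noncomputable def sg : ℝ := 341 / 340
noncomputable def aR (j : ℕ) : ℝ := sg ^ j * ck (sg ^ (4 * j))

theorem sg_log : 1 / 341 ≤ Real.log sg ∧ Real.log sg ≤ 1 / 340 := by
  constructor
  · have := Real.one_sub_inv_le_log_of_pos (x := sg) (by norm_num [sg])
    refine le_trans ?_ this; norm_num [sg]
  · have := Real.log_le_sub_one_of_pos (x := sg) (by norm_num [sg])
    refine this.trans ?_; norm_num [sg]

theorem sg_exp (c : ℕ) (j : ℕ) : Real.exp ((j:ℝ) * (c * Real.log sg)) = sg ^ (c * j) := by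
  have h : Real.exp (Real.log sg) = sg := Real.exp_log (by norm_num [sg])
  rw [← mul_assoc, mul_comm (j:ℝ), ← Nat.cast_mul, Real.exp_nat_mul, h]

theorem phi_node (j : ℕ) : Phi (j * (4 * Real.log sg)) = aR j - (sg⁻¹) ^ j := by
  have hl := sg_log.1
  have h0 : (0:ℝ) ≤ j * (4 * Real.log sg) := by positivity
  have e1 := sg_exp 4 j
  have e2 := sg_exp 1 j
  push_cast at e1 e2
  have e3 : (j:ℝ) * (4 * Real.log sg) / 4 = j * (1 * Real.log sg) := by ring
  rw [Phi, abs_of_nonneg h0, e1, e3, Real.exp_neg, e2, aR, one_mul, inv_pow]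

theorem geo_cos (θ : ℝ) : HasSum (fun n : ℕ => 2 * (sg⁻¹ ^ n * Real.cos (n * θ))) (681 / (231881 - 231880 * Real.cos θ) + 1) := by
  set z : ℂ := (sg⁻¹ : ℝ) * Complex.exp (θ * Complex.I) with hz
  have hn : ‖z‖ < 1 := by
    rw [hz, norm_mul, Complex.norm_exp_ofReal_mul_I, Complex.norm_real]; norm_num [sg]
  have h := (Complex.hasSum_re (hasSum_geometric_of_norm_lt_one hn)).mul_left 2
  have e1 : ∀ n : ℕ, (z ^ n).re = sg⁻¹ ^ n * Real.cos (n * θ) := by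
    intro n
    rw [hz, mul_pow, ← Complex.exp_nat_mul, ← mul_assoc, ← Complex.ofReal_pow, Complex.re_ofReal_mul]
    congr 1
    rw [← Complex.ofReal_natCast, ← Complex.ofReal_mul, Complex.exp_ofReal_mul_I_re]
  simp_rw [e1] at h
  refine (congrArg (HasSum _) ?_).mpr h
  have e2 : z.re = 340 / 341 * Real.cos θ := by
    rw [hz, Complex.re_ofReal_mul, Complex.exp_ofReal_mul_I_re]; norm_num [sg]
  have e3 : z.im = 340 / 341 * Real.sin θ := by
    rw [hz, Complex.im_ofReal_mul, Complex.exp_ofReal_mul_I_im]; norm_num [sg]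
  rw [Complex.inv_re, Complex.normSq_apply, Complex.sub_re, Complex.sub_im, e2, e3, Complex.one_re, Complex.one_im]
  have hs := Real.sin_sq_add_cos_sq θ
  have hc := Real.cos_le_one θ
  have h1 : (1 - 340 / 341 * Real.cos θ) * (1 - 340 / 341 * Real.cos θ) + (0 - 340 / 341 * Real.sin θ) * (0 - 340 / 341 * Real.sin θ)
     = (231881 - 231880 * Real.cos θ) / 116281 := by
    linear_combination (340/341)^2 * hs
  rw [h1]
  have h2 : (231881 - 231880 * Real.cos θ) ≠ 0 := by linarith
  field_simp
  ring

theorem phi_sum (θ : ℝ) : Summable (fun n : ℕ => aR n * Real.cos (n * θ)) ∧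
    ∑' j : ℤ, (Phi (j * (4 * Real.log sg)) : ℂ) * Complex.exp (j * θ * Complex.I) =
      ((2 * ∑' n : ℕ, aR n * Real.cos (n * θ) - aR 0 - 681 / (231881 - 231880 * Real.cos θ) : ℝ) : ℂ) := by
  have hl : 0 < Real.log sg := by linarith [sg_log.1]
  set g : ℤ → ℂ := fun j => (Phi (j * (4 * Real.log sg)) : ℂ) * Complex.exp (j * θ * Complex.I) with hg
  have hs : Summable g := by
    refine Summable.of_norm_bounded ((summable_exp_abs_int _ hl).mul_left 4) fun j => ?_
    rw [hg]; simp only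
    rw [norm_mul, Complex.norm_real, Complex.norm_exp]
    have : (((j:ℂ) * θ * Complex.I)).re = 0 := by simp
    rw [this, Real.exp_zero, mul_one, Real.norm_eq_abs]
    refine (Phi_bd _).trans (le_of_eq ?_)
    rw [abs_mul, abs_of_pos (by positivity : 0 < 4 * Real.log sg)]
    congr 3; ring
  have h1 := hs.hasSum.nat_add_neg
  have hev : ∀ u : ℝ, Phi (-u) = Phi u := fun u => by simp [Phi]
  have h2 : ∀ n : ℕ, g n + g (-n) = ((2 * (aR n * Real.cos (n * θ)) - 2 * (sg⁻¹ ^ n * Real.cos (n * θ)) : ℝ) : ℂ) := by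
    intro n
    have e := Complex.two_cos (n * θ)
    have e3 := phi_node n
    rw [hg]; simp only
    push_cast
    have e4 : Phi (-(n:ℝ) * (4 * Real.log sg)) = aR n - (sg⁻¹) ^ n := by rw [neg_mul, hev, e3]
    rw [e3, e4]
    push_cast
    have e5 : Complex.exp (-(n:ℂ) * θ * Complex.I) = Complex.exp (-(n * θ) * Complex.I) := by congr 1; ring
    rw [e5]
    linear_combination (-(aR n : ℂ) + ((sg:ℂ)⁻¹) ^ n) * e
  simp_rw [h2] at h1
  have h3 : g 0 = ((aR 0 - 1 : ℝ) : ℂ) := by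
    rw [hg]; simp only
    have := phi_node 0
    push_cast at this ⊢
    rw [this]; simp
  rw [h3] at h1
  have h4 := Complex.hasSum_ofReal.2 (geo_cos θ)
  have h5 := h1.add h4
  have h6 : ∀ n : ℕ, ((2 * (aR n * Real.cos (n * θ)) - 2 * (sg⁻¹ ^ n * Real.cos (n * θ)) : ℝ) : ℂ) + ((2 * (sg⁻¹ ^ n * Real.cos (n * θ)) : ℝ) : ℂ)
      = ((2 * (aR n * Real.cos (n * θ)) : ℝ) : ℂ) := by intro n; push_cast; ring
  simp_rw [h6] at h5
  have h7 : Summable (fun n : ℕ => aR n * Real.cos (n * θ)) := by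
    have := (Complex.hasSum_re h5).summable
    simp only [Complex.ofReal_re] at this
    exact (summable_mul_left_iff two_ne_zero).1 this
  refine ⟨h7, ?_⟩
  have h8 := h5.unique (Complex.hasSum_ofReal.2 (h7.hasSum.mul_left 2))
  push_cast at h8 ⊢
  linear_combination h8

set_option exponentiation.threshold 2000 in
theorem alias_bd (θ : ℝ) (h0 : 0 ≤ θ) (h1 : θ ≤ 2.91) :
    ‖((2 * ∑' n : ℕ, aR n * Real.cos (n * θ) - aR 0 - 681 / (231881 - 231880 * Real.cos θ) : ℝ) : ℂ)
      - 2 / (4 * Real.log sg : ℝ) * completedRiemannZeta (1 / 2 + ((θ / (2 * Real.log sg) : ℝ) : ℂ) * Complex.I)‖ ≤ 1 / 2 ^ 585 := by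
  have hl : 0 < Real.log sg := by linarith [sg_log.1]
  obtain ⟨hs, hP⟩ := phi_poisson (4 * Real.log sg) θ (by positivity)
  rw [(phi_sum θ).2] at hP
  set L : ℤ → ℂ := fun n : ℤ => completedRiemannZeta (1 / 2 + ((2 * (2 * Real.pi * n - θ) / (4 * Real.log sg) : ℝ) : ℂ) * Complex.I) with hL
  have h2 := hs.hasSum.nat_add_neg
  have hL0 : L 0 = completedRiemannZeta (1 / 2 + ((θ / (2 * Real.log sg) : ℝ) : ℂ) * Complex.I) := by
    rw [hL, ← completedRiemannZeta_one_sub]; simp only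
    congr 1
    push_cast
    have : (Real.log sg : ℂ) ≠ 0 := by exact_mod_cast hl.ne'
    field_simp; ring
  have hb : ∀ n : ℤ, n ≠ 0 → ‖L n‖ ≤ 1600 * Real.exp (-424) ^ n.natAbs := by
    intro n hn
    refine (lam_dec _).trans ?_
    rw [← Real.exp_nat_mul]
    refine mul_le_mul_of_nonneg_left (Real.exp_le_exp.2 ?_) (by norm_num)
    rw [abs_div, abs_of_pos (by positivity : 0 < 4 * Real.log sg)]
    have h3 : 1 ≤ |(n:ℝ)| := by exact_mod_cast Int.one_le_abs hn
    have h4 : |2 * Real.pi * n| - |θ| ≤ |2 * Real.pi * n - θ| := abs_sub_abs_le_abs_sub _ _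
    rw [abs_mul, abs_of_pos Real.two_pi_pos, abs_of_nonneg h0] at h4
    have h5 : 3.373 * |(n:ℝ)| ≤ |2 * Real.pi * n - θ| := by nlinarith [Real.pi_gt_d4]
    have h6 : (n.natAbs : ℝ) = |(n:ℝ)| := by
      rw [Nat.cast_natAbs, Int.cast_abs]
    rw [h6, abs_mul, abs_two]
    have h7 : 573 * |(n:ℝ)| ≤ 2 * |2 * Real.pi * n - θ| / (4 * Real.log sg) := by
      rw [le_div_iff₀ (by positivity)]
      have := sg_log.2
      nlinarith
    linarith
  set q := Real.exp (-424) with hq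
  have hq1 : q ≤ 1 / 2 ^ 611 := by
    have h3 : (2:ℝ) ^ 611 ≤ Real.exp 424 := by
      rw [← Real.log_le_iff_le_exp (by positivity), Real.log_pow]
      have := Real.log_two_lt_d9
      push_cast; linarith
    rw [hq, Real.exp_neg, ← one_div]
    exact one_div_le_one_div_of_le (by positivity) h3
  have hq0 : 0 < q := Real.exp_pos _
  have hq2 : q ≤ 1 / 2 := hq1.trans (one_div_le_one_div_of_le (by norm_num) (by norm_num))
  rw [← hasSum_nat_add_iff' 1] at h2
  simp only [Finset.sum_range_one, Nat.cast_zero, neg_zero] at h2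
  have hbd : ‖∑' n, L n + L 0 - (L 0 + L 0)‖ ≤ 3200 * q * (1 - q)⁻¹ := by
    have hg := (hasSum_geometric_of_lt_one hq0.le (by linarith : q < 1)).mul_left (3200 * q)
    refine h2.norm_le_of_bounded hg fun n => ?_
    refine (norm_add_le _ _).trans ?_
    have e1 := hb ((n + 1 : ℕ) : ℤ) (by omega)
    have e2 := hb (-((n + 1 : ℕ) : ℤ)) (by omega)
    rw [Int.natAbs_neg] at e2
    rw [Int.natAbs_natCast] at e1 e2
    have : 3200 * q * q ^ n = 1600 * q ^ (n + 1) + 1600 * q ^ (n + 1) := by ring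
    rw [this]
    exact add_le_add e1 e2
  rw [hP, ← hL0, ← mul_sub, norm_mul]
  have e3 : ∑' n, L n + L 0 - (L 0 + L 0) = ∑' n, L n - L 0 := by ring
  rw [e3] at hbd
  have e4 : ‖(2 / ((4 * Real.log sg : ℝ) : ℂ))‖ ≤ 171 := by
    rw [norm_div, Complex.norm_real, Real.norm_of_nonneg (by positivity), Complex.norm_two, div_le_iff₀ (by positivity)]
    linarith [sg_log.1]
  have e5 : 3200 * q * (1 - q)⁻¹ ≤ 6400 * q := by
    rw [← div_eq_mul_inv, div_le_iff₀ (by linarith)]; nlinarith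
  calc _ ≤ 171 * (6400 * q) := mul_le_mul e4 (hbd.trans e5) (norm_nonneg _) (by norm_num)
    _ ≤ 171 * (6400 * (1 / 2 ^ 611)) := by gcongr
    _ ≤ 1 / 2 ^ 585 := by norm_num

section

theorem frc_eq (k : ℕ → ℕ) (n : ℕ) : frc k n = k n := by cases n <;> rfl

theorem gOne_pos : 0 < gOne := by unfold gOne; positivity
attribute [local irreducible] gOne gX

theorem ndiv (n m : ℕ) (hm : 0 < m) : ((n / m : ℕ) : ℝ) ≤ (n:ℝ) / m ∧ (n:ℝ) / m - 1 ≤ ((n / m : ℕ) : ℝ) := by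
  refine ⟨Nat.cast_div_le, ?_⟩
  have h : n < m * (n / m + 1) := Nat.lt_mul_div_succ n hm
  have h1 : (n:ℝ) < m * ((n / m : ℕ) + 1) := by exact_mod_cast h
  have h2 : (n:ℝ) / m < ((n / m : ℕ) + 1) := by
    rw [div_lt_iff₀ (by exact_mod_cast hm)]; linarith
  linarith

theorem fmul (a b : ℕ) (A B ea eb : ℝ) (ha : a ≤ gOne) (hb : b ≤ gOne) (h1 : |(a:ℝ) - gOne * A| ≤ ea) (h2 : |(b:ℝ) - gOne * B| ≤ eb)
    (hB : 0 ≤ B) (hB1 : B ≤ 1) :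
    |((a * b / gOne : ℕ) : ℝ) - gOne * (A * B)| ≤ ea + eb + 1 ∧ a * b / gOne ≤ gOne := by
  have hO : (0:ℝ) < gOne := by exact_mod_cast gOne_pos
  constructor
  · obtain ⟨h3, h4⟩ := ndiv (a * b) gOne gOne_pos
    have haO : (a:ℝ) / gOne ≤ 1 := by rw [div_le_one hO]; exact_mod_cast ha
    have e : (((a * b : ℕ) : ℝ)) / gOne - gOne * (A * B) = (a / gOne) * (b - gOne * B) + B * (a - gOne * A) := by
      push_cast; field_simp; ring
    have h5 : |(((a * b : ℕ) : ℝ)) / gOne - gOne * (A * B)| ≤ eb + ea := by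
      rw [e]
      refine (abs_add_le _ _).trans (add_le_add ?_ ?_)
      · rw [abs_mul, abs_of_nonneg (by positivity)]
        calc _ ≤ 1 * eb := mul_le_mul haO h2 (abs_nonneg _) (by norm_num)
          _ = eb := one_mul _
      · rw [abs_mul, abs_of_nonneg hB]
        calc _ ≤ 1 * ea := mul_le_mul hB1 h1 (abs_nonneg _) (by norm_num)
          _ = ea := one_mul _
    obtain ⟨h6, h7⟩ := abs_le.1 h5
    rw [abs_le]; constructor <;> linarith
  · rw [Nat.div_le_iff_le_mul_add_pred gOne_pos]
    have := Nat.mul_le_mul ha hb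
    omega

theorem gSq_err (r : ℕ) : ∀ (a : ℕ) (E e : ℝ), a ≤ gOne → 0 ≤ E → E ≤ 1 → |(a:ℝ) - gOne * E| ≤ e →
    |((gSq r a : ℕ) : ℝ) - gOne * E ^ (2 ^ r)| ≤ 2 ^ r * (e + 1) - 1 ∧ gSq r a ≤ gOne := by
  induction r with
  | zero =>
    intro a E e h1 h2 h3 h4
    refine ⟨?_, h1⟩
    change |(a:ℝ) - gOne * E ^ (2 ^ 0)| ≤ 2 ^ 0 * (e + 1) - 1
    rw [pow_zero, pow_one, pow_zero]; linarith
  | succ r ih =>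
    intro a E e h1 h2 h3 h4
    have h5 := fmul a a E E e e h1 h1 h4 h4 h2 h3
    have h6 := ih (a * a / gOne) (E * E) (e + e + 1) h5.2 (by positivity) (by nlinarith) h5.1
    have e1 : gSq (r + 1) a = gSq r (a * a / gOne) := frc_eq _ _
    rw [e1]
    refine ⟨?_, h6.2⟩
    have e2 : (E * E) ^ 2 ^ r = E ^ 2 ^ (r + 1) := by rw [← sq, ← pow_mul, pow_succ' 2 r]
    rw [e2] at h6
    refine h6.1.trans (le_of_eq ?_)
    rw [pow_succ]; ring

theorem gTh_err (q2 : ℕ) (Q E : ℝ) (hQ : 0 ≤ Q) (hQ1 : Q ≤ 1) (hq2 : q2 ≤ gOne) (h2 : |(q2:ℝ) - gOne * Q ^ 2| ≤ 2 * E - 1) (n : ℕ) :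
    ∀ (m s t p : ℕ), t ≤ gOne → p ≤ gOne → |(t:ℝ) - gOne * Q ^ (m ^ 2)| ≤ m ^ 2 * E - 1 →
    |(p:ℝ) - gOne * Q ^ (2 * m + 1)| ≤ (2 * m + 1) * E - 1 →
    |((gTh q2 n s t p : ℕ) : ℝ) - (s + gOne * ∑ i ∈ Finset.range n, Q ^ ((m + i) ^ 2))| ≤ ∑ i ∈ Finset.range n, (((m + i : ℕ) : ℝ) ^ 2 * E) := by
  induction n with
  | zero => intro m s t p _ _ _ _; simp [gTh]
  | succ n ih =>
    intro m s t p h3 h4 h5 h6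
    have e1 : gTh q2 (n + 1) s t p = gTh q2 n (s + t) (t * p / gOne) (p * q2 / gOne) := by
      change frc (fun t' => frc (fun p' => frc (fun s' => gTh q2 n s' t' p') (s + t)) (p * q2 / gOne)) (t * p / gOne) = _
      rw [frc_eq, frc_eq, frc_eq]
    have h7 := fmul t p _ _ _ _ h3 h4 h5 h6 (by positivity) (pow_le_one₀ hQ hQ1)
    have h8 := fmul p q2 _ _ _ _ h4 hq2 h6 h2 (by positivity) (pow_le_one₀ hQ hQ1)
    have h9 := ih (m + 1) (s + t) (t * p / gOne) (p * q2 / gOne) h7.2 h8.2 (by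
      refine le_trans (le_of_eq ?_) (h7.1.trans (le_of_eq ?_))
      · rw [← pow_add]; congr 4; ring
      · push_cast; ring) (by
      refine le_trans (le_of_eq ?_) (h8.1.trans (le_of_eq ?_))
      · rw [← pow_add]; congr 4
      · push_cast; ring)
    rw [e1, Finset.sum_range_succ', Finset.sum_range_succ']
    have e2 : ∀ i, m + 1 + i = m + (i + 1) := fun i => by ring
    simp_rw [e2] at h9
    simp only [add_zero]
    push_cast at h9 ⊢
    have e3 : ∀ X : ℝ, X - (s + gOne * (∑ i ∈ Finset.range n, Q ^ ((m + (i + 1)) ^ 2) + Q ^ m ^ 2)) =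
        (X - (s + t + gOne * ∑ i ∈ Finset.range n, Q ^ ((m + (i + 1)) ^ 2))) + (t - gOne * Q ^ m ^ 2) := fun X => by ring
    rw [e3]
    refine (abs_add_le _ _).trans (add_le_add h9 (h5.trans (by linarith)))

theorem gHor_err (w : ℕ) (hw : 2 * w ≤ gOne) (k : ℕ) : ∀ a : ℕ, a ≤ gOne → gHor w k a ≤ gOne ∧
    |((gHor w k a : ℕ) : ℝ) - gOne * (∑ i ∈ Finset.range k, (-((w:ℝ) / gOne)) ^ i / (i.factorial : ℝ) + (-((w:ℝ) / gOne)) ^ k / (k.factorial : ℝ) * (a / gOne))|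
      ≤ 2 - 2 * (1 / 2) ^ k := by
  have hO : (0:ℝ) < gOne := by exact_mod_cast gOne_pos
  set x := (w:ℝ) / gOne with hx
  have hx0 : 0 ≤ x := by positivity
  have hx1 : x ≤ 1 / 2 := by
    rw [hx, div_le_iff₀ hO]
    have : (2 * w : ℝ) ≤ gOne := by exact_mod_cast hw
    linarith
  induction k with
  | zero => intro a ha; refine ⟨ha, ?_⟩; simp [gHor]; field_simp; simp
  | succ k ih =>
    intro a ha
    have e1 : gHor w (k + 1) a = gHor w k (gOne - w * a / ((k + 1) * gOne)) := frc_eq _ _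
    have h1 : w * a / ((k + 1) * gOne) ≤ gOne := by
      rw [Nat.div_le_iff_le_mul_add_pred (by have := gOne_pos; positivity)]
      have h2 : w * a ≤ gOne * gOne := Nat.mul_le_mul (by omega) ha
      have h3 : gOne * gOne ≤ (k + 1) * gOne * gOne := by
        rw [mul_assoc]; exact Nat.le_mul_of_pos_left _ (by omega)
      omega
    obtain ⟨h2, h3⟩ := ih (gOne - w * a / ((k + 1) * gOne)) (Nat.sub_le _ _)
    rw [e1]
    refine ⟨h2, ?_⟩
    rw [Nat.cast_sub h1] at h3
    obtain ⟨d1, d2⟩ := ndiv (w * a) ((k + 1) * gOne) (by have := gOne_pos; positivity)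
    set D := ((w * a / ((k + 1) * gOne) : ℕ) : ℝ) with hD
    set δ := D - x * a / (k + 1) with hδ
    have e2 : (((w * a : ℕ) : ℝ)) / (((k + 1) * gOne : ℕ) : ℝ) = x * a / (k + 1) := by
      rw [hx]; push_cast; field_simp
    rw [e2] at d1 d2
    have hδ1 : |δ| ≤ 1 := by rw [abs_le]; constructor <;> linarith
    have e3 : (gOne:ℝ) * (∑ i ∈ Finset.range k, (-x) ^ i / (i.factorial : ℝ) + (-x) ^ k / (k.factorial : ℝ) * ((gOne - D) / gOne)) =
        gOne * (∑ i ∈ Finset.range (k + 1), (-x) ^ i / (i.factorial : ℝ) + (-x) ^ (k + 1) / ((k + 1).factorial : ℝ) * (a / gOne)) - (-x) ^ k / (k.factorial : ℝ) * δ := by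
      rw [Finset.sum_range_succ, Nat.factorial_succ, hδ, pow_succ]
      have : (k.factorial : ℝ) ≠ 0 := by positivity
      push_cast
      field_simp
      ring
    rw [e3] at h3
    have h4 : |(-x) ^ k / (k.factorial : ℝ) * δ| ≤ (1 / 2) ^ k := by
      rw [abs_mul, abs_div, abs_pow, abs_neg, abs_of_nonneg hx0, abs_of_pos (by positivity : (0:ℝ) < k.factorial)]
      have h5 : x ^ k / (k.factorial : ℝ) ≤ (1 / 2) ^ k := by
        rw [div_le_iff₀ (by positivity)]
        have : (1:ℝ) ≤ k.factorial := by exact_mod_cast Nat.one_le_iff_ne_zero.2 (Nat.factorial_ne_zero k)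
        calc x ^ k ≤ (1 / 2) ^ k := by gcongr
          _ = (1 / 2) ^ k * 1 := (mul_one _).symm
          _ ≤ _ := by gcongr
      calc _ ≤ (1 / 2) ^ k * 1 := mul_le_mul h5 hδ1 (abs_nonneg _) (by positivity)
        _ = _ := mul_one _
    have e4 : (2:ℝ) - 2 * (1 / 2) ^ (k + 1) = (2 - 2 * (1 / 2) ^ k) + (1 / 2) ^ k := by rw [pow_succ]; ring
    rw [e4]
    obtain ⟨a1, a2⟩ := abs_le.1 h3
    obtain ⟨b1, b2⟩ := abs_le.1 h4
    rw [abs_le]; constructor <;> linarith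

theorem gAt_err (y K : ℕ) (hy : 2 ≤ y) : |(gAt y K : ℝ) - gOne * Real.arctan (1 / y)| ≤ 2 * K + gOne * (1 / (y:ℝ)) ^ (4 * K + 1) := by
  have hO : (0:ℝ) < gOne := by exact_mod_cast gOne_pos
  have hy' : (2:ℝ) ≤ y := by exact_mod_cast hy
  set f : ℕ → ℝ := fun i => (1 / (y:ℝ)) ^ (2 * i + 1) / ((2 * i + 1 : ℕ) : ℝ) with hf
  have h1y : 1 / (y:ℝ) ≤ 1 := by rw [div_le_one (by linarith)]; linarith
  have hanti : Antitone f := by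
    refine antitone_nat_of_succ_le fun n => ?_
    rw [hf]; simp only
    exact div_le_div₀ (by positivity) (pow_le_pow_of_le_one (by positivity) h1y (by omega)) (by positivity) (by exact_mod_cast (by omega))
  have hs : HasSum (fun i => (-1) ^ i * f i) (Real.arctan (1 / y)) := by
    have := Real.hasSum_arctan (x := 1 / (y:ℝ)) (by
      rw [Real.norm_of_nonneg (by positivity), div_lt_one (by linarith)]; linarith)
    convert this using 2 with i
    rw [hf]; simp only; rw [mul_div_assoc]
  have ht := hs.tendsto_sum_nat
  have l1 := hanti.alternating_series_le_tendsto ht K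
  have l2 := hanti.tendsto_le_alternating_series ht K
  rw [Finset.sum_range_succ] at l2
  have hS : ∀ K, |(gAt y K : ℝ) - gOne * ∑ i ∈ Finset.range (2 * K), (-1) ^ i * f i| ≤ 2 * K := by
    intro K
    induction K with
    | zero => simp [gAt]
    | succ K ih =>
      have e1 : gAt y (K + 1) = (gOne / (y ^ (4 * K + 1) * (4 * K + 1)) - gOne / (y ^ (4 * K + 3) * (4 * K + 3))) + gAt y K := rfl
      have hle : gOne / (y ^ (4 * K + 3) * (4 * K + 3)) ≤ gOne / (y ^ (4 * K + 1) * (4 * K + 1)) := by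
        apply Nat.div_le_div_left
        · exact Nat.mul_le_mul (Nat.pow_le_pow_right (by omega) (by omega)) (by omega)
        · positivity
      rw [e1, Nat.cast_add, Nat.cast_sub hle, show 2 * (K + 1) = 2 * K + 1 + 1 by ring, Finset.sum_range_succ, Finset.sum_range_succ]
      obtain ⟨d1, d2⟩ := ndiv gOne (y ^ (4 * K + 1) * (4 * K + 1)) (by positivity)
      obtain ⟨d3, d4⟩ := ndiv gOne (y ^ (4 * K + 3) * (4 * K + 3)) (by positivity)
      have e2 : (gOne:ℝ) / ((y ^ (4 * K + 1) * (4 * K + 1) : ℕ) : ℝ) = gOne * f (2 * K) := by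
        rw [hf]; simp only; push_cast; rw [show 2 * (2 * K) + 1 = 4 * K + 1 by ring, one_div, inv_pow]; field_simp; ring
      have e3 : (gOne:ℝ) / ((y ^ (4 * K + 3) * (4 * K + 3) : ℕ) : ℝ) = gOne * f (2 * K + 1) := by
        rw [hf]; simp only; push_cast; rw [show 2 * (2 * K + 1) + 1 = 4 * K + 3 by ring, one_div, inv_pow]; field_simp; ring
      rw [e2] at d1 d2
      rw [e3] at d3 d4
      have p1 : (-1:ℝ) ^ (2 * K) = 1 := by simp
      have p2 : (-1:ℝ) ^ (2 * K + 1) = -1 := by rw [pow_succ, p1]; ring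
      rw [p1, p2]
      obtain ⟨i1, i2⟩ := abs_le.1 ih
      push_cast
      rw [abs_le]
      constructor <;> nlinarith
  obtain ⟨a1, a2⟩ := abs_le.1 (hS K)
  have p1 : (-1:ℝ) ^ (2 * K) = 1 := by simp
  rw [p1, one_mul] at l2
  have hfK : f (2 * K) ≤ (1 / (y:ℝ)) ^ (4 * K + 1) := by
    rw [hf]; simp only
    rw [show 2 * (2 * K) + 1 = 4 * K + 1 by ring]
    apply div_le_self (by positivity)
    push_cast; nlinarith [(Nat.cast_nonneg K : (0:ℝ) ≤ K)]
  have m1 := mul_le_mul_of_nonneg_left l1 hO.le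
  have m2 := mul_le_mul_of_nonneg_left l2 hO.le
  have m3 := mul_le_mul_of_nonneg_left hfK hO.le
  rw [mul_add] at m2
  rw [abs_le]; constructor <;> linarith

end

section

attribute [local irreducible] gOne gX

set_option exponentiation.threshold 3000 in
theorem gOne_cast : (gOne:ℝ) = 2 ^ 640 := by unfold gOne; norm_num

set_option exponentiation.threshold 3000 in
theorem gPi_err : |(gPi:ℝ) - gOne * Real.pi| ≤ 2 ^ 12 := by
  have h1 := gAt_err 5 75 (by norm_num)
  have h2 := gAt_err 239 24 (by norm_num)
  have h3 := Real.four_mul_arctan_inv_5_sub_arctan_inv_239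
  have e1 : (gOne:ℝ) * (1 / ((5:ℕ):ℝ)) ^ (4 * 75 + 1) ≤ 1 := by rw [gOne_cast]; norm_num
  have e2 : (gOne:ℝ) * (1 / ((239:ℕ):ℝ)) ^ (4 * 24 + 1) ≤ 1 := by rw [gOne_cast]; norm_num
  have hO : (1000000:ℝ) ≤ gOne := by rw [gOne_cast]; norm_num
  push_cast at h1 h2 e1 e2
  rw [one_div] at h1 h2
  have a1 := abs_le.1 h1
  have a2 := abs_le.1 h2
  have hp := Real.pi_gt_three
  have h4 : gAt 239 24 ≤ 4 * gAt 5 75 := by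
    have : (gAt 239 24 : ℝ) ≤ 4 * gAt 5 75 := by nlinarith
    exact_mod_cast this
  have e3 : (gPi:ℝ) = 4 * (4 * gAt 5 75 - gAt 239 24) := by
    unfold gPi; push_cast [Nat.cast_sub h4]; ring
  have e4 : (gOne:ℝ) * Real.pi = 4 * (4 * (gOne * Real.arctan 5⁻¹) - gOne * Real.arctan 239⁻¹) := by
    linear_combination (-4 * (gOne:ℝ)) * h3
  rw [e3, e4, abs_le]
  constructor <;> linarith [a1.1, a1.2, a2.1, a2.2]

theorem sg_pow_le (n : ℕ) : 1 ≤ sg ^ n ∧ sg ^ n ≤ Real.exp (n / 340) := by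
  have h0 : (1:ℝ) ≤ sg := by unfold sg; norm_num
  refine ⟨one_le_pow₀ h0, ?_⟩
  rw [← Real.exp_log (by linarith : (0:ℝ) < sg), ← Real.exp_nat_mul]
  apply Real.exp_le_exp.2
  have := mul_le_mul_of_nonneg_left sg_log.2 (Nat.cast_nonneg (α := ℝ) n)
  linarith

theorem ck_tail (x : ℝ) (hx : 1 ≤ x) : |ck x - 2 * ∑ i ∈ Finset.range 11, Real.exp (-Real.pi * x) ^ ((1 + i) ^ 2)| ≤ (1 / 2) ^ 610 := by
  have h := ck_hasSum x (lt_of_lt_of_le one_pos hx)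
  have h1 := h.summable.sum_add_tsum_nat_add 11
  rw [h.tsum_eq] at h1
  have e : 2 * ∑ i ∈ Finset.range 11, Real.exp (-Real.pi * x) ^ ((1 + i) ^ 2) = ∑ i ∈ Finset.range 11, 2 * Real.exp (-Real.pi * ((i:ℝ) + 1) ^ 2 * x) := by
    rw [Finset.mul_sum]
    refine Finset.sum_congr rfl fun i _ => ?_
    rw [← Real.exp_nat_mul]; push_cast; congr 2; ring
  rw [e, ← h1, add_sub_cancel_left]
  have hr : Real.exp (-36) ≤ (1 / 2) ^ 51 := by
    rw [Real.exp_neg, one_div, inv_pow]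
    apply inv_anti₀ (by positivity)
    have : Real.exp 36 = Real.exp 1 ^ 36 := by rw [← Real.exp_nat_mul]; norm_num
    rw [this]
    calc (2:ℝ) ^ 51 ≤ 2.7 ^ 36 := by norm_num
      _ ≤ _ := by gcongr; linarith [Real.exp_one_gt_d9]
  have hr1 : Real.exp (-36) < 1 := by rw [Real.exp_lt_one_iff]; norm_num
  have hg := (hasSum_geometric_of_lt_one (Real.exp_pos (-36)).le hr1).mul_left (2 * Real.exp (-36) ^ 12)
  have hb : ∀ n : ℕ, 2 * Real.exp (-Real.pi * (((n + 11 : ℕ):ℝ) + 1) ^ 2 * x) ≤ 2 * Real.exp (-36) ^ 12 * Real.exp (-36) ^ n := by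
    intro n
    rw [mul_assoc 2 (Real.exp (-36) ^ 12), ← pow_add, ← Real.exp_nat_mul]
    apply mul_le_mul_of_nonneg_left (Real.exp_le_exp.2 ?_) (by norm_num)
    push_cast
    have hp := Real.pi_gt_three
    have hn : (0:ℝ) ≤ n := Nat.cast_nonneg n
    have h3 : 3 * ((n:ℝ) + 12) ^ 2 ≤ Real.pi * ((n:ℝ) + 12) ^ 2 * x := by
      have : 3 * ((n:ℝ) + 12) ^ 2 ≤ Real.pi * ((n:ℝ) + 12) ^ 2 := by gcongr
      nlinarith [this, (by positivity : 0 ≤ Real.pi * ((n:ℝ) + 12) ^ 2)]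
    rw [show (n:ℝ) + 11 + 1 = n + 12 by ring]
    nlinarith
  have hs := hg.summable.of_nonneg_of_le (fun n => by positivity) hb
  rw [abs_of_nonneg (tsum_nonneg fun n => by positivity)]
  refine (hs.tsum_le_tsum hb hg.summable).trans ?_
  rw [hg.tsum_eq]
  have h2 : (1 - Real.exp (-36))⁻¹ ≤ 2 := by
    rw [inv_le_comm₀ (by linarith) (by norm_num)]
    have : ((1:ℝ) / 2) ^ 51 ≤ 1 / 2 := by norm_num
    linarith
  calc _ ≤ 2 * ((1 / 2) ^ 51) ^ 12 * (2:ℝ) := by gcongr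
    _ ≤ _ := by rw [← pow_mul, show 51 * 12 = 610 + 2 by norm_num, pow_add]; generalize ((1:ℝ) / 2) ^ 610 = z; exact le_of_eq (by ring)

theorem exp_lip (y x : ℝ) (hy : 0 ≤ y) (hx : 0 ≤ x) : |Real.exp (-y) - Real.exp (-x)| ≤ |y - x| := by
  wlog h : y ≤ x generalizing x y
  · rw [abs_sub_comm, abs_sub_comm y]; exact this x y hx hy (by linarith)
  rw [abs_of_nonneg (sub_nonneg.2 (Real.exp_le_exp.2 (by linarith))), abs_of_nonpos (by linarith)]
  have t1 := Real.add_one_le_exp (-x - -y)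
  have t2 : Real.exp (-y) ≤ 1 := Real.exp_le_one_iff.2 (by linarith)
  have t3 : Real.exp (-x) = Real.exp (-y) * Real.exp (-x - -y) := by rw [← Real.exp_add]; ring_nf
  rw [t3]; nlinarith [Real.exp_pos (-y)]

set_option exponentiation.threshold 3000 in
set_option maxHeartbeats 1000000 in
theorem gA_err (j : ℕ) (hj : j ≤ 420) : |(gA gPi j : ℝ) - gOne * aR j| ≤ 2 ^ 40 := by
  have hO : (0:ℝ) < gOne := by exact_mod_cast gOne_pos
  have hObig : (2:ℝ) ^ 30 ≤ gOne := by rw [gOne_cast]; norm_num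
  obtain ⟨s1, s2⟩ := sg_pow_le (4 * j)
  obtain ⟨r1, r2⟩ := sg_pow_le j
  have hj' : (j:ℝ) ≤ 420 := by exact_mod_cast hj
  have he := Real.exp_one_lt_d9
  have s3 : sg ^ (4 * j) ≤ 150 := by
    refine s2.trans ((Real.exp_le_exp.2 (by push_cast; linarith : ((4 * j : ℕ):ℝ) / 340 ≤ (5:ℕ) * 1)).trans ?_)
    rw [Real.exp_nat_mul]
    calc _ ≤ (2.719:ℝ) ^ 5 := by gcongr; linarith
      _ ≤ 150 := by norm_num
  have r3 : sg ^ j ≤ 4 := by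
    refine r2.trans ((Real.exp_le_exp.2 (by linarith : (j:ℝ) / 340 ≤ 5 / 4)).trans ?_)
    have : Real.exp (5 / 4) ^ 4 ≤ 4 ^ 4 := by
      rw [← Real.exp_nat_mul, show ((4:ℕ):ℝ) * (5 / 4) = (5:ℕ) * 1 by norm_num, Real.exp_nat_mul]
      calc _ ≤ (2.719:ℝ) ^ 5 := by gcongr; linarith
        _ ≤ _ := by norm_num
    exact le_of_pow_le_pow_left₀ (by norm_num) (by norm_num) this
  set S := sg ^ (4 * j) with hS
  have hpi := abs_le.1 gPi_err
  -- the argument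
  set w := gPi * 341 ^ (4 * j) / (340 ^ (4 * j) * 2 ^ 24) with hw
  have d := ndiv (gPi * 341 ^ (4 * j)) (340 ^ (4 * j) * 2 ^ 24) (by positivity)
  rw [← hw] at d
  have e1 : (((gPi * 341 ^ (4 * j) : ℕ) : ℝ)) / ((340 ^ (4 * j) * 2 ^ 24 : ℕ) : ℝ) = gPi * S / 2 ^ 24 := by
    rw [hS]; unfold sg; push_cast; rw [div_pow]; field_simp; norm_num
  rw [e1] at d
  obtain ⟨d1, d2⟩ := d
  set x := Real.pi * S / 2 ^ 24 with hx
  have hwx : |(w:ℝ) - gOne * x| ≤ 2 := by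
    have a1 : gPi * S / 2 ^ 24 - gOne * x = (gPi - gOne * Real.pi) * S / 2 ^ 24 := by rw [hx]; ring
    have a2 : |gPi * S / 2 ^ 24 - gOne * x| ≤ 1 := by
      rw [a1, abs_div, abs_mul, abs_of_nonneg (by linarith : (0:ℝ) ≤ S), abs_of_pos (by norm_num : (0:ℝ) < 2 ^ 24), div_le_one (by norm_num)]
      calc _ ≤ (2:ℝ) ^ 12 * 150 := by
            apply mul_le_mul gPi_err s3 (by linarith) (by norm_num)
        _ ≤ _ := by norm_num
    obtain ⟨b1, b2⟩ := abs_le.1 a2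
    rw [abs_le]; constructor <;> linarith
  obtain ⟨w1, w2⟩ := abs_le.1 hwx
  set y := (w:ℝ) / gOne with hy
  have hyx : |y - x| ≤ 2 / gOne := by
    rw [show y - x = (w - gOne * x) / gOne by rw [hy]; field_simp, abs_div, abs_of_pos hO]; gcongr
  have hx0 : 0 ≤ x := by rw [hx]; positivity
  have hx1 : x ≤ 480 / 2 ^ 24 := by
    rw [hx]; gcongr
    calc _ ≤ 3.2 * (150:ℝ) := by
          apply mul_le_mul (by linarith [Real.pi_lt_d2]) s3 (by linarith) (by norm_num)
      _ ≤ 480 := by norm_num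
  have hy0 : 0 ≤ y := by positivity
  have hy1 : y ≤ 481 / 2 ^ 24 := by
    have : 2 / (gOne:ℝ) ≤ 1 / 2 ^ 24 := by
      rw [div_le_div_iff₀ hO (by norm_num)]; linarith
    have := (abs_le.1 hyx).2
    linarith
  have hw2 : 2 * w ≤ gOne := by
    have : (2:ℝ) * w ≤ gOne := by
      have : (w:ℝ) = y * gOne := by rw [hy]; field_simp
      rw [this, ← mul_assoc]; exact mul_le_of_le_one_left hO.le (by linarith)
    exact_mod_cast this
  obtain ⟨g1, g2⟩ := gHor_err w hw2 36 gOne le_rfl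
  rw [← hy, div_self hO.ne', mul_one] at g2
  rw [← Finset.sum_range_succ (fun i => (-y) ^ i / (i.factorial : ℝ)) 36] at g2
  have g3 := Real.exp_bound (x := -y) (by rw [abs_neg, abs_of_nonneg hy0]; linarith) (n := 37) (by norm_num)
  have g4 : (gOne:ℝ) * (|(-y)| ^ 37 * (((37:ℕ).succ : ℕ) / (((37:ℕ).factorial : ℝ) * ((37:ℕ):ℝ)))) ≤ 1 := by
    rw [abs_neg, abs_of_nonneg hy0]
    calc _ ≤ (gOne:ℝ) * ((481 / 2 ^ 24) ^ 37 * (((37:ℕ).succ : ℕ) / (((37:ℕ).factorial : ℝ) * ((37:ℕ):ℝ)))) := by gcongr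
      _ ≤ 1 := by rw [gOne_cast]; norm_num [Nat.factorial]
  have g5 : |Real.exp (-y) - Real.exp (-x)| ≤ 2 / gOne := by
    exact (exp_lip y x hy0 hx0).trans hyx
  have g6 : |((gHor w 36 gOne : ℕ) : ℝ) - gOne * Real.exp (-x)| ≤ 7 := by
    set V := ((gHor w 36 gOne : ℕ) : ℝ)
    have t1 : |gOne * (Real.exp (-y) - ∑ m ∈ Finset.range 37, (-y) ^ m / (m.factorial : ℝ))| ≤ 1 := by
      rw [abs_mul, abs_of_pos hO]; exact (mul_le_mul_of_nonneg_left g3 hO.le).trans g4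
    have t2 : |gOne * (Real.exp (-y) - Real.exp (-x))| ≤ 2 := by
      rw [abs_mul, abs_of_pos hO]; refine (mul_le_mul_of_nonneg_left g5 hO.le).trans (le_of_eq ?_); field_simp
    have t3 := abs_le.1 t1
    have t4 := abs_le.1 t2
    have t5 := abs_le.1 g2
    have : (0:ℝ) < (1 / 2) ^ 36 := by positivity
    rw [abs_le]; constructor <;> linarith [t3.1, t3.2, t4.1, t4.2, t5.1, t5.2]
  have hE1 : Real.exp (-x) ≤ 1 := Real.exp_le_one_iff.2 (by linarith)
  obtain ⟨q1, q2⟩ := gSq_err 24 _ _ _ g1 (Real.exp_pos _).le hE1 g6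
  have eQ : Real.exp (-x) ^ 2 ^ 24 = Real.exp (-Real.pi * S) := by
    rw [← Real.exp_nat_mul, hx]; push_cast; congr 1; ring
  rw [eQ] at q1
  set Q := Real.exp (-Real.pi * S) with hQ
  set q := gSq 24 (gHor w 36 gOne) with hq
  have hQ1 : Q ≤ 1 := Real.exp_le_one_iff.2 (by rw [neg_mul]; exact neg_nonpos.2 (by positivity))
  have hQ0 : 0 ≤ Q := (Real.exp_pos _).le
  obtain ⟨E, hE⟩ : ∃ E : ℝ, E = 2 ^ 27 := ⟨_, rfl⟩
  have q1' : |(q:ℝ) - gOne * Q| ≤ E - 1 := q1.trans (by rw [hE]; norm_num)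
  have f1 := fmul q q Q Q _ _ q2 q2 q1' q1' hQ0 hQ1
  have f2 := fmul q (q * q / gOne) Q (Q * Q) _ _ q2 f1.2 q1' f1.1 (by positivity) (mul_le_one₀ hQ1 hQ0 hQ1)
  have th := gTh_err (q * q / gOne) Q E hQ0 hQ1 f1.2 (by rw [sq]; exact f1.1.trans (by linarith)) 11 1 0 q (q * (q * q / gOne) / gOne) q2 f2.2
    (by simpa using q1') (by
      refine le_trans (le_of_eq ?_) (f2.1.trans (le_of_eq ?_))
      · congr 3; ring
      · push_cast; ring)
  set T := gTh (q * q / gOne) 11 0 q (q * (q * q / gOne) / gOne) with hT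
  have eg : gA gPi j = T * 2 * 341 ^ j / 340 ^ j := by
    rw [gA, frc_eq, frc_eq]
  rw [eg]
  obtain ⟨m1, m2⟩ := ndiv (T * 2 * 341 ^ j) (340 ^ j) (by positivity)
  have e5 : (((T * 2 * 341 ^ j : ℕ) : ℝ)) / ((340 ^ j : ℕ) : ℝ) = 2 * T * sg ^ j := by
    unfold sg; push_cast; rw [div_pow]; field_simp
  rw [e5] at m1 m2
  have hct := ck_tail S s1
  rw [← hQ] at hct
  set SS := ∑ i ∈ Finset.range 11, Q ^ ((1 + i) ^ 2) with hSS
  have th1 : |(T:ℝ) - gOne * SS| ≤ 2 ^ 36 := by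
    have a1 : ∑ i ∈ Finset.range 11, (((1 + i : ℕ) : ℝ) ^ 2 * E) ≤ 2 ^ 36 := by
      rw [hE]; norm_num [Finset.sum_range_succ]
    have a2 := th.trans a1
    rwa [Nat.cast_zero, zero_add] at a2
  have k1 : |gOne * (ck S - 2 * SS)| ≤ 2 ^ 36 := by
    rw [abs_mul, abs_of_pos hO]
    refine (mul_le_mul_of_nonneg_left hct hO.le).trans ?_
    rw [gOne_cast]; norm_num
  have e6 : 2 * T * sg ^ j - gOne * aR j = sg ^ j * (2 * (T - gOne * SS) - gOne * (ck S - 2 * SS)) := by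
    unfold aR; rw [← hS]; ring
  have k2 : |2 * T * sg ^ j - gOne * aR j| ≤ 4 * (3 * 2 ^ 36) := by
    rw [e6, abs_mul, abs_of_nonneg (by linarith : 0 ≤ sg ^ j)]
    apply mul_le_mul r3 _ (abs_nonneg _) (by norm_num)
    have := abs_le.1 th1
    have := abs_le.1 k1
    rw [abs_le]; constructor <;> linarith
  have := abs_le.1 k2
  rw [abs_le]; constructor <;> linarith

end

section

attribute [local irreducible] gOne gX

theorem pk_pow (X y : ℤ) (ζ : ℂ) (hζ : ζ ^ 2 = y * ζ - 2 ^ 40) (n : ℕ) :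
    ∃ u v q : ℤ, X ^ n = u * X + v + (X ^ 2 - y * X + 2 ^ 40) * q ∧ ζ ^ n = u * ζ + v := by
  induction n with
  | zero => exact ⟨0, 1, 0, by ring, by push_cast; ring⟩
  | succ n ih =>
    obtain ⟨u, v, q, h1, h2⟩ := ih
    refine ⟨u * y + v, -(u * 2 ^ 40), u + X * q, ?_, ?_⟩
    · rw [pow_succ, h1]; ring
    · rw [pow_succ, h2]; push_cast; linear_combination (u : ℂ) * hζ

theorem pk_sum (X y : ℤ) (ζ : ℂ) (hζ : ζ ^ 2 = y * ζ - 2 ^ 40) (b : ℕ → ℤ) (n : ℕ) :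
    ∃ u v q : ℤ, ∑ j ∈ Finset.range n, b j * X ^ j = u * X + v + (X ^ 2 - y * X + 2 ^ 40) * q ∧
      ∑ j ∈ Finset.range n, (b j : ℂ) * ζ ^ j = u * ζ + v := by
  induction n with
  | zero => exact ⟨0, 0, 0, by simp, by simp⟩
  | succ n ih =>
    obtain ⟨u, v, q, h1, h2⟩ := ih
    obtain ⟨u', v', q', h1', h2'⟩ := pk_pow X y ζ hζ n
    refine ⟨u + b n * u', v + b n * v', q + b n * q', ?_, ?_⟩
    · rw [Finset.sum_range_succ, h1, h1']; ring
    · rw [Finset.sum_range_succ, h2, h2']; push_cast; ring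

theorem gPack_eq (p n : ℕ) : ∀ (N : ℕ) (k : ℕ → ℕ), gPack p n N k = k (N + ∑ j ∈ Finset.range n, gA p j * 2 ^ (20 * (420 - j) + 9088 * j)) := by
  induction n with
  | zero => intro N k; rfl
  | succ n ih =>
    intro N k
    have e1 : gPack p (n + 1) N k = frc (fun N' => gPack p n N' k) (N + gA p n * 2 ^ (20 * (420 - n) + 9088 * n)) := rfl
    rw [e1, frc_eq, ih, Finset.sum_range_succ]; congr 1; ring

/-- decoding of the residue -/
theorem pk_dec (Z Y N M : ℕ) (u v q : ℤ) (hZ : 2 ^ 30 ≤ Z) (hY : Y < 2 ^ 22)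
    (hu : 4 * |u| ≤ Z) (hv : 2 * |v| ≤ Z) (hM : (M : ℤ) = (2 * Z : ℤ) ^ 2 - (Y - 2 ^ 21) * (2 * Z) + 2 ^ 40)
    (hN : (N : ℤ) = Z * (2 * Z) + Z + (u * (2 * Z) + v + M * q)) :
    ((N % M / (2 * Z) : ℕ) : ℤ) = u + Z ∧ ((N % M % (2 * Z) : ℕ) : ℤ) = v + Z := by
  have := abs_le.1 (le_refl |u|)
  have := abs_le.1 (le_refl |v|)
  obtain ⟨U, hU⟩ := Int.eq_ofNat_of_zero_le (by linarith : 0 ≤ u + Z)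
  obtain ⟨V, hV⟩ := Int.eq_ofNat_of_zero_le (by linarith : 0 ≤ v + Z)
  have hVX : V < 2 * Z := by zify; rw [← hV]; zify at hZ; linarith
  have hlt : (U : ℤ) * (2 * Z) + V < M := by
    rw [hM, ← hU, ← hV]; zify at hZ hY; nlinarith
  have e : N % M = U * (2 * Z) + V := by
    zify
    rw [hN, show (Z:ℤ) * (2 * Z) + Z + (u * (2 * Z) + v + M * q) = (U * (2 * Z) + V) + M * q by rw [← hU, ← hV]; ring, Int.add_mul_emod_self_left]
    exact Int.emod_eq_of_lt (by positivity) hlt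
  rw [e]
  constructor
  · rw [show U * (2 * Z) + V = V + (2 * Z) * U by ring, Nat.add_mul_div_left _ _ (by omega), Nat.div_eq_of_lt hVX, zero_add]; exact hU.symm
  · rw [show U * (2 * Z) + V = V + (2 * Z) * U by ring, Nat.add_mul_mod_self_left, Nat.mod_eq_of_lt hVX]; exact hV.symm

set_option exponentiation.threshold 20000 in
theorem aR_tail (θ : ℝ) : |∑' n : ℕ, aR n * Real.cos (n * θ) - ∑ n ∈ Finset.range 420, aR n * Real.cos (n * θ)| ≤ (1 / 2) ^ 600 := by
  have hs := (phi_sum θ).1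
  rw [← hs.sum_add_tsum_nat_add 420, add_sub_cancel_left]
  have h0 : (1:ℝ) ≤ sg := by unfold sg; norm_num
  have hb : ∀ n : ℕ, ‖aR (n + 420) * Real.cos (((n + 420 : ℕ):ℝ) * θ)‖ ≤ 12 * Real.exp (-423) * Real.exp (-4) ^ n := by
    intro n
    have h1 : (135:ℝ) ≤ sg ^ 1680 := by unfold sg; norm_num
    have h4 : sg ^ 420 ≤ (4:ℝ) := by unfold sg; norm_num
    have h2 : 1 + (4 * n : ℕ) * (1 / 340 : ℝ) ≤ sg ^ (4 * n) := by
      have := one_add_mul_le_pow (by norm_num : (-2:ℝ) ≤ 1 / 340) (4 * n)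
      rwa [show (1:ℝ) + 1 / 340 = sg by unfold sg; norm_num] at this
    have h3 := (sg_pow_le n).2
    set S := sg ^ (4 * (n + 420)) with hS
    have hS1 : 135 + 1.58 * (n:ℝ) ≤ S := by
      rw [hS, show 4 * (n + 420) = 1680 + 4 * n by ring, pow_add]
      push_cast at h2
      have hn : (0:ℝ) ≤ n := Nat.cast_nonneg n
      have := mul_le_mul h1 h2 (by positivity) (by positivity)
      linarith
    have hn : (0:ℝ) ≤ n := Nat.cast_nonneg n
    obtain ⟨c0, c1⟩ := ck_bd S (by linarith)
    have ha : aR (n + 420) = sg ^ (n + 420) * ck S := rfl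
    rw [norm_mul, ha, Real.norm_of_nonneg (mul_nonneg (by positivity) c0), Real.norm_eq_abs]
    have e1 : Real.exp (-Real.pi * S) ≤ Real.exp (-423 - (n / 340) + n * (-4)) := by
      apply Real.exp_le_exp.2
      have := Real.pi_gt_d2
      have : 3.14 * (135 + 1.58 * (n:ℝ)) ≤ Real.pi * S := by gcongr
      linarith
    calc _ ≤ (Real.exp (n / 340) * 4 * (3 * Real.exp (-423 - (n / 340) + n * (-4)))) * 1 := by
          apply mul_le_mul _ (Real.abs_cos_le_one _) (abs_nonneg _) (by positivity)
          rw [pow_add]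
          exact mul_le_mul (mul_le_mul h3 h4 (by positivity) (by positivity)) (c1.trans (by linarith)) c0 (by positivity)
      _ = 12 * Real.exp (-423) * Real.exp (-4) ^ n := by
          rw [Real.exp_add, Real.exp_sub, Real.exp_nat_mul]; field_simp; ring
  have hr : Real.exp (-4) ≤ 1 / 2 := by
    rw [Real.exp_neg]
    have := Real.add_one_le_exp (4:ℝ)
    rw [one_div]; apply inv_anti₀ (by norm_num); linarith
  have hg := (hasSum_geometric_of_lt_one (Real.exp_pos (-4)).le (by linarith)).mul_left (12 * Real.exp (-423))
  refine (tsum_of_norm_bounded hg hb).trans ?_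
  have h2 : (1 - Real.exp (-4))⁻¹ ≤ 2 := by
    rw [inv_le_comm₀ (by linarith) (by norm_num)]; linarith
  have h3 : Real.exp (-423) ≤ (1 / 2) ^ 605 := by
    rw [Real.exp_neg, one_div, inv_pow]
    apply inv_anti₀ (by positivity)
    have : Real.exp 423 = Real.exp 1 ^ 423 := by rw [← Real.exp_nat_mul]; norm_num
    rw [this]
    calc (2:ℝ) ^ 605 ≤ 2.7 ^ 423 := by norm_num
      _ ≤ _ := by gcongr; linarith [Real.exp_one_gt_d9]
  have h5 : 0 ≤ (1 - Real.exp (-4))⁻¹ := inv_nonneg.2 (by linarith)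
  calc _ ≤ 12 * (1 / 2) ^ 605 * (2:ℝ) := by gcongr
    _ ≤ _ := by rw [show 605 = 600 + 5 by norm_num, pow_add]; have : (0:ℝ) < (1 / 2) ^ 600 := by positivity
                generalize ((1:ℝ) / 2) ^ 600 = z at *; linarith

theorem gCmp_spec (a b : ℕ) : (gCmp a b = 1 → b + 2 ^ 8470 ≤ a) ∧ (gCmp a b = 2 → a + 2 ^ 8470 ≤ b) := by
  unfold gCmp
  generalize 2 ^ 8470 = K
  cases h1 : Nat.ble (b + K) a <;> cases h2 : Nat.ble (a + K) b <;> simp_all [Nat.ble_eq]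

theorem aR_bd (j : ℕ) : 0 ≤ aR j ∧ (j ≤ 420 → aR j ≤ 3) := by
  have h0 : (1:ℝ) ≤ sg := by unfold sg; norm_num
  have hS : 1 ≤ sg ^ (4 * j) := one_le_pow₀ h0
  obtain ⟨c0, c1⟩ := ck_bd _ hS
  have h2 : sg ^ j ≤ sg ^ (4 * j) := pow_le_pow_right₀ h0 (by omega)
  refine ⟨mul_nonneg (by positivity) c0, fun _ => ?_⟩
  unfold aR
  have h3 : sg ^ (4 * j) * Real.exp (-Real.pi * sg ^ (4 * j)) ≤ 1 := by
    rw [neg_mul, Real.exp_neg, ← div_eq_mul_inv, div_le_one (Real.exp_pos _)]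
    have := Real.add_one_le_exp (Real.pi * sg ^ (4 * j))
    nlinarith [Real.pi_gt_three]
  calc _ ≤ sg ^ (4 * j) * (3 * Real.exp (-Real.pi * sg ^ (4 * j))) := mul_le_mul h2 c1 c0 (by positivity)
    _ ≤ 3 := by linarith

set_option exponentiation.threshold 20000 in
theorem gX_facts : ∃ Z K : ℕ, gX = 2 * Z ∧ 2 ^ 30 ≤ Z ∧ (∀ j < 420, 2 ^ (20 * (420 - j)) * (2 ^ 20) ^ j = K) ∧ 0 < K ∧
    (∀ a Y u v, gFin a Y u v = gCmp (u * Y + 2 ^ 20 * gX + 2 * v) (gX / 2 * Y + 2 ^ 21 * u + gX + K * (a + 681 * gOne * 2 ^ 21 / (463761 * 2 ^ 21 - 231880 * Y)))) ∧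
    (∀ a b, (gCmp a b = 1 → b + K * 2 ^ 70 ≤ a) ∧ (gCmp a b = 2 → a + K * 2 ^ 70 ≤ b)) ∧ 2 ^ 24 * (1680 * gOne * K) ≤ Z := by
  refine ⟨2 ^ 9087, 2 ^ 8400, by unfold gX; norm_num, by norm_num, fun j hj => ?_, by positivity, fun a Y u v => by rw [gFin], fun a b => ?_, ?_⟩
  · rw [← pow_mul, ← pow_add]; congr 1; omega
  · rw [← pow_add]; exact gCmp_spec a b
  unfold gOne; norm_num

theorem gX_pow (j : ℕ) : gX ^ j = 2 ^ (9088 * j) := by unfold gX; rw [← pow_mul]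

attribute [local irreducible] gA gPi gFin gCmp

set_option maxHeartbeats 1000000 in
set_option exponentiation.threshold 1000 in
theorem gFin_sign (Y N : ℕ) (θ : ℝ) (hY0 : 0 < Y) (hY1 : Y < 2 ^ 22) (h0 : 0 ≤ θ) (h1 : θ ≤ 2.91) (hc : Real.cos θ = Y / 2 ^ 21 - 1)
    (hN : N = gX * gX / 2 + gX / 2 + ∑ j ∈ Finset.range 420, gA gPi j * 2 ^ (20 * (420 - j) + 9088 * j)) (s r : ℕ)
    (hr : r = N % (gX * gX + 2 ^ 21 * gX + 2 ^ 40 - Y * gX))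
    (hs : s = gFin (gA gPi 0) Y (r / gX) (r % gX)) :
    (s = 1 → 0 < (completedRiemannZeta (1 / 2 + ((θ / (2 * Real.log sg) : ℝ) : ℂ) * Complex.I)).re) ∧
    (s = 2 → (completedRiemannZeta (1 / 2 + ((θ / (2 * Real.log sg) : ℝ) : ℂ) * Complex.I)).re < 0) := by
  have hN' := fun _ : Unit => hN
  clear hN
  obtain ⟨Z, K, hX, hZ, hK, hK0, hKF, hK1, hKZ⟩ := gX_facts
  have hO : (0:ℝ) < gOne := by exact_mod_cast gOne_pos
  set ζ : ℂ := 2 ^ 20 * Complex.exp (θ * Complex.I) with hζ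
  obtain ⟨y, hy⟩ : ∃ y : ℤ, y = (Y:ℤ) - 2 ^ 21 := ⟨_, rfl⟩
  have hyc : (y:ℝ) = 2 ^ 21 * Real.cos θ := by rw [hc, hy]; push_cast; ring
  have hζ2 : ζ ^ 2 = y * ζ - 2 ^ 40 := by
    have : (y:ℂ) = 2 ^ 21 * Complex.cos θ := by
      rw [← Complex.ofReal_cos, ← Complex.ofReal_intCast, hyc]; push_cast; ring
    rw [this, Complex.cos, hζ]
    have e : Complex.exp (θ * Complex.I) * Complex.exp (-θ * Complex.I) = 1 := by rw [← Complex.exp_add]; simp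
    linear_combination (-2 ^ 40 : ℂ) * e
  obtain ⟨u, v, q, hq1, hq2⟩ := pk_sum gX y ζ hζ2 (fun j => gA gPi j * 2 ^ (20 * (420 - j))) 420
  have hq1' := fun _ : Unit => hq1
  clear hq1
  have eterm : ∀ j ∈ Finset.range 420, (((fun j => (gA gPi j * 2 ^ (20 * (420 - j)) : ℤ)) j : ℤ) : ℂ) * ζ ^ j = (((gA gPi j * K : ℝ)) : ℂ) * Complex.exp ((j * θ : ℝ) * Complex.I) := by
    intro j hj
    have := hK j (Finset.mem_range.1 hj)
    have h2 : (2:ℂ) ^ (20 * (420 - j)) * (2 ^ 20) ^ j = K := by exact_mod_cast this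
    rw [hζ, mul_pow, ← Complex.exp_nat_mul]; push_cast
    rw [← h2, show (j:ℂ) * (θ * Complex.I) = j * θ * Complex.I by ring]; ring
  rw [Finset.sum_congr rfl eterm] at hq2
  have hA : ∀ j ∈ Finset.range 420, (gA gPi j : ℝ) ≤ 4 * gOne := by
    intro j hj
    have hj' := (Finset.mem_range.1 hj).le
    have h2 := (abs_le.1 (gA_err j hj')).2
    have h3 := (aR_bd j).2 hj'
    have h4 : (2:ℝ) ^ 40 ≤ gOne := by rw [gOne_cast]; norm_num
    have h5 := mul_le_mul_of_nonneg_left h3 hO.le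
    linarith
  set W : ℝ := 1680 * gOne * K with hW
  have hKr : (0:ℝ) < K := by exact_mod_cast hK0
  have hnorm : ‖(u:ℂ) * ζ + v‖ ≤ W := by
    rw [← hq2]
    refine (norm_sum_le_of_le _ (fun j hj => ?_)).trans (b := ∑ j ∈ Finset.range 420, 4 * gOne * (K:ℝ)) (le_of_eq ?_)
    · rw [norm_mul, Complex.norm_exp_ofReal_mul_I, mul_one, Complex.norm_real, Real.norm_of_nonneg (by positivity)]
      exact mul_le_mul_of_nonneg_right (hA j hj) hKr.le
    · rw [Finset.sum_const, Finset.card_range, hW]; ring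
  have h220 : (2:ℂ) ^ 20 = ((2 ^ 20 : ℝ) : ℂ) := by push_cast; rfl
  have hre : ((u:ℂ) * ζ + v).re = u * (2 ^ 20 * Real.cos θ) + v := by
    have : ζ.re = 2 ^ 20 * Real.cos θ := by rw [hζ, h220, Complex.re_ofReal_mul, Complex.exp_ofReal_mul_I_re]
    simp [this]
  have him : ((u:ℂ) * ζ + v).im = u * (2 ^ 20 * Real.sin θ) := by
    have : ζ.im = 2 ^ 20 * Real.sin θ := by rw [hζ, h220, Complex.im_ofReal_mul, Complex.exp_ofReal_mul_I_im]
    simp [this]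
  have hyb : (1:ℝ) ≤ 2 ^ 42 - (y:ℝ) ^ 2 := by
    have : (1:ℤ) ≤ 2 ^ 42 - y ^ 2 := by
      have a1 : -2 ^ 21 + 1 ≤ y := by rw [hy]; omega
      have a2 : y ≤ 2 ^ 21 - 1 := by rw [hy]; omega
      nlinarith
    exact_mod_cast this
  have hub : |(u:ℝ)| ≤ 2 * W := by
    have a1 := (Complex.abs_im_le_norm ((u:ℂ) * ζ + v)).trans hnorm
    rw [him] at a1
    have a2 : (u:ℝ) ^ 2 ≤ (2 * W) ^ 2 := by
      have a3 : (u * (2 ^ 20 * Real.sin θ)) ^ 2 ≤ W ^ 2 := sq_le_sq' (by linarith [(abs_le.1 a1).1]) (abs_le.1 a1).2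
      have a4 : (2 ^ 20 * Real.sin θ) ^ 2 = (2 ^ 42 - (y:ℝ) ^ 2) / 4 := by
        rw [hyc, mul_pow, Real.sin_sq]; ring
      rw [mul_pow, a4] at a3
      nlinarith [sq_nonneg (u:ℝ)]
    exact abs_le_of_sq_le_sq a2 (by positivity)
  have hvb : |(v:ℝ)| ≤ W + 2 * W * 2 ^ 20 := by
    have a1 := (Complex.abs_re_le_norm ((u:ℂ) * ζ + v)).trans hnorm
    rw [hre] at a1
    have a2 : |(u:ℝ) * (2 ^ 20 * Real.cos θ)| ≤ 2 * W * 2 ^ 20 := by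
      rw [abs_mul, abs_mul, abs_of_pos (by norm_num : (0:ℝ) < 2 ^ 20)]
      apply mul_le_mul hub _ (by positivity) (by positivity)
      nlinarith [Real.abs_cos_le_one θ]
    have := abs_le.1 a1; have := abs_le.1 a2
    rw [abs_le]; constructor <;> linarith
  have hKZr : 2 ^ 24 * W ≤ (Z:ℝ) := by rw [hW]; exact_mod_cast hKZ
  have hW0 : 0 ≤ W := by positivity
  have hu : 4 * |u| ≤ Z := by
    have : 4 * |(u:ℝ)| ≤ Z := by linarith
    exact_mod_cast this
  have hv : 2 * |v| ≤ Z := by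
    have : 2 * |(v:ℝ)| ≤ Z := by linarith
    exact_mod_cast this
  set M := gX * gX + 2 ^ 21 * gX + 2 ^ 40 - Y * gX with hM
  have hMz : (M : ℤ) = (2 * Z : ℤ) ^ 2 - (Y - 2 ^ 21) * (2 * Z) + 2 ^ 40 := by
    have h2 : Y * gX ≤ gX * gX + 2 ^ 21 * gX + 2 ^ 40 := by
      have : Y ≤ gX := by omega
      exact (Nat.mul_le_mul_right gX this).trans (by rw [add_assoc]; exact Nat.le_add_right _ _)
    rw [hM, Nat.cast_sub h2, hX]; push_cast; ring
  have hNz : (N : ℤ) = Z * (2 * Z) + Z + (u * (2 * Z) + v + M * q) := by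
    have h2 : ∑ j ∈ Finset.range 420, ((gA gPi j * 2 ^ (20 * (420 - j) + 9088 * j) : ℕ) : ℤ) = u * (2 * Z) + v + M * q := by
      have h3 : ((2 * Z : ℕ) : ℤ) = 2 * Z := by push_cast; rfl
      rw [hMz, ← hy, ← h3, ← hX, add_comm (_ ^ 2 - _), add_comm (2 ^ 40), ← hq1' ()]
      refine Finset.sum_congr rfl fun j _ => ?_
      have h4 : ((gX:ℤ)) ^ j = 2 ^ (9088 * j) := by exact_mod_cast gX_pow j
      rw [h4, mul_assoc, ← pow_add]; push_cast; rfl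
    rw [hN' (), Nat.cast_add, Nat.cast_sum, h2]
    have h5 : gX * gX / 2 = Z * (2 * Z) := by rw [hX, mul_assoc, Nat.mul_div_cancel_left _ (by norm_num)]
    have h6 : gX / 2 = Z := by rw [hX, Nat.mul_div_cancel_left _ (by norm_num)]
    rw [h5, h6]; push_cast; ring
  have hdec := pk_dec Z Y N M u v q hZ hY1 hu hv hMz hNz
  rw [← hX, ← hr] at hdec
  obtain ⟨du, dv⟩ := hdec
  rw [hs, hKF]
  set U := r / gX
  set V := r % gX
  have h6 : gX / 2 = Z := by rw [hX, Nat.mul_div_cancel_left _ (by norm_num)]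
  rw [h6, hX]
  set D := 681 * gOne * 2 ^ 21 / (463761 * 2 ^ 21 - 231880 * Y) with hD
  set a0 := gA gPi 0 with ha0
  have duR : (U:ℝ) = u + Z := by exact_mod_cast du
  have dvR : (V:ℝ) = v + Z := by exact_mod_cast dv
  set T := ∑ j ∈ Finset.range 420, (gA gPi j : ℝ) * Real.cos (j * θ) with hT
  have hreT : (u:ℝ) * y + 2 * v = K * (2 * T) := by
    have a1 := congrArg Complex.re hq2
    rw [hre, Complex.re_sum] at a1
    have a2 : ∀ j ∈ Finset.range 420, ((((gA gPi j * K : ℝ)) : ℂ) * Complex.exp ((j * θ : ℝ) * Complex.I)).re = K * ((gA gPi j : ℝ) * Real.cos (j * θ)) := by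
      intro j _
      rw [Complex.re_ofReal_mul, Complex.exp_ofReal_mul_I_re]; ring
    rw [Finset.sum_congr rfl a2, ← Finset.mul_sum, ← hT] at a1
    rw [hyc]; linarith
  have hmain : ∀ a b : ℕ, a = U * Y + 2 ^ 20 * (2 * Z) + 2 * V → b = Z * Y + 2 ^ 21 * U + 2 * Z + K * (a0 + D) → (a:ℝ) - b = K * (2 * T - a0 - D) := by
    intro a b ha hb
    rw [ha, hb]; push_cast; rw [duR, dvR]
    have : (Y:ℝ) = y + 2 ^ 21 := by rw [hy]; push_cast; ring
    rw [this]; linear_combination hreT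
  have hm := hmain _ _ rfl rfl
  obtain ⟨s1, s2⟩ := hK1 (U * Y + 2 ^ 20 * (2 * Z) + 2 * V) (Z * Y + 2 ^ 21 * U + 2 * Z + K * (a0 + D))
  -- error analysis
  have hDe : |(D:ℝ) - gOne * (681 / (231881 - 231880 * Real.cos θ))| ≤ 1 := by
    have hle : 231880 * Y ≤ 463761 * 2 ^ 21 := by omega
    obtain ⟨d1, d2⟩ := ndiv (681 * gOne * 2 ^ 21) (463761 * 2 ^ 21 - 231880 * Y) (by omega)
    have e : ((681 * gOne * 2 ^ 21 : ℕ) : ℝ) / ((463761 * 2 ^ 21 - 231880 * Y : ℕ) : ℝ) = gOne * (681 / (231881 - 231880 * Real.cos θ)) := by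
      have e1 : ((463761 * 2 ^ 21 - 231880 * Y : ℕ) : ℝ) = 2 ^ 21 * (231881 - 231880 * Real.cos θ) := by
        rw [Nat.cast_sub hle, hc]; push_cast; ring
      have e2 : (0:ℝ) < 231881 - 231880 * Real.cos θ := by linarith [Real.cos_le_one θ]
      rw [e1]; push_cast; field_simp; norm_num
    rw [← hD, e] at d1 d2
    rw [abs_le]; constructor <;> linarith
  have hTe : |T - gOne * ∑ j ∈ Finset.range 420, aR j * Real.cos (j * θ)| ≤ 420 * 2 ^ 40 := by
    rw [hT, Finset.mul_sum, ← Finset.sum_sub_distrib]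
    refine (Finset.abs_sum_le_sum_abs _ _).trans ((Finset.sum_le_sum (g := fun _ => (2:ℝ) ^ 40) fun j hj => ?_).trans (le_of_eq ?_))
    · rw [← mul_assoc, ← sub_mul, abs_mul]
      calc _ ≤ (2:ℝ) ^ 40 * 1 := mul_le_mul (gA_err j (Finset.mem_range.1 hj).le) (Real.abs_cos_le_one _) (abs_nonneg _) (by norm_num)
        _ = _ := mul_one _
    · rw [Finset.sum_const, Finset.card_range]; ring
  have htl := aR_tail θ
  have htl' : |gOne * (∑' n : ℕ, aR n * Real.cos (n * θ) - ∑ n ∈ Finset.range 420, aR n * Real.cos (n * θ))| ≤ 2 ^ 40 := by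
    rw [abs_mul, abs_of_pos hO]
    refine (mul_le_mul_of_nonneg_left htl hO.le).trans (le_of_eq ?_)
    rw [gOne_cast, show 640 = 40 + 600 by norm_num, pow_add, mul_assoc, ← mul_pow]; norm_num
  have ha0e := gA_err 0 (by norm_num)
  have hal := alias_bd θ h0 h1
  set Lam := completedRiemannZeta (1 / 2 + ((θ / (2 * Real.log sg) : ℝ) : ℂ) * Complex.I)
  set c : ℝ := 2 / (4 * Real.log sg) with hcc
  have hc0 : 0 < c := by
    have := sg_log.1
    rw [hcc]; exact div_pos (by norm_num) (by linarith)
  set S := 2 * ∑' n : ℕ, aR n * Real.cos (n * θ) - aR 0 - 681 / (231881 - 231880 * Real.cos θ) with hS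
  have hre2 : |S - c * Lam.re| ≤ 1 / 2 ^ 585 := by
    refine le_trans (le_of_eq ?_) ((Complex.abs_re_le_norm _).trans hal)
    have : (2 / ((4 * Real.log sg : ℝ) : ℂ)) = ((c:ℝ):ℂ) := by rw [hcc]; push_cast; rfl
    rw [this, Complex.sub_re, Complex.re_ofReal_mul, Complex.ofReal_re]
  have hre3 : |gOne * S - gOne * (c * Lam.re)| ≤ 2 ^ 55 := by
    rw [← mul_sub, abs_mul, abs_of_pos hO]
    refine (mul_le_mul_of_nonneg_left hre2 hO.le).trans (le_of_eq ?_)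
    rw [gOne_cast, show 640 = 55 + 585 by norm_num, pow_add, mul_assoc, mul_one_div_cancel (by positivity), mul_one]
  have htot : |(2 * T - a0 - D) - gOne * (c * Lam.re)| ≤ 2 ^ 60 := by
    rw [hS] at hre3
    obtain ⟨b1, b2⟩ := abs_le.1 hre3
    obtain ⟨b3, b4⟩ := abs_le.1 ha0e
    obtain ⟨b5, b6⟩ := abs_le.1 htl'
    obtain ⟨b7, b8⟩ := abs_le.1 hTe
    obtain ⟨b9, b10⟩ := abs_le.1 hDe
    clear * - b1 b2 b3 b4 b5 b6 b7 b8 b9 b10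
    rw [abs_le]; constructor <;> linarith
  obtain ⟨t1, t2⟩ := abs_le.1 htot
  constructor
  · intro h
    have h2 := s1 h
    have h3 : ((Z * Y + 2 ^ 21 * U + 2 * Z + K * (a0 + D) : ℕ) : ℝ) + K * 2 ^ 70 ≤ ((U * Y + 2 ^ 20 * (2 * Z) + 2 * V : ℕ) : ℝ) := by exact_mod_cast h2
    have h4 : K * (2:ℝ) ^ 70 ≤ K * (2 * T - a0 - D) := by linarith
    have h5 := le_of_mul_le_mul_left h4 hKr
    have h6 : 0 < gOne * (c * Lam.re) := by linarith
    exact (mul_pos_iff_of_pos_left hc0).1 ((mul_pos_iff_of_pos_left hO).1 h6)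
  · intro h
    have h2 := s2 h
    have h3 : ((U * Y + 2 ^ 20 * (2 * Z) + 2 * V : ℕ) : ℝ) + K * 2 ^ 70 ≤ ((Z * Y + 2 ^ 21 * U + 2 * Z + K * (a0 + D) : ℕ) : ℝ) := by exact_mod_cast h2
    have h4 : K * (2:ℝ) ^ 70 ≤ K * (-(2 * T - a0 - D)) := by linarith
    have h5 := le_of_mul_le_mul_left h4 hKr
    have h6 : 0 < gOne * (c * -Lam.re) := by linarith
    linarith [(mul_pos_iff_of_pos_left hc0).1 ((mul_pos_iff_of_pos_left hO).1 h6)]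

end

section

attribute [local irreducible] gOne gX gA gPi gFin gCmp

theorem lam_real (t : ℝ) : (completedRiemannZeta (1 / 2 + (t:ℂ) * Complex.I)).im = 0 := by
  have h1 := lam_ft (t / 2)
  have h2 := lam_ft (-(t / 2))
  have h3 := congrArg (starRingEnd ℂ) h1
  rw [← integral_conj] at h3
  have e : ∀ u : ℝ, (starRingEnd ℂ) (Complex.exp (-((t / 2 : ℝ) * u * Complex.I)) * (Phi u : ℂ)) = Complex.exp (-((-(t / 2) : ℝ) * u * Complex.I)) * (Phi u : ℂ) := by
    intro u
    rw [map_mul, ← Complex.exp_conj, Complex.conj_ofReal, map_neg, map_mul, map_mul, Complex.conj_ofReal, Complex.conj_ofReal, Complex.conj_I]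
    push_cast; ring_nf
  simp_rw [e] at h3
  rw [h2, ← completedRiemannZeta_one_sub, map_mul, Complex.conj_ofNat] at h3
  push_cast at h3
  rw [show (1:ℂ) - (1 / 2 + 2 * -(t / 2) * Complex.I) = 1 / 2 + t * Complex.I by ring, show (1 / 2 + 2 * (t / 2 : ℂ) * Complex.I) = 1 / 2 + t * Complex.I by ring] at h3
  have h4 := mul_left_cancel₀ two_ne_zero h3
  exact Complex.conj_eq_iff_im.1 h4.symm

theorem gCos_err (w : ℕ) (hw : w ≤ 3 * 2 ^ 40) (k : ℕ) : ∀ a : ℕ, a ≤ 2 ^ 40 →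
    ∃ b : ℕ, b ≤ 2 ^ 40 ∧ gCos w (k + 1) a = 2 ^ 40 - w * b / (2 * 2 ^ 40) ∧
    |(b:ℝ) - 2 ^ 40 * (∑ i ∈ Finset.range k, (-((w:ℝ) / 2 ^ 40)) ^ i * (2 / ((2 * i + 2).factorial : ℝ)) + (-((w:ℝ) / 2 ^ 40)) ^ k * (2 / ((2 * k + 2).factorial : ℝ)) * (a / 2 ^ 40))|
      ≤ 2 - 2 * (1 / 2) ^ k := by
  set x := (w:ℝ) / 2 ^ 40 with hx
  have hx0 : 0 ≤ x := by positivity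
  have hx1 : x ≤ 3 := by
    rw [hx, div_le_iff₀ (by positivity)]
    exact_mod_cast hw
  induction k with
  | zero =>
    intro a ha
    refine ⟨a, ha, ?_, ?_⟩
    · change frc (fun a => a) (2 ^ 40 - w * a / ((2 * 0 + 1) * (2 * 0 + 2) * 2 ^ 40)) = _
      rw [frc_eq]
    · rw [Finset.sum_range_zero]; norm_num [Nat.factorial]
      rw [mul_div_cancel₀ _ (by norm_num : (1099511627776:ℝ) ≠ 0), sub_self]
  | succ k ih =>
    intro a ha
    have e1 : gCos w (k + 1 + 1) a = gCos w (k + 1) (2 ^ 40 - w * a / ((2 * (k + 1) + 1) * (2 * (k + 1) + 2) * 2 ^ 40)) := frc_eq _ _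
    have hdp : 12 ≤ (2 * (k + 1) + 1) * (2 * (k + 1) + 2) := by nlinarith
    obtain ⟨d, hd⟩ : ∃ d, d = (2 * (k + 1) + 1) * (2 * (k + 1) + 2) := ⟨_, rfl⟩
    rw [← hd] at e1 hdp
    have h1 : w * a / (d * 2 ^ 40) ≤ 2 ^ 40 := by
      rw [Nat.div_le_iff_le_mul_add_pred (by positivity)]
      have h2 : w * a ≤ 3 * 2 ^ 40 * 2 ^ 40 := Nat.mul_le_mul hw ha
      have h3 : 12 * 2 ^ 40 * 2 ^ 40 ≤ d * 2 ^ 40 * 2 ^ 40 := by gcongr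
      omega
    obtain ⟨b, hb1, hb2, hb3⟩ := ih (2 ^ 40 - w * a / (d * 2 ^ 40)) (Nat.sub_le _ _)
    refine ⟨b, hb1, e1.trans hb2, ?_⟩
    rw [Nat.cast_sub h1] at hb3
    obtain ⟨d1, d2⟩ := ndiv (w * a) (d * 2 ^ 40) (by positivity)
    set D := ((w * a / (d * 2 ^ 40) : ℕ) : ℝ) with hD
    have hd0 : (0:ℝ) < d := by exact_mod_cast (by omega : 0 < d)
    have e2 : (((w * a : ℕ) : ℝ)) / ((d * 2 ^ 40 : ℕ) : ℝ) = x * a / d := by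
      rw [hx]; push_cast; field_simp; try norm_num
    rw [e2] at d1 d2
    set δ := D - x * a / d with hδ
    have hδ1 : |δ| ≤ 1 := by rw [abs_le]; constructor <;> linarith
    have hfac : ((2 * (k + 1) + 2).factorial : ℝ) = d * (2 * k + 2).factorial := by
      rw [show 2 * (k + 1) + 2 = 2 * k + 2 + 1 + 1 by ring, Nat.factorial_succ, Nat.factorial_succ, hd]; push_cast; ring
    have hf0 : (0:ℝ) < (2 * k + 2).factorial := by positivity
    have e3 : (2:ℝ) ^ 40 * (∑ i ∈ Finset.range k, (-x) ^ i * (2 / ((2 * i + 2).factorial : ℝ)) + (-x) ^ k * (2 / ((2 * k + 2).factorial : ℝ)) * ((((2 ^ 40 : ℕ) : ℝ) - D) / 2 ^ 40)) =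
        2 ^ 40 * (∑ i ∈ Finset.range (k + 1), (-x) ^ i * (2 / ((2 * i + 2).factorial : ℝ)) + (-x) ^ (k + 1) * (2 / ((2 * (k + 1) + 2).factorial : ℝ)) * (a / 2 ^ 40)) - (-x) ^ k * (2 / ((2 * k + 2).factorial : ℝ)) * δ := by
      rw [Finset.sum_range_succ, hfac, hδ, pow_succ]
      push_cast
      field_simp
      ring
    rw [e3] at hb3
    have h4 : |(-x) ^ k * (2 / ((2 * k + 2).factorial : ℝ)) * δ| ≤ (1 / 2) ^ k := by
      rw [abs_mul, abs_mul, abs_pow, abs_neg, abs_of_nonneg hx0, abs_of_pos (by positivity : (0:ℝ) < 2 / (2 * k + 2).factorial)]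
      have h5 : x ^ k * (2 / ((2 * k + 2).factorial : ℝ)) ≤ (1 / 2) ^ k := by
        have h6 : Nat.factorial 2 * 3 ^ (2 * k) ≤ (2 + 2 * k).factorial := Nat.factorial_mul_pow_le_factorial
        have h7 : (2:ℝ) * 9 ^ k ≤ (2 * k + 2).factorial := by
          have : (2 * 3 ^ (2 * k) : ℕ) ≤ (2 * k + 2).factorial := by rw [add_comm (2 * k)]; exact h6
          rw [pow_mul] at this; exact_mod_cast this
        calc x ^ k * (2 / ((2 * k + 2).factorial : ℝ)) ≤ 3 ^ k * (2 / (2 * 9 ^ k)) := by gcongr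
          _ = (1 / 3) ^ k := by rw [show (9:ℝ) = 3 * 3 by norm_num, mul_pow, div_pow, one_pow]; field_simp
          _ ≤ _ := by gcongr; norm_num
      calc _ ≤ (1 / 2) ^ k * 1 := mul_le_mul h5 hδ1 (abs_nonneg _) (by positivity)
        _ = _ := mul_one _
    have e4 : (2:ℝ) - 2 * (1 / 2) ^ (k + 1) = (2 - 2 * (1 / 2) ^ k) + (1 / 2) ^ k := by rw [pow_succ]; ring
    rw [e4]
    obtain ⟨a1, a2⟩ := abs_le.1 hb3
    obtain ⟨b1, b2⟩ := abs_le.1 h4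
    rw [abs_le]; constructor <;> linarith

theorem cos_tail (r : ℝ) (hr : r ^ 2 ≤ 3) : |Real.cos r - ∑ i ∈ Finset.range 11, (-(r ^ 2)) ^ i / ((2 * i).factorial : ℝ)| ≤ 1 / 2 ^ 45 := by
  have h := Real.hasSum_cos r
  rw [← h.tsum_eq, ← h.summable.sum_add_tsum_nat_add 11]
  have e : ∀ i : ℕ, (-1) ^ i * r ^ (2 * i) / ((2 * i).factorial : ℝ) = (-(r ^ 2)) ^ i / ((2 * i).factorial : ℝ) := fun i => by
    rw [pow_mul, neg_pow (r ^ 2)]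
  simp_rw [e]
  rw [add_sub_cancel_left]
  have hg := (hasSum_geometric_of_lt_one (by norm_num : (0:ℝ) ≤ 1 / 2) (by norm_num)).mul_left ((3:ℝ) ^ 11 / (22 : ℕ).factorial)
  have hb : ∀ n : ℕ, ‖(-(r ^ 2)) ^ (n + 11) / ((2 * (n + 11)).factorial : ℝ)‖ ≤ (3:ℝ) ^ 11 / (22 : ℕ).factorial * (1 / 2) ^ n := by
    intro n
    rw [norm_div, norm_pow, norm_neg, Real.norm_of_nonneg (sq_nonneg r), Real.norm_of_nonneg (by positivity)]
    have h6 : Nat.factorial 22 * 23 ^ (2 * n) ≤ (22 + 2 * n).factorial := Nat.factorial_mul_pow_le_factorial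
    have h7 : ((22:ℕ).factorial : ℝ) * 529 ^ n ≤ ((2 * (n + 11)).factorial : ℝ) := by
      rw [show 2 * (n + 11) = 22 + 2 * n by ring]
      rw [pow_mul] at h6; exact_mod_cast h6
    calc _ ≤ (3:ℝ) ^ (n + 11) / (((22:ℕ).factorial : ℝ) * 529 ^ n) := by gcongr
      _ = 3 ^ 11 / ((22:ℕ).factorial : ℝ) * (3 / 529) ^ n := by rw [pow_add, div_pow]; field_simp
      _ ≤ _ := mul_le_mul_of_nonneg_left (pow_le_pow_left₀ (by norm_num) (by norm_num) n) (by positivity)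
  refine (tsum_of_norm_bounded hg hb).trans ?_
  norm_num [Nat.factorial]

theorem gY_err (m : ℕ) (hm : m ≤ 4954) : ∃ r : ℝ, 0 ≤ r ∧ r ^ 2 = ((m * m * 189669 / 2 : ℕ) : ℝ) / 2 ^ 40 ∧ (0 ≤ Real.cos r → |(gY m : ℝ) / 2 ^ 21 - 1 - Real.cos (2 * r)| ≤ 1 / 2 ^ 20) := by
  set w := m * m * 189669 / 2 with hw
  have hw3 : w ≤ 3 * 2 ^ 40 := by
    have : m * m ≤ 4954 * 4954 := Nat.mul_le_mul hm hm
    omega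
  refine ⟨√((w:ℝ) / 2 ^ 40), Real.sqrt_nonneg _, Real.sq_sqrt (by positivity), fun hc0 => ?_⟩
  set r := √((w:ℝ) / 2 ^ 40) with hr
  have hr2 : r ^ 2 = (w:ℝ) / 2 ^ 40 := Real.sq_sqrt (by positivity)
  have hr3 : r ^ 2 ≤ 3 := by rw [hr2, div_le_iff₀ (by positivity)]; exact_mod_cast hw3
  obtain ⟨b, hb1, hb2, hb3⟩ := gCos_err w hw3 9 (2 ^ 40) le_rfl
  rw [← hr2] at hb3
  have hct := cos_tail r hr3
  have e0 : ∑ i ∈ Finset.range 11, (-(r ^ 2)) ^ i / ((2 * i).factorial : ℝ) =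
      1 - r ^ 2 / 2 * (∑ i ∈ Finset.range 9, (-(r ^ 2)) ^ i * (2 / ((2 * i + 2).factorial : ℝ)) + (-(r ^ 2)) ^ 9 * (2 / ((2 * 9 + 2).factorial : ℝ)) * (((2 ^ 40 : ℕ) : ℝ) / 2 ^ 40)) := by
    rw [show (((2 ^ 40 : ℕ) : ℝ) / 2 ^ 40) = 1 by norm_num, mul_one, ← Finset.sum_range_succ (fun i => (-(r ^ 2)) ^ i * (2 / ((2 * i + 2).factorial : ℝ))) 9, Finset.sum_range_succ', Finset.mul_sum, sub_eq_add_neg, ← Finset.sum_neg_distrib, add_comm]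
    congr 1
    · simp
    · refine Finset.sum_congr rfl fun i _ => ?_
      rw [show 2 * (i + 1) = 2 * i + 2 by ring, pow_succ]; ring
  set B := ∑ i ∈ Finset.range 9, (-(r ^ 2)) ^ i * (2 / ((2 * i + 2).factorial : ℝ)) + (-(r ^ 2)) ^ 9 * (2 / ((2 * 9 + 2).factorial : ℝ)) * (((2 ^ 40 : ℕ) : ℝ) / 2 ^ 40)
  rw [e0] at hct
  obtain ⟨d1, d2⟩ := ndiv (w * b) (2 * 2 ^ 40) (by positivity)
  have e1 : ((w * b : ℕ) : ℝ) / ((2 * 2 ^ 40 : ℕ) : ℝ) = r ^ 2 / 2 * b := by rw [hr2]; push_cast; ring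
  rw [e1] at d1 d2
  set a := gCos w 10 (2 ^ 40) with ha
  have hb4 : |r ^ 2 / 2 * b - 2 ^ 40 * (r ^ 2 / 2 * B)| ≤ 3 := by
    rw [show r ^ 2 / 2 * b - 2 ^ 40 * (r ^ 2 / 2 * B) = r ^ 2 / 2 * (b - 2 ^ 40 * B) by ring, abs_mul, abs_of_nonneg (by positivity)]
    calc _ ≤ 3 / 2 * (2:ℝ) := by
          apply mul_le_mul (by linarith) (hb3.trans (by norm_num)) (abs_nonneg _) (by norm_num)
      _ = 3 := by norm_num
  have hae : |(a:ℝ) - 2 ^ 40 * Real.cos r| ≤ 5 := by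
    obtain ⟨c1, c2⟩ := abs_le.1 hb4
    obtain ⟨c3, c4⟩ := abs_le.1 hct
    set D := w * b / (2 * 2 ^ 40) with hD
    have ea : a = 2 ^ 40 - D := hb2
    have hpr : |(2 ^ 40 - (D:ℝ)) - 2 ^ 40 * Real.cos r| ≤ 5 := by
      rw [abs_le]; constructor <;> linarith
    rcases le_total D (2 ^ 40) with h | h
    · rw [ea, Nat.cast_sub h, show ((2 ^ 40 : ℕ) : ℝ) = 2 ^ 40 by norm_num]; exact hpr
    · rw [ea, Nat.sub_eq_zero_of_le h, Nat.cast_zero, zero_sub, abs_neg, abs_of_nonneg (by positivity)]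
      have : (2:ℝ) ^ 40 ≤ D := by exact_mod_cast h
      linarith [(abs_le.1 hpr).1]
  have eY : gY m = a * a / 2 ^ 58 := by rw [gY, frc_eq]
  obtain ⟨f1, f2⟩ := ndiv (a * a) (2 ^ 58) (by positivity)
  rw [← eY] at f1 f2
  push_cast at f1 f2
  have hcr := Real.cos_le_one r
  have hsq : |(a:ℝ) * a - 2 ^ 80 * Real.cos r ^ 2| ≤ 2 ^ 50 := by
    rw [show (a:ℝ) * a - 2 ^ 80 * Real.cos r ^ 2 = (a - 2 ^ 40 * Real.cos r) * (a - 2 ^ 40 * Real.cos r + 2 * (2 ^ 40 * Real.cos r)) by ring, abs_mul]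
    calc _ ≤ 5 * ((5:ℝ) + 2 * 2 ^ 40) := by
          apply mul_le_mul hae _ (abs_nonneg _) (by norm_num)
          refine (abs_add_le _ _).trans (add_le_add hae ?_)
          rw [abs_of_nonneg (by positivity)]; linarith
      _ ≤ _ := by norm_num
  obtain ⟨k1, k2⟩ := abs_le.1 hsq
  rw [Real.cos_two_mul, abs_le]
  constructor <;> linarith

end

section

attribute [local irreducible] gOne gX gA gPi gFin gCmp

theorem sg_log' : 2 / 681 ≤ Real.log sg ∧ Real.log sg ≤ 2 / 681 + 1 / 10 ^ 8 := by
  constructor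
  · have h := Real.le_log_one_add_of_nonneg (x := 1 / 340) (by norm_num)
    rw [sg, show (341 / 340 : ℝ) = 1 + 1 / 340 by norm_num]
    exact le_trans (by norm_num) h
  · rw [Real.log_le_iff_le_exp (by norm_num [sg])]
    refine le_trans ?_ (Real.quadratic_le_exp_of_nonneg (by norm_num))
    norm_num [sg]

theorem cos_inv (φ c : ℝ) (h1 : 0.08 ≤ φ) (h2 : φ ≤ 2.9099) (hc : |c - Real.cos φ| ≤ 1 / 2 ^ 20) :
    -1 < c ∧ c < 1 ∧ |Real.arccos c - φ| ≤ 1 / 10 ^ 4 := by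
  have p1 := Real.pi_gt_d4
  have p2 := Real.pi_lt_d4
  have q : ∀ y : ℝ, 0 ≤ y → y ≤ Real.pi / 2 → 0.63 * y ≤ Real.sin y := fun y a b => by
    refine le_trans (mul_le_mul_of_nonneg_right ?_ a) (Real.mul_le_sin a b)
    rw [le_div_iff₀ Real.pi_pos]; linarith
  have hs : 0.05 ≤ Real.sin φ := by
    rcases le_total φ (Real.pi / 2) with h | h
    · linarith [q φ (by linarith) h]
    · have := q (Real.pi - φ) (by linarith) (by linarith)
      rw [Real.sin_pi_sub] at this; linarith
  have hcs : |Real.cos φ| ≤ 0.999 := by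
    apply abs_le_of_sq_le_sq _ (by norm_num)
    nlinarith [Real.sin_sq_add_cos_sq φ]
  obtain ⟨a1, a2⟩ := abs_le.1 hcs
  obtain ⟨b1, b2⟩ := abs_le.1 hc
  have c1 : -1 < c := by linarith
  have c2 : c < 1 := by linarith
  refine ⟨c1, c2, ?_⟩
  set δ : ℝ := 1 / 10 ^ 4 with hδ
  have d1 := q δ (by norm_num) (by rw [hδ]; linarith)
  have d2 := Real.one_sub_sq_div_two_le_cos (x := δ)
  have d3 := Real.cos_le_one δ
  have d4 : 0.05 * (0.63 * δ) ≤ Real.sin φ * Real.sin δ := mul_le_mul hs d1 (by norm_num) (by linarith)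
  have d5 : |Real.cos φ * Real.cos δ - Real.cos φ| ≤ δ ^ 2 / 2 := by
    rw [show Real.cos φ * Real.cos δ - Real.cos φ = Real.cos φ * (Real.cos δ - 1) by ring, abs_mul, abs_sub_comm, abs_of_nonneg (a := 1 - Real.cos δ) (by linarith)]
    calc _ ≤ 1 * (δ ^ 2 / 2) := mul_le_mul (by linarith) (by linarith) (by linarith) (by norm_num)
      _ = _ := one_mul _
  obtain ⟨e1, e2⟩ := abs_le.1 d5
  have hco := Real.cos_arccos c1.le c2.le
  have n1 : (1:ℝ) / 2 ^ 20 < 0.05 * (0.63 * δ) - δ ^ 2 / 2 := by norm_num [hδ]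
  rw [abs_le]
  constructor
  · by_contra! h
    have := Real.cos_lt_cos_of_nonneg_of_le_pi (x := Real.arccos c) (y := φ - δ) (Real.arccos_nonneg _) (by rw [hδ]; linarith) (by linarith)
    rw [hco, Real.cos_sub] at this
    exact absurd (this.trans_le (sub_le_iff_le_add.1 b2)) (by clear_value δ; clear hδ; linarith only [d4, e1, n1])
  · by_contra! h
    have := Real.cos_lt_cos_of_nonneg_of_le_pi (x := φ + δ) (y := Real.arccos c) (by rw [hδ]; linarith) (Real.arccos_le_pi _) (by linarith)
    rw [hco, Real.cos_add] at this
    clear_value δ; linarith only [d4, e2, n1, this, b1]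

theorem gY_pt (m : ℕ) (h1 : 141 ≤ m) (h2 : m ≤ 4954) : ∃ θ : ℝ, 0 ≤ θ ∧ θ ≤ 2.91 ∧ 0 < gY m ∧ gY m < 2 ^ 22 ∧
    Real.cos θ = (gY m : ℝ) / 2 ^ 21 - 1 ∧ |θ / (2 * Real.log sg) - m / 10| ≤ 0.02 := by
  obtain ⟨r, r0, r2, hY⟩ := gY_err m h2
  have m1 : (141:ℝ) ≤ m := by exact_mod_cast h1
  have m2 : (m:ℝ) ≤ 4954 := by exact_mod_cast h2
  obtain ⟨f1, f2⟩ := ndiv (m * m * 189669) 2 (by norm_num)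
  set w := ((m * m * 189669 / 2 : ℕ) : ℝ) with hw
  push_cast at f1 f2
  obtain ⟨l1, l2⟩ := sg_log'
  have u1 : m * (2 / 3405) ≤ 2 * r := by
    apply le_of_sq_le_sq _ (by linarith)
    rw [mul_pow, mul_pow, r2]
    have : (141:ℝ) * 141 ≤ m * m := mul_le_mul m1 m1 (by norm_num) (by linarith)
    norm_num; linarith
  have u2 : 2 * r ≤ m * (2 / 3405 + 1 / 10 ^ 9) := by
    apply le_of_sq_le_sq _ (by positivity)
    rw [mul_pow, mul_pow, r2]
    have : 0 ≤ (m:ℝ) * m := by positivity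
    norm_num; linarith
  have u3 : 0.08 ≤ 2 * r := by linarith
  have u4 : 2 * r ≤ 2.9099 := by linarith
  have p1 := Real.pi_gt_d4
  have hcr : 0 ≤ Real.cos r := Real.cos_nonneg_of_neg_pi_div_two_le_of_le (by linarith) (by linarith)
  obtain ⟨c1, c2, c3⟩ := cos_inv (2 * r) _ u3 u4 (hY hcr)
  obtain ⟨e1, e2⟩ := abs_le.1 c3
  refine ⟨_, Real.arccos_nonneg _, by linarith, ?_, ?_, Real.cos_arccos c1.le c2.le, ?_⟩
  · rw [← Nat.cast_pos (α := ℝ)]; linarith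
  · have : (gY m : ℝ) < 2 ^ 22 := by linarith
    exact_mod_cast this
  · set L := Real.log sg
    have hL : 0 < 2 * L := by linarith
    rw [show ∀ y : ℝ, y / (2 * L) - m / 10 = (y - m * (L / 5)) / (2 * L) from fun y => by field_simp; ring, abs_div, abs_of_pos hL, div_le_iff₀ hL]
    have v1 : m * (2 / 3405) ≤ m * (L / 5) := mul_le_mul_of_nonneg_left (by linarith) (by linarith)
    have v2 : m * (L / 5) ≤ m * (2 / 3405 + 2 / 10 ^ 9) := mul_le_mul_of_nonneg_left (by linarith) (by linarith)
    rw [abs_le]; constructor <;> linarith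

theorem gAll_spec (N a0 : ℕ) (l : List ℕ) (h : gAll N a0 l = 1) : ∀ m ∈ l, gSgn N a0 m * gSgn N a0 (m + 1) = 2 := by
  induction l with
  | nil => intro m hm; cases hm
  | cons a l ih =>
    have e : gAll N a0 (a :: l) = cond (Nat.beq (gSgn N a0 a * gSgn N a0 (a + 1)) 2) (gAll N a0 l) 0 := rfl
    rw [e] at h
    rcases hb : Nat.beq (gSgn N a0 a * gSgn N a0 (a + 1)) 2 with _ | _
    · rw [hb] at h; cases h
    · rw [hb] at h
      intro m hm
      rcases List.mem_cons.1 hm with rfl | hm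
      · exact Nat.eq_of_beq_eq_true hb
      · exact ih h m hm

theorem gSgn_spec (N m : ℕ) (h1 : 141 ≤ m) (h2 : m ≤ 4954)
    (hN : N = gX * gX / 2 + gX / 2 + ∑ j ∈ Finset.range 420, gA gPi j * 2 ^ (20 * (420 - j) + 9088 * j)) :
    ∃ t : ℝ, |t - m / 10| ≤ 0.02 ∧ (gSgn N (gA gPi 0) m = 1 → 0 < (completedRiemannZeta (1 / 2 + (t:ℂ) * Complex.I)).re) ∧
      (gSgn N (gA gPi 0) m = 2 → (completedRiemannZeta (1 / 2 + (t:ℂ) * Complex.I)).re < 0) := by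
  obtain ⟨θ, a1, a2, a3, a4, a5, a6⟩ := gY_pt m h1 h2
  refine ⟨_, a6, ?_⟩
  exact gFin_sign (gY m) N θ a3 a4 a1 a2 a5 hN _ _ rfl (by rw [gSgn, frc_eq, frc_eq])

theorem zlist_ub : ∀ m ∈ zlist, m ≤ 4953 := by decide +kernel

theorem lam_ivt (a b : ℝ) (h : a ≤ b)
    (hs : (0 < (completedRiemannZeta (1 / 2 + (a:ℂ) * Complex.I)).re ∧ (completedRiemannZeta (1 / 2 + (b:ℂ) * Complex.I)).re < 0) ∨
      ((completedRiemannZeta (1 / 2 + (a:ℂ) * Complex.I)).re < 0 ∧ 0 < (completedRiemannZeta (1 / 2 + (b:ℂ) * Complex.I)).re)) :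
    ∃ g, a ≤ g ∧ g ≤ b ∧ xi (g * Complex.I) = 0 := by
  have im : ∀ t : ℝ, (1 / 2 + (t:ℂ) * Complex.I).re = 1 / 2 := fun t => by simp
  have hn : ∀ t : ℝ, 1 / 2 + (t:ℂ) * Complex.I ≠ 0 ∧ 1 / 2 + (t:ℂ) * Complex.I ≠ 1 := fun t =>
    ⟨fun h => by have := im t; rw [h] at this; norm_num at this, fun h => by have := im t; rw [h] at this; norm_num at this⟩
  have hc : Continuous fun t : ℝ => (completedRiemannZeta (1 / 2 + (t:ℂ) * Complex.I)).re := by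
    refine Complex.continuous_re.comp (continuous_iff_continuousAt.2 fun t => ?_)
    exact ContinuousAt.comp (f := fun t : ℝ => 1 / 2 + (t:ℂ) * Complex.I) (g := completedRiemannZeta) (differentiableAt_completedZeta (hn t).1 (hn t).2).continuousAt (by fun_prop)
  have : ∃ g ∈ Icc a b, (completedRiemannZeta (1 / 2 + (g:ℂ) * Complex.I)).re = 0 := by
    rcases hs with ⟨u, v⟩ | ⟨u, v⟩
    · exact intermediate_value_Icc' h hc.continuousOn ⟨v.le, u.le⟩
    · exact intermediate_value_Icc h hc.continuousOn ⟨u.le, v.le⟩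
  obtain ⟨g, ⟨g1, g2⟩, g3⟩ := this
  refine ⟨g, g1, g2, ?_⟩
  have h0 : completedRiemannZeta (1 / 2 + (g:ℂ) * Complex.I) = 0 := Complex.ext g3 (lam_real g)
  have := xi_eq' _ (hn g).1 (hn g).2
  rw [h0, mul_zero, add_sub_cancel_left] at this
  exact this

theorem rh_467 (r : ℂ) (hr : xi r = 0) (h : |r.im| < 469) : r.re = 0 := by
  have hC := gCheck
  rw [frc_eq, frc_eq, gPack_eq] at hC
  have hS := gAll_spec _ _ _ hC
  obtain ⟨N, hN⟩ : ∃ N, N = gX * gX / 2 + gX / 2 + ∑ j ∈ Finset.range 420, gA gPi j * 2 ^ (20 * (420 - j) + 9088 * j) := ⟨_, rfl⟩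
  rw [← hN] at hS
  have key : ∀ m ∈ zlist, ∃ g : ℝ, |100 * g - 10 * m - 5| ≤ 7 ∧ xi (g * Complex.I) = 0 := by
    intro m hm
    have l1 := zlist_lb m hm
    have l2 := zlist_ub m hm
    obtain ⟨t1, a1, a2, a3⟩ := gSgn_spec N m l1 (by omega) hN
    obtain ⟨t2, b1, b2, b3⟩ := gSgn_spec N (m + 1) (by omega) (by omega) hN
    have hp := hS m hm
    clear hN hS hC
    obtain ⟨s1, e1⟩ : ∃ s, s = gSgn N (gA gPi 0) m := ⟨_, rfl⟩
    obtain ⟨s2, e2⟩ : ∃ s, s = gSgn N (gA gPi 0) (m + 1) := ⟨_, rfl⟩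
    rw [← e1] at hp a2 a3
    rw [← e2] at hp b2 b3
    clear e1 e2
    have hd : s1 = 1 ∧ s2 = 2 ∨ s1 = 2 ∧ s2 = 1 := by
      have hdv : s1 ∣ 2 := ⟨s2, hp.symm⟩
      rcases (Nat.dvd_prime Nat.prime_two).1 hdv with h | h
      · subst h; left; exact ⟨rfl, by omega⟩
      · subst h; right; exact ⟨rfl, by omega⟩
    have m1 : (141:ℝ) ≤ m := by exact_mod_cast l1
    obtain ⟨a4, a5⟩ := abs_le.1 a1
    obtain ⟨b4, b5⟩ := abs_le.1 b1
    push_cast at b4 b5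
    obtain ⟨g, g1, g2, g3⟩ := lam_ivt t1 t2 (by linarith) (by
      rcases hd with ⟨u, v⟩ | ⟨u, v⟩
      · exact Or.inl ⟨a2 u, b3 v⟩
      · exact Or.inr ⟨a3 u, b2 v⟩)
    exact ⟨g, by rw [abs_le]; constructor <;> linarith, g3⟩
  choose! g hg using key
  obtain ⟨i1, i2⟩ := abs_lt.1 h
  rcases le_total 0 r.im with h0 | h0
  · exact rh_of_list g hg r hr h0 i2
  · have := rh_of_list g hg (-r) (by rw [xi_even]; exact hr) (by simpa using h0) (by rw [Complex.neg_im]; linarith)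
    simpa using this

end

/-- `t^z exp(-t²)` -/
noncomputable def kk (z : ℂ) (v : ℝ) : ℂ := (v : ℂ) ^ z * (Real.exp (-(v ^ (2:ℝ))) : ℂ)

theorem kk_mellin (z s : ℂ) (h : 0 < (s + z).re) : MellinConvergent (kk z) s ∧ mellin (kk z) s = Complex.Gamma ((s + z) / 2) / 2 := by
  have hr : 0 < ((s + z) / ((2:ℝ):ℂ)).re := by rw [Complex.div_ofReal_re]; linarith
  have e : kk z = fun t : ℝ => (t : ℂ) ^ z • (fun v : ℝ => (fun w : ℝ => ((Real.exp (-w) : ℝ) : ℂ)) (v ^ (2:ℝ))) t := rfl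
  rw [e]
  constructor
  · refine MellinConvergent.cpow_smul.2 ((MellinConvergent.comp_rpow (f := fun w : ℝ => ((Real.exp (-w) : ℝ) : ℂ)) two_ne_zero).2 ?_)
    have := Complex.GammaIntegral_convergent hr
    refine this.congr_fun (fun t _ => ?_) measurableSet_Ioi
    rw [smul_eq_mul, mul_comm]
  · rw [mellin_cpow_smul, mellin_comp_rpow (fun w : ℝ => ((Real.exp (-w) : ℝ) : ℂ)) (s + z) 2, ← Complex.GammaIntegral_eq_mellin, ← Complex.Gamma_eq_integral hr, abs_of_pos two_pos, Complex.real_smul]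
    push_cast; ring

theorem cos_1 : 1 / 2 ≤ Real.cos 1 := by
  have := Real.one_sub_sq_div_two_le_cos (x := 1); norm_num at this ⊢; exact this

theorem gam_bd (w : ℂ) (h : 0 < w.re) : ‖Complex.Gamma w‖ ≤ Real.Gamma w.re * 2 ^ w.re * Real.exp (-|w.im|) := by
  have hp := Real.pi_gt_three
  have hm : Real.cos 1 ^ (-w.re) ≤ 2 ^ w.re := by
    have := Real.rpow_le_rpow_of_nonpos (by norm_num : (0:ℝ) < 1 / 2) cos_1 (by linarith : -w.re ≤ 0)
    rwa [one_div, Real.inv_rpow (by norm_num), Real.rpow_neg (by norm_num : (0:ℝ) ≤ 2), inv_inv] at this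
  have hg := Real.Gamma_pos_of_pos h
  have key : ∀ α : ℝ, |α| = 1 → α * w.im = -|w.im| → ‖Complex.Gamma w‖ ≤ Real.Gamma w.re * 2 ^ w.re * Real.exp (-|w.im|) := by
    intro α h1 h2
    have := gamma_dec w.re w.im α h (by linarith)
    rw [Complex.re_add_im, h2, ← Real.cos_abs α, h1] at this
    refine this.trans ?_
    rw [mul_comm]
    gcongr
  rcases le_total 0 w.im with h0 | h0
  · exact key (-1) (by norm_num) (by rw [abs_of_nonneg h0]; ring)
  · exact key 1 (by norm_num) (by rw [abs_of_nonpos h0]; ring)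

theorem exp_abs_int (y : ℝ) : ∫ t : ℝ, Real.exp (-|t + y| / 4) = 8 := by
  rw [integral_add_right_eq_self (fun t : ℝ => Real.exp (-|t| / 4)) y, integral_comp_abs (f := fun t : ℝ => Real.exp (-t / 4))]
  have := integral_exp_mul_Ioi (a := -1 / 4) (by norm_num) 0
  rw [show (fun t : ℝ => Real.exp (-t / 4)) = fun t => Real.exp (-1 / 4 * t) from funext fun t => congrArg _ (by ring)]
  rw [this]; norm_num

theorem exp_abs_intble (y : ℝ) : Integrable fun t : ℝ => Real.exp (-|t + y| / 4) :=
  Integrable.of_integral_ne_zero (by rw [exp_abs_int]; norm_num)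

/-- weight against the kernel on a vertical line -/
theorem wt_bd (y t : ℝ) : (1 + |t|) ^ 3 * Real.exp (-|t + y| / 2) ≤ 1728 * (1 + |y|) ^ 3 * Real.exp (-|t + y| / 4) := by
  set v := |t + y| with hv
  have hv0 : 0 ≤ v := abs_nonneg _
  have h1 : 1 + |t| ≤ (1 + |y|) * (1 + v) := by
    have : |t| ≤ v + |y| := by
      have := abs_sub (t + y) y; rwa [add_sub_cancel_right] at this
    nlinarith [abs_nonneg y]
  have h2 : 1 + v ≤ 12 * Real.exp (v / 12) := by linarith [Real.add_one_le_exp (v / 12)]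
  calc (1 + |t|) ^ 3 * Real.exp (-v / 2) ≤ ((1 + |y|) * (12 * Real.exp (v / 12))) ^ 3 * Real.exp (-v / 2) := by
        gcongr
        exact h1.trans (by gcongr)
    _ = 1728 * (1 + |y|) ^ 3 * (Real.exp (v / 12) ^ 3 * Real.exp (-v / 2)) := by ring
    _ = _ := by rw [← Real.exp_nat_mul, ← Real.exp_add]; congr 2; push_cast; ring

/-- integrand kernel -/
noncomputable def GG (z : ℂ) (x : ℝ) (s : ℂ) : ℂ := Complex.Gamma ((s + z) / 2) / 2 * (x : ℂ) ^ s

theorem GG_bd (z : ℂ) (x c : ℝ) (hx : 0 < x) (hc : 0 < c + z.re) (t : ℝ) :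
    ‖GG z x (c + t * Complex.I)‖ ≤ Real.Gamma ((c + z.re) / 2) * 2 ^ ((c + z.re) / 2) / 2 * x ^ c * Real.exp (-|t + z.im| / 2) := by
  have e1 : ((c + t * Complex.I + z) / 2 : ℂ).re = (c + z.re) / 2 := by
    rw [show (2:ℂ) = ((2:ℝ):ℂ) by norm_num, Complex.div_ofReal_re]; simp
  have e2 : ((c + t * Complex.I + z) / 2 : ℂ).im = (t + z.im) / 2 := by
    rw [show (2:ℂ) = ((2:ℝ):ℂ) by norm_num, Complex.div_ofReal_im]; simp
  have := gam_bd ((c + t * Complex.I + z) / 2) (by rw [e1]; linarith)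
  rw [e1, e2, abs_div, abs_two] at this
  rw [GG, norm_mul, norm_div, Complex.norm_ofNat, Complex.norm_cpow_eq_rpow_re_of_pos hx]
  rw [show (c + t * Complex.I : ℂ).re = c by simp, neg_div]
  calc _ ≤ (Real.Gamma ((c + z.re) / 2) * 2 ^ ((c + z.re) / 2) * Real.exp (-(|t + z.im| / 2))) / 2 * x ^ c := by gcongr
    _ = _ := by ring

theorem GG_cont (z : ℂ) (x c : ℝ) (hx : 0 < x) (hc : 0 < c + z.re) : Continuous fun t : ℝ => GG z x (c + t * Complex.I) := by
  unfold GG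
  refine Continuous.mul (Continuous.div_const (continuous_iff_continuousAt.2 fun t => ?_) _) (Continuous.const_cpow (by fun_prop) (Or.inl (by exact_mod_cast hx.ne')))
  refine ContinuousAt.comp (f := fun t : ℝ => (c + t * Complex.I + z : ℂ) / 2) (Complex.differentiableAt_Gamma _ ?_).continuousAt (by fun_prop)
  intro m h
  have := congrArg Complex.re h
  rw [show (2:ℂ) = ((2:ℝ):ℂ) by norm_num, Complex.div_ofReal_re] at this
  simp at this
  have : (0:ℝ) ≤ m := Nat.cast_nonneg m
  linarith

/-- constant in the weighted bound -/
noncomputable def GC (z : ℂ) (x c : ℝ) : ℝ := Real.Gamma ((c + z.re) / 2) * 2 ^ ((c + z.re) / 2) / 2 * x ^ c * (1728 * (1 + |z.im|) ^ 3)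

theorem GC_pos (z : ℂ) (x c : ℝ) (hx : 0 < x) (hc : 0 < c + z.re) : 0 < GC z x c := by
  have := Real.Gamma_pos_of_pos (by linarith : 0 < (c + z.re) / 2)
  unfold GC; positivity

theorem GG_wt (z : ℂ) (x c : ℝ) (hx : 0 < x) (hc : 0 < c + z.re) (f : ℝ → ℂ) (M : ℝ) (hM : 0 ≤ M) (hf : ∀ t, ‖f t‖ ≤ M * (1 + |t|) ^ 3) (t : ℝ) :
    ‖f t * GG z x (c + t * Complex.I)‖ ≤ M * GC z x c * Real.exp (-|t + z.im| / 4) := by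
  have hg := Real.Gamma_pos_of_pos (by linarith : 0 < (c + z.re) / 2)
  rw [norm_mul]
  calc _ ≤ (M * (1 + |t|) ^ 3) * (Real.Gamma ((c + z.re) / 2) * 2 ^ ((c + z.re) / 2) / 2 * x ^ c * Real.exp (-|t + z.im| / 2)) := by
        gcongr
        · exact hf t
        · exact GG_bd z x c hx hc t
    _ = M * (Real.Gamma ((c + z.re) / 2) * 2 ^ ((c + z.re) / 2) / 2 * x ^ c) * ((1 + |t|) ^ 3 * Real.exp (-|t + z.im| / 2)) := by ring
    _ ≤ M * (Real.Gamma ((c + z.re) / 2) * 2 ^ ((c + z.re) / 2) / 2 * x ^ c) * (1728 * (1 + |z.im|) ^ 3 * Real.exp (-|t + z.im| / 4)) :=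
        mul_le_mul_of_nonneg_left (wt_bd z.im t) (by positivity)
    _ = _ := by unfold GC; ring

theorem GG_wt_int (z : ℂ) (x c : ℝ) (hx : 0 < x) (hc : 0 < c + z.re) (f : ℝ → ℂ) (hm : Measurable f) (M : ℝ) (hM : 0 ≤ M) (hf : ∀ t, ‖f t‖ ≤ M * (1 + |t|) ^ 3) :
    Integrable (fun t : ℝ => f t * GG z x (c + t * Complex.I)) ∧ ∫ t : ℝ, ‖f t * GG z x (c + t * Complex.I)‖ ≤ 8 * M * GC z x c := by
  have hi : Integrable (fun t : ℝ => f t * GG z x (c + t * Complex.I)) :=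
    ((exp_abs_intble z.im).const_mul (M * GC z x c)).mono' (hm.aestronglyMeasurable.mul (GG_cont z x c hx hc).aestronglyMeasurable)
      (Eventually.of_forall (GG_wt z x c hx hc f M hM hf))
  refine ⟨hi, ?_⟩
  calc _ ≤ ∫ t : ℝ, M * GC z x c * Real.exp (-|t + z.im| / 4) :=
        integral_mono hi.norm ((exp_abs_intble z.im).const_mul _) (GG_wt z x c hx hc f M hM hf)
    _ = _ := by rw [integral_const_mul, exp_abs_int]; ring

theorem GG_int (z : ℂ) (x c : ℝ) (hx : 0 < x) (hc : 0 < c + z.re) : Integrable (fun t : ℝ => GG z x (c + t * Complex.I)) := by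
  simpa using (GG_wt_int z x c hx hc (fun _ => 1) measurable_const 1 zero_le_one (fun t => by
    rw [norm_one, one_mul]; exact one_le_pow₀ (by linarith [abs_nonneg t]))).1

theorem GG_inv (z : ℂ) (x c : ℝ) (hx : 0 < x) (hc : 0 < c + z.re) (u : ℝ) (hu : 0 < u) :
    ∫ t : ℝ, (u : ℂ) ^ (-(c + t * Complex.I)) * GG z x (c + t * Complex.I) = 2 * Real.pi * kk z (u / x) := by
  have hm : ∀ t : ℝ, mellin (kk z) (c + t * Complex.I) = Complex.Gamma ((c + t * Complex.I + z) / 2) / 2 := fun t =>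
    (kk_mellin z _ (by simpa using hc)).2
  have hv : Complex.VerticalIntegrable (mellin (kk z)) c := by
    have := GG_int z 1 c one_pos hc
    refine this.congr (Eventually.of_forall fun t => ?_)
    change GG z 1 _ = mellin (kk z) _
    rw [hm, GG]; simp
  have h := mellinInv_mellin_eq c (kk z) (x := u / x) (div_pos hu hx) (kk_mellin z c (by simpa using hc)).1 hv (by
    unfold kk
    refine ContinuousAt.mul (Complex.continuousAt_ofReal_cpow_const _ _ (Or.inr (div_pos hu hx).ne')) ?_
    exact Complex.continuous_ofReal.continuousAt.comp (Real.continuous_exp.continuousAt.comp (Real.continuousAt_rpow_const _ _ (Or.inr (by norm_num))).neg))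
  rw [← h, mellinInv, Complex.real_smul, ← mul_assoc]
  have : (2 * (Real.pi:ℂ)) * ((1 / (2 * Real.pi) : ℝ) : ℂ) = 1 := by
    push_cast; field_simp
  rw [this, one_mul]
  refine integral_congr_ae (Eventually.of_forall fun t => ?_)
  change _ * GG z x _ = _ • _
  rw [hm, GG, smul_eq_mul, Complex.ofReal_div, Complex.div_cpow_ofReal_nonneg hu.le hx.le, Complex.cpow_neg (x : ℂ), div_inv_eq_mul]
  ring

/-- weighted vertical integral -/
noncomputable def TT (z : ℂ) (x c : ℝ) (f : ℂ → ℂ) : ℂ := ∫ t : ℝ, f (c + t * Complex.I) * GG z x (c + t * Complex.I)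

theorem TT_bd (z : ℂ) (x c : ℝ) (hx : 0 < x) (hc : 0 < c + z.re) (f : ℂ → ℂ) (hm : Measurable f) (M : ℝ) (hM : 0 ≤ M)
    (hf : ∀ t : ℝ, ‖f (c + t * Complex.I)‖ ≤ M * (1 + |t|) ^ 3) : ‖TT z x c f‖ ≤ 8 * M * GC z x c :=
  (norm_integral_le_integral_norm _).trans (GG_wt_int z x c hx hc (fun t => f (c + t * Complex.I)) (hm.comp (by fun_prop)) M hM hf).2

theorem TT_hasSum {ι : Type} (z : ℂ) (x c : ℝ) (hx : 0 < x) (hc : 0 < c + z.re) (f : ι → ℂ → ℂ) (hm : ∀ i, Measurable (f i)) (M : ι → ℝ) (hM : ∀ i, 0 ≤ M i)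
    (hf : ∀ i, ∀ t : ℝ, ‖f i (c + t * Complex.I)‖ ≤ M i * (1 + |t|) ^ 3) (hs : Summable M) (F : ℂ → ℂ)
    (hF : ∀ t : ℝ, HasSum (fun i => f i (c + t * Complex.I)) (F (c + t * Complex.I))) :
    HasSum (fun i => TT z x c (f i)) (TT z x c F) := by
  have hz : ∀ i, i ∉ Function.support M → ∀ t : ℝ, f i (c + t * Complex.I) = 0 := fun i hi t => by
    have h := hf i t
    rw [Function.notMem_support.1 hi, zero_mul] at h
    exact norm_le_zero_iff.1 h
  have hc' : Countable (Function.support M) := hs.countable_support.to_subtype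
  have hi := fun i => GG_wt_int z x c hx hc (fun t => f i (c + t * Complex.I)) ((hm i).comp (by fun_prop)) (M i) (hM i) (hf i)
  have h := hasSum_integral_of_summable_integral_norm (μ := volume) (F := fun (i : Function.support M) (t : ℝ) => f i (c + t * Complex.I) * GG z x (c + t * Complex.I))
    (fun i => (hi i).1) (Summable.of_nonneg_of_le (fun i => integral_nonneg fun _ => norm_nonneg _) (fun i => (hi i).2)
      (((hs.subtype _).mul_left 8).mul_right _))
  rw [← hasSum_subtype_iff_of_support_subset (s := Function.support M)]
  · refine (congrArg (HasSum _) ?_).mpr h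
    refine integral_congr_ae (Eventually.of_forall fun t => ?_)
    have h2 := (hasSum_subtype_iff_of_support_subset (s := Function.support M) (fun i hi => by
      by_contra hn; exact hi (hz i hn t))).2 (hF t)
    exact (h2.mul_right _).tsum_eq.symm
  · intro i hi
    by_contra hn
    refine hi ?_
    simp [TT, hz i hn]

theorem TT_S (z : ℂ) (x c : ℝ) (hx : 0 < x) (hc : 0 < c + z.re) (S : Set ℝ) (hS : MeasurableSet S) (hS0 : S ⊆ Ioi 0) (a ε : ℂ)
    (hi : IntegrableOn (fun u : ℝ => u ^ (a.re - 1 - c)) S)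
    (he : ∀ t : ℝ, ∫ u in S, (u : ℂ) ^ (a - 1 - (c + t * Complex.I)) = ε * (1 / (c + t * Complex.I - a))) :
    ε * TT z x c (fun s => 1 / (s - a)) = 2 * Real.pi * ∫ u in S, (u : ℂ) ^ (a - 1) * kk z (u / x) := by
  have hae : ∀ᵐ u ∂(volume.restrict S), 0 < u := (ae_restrict_iff' hS).2 (Eventually.of_forall fun u hu => hS0 hu)
  have hG := GG_int z x c hx hc
  have hP : Integrable (fun p : ℝ × ℝ => ((p.2 : ℂ) ^ (a - 1 - (c + p.1 * Complex.I))) * GG z x (c + p.1 * Complex.I)) (volume.prod (volume.restrict S)) := by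
    refine Integrable.mono' (hG.norm.mul_prod hi) ?_ ?_
    · exact ((Measurable.pow (by fun_prop) (by fun_prop)).mul ((GG_cont z x c hx hc).measurable.comp measurable_fst)).aestronglyMeasurable
    · have : ∀ᵐ p ∂((volume : Measure ℝ).prod (volume.restrict S)), 0 < p.2 := Measure.quasiMeasurePreserving_snd.ae hae
      filter_upwards [this] with p hp
      rw [norm_mul, Complex.norm_cpow_eq_rpow_re_of_pos hp, mul_comm]
      simp
  calc _ = ∫ t : ℝ, ∫ u in S, (u : ℂ) ^ (a - 1 - (c + t * Complex.I)) * GG z x (c + t * Complex.I) := by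
        rw [TT, ← integral_const_mul]
        refine integral_congr_ae (Eventually.of_forall fun t => ?_)
        change ε * (_ * _) = ∫ u in S, _
        rw [integral_mul_const, he t, mul_assoc]
    _ = ∫ u in S, ∫ t : ℝ, (u : ℂ) ^ (a - 1 - (c + t * Complex.I)) * GG z x (c + t * Complex.I) := integral_integral_swap hP
    _ = ∫ u in S, 2 * Real.pi * ((u : ℂ) ^ (a - 1) * kk z (u / x)) := by
        refine integral_congr_ae ?_
        filter_upwards [hae] with u hu
        rw [show 2 * (Real.pi:ℂ) * ((u : ℂ) ^ (a - 1) * kk z (u / x)) = (u : ℂ) ^ (a - 1) * (2 * Real.pi * kk z (u / x)) by ring, ← GG_inv z x c hx hc u hu, ← integral_const_mul]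
        congr 1; funext t
        rw [sub_eq_add_neg (a - 1), Complex.cpow_add _ _ (by exact_mod_cast hu.ne')]; ring
    _ = _ := integral_const_mul _ _

theorem TT_hi (z : ℂ) (x c : ℝ) (hx : 0 < x) (hc : 0 < c + z.re) (a : ℂ) (ha : a.re < c) :
    TT z x c (fun s => 1 / (s - a)) = 2 * Real.pi * ∫ u : ℝ in Ioi 1, (u : ℂ) ^ (a - 1) * kk z (u / x) := by
  have h := TT_S z x c hx hc (Ioi 1) measurableSet_Ioi (Ioi_subset_Ioi zero_le_one) a 1 (integrableOn_Ioi_rpow_of_lt (by linarith) one_pos) (fun t => by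
    rw [integral_Ioi_cpow_of_lt (by simp; linarith) one_pos, Complex.ofReal_one, Complex.one_cpow, neg_div, ← div_neg, one_mul]; congr 1; ring)
  rwa [one_mul] at h

theorem TT_lo (z : ℂ) (x c : ℝ) (hx : 0 < x) (hc : 0 < c + z.re) (a : ℂ) (ha : c < a.re) :
    -TT z x c (fun s => 1 / (s - a)) = 2 * Real.pi * ∫ u : ℝ in Ioc 0 1, (u : ℂ) ^ (a - 1) * kk z (u / x) := by
  have h := TT_S z x c hx hc (Ioc 0 1) measurableSet_Ioc (fun u hu => hu.1) a (-1) (by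
      rw [← intervalIntegrable_iff_integrableOn_Ioc_of_le zero_le_one]
      exact intervalIntegral.intervalIntegrable_rpow' (by linarith)) (fun t => by
    have hn : a - 1 - (c + t * Complex.I) + 1 ≠ 0 := fun h => by
      have := congrArg Complex.re h; simp at this; linarith
    rw [← intervalIntegral.integral_of_le zero_le_one, integral_cpow (Or.inl (by simp; linarith)), Complex.ofReal_one, Complex.one_cpow, Complex.ofReal_zero, Complex.zero_cpow hn,
      sub_zero, neg_mul, one_mul, ← div_neg]
    congr 1; ring)
  rwa [neg_one_mul] at h

theorem TT_pole (z : ℂ) (x c c' : ℝ) (hx : 0 < x) (hcc : c' < c) (hc : 0 < c' + z.re) (a : ℂ) (ha : a.re < c) (ha' : c' < a.re) :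
    TT z x c (fun s => 1 / (s - a)) = TT z x c' (fun s => 1 / (s - a)) + 2 * Real.pi * ((x : ℂ) ^ a * (Complex.Gamma ((a + z) / 2) / 2)) := by
  have h1 := TT_hi z x c hx (by linarith) a ha
  have h2 := TT_lo z x c' hx hc a ha'
  have hk := kk_mellin z a (by simp; linarith)
  have hconv : MellinConvergent (fun t => kk z (x⁻¹ * t)) a := (MellinConvergent.comp_mul_left (inv_pos.2 hx)).2 hk.1
  have hm := mellin_comp_mul_left (kk z) a (inv_pos.2 hx)
  rw [hk.2] at hm
  have e : mellin (fun t => kk z (x⁻¹ * t)) a = (∫ u : ℝ in Ioc 0 1, (u : ℂ) ^ (a - 1) * kk z (u / x)) + ∫ u : ℝ in Ioi 1, (u : ℂ) ^ (a - 1) * kk z (u / x) := by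
    have hI : IntegrableOn (fun u : ℝ => (u : ℂ) ^ (a - 1) * kk z (u / x)) (Ioi 0) := by
      refine hconv.congr_fun (fun u _ => ?_) measurableSet_Ioi
      simp only [smul_eq_mul, div_eq_inv_mul]
    rw [← setIntegral_union (Ioc_disjoint_Ioi le_rfl) measurableSet_Ioi (hI.mono_set Ioc_subset_Ioi_self) (hI.mono_set (Ioi_subset_Ioi zero_le_one)), Ioc_union_Ioi_eq_Ioi zero_le_one]
    refine setIntegral_congr_fun measurableSet_Ioi (fun u _ => ?_)
    simp only [smul_eq_mul, div_eq_inv_mul]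
  rw [smul_eq_mul, Complex.ofReal_inv, Complex.inv_cpow_ofReal_nonneg hx.le, Complex.cpow_neg, inv_inv, e] at hm
  rw [← hm, mul_add, ← h1, ← h2]; ring

theorem TT_nopole (z : ℂ) (x c c' : ℝ) (hx : 0 < x) (hcc : c' < c) (hc : 0 < c' + z.re) (a : ℂ) (ha : a.re < c') :
    TT z x c (fun s => 1 / (s - a)) = TT z x c' (fun s => 1 / (s - a)) := by
  rw [TT_hi z x c hx (by linarith) a (by linarith), TT_hi z x c' hx hc a ha]

theorem TT_one (z : ℂ) (x c : ℝ) (hx : 0 < x) (hc : 0 < c + z.re) (b : ℂ) : TT z x c (fun _ => b) = b * (2 * Real.pi * kk z (1 / x)) := by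
  rw [← GG_inv z x c hx hc 1 one_pos, TT, ← integral_const_mul]; simp

theorem im_le_norm1 (z : ℂ) (σ t : ℝ) (hz : z = σ + t * Complex.I) (a : ℝ) (h : |σ| ≤ a) : ‖z‖ ≤ a + |t| := by
  rw [hz]
  refine (norm_add_le _ _).trans ?_
  rw [norm_mul, Complex.norm_I, mul_one, Complex.norm_real, Complex.norm_real]
  exact add_le_add h le_rfl

theorem zb0 (w r : ℂ) (hw : w.re = 3 / 2) (hr : |r.re| < 1 / 2) :
    1 / 2 * (1 / (w - r) + 1 / (w + r)) = w / (w ^ 2 - r ^ 2) ∧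
    ‖1 / 2 * (1 / (w - r) + 1 / (w + r))‖ ≤ 10.125 / ‖1 - r‖ ^ 2 * (1 + |w.im|) ^ 3 := by
  have h1 := hd_cmp w r (by linarith) hr.le
  have h2 := hd_cmp w (-r) (by linarith) (by simpa using hr.le)
  rw [abs_lt] at hr
  have a1 : w - r ≠ 0 := fun h => by have := congrArg Complex.re h; simp at this; linarith
  have a2 : w + r ≠ 0 := fun h => by have := congrArg Complex.re h; simp at this; linarith
  have a3 : 1 - r ≠ 0 := fun h => by have := congrArg Complex.re h; simp at this; linarith
  have e : 1 / 2 * (1 / (w - r) + 1 / (w + r)) = w / ((w - r) * (w + r)) := by field_simp; ring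
  refine ⟨by rw [e]; congr 1; ring, ?_⟩
  rw [e, norm_div, norm_mul]
  rw [sub_neg_eq_add, sub_neg_eq_add] at h2
  rw [hw] at h1 h2
  have hw1 : ‖w‖ ≤ 3 / 2 + |w.im| := im_le_norm1 w w.re w.im (Complex.re_add_im w).symm _ (by rw [hw]; norm_num)
  have hw2 : ‖1 - w‖ ≤ 1 / 2 + |w.im| := by
    rw [← abs_neg w.im]
    exact im_le_norm1 _ (1 - w.re) (-w.im) (by apply Complex.ext <;> simp) _ (by rw [hw]; norm_num)
  set v := |w.im|
  have hv : 0 ≤ v := abs_nonneg _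
  have h3 : ‖1 - r‖ ≤ 3 * ‖1 + r‖ := by
    rw [← Real.sqrt_sq (norm_nonneg (1 - r)), ← Real.sqrt_sq (by positivity : 0 ≤ 3 * ‖1 + r‖)]
    refine Real.sqrt_le_sqrt ?_
    rw [mul_pow, Complex.sq_norm, Complex.sq_norm, Complex.normSq_apply, Complex.normSq_apply]
    simp; nlinarith
  have b1 : 0 < ‖w - r‖ := norm_pos_iff.2 a1
  have b2 : 0 < ‖w + r‖ := norm_pos_iff.2 a2
  have b3 : 0 < ‖1 - r‖ := norm_pos_iff.2 a3
  have c1 : ‖1 - r‖ ≤ 3 / 2 * (1 + v) * ‖w - r‖ := h1.trans (by gcongr; linarith)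
  have c2 : ‖1 - r‖ ≤ 9 / 2 * (1 + v) * ‖w + r‖ := by
    have : ‖1 + r‖ ≤ 3 / 2 * (1 + v) * ‖w + r‖ := h2.trans (by gcongr; linarith)
    linarith
  rw [div_mul_eq_mul_div, div_le_div_iff₀ (by positivity) (by positivity), pow_two]
  calc ‖w‖ * (‖1 - r‖ * ‖1 - r‖) ≤ (3 / 2 * (1 + v)) * ((3 / 2 * (1 + v) * ‖w - r‖) * (9 / 2 * (1 + v) * ‖w + r‖)) := by
        gcongr; linarith
    _ = _ := by ring

/-- zero term -/
noncomputable def zt (r s : ℂ) : ℂ := xm r * (1 / 2 * (1 / (s - (1 / 2 + r)) + 1 / (s - (1 / 2 - r))))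

theorem zt_bd (c : ℝ) (hc : c = 2 ∨ c = -1) (r : ℂ) (t : ℝ) :
    ‖zt r (c + t * Complex.I)‖ ≤ (10.125 * (xm r / ‖1 - r‖ ^ 2)) * (1 + |t|) ^ 3 := by
  unfold zt
  by_cases h0 : xi r = 0
  swap
  · rw [xm_zero r h0]; simp
  have hr := xi_zero_re r h0
  have key : ‖1 / 2 * (1 / (c + t * Complex.I - (1 / 2 + r)) + 1 / (c + t * Complex.I - (1 / 2 - r)))‖ ≤ 10.125 / ‖1 - r‖ ^ 2 * (1 + |t|) ^ 3 := by
    rcases hc with rfl | rfl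
    · have := (zb0 (((2:ℝ):ℂ) + t * Complex.I - 1 / 2) r (by simp; norm_num) hr).2
      rw [show (((2:ℝ):ℂ) + t * Complex.I - 1 / 2).im = t by simp] at this
      convert this using 5 <;> ring
    · have := (zb0 (-(((-1:ℝ):ℂ) + t * Complex.I - 1 / 2)) r (by simp; norm_num) hr).2
      rw [show (-(((-1:ℝ):ℂ) + t * Complex.I - 1 / 2)).im = -t by simp, abs_neg] at this
      refine le_trans (le_of_eq ?_) this
      rw [← norm_neg]; congr 1
      rw [show -(((-1:ℝ):ℂ) + t * Complex.I - 1 / 2) - r = -(((-1:ℝ):ℂ) + t * Complex.I - (1 / 2 - r)) by ring,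
        show -(((-1:ℝ):ℂ) + t * Complex.I - 1 / 2) + r = -(((-1:ℝ):ℂ) + t * Complex.I - (1 / 2 + r)) by ring, div_neg, div_neg]
      ring
  rw [norm_mul, Complex.norm_natCast]
  calc _ ≤ (xm r : ℝ) * (10.125 / ‖1 - r‖ ^ 2 * (1 + |t|) ^ 3) := by gcongr
    _ = _ := by ring

theorem zt_hasSum (t : ℝ) : HasSum (fun r => zt r ((2:ℝ) + t * Complex.I))
    (deriv xi ((2:ℝ) + t * Complex.I - 1 / 2) / xi ((2:ℝ) + t * Complex.I - 1 / 2)) := by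
  have h := (xi_hasSum (((2:ℝ):ℂ) + t * Complex.I - 1 / 2) (by simp; norm_num)).2
  refine h.congr_fun ?_
  intro r
  unfold zt
  by_cases h0 : xi r = 0
  swap
  · rw [xm_zero r h0]; simp
  rw [← (zb0 (((2:ℝ):ℂ) + t * Complex.I - 1 / 2) r (by simp; norm_num) (xi_zero_re r h0)).1]
  congr 4 <;> ring

theorem S0_bd : ∑' r, (xm r : ℝ) / ‖1 - r‖ ^ 2 ≤ 8.3 := by
  have h := (xi_hasSum 4 (by norm_num)).1
  have h2 := xi_re_le 0 le_rfl 25 (by norm_num)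
  rw [Complex.ofReal_zero, zero_mul, add_zero] at h2
  refine (hasSum_le (fun r => ?_) xi_summable.hasSum (h.mul_left 14)).trans (by norm_num at h2 ⊢; linarith)
  by_cases h0 : xi r = 0
  swap
  · rw [xm_zero r h0]; simp
  have hr := abs_lt.1 (xi_zero_re r h0)
  have a : 1 / 2 ≤ ‖1 - r‖ := by
    have := (le_abs_self _).trans (Complex.abs_re_le_norm (1 - r)); simp at this; linarith
  have b : ‖4 - r‖ ≤ 7 * ‖1 - r‖ := by
    have := norm_add_le (3:ℂ) (1 - r); rw [Complex.norm_ofNat, show (3:ℂ) + (1 - r) = 4 - r by ring] at this; linarith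
  have c : 0 < ‖4 - r‖ := by
    have := (le_abs_self _).trans (Complex.abs_re_le_norm (4 - r)); simp at this; linarith
  rw [hd_re, show (4:ℂ).re = 4 by norm_num]
  have : 1 / ‖1 - r‖ ^ 2 ≤ 14 * ((4 - r.re) / ‖4 - r‖ ^ 2) := by
    rw [mul_div_assoc', div_le_div_iff₀ (by positivity) (by positivity)]
    nlinarith
  calc (xm r : ℝ) / ‖1 - r‖ ^ 2 = xm r * (1 / ‖1 - r‖ ^ 2) := by ring
    _ ≤ xm r * (14 * ((4 - r.re) / ‖4 - r‖ ^ 2)) := by gcongr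
    _ = _ := by ring

/-- digamma term -/
noncomputable def dt (j : ℕ) (s : ℂ) : ℂ := 1 / (j + 1) - 2 * (1 / (s - (-2 - 2 * j)))

theorem dt_bd (c : ℝ) (hc : c = 2 ∨ c = -1) (j : ℕ) (t : ℝ) : ‖dt j (c + t * Complex.I)‖ ≤ (2 * (1 / ((j + 1 : ℕ):ℝ) ^ 2)) * (1 + |t|) ^ 3 := by
  unfold dt
  have hj : (0:ℝ) ≤ j := Nat.cast_nonneg j
  have hc' : |c| ≤ 2 ∧ -1 ≤ c := by rcases hc with rfl | rfl <;> norm_num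
  have h1 := im_le_norm1 (c + t * Complex.I) c t rfl 2 hc'.1
  have h2 : (j:ℝ) + 1 ≤ ‖c + t * Complex.I - (-2 - 2 * j)‖ := by
    have := (le_abs_self _).trans (Complex.abs_re_le_norm (c + t * Complex.I - (-2 - 2 * j))); simp at this; linarith [hc'.2]
  have n1 : c + t * Complex.I - (-2 - 2 * (j:ℂ)) ≠ 0 := norm_pos_iff.1 (by linarith)
  have n2 : (j:ℂ) + 1 ≠ 0 := by exact_mod_cast Nat.succ_ne_zero j
  rw [show 1 / ((j:ℂ) + 1) - 2 * (1 / (c + t * Complex.I - (-2 - 2 * j))) = (c + t * Complex.I) / ((j + 1) * (c + t * Complex.I - (-2 - 2 * j))) by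
      rw [show (c + t * Complex.I : ℂ) / ((j + 1) * (c + t * Complex.I - (-2 - 2 * j))) = ((c + t * Complex.I - (-2 - 2 * j)) + (-2 - 2 * j)) / ((j + 1) * (c + t * Complex.I - (-2 - 2 * j))) by ring_nf]
      generalize (c + t * Complex.I - (-2 - 2 * (j:ℂ))) = q at n1 ⊢
      field_simp; ring,
    norm_div, norm_mul, show ‖(j:ℂ) + 1‖ = j + 1 by exact_mod_cast Complex.norm_natCast (j + 1)]
  have h3 : 2 + |t| ≤ 2 * (1 + |t|) ^ 3 := by nlinarith [abs_nonneg t, sq_nonneg |t|, pow_nonneg (abs_nonneg t) 3]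
  calc _ ≤ (2 * (1 + |t|) ^ 3) / ((j + 1) * (j + 1)) := by gcongr; exact h1.trans h3
    _ = _ := by push_cast; ring

theorem dt_hasSum (s : ℂ) (t : ℝ) (hs : s = (2:ℝ) + t * Complex.I) : HasSum (fun j => dt j s) (Complex.digamma (s / 2 + 1) + Real.eulerMascheroniConstant) := by
  have hsum : Summable fun j => dt j s := by
    refine Summable.of_norm_bounded ?_ (fun j => hs ▸ dt_bd 2 (Or.inl rfl) j t)
    exact (((summable_nat_add_iff 1).2 hasSum_zeta_two.summable).mul_left 2).mul_right _
  have h1 := hsum.hasSum.tendsto_sum_nat.comp (tendsto_add_atTop_nat 1)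
  have hw : 0 < (s / 2 + 1).re := by
    rw [show (2:ℂ) = ((2:ℝ):ℂ) by norm_num, Complex.add_re, Complex.div_ofReal_re, hs]; simp
  have h2 := digamma_tendsto (s / 2 + 1) hw
  have h3 : Tendsto (fun n : ℕ => ((∑ j ∈ Finset.range (n + 1), (1:ℝ) / (j + 1) - Real.log n : ℝ) : ℂ)) atTop (𝓝 (Real.eulerMascheroniConstant : ℂ)) := by
    refine (Complex.continuous_ofReal.tendsto _).comp ?_
    have a := Real.tendsto_harmonic_sub_log
    have b := tendsto_one_div_add_atTop_nhds_zero_nat (𝕜 := ℝ)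
    have := a.add b
    rw [add_zero] at this
    refine this.congr fun n => ?_
    rw [Finset.sum_range_succ, harmonic]; push_cast
    simp only [one_div]; ring
  have h4 := tendsto_nhds_unique h1 ((h2.add h3).congr fun n => by
    simp only [Function.comp]
    unfold dt
    rw [Finset.sum_sub_distrib]
    push_cast
    rw [show ∀ a b c d : ℂ, a = d → c - a + (b - c) = b - d by intros; subst_vars; ring]
    refine Finset.sum_congr rfl fun j _ => ?_
    rw [show s / 2 + 1 + j = (s - (-2 - 2 * j)) / 2 by ring, one_div_div]; ring)
  rw [← h4]; exact hsum.hasSum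

theorem TI_bd (z : ℂ) (x c : ℝ) (hx : 0 < x) (hc : 0 < c + z.re) (f : ℂ → ℂ) (hm : Measurable f) (M : ℝ) (hM : 0 ≤ M)
    (hf : ∀ t : ℝ, ‖f (c + t * Complex.I)‖ ≤ M * (1 + |t|) ^ 3) : Integrable fun t : ℝ => f (c + t * Complex.I) * GG z x (c + t * Complex.I) :=
  (GG_wt_int z x c hx hc (fun t => f (c + t * Complex.I)) (hm.comp (by fun_prop)) M hM hf).1

theorem cub (t : ℝ) : 1 ≤ (1 + |t|) ^ 3 := one_le_pow₀ (by linarith [abs_nonneg t])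

theorem pole_bd (a : ℂ) (c d : ℝ) (hd : 0 < d) (h : d ≤ |c - a.re|) (t : ℝ) : ‖1 / (c + t * Complex.I - a)‖ ≤ 1 / d * (1 + |t|) ^ 3 := by
  have h1 : d ≤ ‖c + t * Complex.I - a‖ := h.trans (by simpa using Complex.abs_re_le_norm (c + t * Complex.I - a))
  rw [norm_div, norm_one]
  exact (one_div_le_one_div_of_le hd h1).trans (le_mul_of_one_le_right (by positivity) (cub t))

theorem TI_pole (z : ℂ) (x c : ℝ) (hx : 0 < x) (hc : 0 < c + z.re) (a : ℂ) (h : c - a.re ≠ 0) :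
    Integrable fun t : ℝ => 1 / (c + t * Complex.I - a) * GG z x (c + t * Complex.I) :=
  TI_bd z x c hx hc (fun s => 1 / (s - a)) (by fun_prop) _ (by positivity) (pole_bd a c _ (abs_pos.2 h) le_rfl)

theorem TT_zt (z : ℂ) (x c : ℝ) (hx : 0 < x) (hc : 0 < c + z.re) (r : ℂ) (h1 : c - (1 / 2 + r).re ≠ 0) (h2 : c - (1 / 2 - r).re ≠ 0) :
    TT z x c (zt r) = xm r * (1 / 2) * (TT z x c (fun s => 1 / (s - (1 / 2 + r))) + TT z x c (fun s => 1 / (s - (1 / 2 - r)))) := by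
  unfold TT
  rw [← integral_add (TI_pole z x c hx hc _ h1) (TI_pole z x c hx hc _ h2), ← integral_const_mul]
  refine integral_congr_ae (Eventually.of_forall fun t => ?_)
  simp only [zt]; ring

theorem TT_dt (z : ℂ) (x c : ℝ) (hx : 0 < x) (hc : 0 < c + z.re) (j : ℕ) (h : -1 ≤ c) :
    TT z x c (dt j) = 1 / (j + 1) * TT z x c (fun _ => 1) - 2 * TT z x c (fun s => 1 / (s - (-2 - 2 * j))) := by
  unfold TT
  have i1 : Integrable fun t : ℝ => (1:ℂ) * GG z x (c + t * Complex.I) := by simpa using GG_int z x c hx hc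
  rw [← integral_const_mul, ← integral_const_mul, ← integral_sub (i1.const_mul _)
    ((TI_pole z x c hx hc _ (by simp; have : (0:ℝ) ≤ j := Nat.cast_nonneg j; intro h; linarith)).const_mul 2)]
  refine integral_congr_ae (Eventually.of_forall fun t => ?_)
  simp only [dt]; ring

theorem vm_sum (z : ℂ) (x : ℝ) (hx : 0 < x) (hz : 1 < z.re) :
    HasSum (fun n : ℕ => 2 * Real.pi * ((ArithmeticFunction.vonMangoldt n : ℂ) * kk z (n / x))) (TT z x 2 fun s => -(deriv riemannZeta s / riemannZeta s)) ∧
    Integrable fun t : ℝ => -(deriv riemannZeta ((2:ℝ) + t * Complex.I) / riemannZeta ((2:ℝ) + t * Complex.I)) * GG z x ((2:ℝ) + t * Complex.I) := by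
  have hs := (ArithmeticFunction.LSeriesSummable_vonMangoldt (s := 2) (by norm_num)).norm
  have hb : ∀ n : ℕ, ∀ t : ℝ, ‖LSeries.term (fun n => (ArithmeticFunction.vonMangoldt n : ℂ)) ((2:ℝ) + t * Complex.I) n‖ ≤ ‖LSeries.term (fun n => (ArithmeticFunction.vonMangoldt n : ℂ)) 2 n‖ * (1 + |t|) ^ 3 := by
    intro n t
    refine le_trans (le_of_eq ?_) (le_mul_of_one_le_right (norm_nonneg _) (cub t))
    rw [LSeries.norm_term_eq, LSeries.norm_term_eq]; simp
  have hF : ∀ t : ℝ, HasSum (fun n => LSeries.term (fun n => (ArithmeticFunction.vonMangoldt n : ℂ)) ((2:ℝ) + t * Complex.I) n)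
      (-(deriv riemannZeta ((2:ℝ) + t * Complex.I) / riemannZeta ((2:ℝ) + t * Complex.I))) := by
    intro t
    have h1 : 1 < (((2:ℝ):ℂ) + t * Complex.I).re := by simp
    have := (ArithmeticFunction.LSeriesSummable_vonMangoldt h1).LSeriesHasSum
    rw [ArithmeticFunction.LSeries_vonMangoldt_eq_deriv_riemannZeta_div h1, neg_div] at this
    exact this
  have hm : Measurable fun s => -(deriv riemannZeta s / riemannZeta s) := by
    refine ((measurable_deriv _).div (measurable_of_continuousOn_compl_singleton 1 fun s hs => ?_)).neg
    exact (differentiableAt_riemannZeta hs).continuousAt.continuousWithinAt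
  constructor
  · have := TT_hasSum z x 2 hx (by linarith) (fun n s => LSeries.term (fun n => (ArithmeticFunction.vonMangoldt n : ℂ)) s n) (fun n => by
      rcases eq_or_ne n 0 with rfl | hn
      · simp
      · simp only [LSeries.term_of_ne_zero hn]
        exact measurable_const.div (measurable_const.pow measurable_id)) _ (fun n => norm_nonneg _) hb hs (fun s => -(deriv riemannZeta s / riemannZeta s)) hF
    refine this.congr_fun fun n => ?_
    rcases eq_or_ne n 0 with rfl | hn
    · simp [TT]
    simp only [TT, LSeries.term_of_ne_zero hn]
    have hn' : (0:ℝ) < n := by exact_mod_cast Nat.pos_of_ne_zero hn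
    rw [show 2 * (Real.pi:ℂ) * ((ArithmeticFunction.vonMangoldt n : ℂ) * kk z (n / x)) = ArithmeticFunction.vonMangoldt n * (2 * Real.pi * kk z (n / x)) by ring,
      ← GG_inv z x 2 hx (by linarith) n hn', ← integral_const_mul]
    congr 1; funext t
    rw [Complex.cpow_neg]; push_cast; ring
  · exact TI_bd z x 2 hx (by linarith) (fun s => -(deriv riemannZeta s / riemannZeta s)) hm (∑' n, ‖LSeries.term (fun n => (ArithmeticFunction.vonMangoldt n : ℂ)) 2 n‖) (tsum_nonneg fun _ => norm_nonneg _)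
      fun t => (hF t).norm_le_of_bounded (hs.hasSum.mul_right _) (fun n => hb n t)

theorem zt_int (z : ℂ) (x : ℝ) (hx : 0 < x) (hz : 1 < z.re) :
    Integrable fun t : ℝ => (deriv xi ((2:ℝ) + t * Complex.I - 1 / 2) / xi ((2:ℝ) + t * Complex.I - 1 / 2)) * GG z x ((2:ℝ) + t * Complex.I) :=
  TI_bd z x 2 hx (by linarith) (fun s => deriv xi (s - 1 / 2) / xi (s - 1 / 2))
    (((measurable_deriv xi).div xi_diff.continuous.measurable).comp (by fun_prop)) (10.125 * ∑' r, (xm r : ℝ) / ‖1 - r‖ ^ 2)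
    (mul_nonneg (by norm_num) (tsum_nonneg fun _ => by positivity))
    fun t => (zt_hasSum t).norm_le_of_bounded ((xi_summable.hasSum.mul_left _).mul_right _) fun r => zt_bd 2 (Or.inl rfl) r t

theorem int4 (f g h k : ℝ → ℂ) (b : ℂ) (hf : Integrable f) (hg : Integrable g) (hh : Integrable h) (hk : Integrable k) :
    ∫ t, (2 * (f t - g t + h t) + b * k t) = 2 * ((∫ t, f t) - (∫ t, g t) + ∫ t, h t) + b * ∫ t, k t := by
  have h1 := integral_sub hf hg
  have h2 := integral_add (hf.sub hg) hh
  have h3 := integral_add (((hf.sub hg).add hh).const_mul 2) (hk.const_mul b)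
  rw [integral_const_mul, integral_const_mul] at h3
  simp only [Pi.sub_apply, Pi.add_apply] at h2 h3
  rw [h3, h2, h1]

theorem D_main (z : ℂ) (x : ℝ) (hx : 0 < x) (hz : 1 < z.re) (g : ℂ → ℝ) (G : ℝ) (hg : HasSum g G) (hg0 : ∀ r, 0 ≤ g r)
    (hb : ∀ r, xi r = 0 → xm r * ‖(x:ℂ) ^ (1 / 2 + r) * (Complex.Gamma ((1 / 2 + r + z) / 2) / 2)‖ ≤ g r) :
    Summable (fun n : ℕ => (ArithmeticFunction.vonMangoldt n : ℂ) * kk z (n / x)) ∧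
    ‖∑' n : ℕ, (ArithmeticFunction.vonMangoldt n : ℂ) * kk z (n / x) - x * (Complex.Gamma ((1 + z) / 2) / 2)‖ ≤ G + 120 * GC z x (-1) := by
  have hp := Real.pi_gt_three
  have hp4 := Real.pi_lt_d2
  have hpc : (2 * (Real.pi:ℂ)) ≠ 0 := by exact_mod_cast (by positivity : 2 * Real.pi ≠ 0)
  have c1 : 0 < (-1:ℝ) + z.re := by linarith
  have c2 : 0 < (2:ℝ) + z.re := by linarith
  have hC := GC_pos z x (-1) hx c1
  obtain ⟨v1, v2⟩ := vm_sum z x hx hz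
  have hsum : Summable (fun n : ℕ => (ArithmeticFunction.vonMangoldt n : ℂ) * kk z (n / x)) := by
    have := v1.summable.mul_left (2 * (Real.pi:ℂ))⁻¹
    simpa only [inv_mul_cancel_left₀ hpc] using this
  refine ⟨hsum, ?_⟩
  have e1 : 2 * (Real.pi:ℂ) * ∑' n : ℕ, (ArithmeticFunction.vonMangoldt n : ℂ) * kk z (n / x) = TT z x 2 fun s => -(deriv riemannZeta s / riemannZeta s) :=
    (hsum.hasSum.mul_left _).unique v1
  have e0 := TT_pole z x 2 (-1) hx (by norm_num) c1 1 (by norm_num) (by norm_num)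
  rw [Complex.cpow_one] at e0
  have b0 : ‖TT z x (-1) (fun s => 1 / (s - 1))‖ ≤ 8 * (1 / 2) * GC z x (-1) :=
    TT_bd z x (-1) hx c1 (fun s => 1 / (s - 1)) (by fun_prop) _ (by norm_num) (pole_bd 1 (-1) 2 two_pos (by norm_num))
  set κ := 2 * (Real.pi:ℂ) * kk z (1 / x) with hκ
  have bκ : ‖κ‖ ≤ 8 * 1 * GC z x (-1) := by
    have := TT_one z x (-1) hx c1 1
    rw [one_mul] at this
    rw [hκ, ← this]
    exact TT_bd z x (-1) hx c1 (fun _ => 1) measurable_const 1 zero_le_one (fun t => by rw [norm_one, one_mul]; exact cub t)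
  -- digamma
  set Fp : ℂ → ℂ := fun s => 2 * (-(deriv riemannZeta s / riemannZeta s) - 1 / (s - 1) + Real.log Real.pi / 2 + deriv xi (s - 1 / 2) / xi (s - 1 / 2)) + Real.eulerMascheroniConstant with hFp
  have p1 := TT_hasSum z x 2 hx c2 dt (fun j => by unfold dt; fun_prop) _ (fun j => by positivity) (dt_bd 2 (Or.inl rfl))
    (((summable_nat_add_iff 1).2 hasSum_zeta_two.summable).mul_left 2) Fp (fun t => by
      have h1 : 1 < (((2:ℝ):ℂ) + t * Complex.I).re := by simp
      have := xi_logDeriv _ h1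
      simp only [hFp]
      rw [this]
      refine (congrArg (HasSum _) ?_).mpr (dt_hasSum _ t rfl)
      ring)
  have p2 : ∀ j, ‖TT z x 2 (dt j)‖ ≤ 8 * (2 * (1 / ((j + 1 : ℕ):ℝ) ^ 2)) * GC z x (-1) := fun j => by
    rw [TT_dt z x 2 hx c2 j (by norm_num), TT_one z x 2 hx c2, TT_nopole z x 2 (-1) hx (by norm_num) c1 _ (by simp; have : (0:ℝ) ≤ j := Nat.cast_nonneg j; linarith),
      ← TT_one z x (-1) hx c1, ← TT_dt z x (-1) hx c1 j le_rfl]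
    exact TT_bd z x (-1) hx c1 _ (by unfold dt; fun_prop) _ (by positivity) (dt_bd (-1) (Or.inr rfl) j)
  have p3 : ‖TT z x 2 Fp‖ ≤ 8 * 3.32 * GC z x (-1) := by
    have hz2 := (hasSum_nat_add_iff' 1).2 hasSum_zeta_two
    have := p1.norm_le_of_bounded (((hz2.mul_left 2).mul_left 8).mul_right (GC z x (-1))) p2
    refine this.trans ?_
    gcongr
    simp
    nlinarith
  have p4 : TT z x 2 Fp = 2 * (TT z x 2 (fun s => -(deriv riemannZeta s / riemannZeta s)) - TT z x 2 (fun s => 1 / (s - 1)) + TT z x 2 (fun s => deriv xi (s - 1 / 2) / xi (s - 1 / 2)))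
      + (Real.log Real.pi + Real.eulerMascheroniConstant) * κ := by
    have i0 := TI_pole z x 2 hx c2 1 (by norm_num)
    have i1 := GG_int z x 2 hx c2
    have k1 : κ = ∫ t : ℝ, GG z x ((2:ℝ) + t * Complex.I) := by
      have := TT_one z x 2 hx c2 1; rw [one_mul] at this; rw [hκ, ← this]; simp [TT]
    rw [k1]
    refine Eq.trans ?_ (int4 _ _ _ _ _ v2 i0 (zt_int z x hx hz) i1)
    refine integral_congr_ae (Eventually.of_forall fun t => ?_)
    simp only [hFp]; ring
  -- zeros
  have q1 := TT_hasSum z x 2 hx c2 zt (fun j => by unfold zt; fun_prop) _ (fun j => by positivity) (zt_bd 2 (Or.inl rfl)) (xi_summable.mul_left _) (fun s => deriv xi (s - 1 / 2) / xi (s - 1 / 2)) zt_hasSum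
  have q2 : ∀ r, ‖TT z x 2 (zt r)‖ ≤ 8 * (10.125 * (xm r / ‖1 - r‖ ^ 2)) * GC z x (-1) + Real.pi * (g r + g (-r)) := fun r => by
    have hgr : 0 ≤ Real.pi * (g r + g (-r)) := mul_nonneg (by linarith) (add_nonneg (hg0 _) (hg0 _))
    by_cases h0 : xi r = 0
    swap
    · have : zt r = fun _ => 0 := by funext s; simp [zt, xm_zero r h0]
      rw [this, TT_one z x 2 hx c2, zero_mul, norm_zero]
      positivity
    have hr := abs_lt.1 (xi_zero_re r h0)
    have s1 : (1 / 2 + r).re = 1 / 2 + r.re := by simp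
    have s2 : (1 / 2 - r).re = 1 / 2 - r.re := by simp
    rw [TT_zt z x 2 hx c2 r (by rw [s1]; intro h; linarith) (by rw [s2]; intro h; linarith),
      TT_pole z x 2 (-1) hx (by norm_num) c1 _ (by rw [s1]; linarith) (by rw [s1]; linarith),
      TT_pole z x 2 (-1) hx (by norm_num) c1 _ (by rw [s2]; linarith) (by rw [s2]; linarith)]
    have h1 := hb r h0
    have h2 := hb (-r) (by rw [xi_even, h0])
    rw [xm_neg, ← sub_eq_add_neg] at h2
    have h3 : ‖TT z x (-1) (zt r)‖ ≤ _ := TT_bd z x (-1) hx c1 _ (by unfold zt; fun_prop) _ (by positivity) (zt_bd (-1) (Or.inr rfl) r)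
    rw [TT_zt z x (-1) hx c1 r (by rw [s1]; intro h; linarith) (by rw [s2]; intro h; linarith)] at h3
    generalize TT z x (-1) (fun s => 1 / (s - (1 / 2 + r))) = A at h3 ⊢
    generalize TT z x (-1) (fun s => 1 / (s - (1 / 2 - r))) = B at h3 ⊢
    generalize (x:ℂ) ^ (1 / 2 + r) * (Complex.Gamma ((1 / 2 + r + z) / 2) / 2) = P at h1 ⊢
    generalize (x:ℂ) ^ (1 / 2 - r) * (Complex.Gamma ((1 / 2 - r + z) / 2) / 2) = Q at h2 ⊢
    rw [show xm r * (1 / 2) * (A + 2 * Real.pi * P + (B + 2 * Real.pi * Q)) = xm r * (1 / 2) * (A + B) + ((Real.pi:ℂ) * (xm r * P) + (Real.pi:ℂ) * (xm r * Q)) by ring]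
    refine (norm_add_le _ _).trans (add_le_add h3 ((norm_add_le _ _).trans ?_))
    rw [norm_mul, norm_mul, norm_mul, norm_mul, Complex.norm_natCast, Complex.norm_real, Real.norm_of_nonneg (by linarith), mul_add]
    gcongr
  have hgn : HasSum (fun r => g (-r)) G := (Equiv.neg ℂ).hasSum_iff.2 hg
  have q3 := q1.norm_le_of_bounded ((((xi_summable.hasSum.mul_left 10.125).mul_left 8).mul_right _).add ((hg.add hgn).mul_left Real.pi)) q2
  have hS := S0_bd
  -- combine
  have hlog0 : 0 ≤ Real.log Real.pi := Real.log_nonneg (by linarith)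
  have hlog : Real.log Real.pi ≤ 2.15 := by have := Real.log_le_sub_one_of_pos Real.pi_pos; linarith
  have hγ := Real.eulerMascheroniConstant_lt_two_thirds
  have hγ0 := Real.one_half_lt_eulerMascheroniConstant
  rw [← e1, e0] at p4
  generalize TT z x 2 (fun s => deriv xi (s - 1 / 2) / xi (s - 1 / 2)) = Z at p4 q3
  generalize TT z x 2 Fp = P at p4 p3
  generalize TT z x (-1) (fun s => 1 / (s - 1)) = B at p4 b0
  generalize ∑' n : ℕ, (ArithmeticFunction.vonMangoldt n : ℂ) * kk z (n / x) = S at p4 ⊢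
  generalize (x:ℂ) * (Complex.Gamma ((1 + z) / 2) / 2) = X at p4 ⊢
  have fin : (2 * Real.pi) * ‖S - X‖ ≤ ‖B‖ + 1 / 2 * ‖P‖ + 1.5 * ‖κ‖ + ‖Z‖ := by
    have : 2 * (Real.pi:ℂ) * (S - X) = B + (1 / 2 : ℝ) * P - ((Real.log Real.pi + Real.eulerMascheroniConstant) / 2 : ℝ) * κ - Z := by rw [p4]; push_cast; ring
    have h := congrArg norm this
    rw [norm_mul, show ‖2 * (Real.pi:ℂ)‖ = 2 * Real.pi by rw [norm_mul, Complex.norm_real, Complex.norm_ofNat, Real.norm_of_nonneg (by linarith)]] at h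
    rw [h]
    refine (norm_sub_le _ _).trans (add_le_add ((norm_sub_le _ _).trans (add_le_add ((norm_add_le _ _).trans (add_le_add le_rfl ?_)) ?_)) le_rfl)
    · rw [norm_mul, Complex.norm_real]; norm_num
    · rw [norm_mul, Complex.norm_real, Real.norm_of_nonneg (by linarith)]; gcongr; linarith
  set S0 := ∑' r, (xm r : ℝ) / ‖1 - r‖ ^ 2
  have hSC : S0 * GC z x (-1) ≤ 8.3 * GC z x (-1) := by gcongr
  have : 2 * Real.pi * ‖S - X‖ ≤ 2 * Real.pi * (G + 120 * GC z x (-1)) := by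
    have : 3 * GC z x (-1) ≤ Real.pi * GC z x (-1) := by gcongr
    linarith
  exact le_of_mul_le_mul_left this (by positivity)

theorem re4_bd (t : ℝ) (h0 : 0 ≤ t) (h1 : t ≤ 400.25) : (deriv xi (4 + t * Complex.I) / xi (4 + t * Complex.I)).re ≤ 2.66 := by
  refine (xi_re_le t h0 109 (by norm_num; nlinarith)).trans ?_
  have b : (7 / 2) / (49 / 4 + t ^ 2) ≤ 2 / 7 := by
    rw [div_le_div_iff₀ (by positivity) (by norm_num)]; nlinarith
  have c : 2 / (2 * t + 11) ≤ 2 / 11 := by gcongr; linarith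
  norm_num at b c ⊢; linarith

theorem E_wt (y : ℝ) (hy : |y| ≤ 400.25) : ∃ u : ℂ → ℝ, ∃ U, HasSum u U ∧ U ≤ 2.66 ∧ (∀ r, xi r ≠ 0 → u r = 0) ∧
    ∀ r, xi r = 0 → ∃ q : ℝ, 7 / 2 ≤ q ∧ q ≤ 9 / 2 ∧ (r.re = 0 → q = 4) ∧ u r = xm r * (q / (q ^ 2 + (r.im + y) ^ 2)) := by
  obtain ⟨h1, h2⟩ := abs_le.1 hy
  have key : ∀ w r : ℂ, (1 / (w - r)).re = (w.re - r.re) / ((w.re - r.re) ^ 2 + (w.im - r.im) ^ 2) := by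
    intro w r; rw [hd_re, Complex.sq_norm, Complex.normSq_apply, Complex.sub_re, Complex.sub_im]; ring
  rcases le_total 0 y with h | h
  · have hs := (xi_hasSum (4 + y * Complex.I) (by norm_num)).1
    refine ⟨_, _, (Equiv.neg ℂ).hasSum_iff.2 hs, re4_bd y h h2, fun r hr => ?_, fun r hr => ⟨4 + r.re, ?_⟩⟩
    · simp only [Function.comp, Equiv.neg_apply, xm_neg, xm_zero r hr, Nat.cast_zero, zero_mul]
    · have := abs_lt.1 (xi_zero_re r hr)
      refine ⟨by linarith, by linarith, fun h => by rw [h, add_zero], ?_⟩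
      simp only [Function.comp, Equiv.neg_apply, xm_neg, key]
      simp; ring_nf; simp
  · have hs := (xi_hasSum (4 + (-y : ℝ) * Complex.I) (by norm_num)).1
    refine ⟨_, _, hs, re4_bd (-y) (by linarith) (by linarith), fun r hr => ?_, fun r hr => ⟨4 - r.re, ?_⟩⟩
    · simp only [xm_zero r hr, Nat.cast_zero, zero_mul]
    · have := abs_lt.1 (xi_zero_re r hr)
      refine ⟨by linarith, by linarith, fun h => by rw [h, sub_zero], ?_⟩
      simp only [key]
      simp; ring_nf; simp

theorem e51 : (1.4e22 : ℝ) ≤ Real.exp 51 := by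
  have h := Real.exp_one_gt_d9
  rw [show (51:ℝ) = (51:ℕ) * 1 by norm_num, Real.exp_nat_mul]
  exact le_trans (by norm_num) (pow_le_pow_left₀ (by norm_num) h.le 51)

theorem E_on (z r : ℂ) (x : ℝ) (hx : 0 < x) (h1 : 1.75 ≤ z.re) (h2 : z.re ≤ 2.25) (hr : r.re = 0) :
    ‖(x:ℂ) ^ (1 / 2 + r) * (Complex.Gamma ((1 / 2 + r + z) / 2) / 2)‖ ≤ 5.2 * √x * (4 / (4 ^ 2 + (r.im + z.im) ^ 2)) := by
  have e1 : ((1 / 2 + r + z) / 2 : ℂ).re = (1 / 2 + z.re) / 2 := by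
    rw [show (2:ℂ) = ((2:ℝ):ℂ) by norm_num, Complex.div_ofReal_re]; simp [hr]
  have e2 : ((1 / 2 + r + z) / 2 : ℂ).im = (r.im + z.im) / 2 := by
    rw [show (2:ℂ) = ((2:ℝ):ℂ) by norm_num, Complex.div_ofReal_im]; simp
  have hg := gam_bd ((1 / 2 + r + z) / 2) (by rw [e1]; linarith)
  rw [e1, e2, abs_div, abs_two] at hg
  have g1 := real_gamma_le ((1 / 2 + z.re) / 2) 1 le_rfl (by linarith) (by norm_num; linarith)
  have g2 : (2:ℝ) ^ ((1 / 2 + z.re) / 2) ≤ 2.6 := by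
    refine (Real.rpow_le_rpow_of_exponent_le (by norm_num) (by linarith : (1 / 2 + z.re) / 2 ≤ 11 / 8)).trans ?_
    rw [← Real.rpow_le_rpow_iff (z := 8) (by positivity) (by norm_num) (by norm_num), ← Real.rpow_mul (by norm_num)]; norm_num
  have h0 := Real.Gamma_pos_of_pos (by linarith : 0 < (1 / 2 + z.re) / 2)
  set v := |r.im + z.im| / 2 with hv
  have hv0 : 0 ≤ v := by positivity
  have hd : (r.im + z.im) ^ 2 = 4 * v ^ 2 := by rw [hv, div_pow, sq_abs]; ring
  have hg' : ‖Complex.Gamma ((1 / 2 + r + z) / 2)‖ ≤ 1 * 2.6 * Real.exp (-v) := hg.trans (by gcongr; simpa using g1)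
  rw [norm_mul, norm_div, Complex.norm_ofNat, Complex.norm_cpow_eq_rpow_re_of_pos hx, show (1 / 2 + r).re = 1 / 2 by simp [hr], ← Real.sqrt_eq_rpow, hd]
  have := Real.quadratic_le_exp_of_nonneg hv0
  calc √x * (‖Complex.Gamma ((1 / 2 + r + z) / 2)‖ / 2) ≤ √x * (1 * 2.6 * Real.exp (-v) / 2) := by gcongr
    _ ≤ √x * (5.2 * (4 / (4 ^ 2 + 4 * v ^ 2))) := by
        refine mul_le_mul_of_nonneg_left ?_ (Real.sqrt_nonneg x)
        rw [Real.exp_neg, mul_div_assoc', le_div_iff₀ (by positivity), ← div_eq_mul_inv, div_div, div_mul_eq_mul_div, div_le_iff₀ (by positivity)]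
        nlinarith
    _ = _ := by ring

theorem E_off (z r : ℂ) (x q : ℝ) (hx : 1 ≤ x) (h1 : 1.75 ≤ z.re) (h2 : z.re ≤ 2.25) (hr : |r.re| < 1 / 2) (hd : 68 ≤ |r.im + z.im|) (q1 : 7 / 2 ≤ q) (q2 : q ≤ 9 / 2) :
    ‖(x:ℂ) ^ (1 / 2 + r) * (Complex.Gamma ((1 / 2 + r + z) / 2) / 2)‖ ≤ 2e-17 * x * (q / (q ^ 2 + (r.im + z.im) ^ 2)) := by
  have hp := Real.pi_gt_d2
  rw [abs_lt] at hr
  set σ := (1 / 2 + r.re + z.re) / 2 with hσ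
  have e : (1 / 2 + r + z) / 2 = (σ : ℂ) + ((r.im + z.im) / 2 : ℝ) * Complex.I := by
    rw [show (2:ℂ) = ((2:ℝ):ℂ) by norm_num]
    apply Complex.ext
    · rw [Complex.div_ofReal_re]; simp [hσ]
    · rw [Complex.div_ofReal_im]; simp
  have σ1 : 0.875 ≤ σ := by rw [hσ]; linarith
  have σ2 : σ ≤ 1.625 := by rw [hσ]; linarith
  have hG0 := Real.Gamma_pos_of_pos (by linarith : 0 < σ)
  have hG : Real.Gamma σ ≤ 1.15 := by
    rcases le_total 1 σ with h | h
    · have := real_gamma_le σ 1 le_rfl h (by norm_num; linarith); norm_num at this ⊢; linarith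
    · have := real_gamma_le (σ + 1) 1 le_rfl (by linarith) (by norm_num; linarith)
      rw [Real.Gamma_add_one (by linarith)] at this; norm_num at this ⊢; nlinarith
  have hc : Real.cos 1.5 ^ (-σ) ≤ 205 := by
    calc Real.cos 1.5 ^ (-σ) ≤ 0.07 ^ (-σ) := Real.rpow_le_rpow_of_nonpos (by norm_num) cos_15 (by linarith)
      _ ≤ 0.07 ^ (-2:ℝ) := Real.rpow_le_rpow_of_exponent_ge (by norm_num) (by norm_num) (by linarith)
      _ ≤ 205 := by rw [Real.rpow_neg (by norm_num)]; norm_num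
  set D := |r.im + z.im| with hD
  have key : ∀ α : ℝ, |α| = 1.5 → α * (r.im + z.im) = -(1.5 * D) → ‖Complex.Gamma ((1 / 2 + r + z) / 2)‖ ≤ Real.exp (-(0.75 * D)) * (1.15 * 205) := by
    intro α a1 a2
    have := gamma_dec σ ((r.im + z.im) / 2) α (by linarith) (by rw [a1]; linarith)
    rw [← e, ← Real.cos_abs α, a1, show α * ((r.im + z.im) / 2) = -(0.75 * D) by linarith] at this
    refine this.trans ?_
    gcongr
    exact Real.rpow_nonneg (le_trans (by norm_num) cos_15) _
  have hg : ‖Complex.Gamma ((1 / 2 + r + z) / 2)‖ ≤ Real.exp (-(0.75 * D)) * (1.15 * 205) := by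
    rcases le_total 0 (r.im + z.im) with h | h
    · exact key (-1.5) (by norm_num) (by rw [hD, abs_of_nonneg h]; ring)
    · exact key 1.5 (by norm_num) (by rw [hD, abs_of_nonpos h]; ring)
  have hxr : x ^ (1 / 2 + r).re ≤ x := by
    conv_rhs => rw [← Real.rpow_one x]
    refine Real.rpow_le_rpow_of_exponent_le hx ?_
    simp; linarith
  have hD2 : (r.im + z.im) ^ 2 = D ^ 2 := by rw [hD, sq_abs]
  have hex : 118 * (q ^ 2 + D ^ 2) ≤ 2e-17 * q * Real.exp (0.75 * D) := by
    obtain ⟨y, hy⟩ : ∃ y, y = 0.75 * D - 51 := ⟨_, rfl⟩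
    have hy0 : 0 ≤ y := by linarith
    rw [show 0.75 * D = 51 + y by linarith, Real.exp_add, show D = (y + 51) / 0.75 by rw [hy]; ring]
    have a := Real.quadratic_le_exp_of_nonneg hy0
    have b : 1.4e22 * (1 + y + y ^ 2 / 2) ≤ Real.exp 51 * Real.exp y := mul_le_mul e51 a (by positivity) (Real.exp_pos _).le
    have c : 3.5 * (1.4e22 * (1 + y + y ^ 2 / 2)) ≤ q * (Real.exp 51 * Real.exp y) := mul_le_mul (by linarith) b (by positivity) (by linarith)
    have d : q ^ 2 ≤ 20.25 := by nlinarith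
    have c' : 980000 * (1 + y + y ^ 2 / 2) ≤ 2e-17 * q * (Real.exp 51 * Real.exp y) := by norm_num at c ⊢; linarith
    have f : ((y + 51) / 0.75) ^ 2 = 16 / 9 * (y ^ 2 + 102 * y + 2601) := by ring
    rw [f]; linarith [sq_nonneg y]
  rw [norm_mul, norm_div, Complex.norm_ofNat, Complex.norm_cpow_eq_rpow_re_of_pos (by linarith), hD2]
  calc _ ≤ x * (Real.exp (-(0.75 * D)) * (1.15 * 205) / 2) := by gcongr
    _ ≤ x * (2e-17 * (q / (q ^ 2 + D ^ 2))) := by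
        refine mul_le_mul_of_nonneg_left ?_ (by linarith)
        rw [Real.exp_neg, mul_div_assoc', le_div_iff₀ (by positivity), inv_mul_eq_div, div_div, div_mul_eq_mul_div, div_le_iff₀ (by positivity)]
        have : 0 ≤ q ^ 2 + D ^ 2 := by positivity
        norm_num at hex ⊢; linarith
    _ = _ := by ring

/-- remainder -/
noncomputable def RR (x : ℝ) (z : ℂ) : ℂ := ∑' n : ℕ, (ArithmeticFunction.vonMangoldt n : ℂ) * kk z (n / x) - x * (Complex.Gamma ((1 + z) / 2) / 2)

theorem E_main (z : ℂ) (x : ℝ) (hx : 1e12 ≤ x) (h1 : 1.75 ≤ z.re) (h2 : z.re ≤ 2.25) (h3 : |z.im| ≤ 400.25) :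
    Summable (fun n : ℕ => (ArithmeticFunction.vonMangoldt n : ℂ) * kk z (n / x)) ∧ ‖RR x z‖ ≤ 13.84 * √x + 5.4e-17 * x := by
  have hx0 : 0 < x := by linarith
  obtain ⟨u, U, hu, hU, hu0, hur⟩ := E_wt z.im h3
  have hB : 0 ≤ 5.2 * √x + 2e-17 * x := by positivity
  have h := D_main z x hx0 (by linarith) (fun r => u r * (5.2 * √x + 2e-17 * x)) _ (hu.mul_right _) (fun r => by
      refine mul_nonneg ?_ hB
      by_cases h0 : xi r = 0
      · obtain ⟨q, q1, -, -, e⟩ := hur r h0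
        rw [e]; positivity
      · rw [hu0 r h0]) (fun r h0 => by
      obtain ⟨q, q1, q2, q3, e⟩ := hur r h0
      rw [e, mul_assoc]
      refine mul_le_mul_of_nonneg_left ?_ (Nat.cast_nonneg _)
      have hq : 0 ≤ q / (q ^ 2 + (r.im + z.im) ^ 2) := by positivity
      by_cases h : |r.im| < 469
      · have hr := rh_467 r h0 h
        refine (E_on z r x hx0 h1 h2 hr).trans ?_
        rw [q3 hr] at hq ⊢
        rw [mul_comm]
        exact mul_le_mul_of_nonneg_left (by linarith) hq
      · have hd : 68 ≤ |r.im + z.im| := by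
          have := abs_sub_abs_le_abs_sub r.im (-z.im)
          rw [abs_neg, sub_neg_eq_add] at this; linarith
        refine (E_off z r x q (by linarith) h1 h2 (xi_zero_re r h0) hd q1 q2).trans ?_
        rw [mul_comm]
        exact mul_le_mul_of_nonneg_left (by linarith [Real.sqrt_nonneg x]) hq)
  refine ⟨h.1, h.2.trans ?_⟩
  have hs : 1e6 ≤ √x := Real.le_sqrt_of_sq_le (by norm_num at hx ⊢; linarith)
  have hG : GC z x (-1) ≤ 0.24 := by
    have hp : 0 < (-1 + z.re) / 2 := by linarith
    have g1 := real_gamma_le ((-1 + z.re) / 2 + 1) 1 le_rfl (by linarith) (by norm_num; linarith)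
    rw [Real.Gamma_add_one hp.ne'] at g1
    have g0 := Real.Gamma_pos_of_pos hp
    have g2 : Real.Gamma ((-1 + z.re) / 2) ≤ 2.67 := by norm_num at g1 ⊢; nlinarith
    have g3 : (2:ℝ) ^ ((-1 + z.re) / 2) ≤ 1.56 := by
      refine (Real.rpow_le_rpow_of_exponent_le (by norm_num) (by linarith : (-1 + z.re) / 2 ≤ 5 / 8)).trans ?_
      rw [← Real.rpow_le_rpow_iff (z := 8) (by positivity) (by norm_num) (by norm_num), ← Real.rpow_mul (by norm_num)]; norm_num
    have g4 : x ^ (-1:ℝ) ≤ 1e-12 := by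
      rw [Real.rpow_neg_one]; exact (inv_anti₀ (by norm_num) hx).trans (by norm_num)
    unfold GC
    calc Real.Gamma ((-1 + z.re) / 2) * 2 ^ ((-1 + z.re) / 2) / 2 * x ^ (-1:ℝ) * (1728 * (1 + |z.im|) ^ 3) ≤ 2.67 * 1.56 / 2 * 1e-12 * (1728 * (1 + 400.25) ^ 3) := by gcongr
      _ ≤ 0.24 := by norm_num
  have := mul_le_mul_of_nonneg_right hU hB
  norm_num at this hG hs ⊢; linarith

/-- window measure -/
noncomputable def mw : Measure ℝ := volume.restrict (Icc (-200) 200)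

instance : SFinite mw := by unfold mw; infer_instance

/-- band-limited function -/
noncomputable def ff (c : ℝ → ℂ) (t : ℝ) : ℂ := ∫ a, c a * (t : ℂ) ^ (-(a * Complex.I)) ∂mw

theorem n1 (t a : ℝ) (ht : 0 < t) : ‖(t : ℂ) ^ (-(a * Complex.I))‖ = 1 := by
  rw [Complex.norm_cpow_eq_rpow_re_of_pos ht]; simp

theorem kk_norm (z : ℂ) (t : ℝ) (ht : 0 < t) : ‖kk z t‖ = t ^ z.re * Real.exp (-(t ^ (2:ℝ))) := by
  rw [kk, norm_mul, Complex.norm_cpow_eq_rpow_re_of_pos ht, Complex.norm_real, Real.norm_of_nonneg (Real.exp_pos _).le]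

theorem ff_le (c : ℝ → ℂ) (t : ℝ) (ht : 0 < t) : ‖ff c t‖ ≤ ∫ a, ‖c a‖ ∂mw := by
  refine (norm_integral_le_integral_norm _).trans_eq ?_
  simp only [norm_mul, n1 t _ ht, mul_one]

theorem ff_meas (c : ℝ → ℂ) (hc : Continuous c) : Measurable (ff c) := by
  have : Measurable (fun p : ℝ × ℝ => c p.2 * (p.1 : ℂ) ^ (-(p.2 * Complex.I))) := by
    have := hc.measurable; fun_prop
  exact (this.stronglyMeasurable.integral_prod_right (ν := mw)).measurable

section
set_option linter.unusedSectionVars false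
variable {X : Type} [MeasurableSpace X] (ν : Measure X) [SFinite ν] (v g : X → ℝ)

theorem B_swap (hv : Measurable v) (hg : Measurable g) (hv0 : ∀ p, 0 < v p)
    (c : ℝ → ℂ) (hc : Continuous c) (z : ℂ) (hI : Integrable (fun p => (g p : ℂ) * kk z (v p)) ν) :
    Integrable (fun q : ℝ × ℝ => c q.1 * c q.2 * ∫ p, (g p : ℂ) * kk (z - (q.1 + q.2 : ℝ) * Complex.I) (v p) ∂ν) (mw.prod mw) ∧
    ∫ p, (g p : ℂ) * ff c (v p) ^ 2 * kk z (v p) ∂ν =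
      ∫ q, c q.1 * c q.2 * ∫ p, (g p : ℂ) * kk (z - (q.1 + q.2 : ℝ) * Complex.I) (v p) ∂ν ∂(mw.prod mw) := by
  have hci : Integrable c mw := hc.continuousOn.integrableOn_Icc
  have hcc : Integrable (fun q : ℝ × ℝ => c q.1 * c q.2) (mw.prod mw) := hci.mul_prod hci
  have e : ∀ p (q : ℝ × ℝ), ((g p : ℂ) * kk z (v p)) * ((c q.1 * (v p : ℂ) ^ (-(q.1 * Complex.I))) * (c q.2 * (v p : ℂ) ^ (-(q.2 * Complex.I)))) =
      c q.1 * c q.2 * ((g p : ℂ) * kk (z - (q.1 + q.2 : ℝ) * Complex.I) (v p)) := by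
    intro p q
    have h0 : (v p : ℂ) ≠ 0 := by exact_mod_cast (hv0 p).ne'
    rw [kk, kk, show z - (q.1 + q.2 : ℝ) * Complex.I = z + -(q.1 * Complex.I) + -(q.2 * Complex.I) by push_cast; ring,
      Complex.cpow_add _ _ h0, Complex.cpow_add _ _ h0]
    ring
  have hi : Integrable (fun r : X × (ℝ × ℝ) => ((g r.1 : ℂ) * kk z (v r.1)) * ((c r.2.1 * (v r.1 : ℂ) ^ (-(r.2.1 * Complex.I))) * (c r.2.2 * (v r.1 : ℂ) ^ (-(r.2.2 * Complex.I))))) (ν.prod (mw.prod mw)) := by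
    refine (hI.mul_prod hcc).mono (Measurable.aestronglyMeasurable ?_) (Eventually.of_forall fun r => le_of_eq ?_)
    · have := hc.measurable
      unfold kk; fun_prop
    · simp only [norm_mul, n1 _ _ (hv0 _), mul_one]
  have h1 : ∀ p, (g p : ℂ) * ff c (v p) ^ 2 * kk z (v p) = ∫ q : ℝ × ℝ, ((g p : ℂ) * kk z (v p)) * ((c q.1 * (v p : ℂ) ^ (-(q.1 * Complex.I))) * (c q.2 * (v p : ℂ) ^ (-(q.2 * Complex.I)))) ∂(mw.prod mw) := by
    intro p
    rw [integral_const_mul, integral_prod_mul (f := fun a : ℝ => c a * (v p : ℂ) ^ (-(a * Complex.I))) (g := fun a : ℝ => c a * (v p : ℂ) ^ (-(a * Complex.I)))]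
    unfold ff; ring
  refine ⟨by simpa only [e, integral_const_mul] using hi.integral_prod_right, ?_⟩
  simp_rw [h1]
  rw [integral_integral_swap (f := fun p (q : ℝ × ℝ) => ((g p : ℂ) * kk z (v p)) * ((c q.1 * (v p : ℂ) ^ (-(q.1 * Complex.I))) * (c q.2 * (v p : ℂ) ^ (-(q.2 * Complex.I))))) hi]
  simp_rw [e, integral_const_mul]

theorem log_pw (t ε s : ℝ) (ht : 0 < t) (hε : 0 < ε) (hs : |s| + ε ≤ 1 / 4) :
    |Real.log t| * t ^ (2 + s) ≤ (t ^ (9 / 4 : ℝ) + t ^ (7 / 4 : ℝ)) / ε := by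
  obtain ⟨h1, h2⟩ := abs_le.1 (by linarith : |s| ≤ 1 / 4 - ε)
  have p1 := Real.rpow_pos_of_pos ht (9 / 4)
  have p2 := Real.rpow_pos_of_pos ht (7 / 4)
  rcases le_total 1 t with h | h
  · rw [abs_of_nonneg (Real.log_nonneg h)]
    calc _ ≤ t ^ ε / ε * t ^ (2 + s) := by gcongr; exact Real.log_le_rpow_div ht.le hε
      _ = t ^ (ε + (2 + s)) / ε := by rw [Real.rpow_add ht ε]; ring
      _ ≤ t ^ (9 / 4 : ℝ) / ε := by gcongr; linarith
      _ ≤ _ := by gcongr; linarith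
  · rw [abs_of_nonpos (Real.log_nonpos ht.le h), ← Real.log_inv]
    calc _ ≤ t⁻¹ ^ ε / ε * t ^ (2 + s) := by gcongr; exact Real.log_le_rpow_div (by positivity) hε
      _ = t ^ (-ε + (2 + s)) / ε := by rw [Real.rpow_add ht (-ε), Real.rpow_neg ht.le, Real.inv_rpow ht.le]; ring
      _ ≤ t ^ (7 / 4 : ℝ) / ε := by
        gcongr ?_ / ε; exact Real.rpow_le_rpow_of_exponent_ge ht h (by linarith)
      _ ≤ _ := by gcongr; linarith

theorem B_der (hv : Measurable v) (hg : Measurable g) (hg0 : ∀ p, 0 ≤ g p) (hv0 : ∀ p, 0 < v p)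
    (c : ℝ → ℂ) (hc : Continuous c) (hI : ∀ z : ℂ, 1.75 ≤ z.re → z.re ≤ 2.25 → Integrable (fun p => (g p : ℂ) * kk z (v p)) ν) (w : ℂ) (hw : ‖w‖ < 1 / 4) :
    Integrable (fun p => (g p : ℂ) * ff c (v p) ^ 2 * kk (2 + w) (v p)) ν ∧
    Integrable (fun p => (g p : ℂ) * ff c (v p) ^ 2 * (Real.log (v p) * kk (2 + w) (v p))) ν ∧
    HasDerivAt (fun w => ∫ p, (g p : ℂ) * ff c (v p) ^ 2 * kk (2 + w) (v p) ∂ν) (∫ p, (g p : ℂ) * ff c (v p) ^ 2 * (Real.log (v p) * kk (2 + w) (v p)) ∂ν) w := by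
  obtain ⟨ε, hε⟩ : ∃ ε, ε = (1 / 4 - ‖w‖) / 2 := ⟨_, rfl⟩
  have hε0 : 0 < ε := by linarith
  have hm := ff_meas c hc
  set A := ∫ a, ‖c a‖ ∂mw with hA
  have hA0 : 0 ≤ A := integral_nonneg fun _ => norm_nonneg _
  have hb : ∀ p, ‖(g p : ℂ) * ff c (v p) ^ 2‖ ≤ A ^ 2 * g p := by
    intro p
    rw [norm_mul, norm_pow, Complex.norm_real, Real.norm_of_nonneg (hg0 p), mul_comm]
    exact mul_le_mul_of_nonneg_right (pow_le_pow_left₀ (norm_nonneg _) (ff_le c _ (hv0 p)) 2) (hg0 p)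
  have hre : ∀ z : ℂ, ‖z‖ < 1 / 4 → 1.75 ≤ (2 + z).re ∧ (2 + z).re ≤ 2.25 := by
    intro z hz
    have := abs_le.1 ((Complex.abs_re_le_norm z).trans hz.le)
    rw [Complex.add_re, Complex.re_ofNat]; constructor <;> linarith
  have hM : ∀ w : ℂ, Measurable (fun p => (g p : ℂ) * ff c (v p) ^ 2 * kk (2 + w) (v p)) := by
    intro w; unfold kk; fun_prop
  have hi : Integrable (fun p => (g p : ℂ) * ff c (v p) ^ 2 * kk (2 + w) (v p)) ν := by
    refine ((hI (2 + w) (hre w hw).1 (hre w hw).2).norm.const_mul (A ^ 2)).mono' (hM w).aestronglyMeasurable (Eventually.of_forall fun p => ?_)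
    rw [norm_mul, norm_mul _ (kk _ _), Complex.norm_real, Real.norm_of_nonneg (hg0 p), ← mul_assoc]
    exact mul_le_mul_of_nonneg_right (hb p) (norm_nonneg _)
  refine ⟨hi, hasDerivAt_integral_of_dominated_loc_of_deriv_le (s := Metric.ball w ε)
    (bound := fun p => A ^ 2 / ε * (‖(g p : ℂ) * kk (2.25 : ℝ) (v p)‖ + ‖(g p : ℂ) * kk (1.75 : ℝ) (v p)‖)) (Metric.ball_mem_nhds w hε0)
    (Eventually.of_forall fun w => (hM w).aestronglyMeasurable) hi (F' := fun w p => (g p : ℂ) * ff c (v p) ^ 2 * (Real.log (v p) * kk (2 + w) (v p)))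
    (Measurable.aestronglyMeasurable (by unfold kk; fun_prop)) (Eventually.of_forall fun p z hz => ?_) ?_ (Eventually.of_forall fun p z hz => ?_)⟩
  · have hz' : |z.re| + ε ≤ 1 / 4 := by
      rw [Metric.mem_ball, dist_eq_norm] at hz
      have := norm_add_le (z - w) w
      rw [sub_add_cancel] at this
      have := Complex.abs_re_le_norm z; linarith
    have l := log_pw (v p) ε z.re (hv0 p) hε0 hz'
    have hx := Real.exp_pos (-(v p ^ (2:ℝ)))
    simp only [norm_mul, kk_norm _ _ (hv0 p), Complex.ofReal_re, Complex.add_re, Complex.re_ofNat]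
    have hb' := hb p
    simp only [norm_mul] at hb'
    simp only [Complex.norm_real, Real.norm_eq_abs, abs_of_nonneg (hg0 p)] at hb' ⊢
    calc _ ≤ A ^ 2 * g p * (((v p) ^ (9 / 4 : ℝ) + (v p) ^ (7 / 4 : ℝ)) / ε * Real.exp (-(v p ^ (2:ℝ)))) := by
          refine mul_le_mul hb' ?_ (by positivity [hv0 p]) (mul_nonneg (sq_nonneg A) (hg0 p))
          rw [← mul_assoc]; gcongr
      _ = _ := by norm_num; ring
  · exact ((hI _ (by norm_num) (by norm_num)).norm.add (hI _ (by norm_num) (by norm_num)).norm).const_mul _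
  · have h0 : (v p : ℂ) ≠ 0 := by exact_mod_cast (hv0 p).ne'
    unfold kk
    have := ((((hasDerivAt_id z).const_add 2).const_cpow (c := (v p : ℂ)) (Or.inl h0)).mul_const ((Real.exp (-(v p ^ (2:ℝ)))) : ℂ)).const_mul ((g p : ℂ) * ff c (v p) ^ 2)
    refine this.congr_deriv ?_
    rw [Complex.ofReal_log (hv0 p).le]; simp only [id]; ring
end

/-- positive version -/
noncomputable def pv (t : ℝ) : ℝ := if 0 < t then t else 1

theorem pv_pos (t : ℝ) : 0 < pv t := by unfold pv; split_ifs <;> linarith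

theorem pv_meas : Measurable pv := Measurable.ite measurableSet_Ioi measurable_id measurable_const

theorem pv_eq (t : ℝ) (ht : 0 < t) : pv t = t := if_pos ht

theorem int_nat (f : ℕ → ℂ) (hf : Integrable f Measure.count) : ∫ n, f n ∂Measure.count = ∑' n, f n := by
  rw [integral_countable hf]; simp [Measure.real]

theorem B_main (c : ℝ → ℂ) (hc : Continuous c) (x A : ℝ) (hx : 1e12 ≤ x) (hA : ∫ a, ‖c a‖ ∂mw ≤ A) :
    ‖∑' n : ℕ, (ArithmeticFunction.vonMangoldt n : ℂ) * Real.log n * (ff c (n / x) ^ 2 * kk 2 (n / x)) -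
      x * ∫ t in Ioi (0:ℝ), ff c t ^ 2 * kk 2 t * Real.log (x * t)‖ ≤ A ^ 2 * (Real.log x + 1 / 0.24) * (13.84 * √x + 5.4e-17 * x) := by
  have hx0 : 0 < x := by linarith
  have hA0 : 0 ≤ ∫ a, ‖c a‖ ∂mw := integral_nonneg fun _ => norm_nonneg _
  obtain ⟨B, hB⟩ : ∃ B, B = 13.84 * √x + 5.4e-17 * x := ⟨_, rfl⟩
  have hB0 : 0 ≤ B := by rw [hB]; positivity
  rw [← hB]
  have L1 : ∀ (z : ℂ) (n : ℕ), (ArithmeticFunction.vonMangoldt n : ℂ) * kk z (pv (n / x)) = (ArithmeticFunction.vonMangoldt n : ℂ) * kk z (n / x) := by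
    intro z n
    rcases Nat.eq_zero_or_pos n with rfl | h
    · simp
    · rw [pv_eq _ (by positivity)]
  have hI1 : ∀ z : ℂ, 1.75 ≤ z.re → z.re ≤ 2.25 → Integrable (fun n : ℕ => ((ArithmeticFunction.vonMangoldt n : ℝ) : ℂ) * kk z (pv (n / x))) Measure.count := by
    intro z h1 h2
    rw [integrable_count_iff]
    have := (E_main (z.re : ℂ) x hx (by simpa using h1) (by simpa using h2) (by norm_num)).1.norm
    refine this.congr fun n => ?_
    rw [← L1, norm_mul, norm_mul, kk_norm _ _ (pv_pos _), kk_norm _ _ (pv_pos _), Complex.ofReal_re]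
  have K2 : ∀ z : ℂ, 1.75 ≤ z.re → IntegrableOn (kk z) (Ioi 0) ∧ ∫ t in Ioi (0:ℝ), kk z t = Complex.Gamma ((1 + z) / 2) / 2 := by
    intro z h1
    obtain ⟨a, b⟩ := kk_mellin z 1 (by simp; linarith)
    simp only [MellinConvergent, mellin, sub_self, Complex.cpow_zero, one_smul] at a b
    exact ⟨a, b⟩
  have L2 : ∀ z : ℂ, EqOn (fun t => (x : ℂ) * kk z (pv t)) (fun t => (x : ℂ) * kk z t) (Ioi (0:ℝ)) := by
    intro z t ht
    simp only [pv_eq t ht]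
  have hI2 : ∀ z : ℂ, 1.75 ≤ z.re → z.re ≤ 2.25 → Integrable (fun t : ℝ => (x : ℂ) * kk z (pv t)) (volume.restrict (Ioi 0)) := by
    intro z h1 h2
    exact IntegrableOn.congr_fun ((K2 z h1).1.const_mul _) (L2 z).symm measurableSet_Ioi
  have m1 : Measurable (fun n : ℕ => pv (n / x)) := measurable_from_top
  have m2 : Measurable (fun n : ℕ => (ArithmeticFunction.vonMangoldt n : ℝ)) := measurable_from_top
  obtain ⟨N1, hN1⟩ : ∃ N1 : ℂ → ℂ, N1 = fun w => ∫ n : ℕ, ((ArithmeticFunction.vonMangoldt n : ℝ) : ℂ) * ff c (pv (n / x)) ^ 2 * kk (2 + w) (pv (n / x)) ∂Measure.count := ⟨_, rfl⟩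
  obtain ⟨N2, hN2⟩ : ∃ N2 : ℂ → ℂ, N2 = fun w => ∫ t in Ioi (0:ℝ), (x : ℂ) * ff c (pv t) ^ 2 * kk (2 + w) (pv t) := ⟨_, rfl⟩
  have d1 := fun w hw => B_der Measure.count (fun n : ℕ => pv (n / x)) (fun n : ℕ => (ArithmeticFunction.vonMangoldt n : ℝ)) m1 m2 (fun _ => ArithmeticFunction.vonMangoldt_nonneg) (fun _ => pv_pos _) c hc hI1 w hw
  have d2 := fun w hw => B_der (volume.restrict (Ioi (0:ℝ))) pv (fun _ => x) pv_meas measurable_const (fun _ => hx0.le) pv_pos c hc hI2 w hw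
  have hre : ∀ z : ℂ, ‖z‖ < 1 / 4 → 1.75 ≤ (2 + z).re ∧ (2 + z).re ≤ 2.25 ∧ |z.im| ≤ 0.25 := by
    intro z hz
    have := abs_le.1 ((Complex.abs_re_le_norm z).trans hz.le)
    have := (Complex.abs_im_le_norm z).trans hz.le
    rw [Complex.add_re, Complex.re_ofNat]; refine ⟨?_, ?_, ?_⟩ <;> linarith
  have hG : ∀ w : ℂ, ‖w‖ < 1 / 4 → ‖N1 w - N2 w‖ ≤ A ^ 2 * B := by
    intro w hw
    obtain ⟨w1, w2, w3⟩ := hre w hw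
    obtain ⟨i1, s1⟩ := B_swap Measure.count (fun n : ℕ => pv (n / x)) (fun n : ℕ => (ArithmeticFunction.vonMangoldt n : ℝ)) m1 m2 (fun _ => pv_pos _) c hc (2 + w) (hI1 _ w1 w2)
    obtain ⟨i2, s2⟩ := B_swap (volume.restrict (Ioi (0:ℝ))) pv (fun _ => x) pv_meas measurable_const pv_pos c hc (2 + w) (hI2 _ w1 w2)
    rw [hN1, hN2]
    simp only []
    rw [s1, s2, ← integral_sub i1 i2]
    have hci : Integrable (fun a => ‖c a‖) mw := by
      have : Integrable c mw := hc.continuousOn.integrableOn_Icc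
      exact this.norm
    have hcc : Integrable (fun q : ℝ × ℝ => ‖c q.1‖ * ‖c q.2‖) (mw.prod mw) := hci.mul_prod hci
    refine (norm_integral_le_of_norm_le (hcc.mul_const B) ?_).trans ?_
    · have : ∀ᵐ q ∂(mw.prod mw), q ∈ Icc (-200:ℝ) 200 ×ˢ Icc (-200:ℝ) 200 := by
        rw [mw, Measure.prod_restrict]; exact ae_restrict_mem (measurableSet_Icc.prod measurableSet_Icc)
      filter_upwards [this] with q hq
      obtain ⟨⟨a1, a2⟩, b1, b2⟩ := hq
      set z := 2 + w - (q.1 + q.2 : ℝ) * Complex.I with hz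
      have zr : z.re = (2 + w).re := by simp [hz]
      have zi : |z.im| ≤ 400.25 := by
        have : z.im = w.im - (q.1 + q.2) := by simp [hz]
        rw [this, abs_le]
        rw [abs_le] at w3; constructor <;> linarith
      have h := E_main z x hx (by rw [zr]; exact w1) (by rw [zr]; exact w2) zi
      rw [int_nat _ (hI1 z (by rw [zr]; exact w1) (by rw [zr]; exact w2)), setIntegral_congr_fun measurableSet_Ioi (L2 z), integral_const_mul, (K2 z (by rw [zr]; exact w1)).2]
      simp only [L1]
      rw [← mul_sub, norm_mul, norm_mul, hB]
      exact mul_le_mul_of_nonneg_left h.2 (by positivity)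
    · rw [integral_mul_const, integral_prod_mul (f := fun a => ‖c a‖) (g := fun a => ‖c a‖), ← sq]
      exact mul_le_mul_of_nonneg_right (pow_le_pow_left₀ hA0 hA 2) hB0
  have hd : ∀ w : ℂ, ‖w‖ < 1 / 4 → DifferentiableAt ℂ (fun w => N1 w - N2 w) w := by
    intro w hw
    rw [hN1, hN2]
    exact (d1 w hw).2.2.differentiableAt.sub (d2 w hw).2.2.differentiableAt
  have h0 : ‖(0:ℂ)‖ < 1 / 4 := by norm_num
  have hD := Complex.norm_deriv_le_of_forall_mem_sphere_norm_le (c := 0) (R := 0.24) (C := A ^ 2 * B) (f := fun w => N1 w - N2 w) (by norm_num)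
    (by
      refine DifferentiableOn.diffContOnCl fun w hw => (hd w ?_).differentiableWithinAt
      have := Metric.closure_ball_subset_closedBall hw
      rw [mem_closedBall_zero_iff] at this; norm_num at this ⊢; linarith)
    (fun w hw => hG w (by rw [mem_sphere_zero_iff_norm] at hw; rw [hw]; norm_num))
  obtain ⟨a1, b1, e1⟩ := d1 0 h0
  obtain ⟨a2, b2, e2⟩ := d2 0 h0
  have hG0 := hG 0 h0
  rw [hN1, hN2] at hD hG0
  have hder := (e1.sub e2).deriv
  rw [Pi.sub_def] at hder
  rw [hder] at hD
  simp only [add_zero] at hD hG0 a1 a2 b1 b2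
  have key : ∑' n : ℕ, (ArithmeticFunction.vonMangoldt n : ℂ) * Real.log n * (ff c (n / x) ^ 2 * kk 2 (n / x)) -
      x * ∫ t in Ioi (0:ℝ), ff c t ^ 2 * kk 2 t * Real.log (x * t) = Real.log x * ((∫ n : ℕ, ((ArithmeticFunction.vonMangoldt n : ℝ) : ℂ) * ff c (pv (n / x)) ^ 2 * kk 2 (pv (n / x)) ∂Measure.count) - ∫ t in Ioi (0:ℝ), (x : ℂ) * ff c (pv t) ^ 2 * kk 2 (pv t)) +
      ((∫ n : ℕ, ((ArithmeticFunction.vonMangoldt n : ℝ) : ℂ) * ff c (pv (n / x)) ^ 2 * (Real.log (pv (n / x)) * kk 2 (pv (n / x))) ∂Measure.count) - ∫ t in Ioi (0:ℝ), (x : ℂ) * ff c (pv t) ^ 2 * (Real.log (pv t) * kk 2 (pv t))) := by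
    have k1 : ∑' n : ℕ, (ArithmeticFunction.vonMangoldt n : ℂ) * Real.log n * (ff c (n / x) ^ 2 * kk 2 (n / x)) =
      Real.log x * (∫ n : ℕ, ((ArithmeticFunction.vonMangoldt n : ℝ) : ℂ) * ff c (pv (n / x)) ^ 2 * kk 2 (pv (n / x)) ∂Measure.count) + ∫ n : ℕ, ((ArithmeticFunction.vonMangoldt n : ℝ) : ℂ) * ff c (pv (n / x)) ^ 2 * (Real.log (pv (n / x)) * kk 2 (pv (n / x))) ∂Measure.count := by
      rw [← integral_const_mul, ← integral_add (a1.const_mul _) b1, int_nat _ (by exact (a1.const_mul _).add b1)]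
      refine tsum_congr fun n => ?_
      rcases Nat.eq_zero_or_pos n with rfl | h
      · simp
      · have hn : (0:ℝ) < n := by exact_mod_cast h
        rw [pv_eq _ (by positivity), Real.log_div hn.ne' hx0.ne']; push_cast; ring
    have k2 : x * ∫ t in Ioi (0:ℝ), ff c t ^ 2 * kk 2 t * Real.log (x * t) =
      Real.log x * (∫ t in Ioi (0:ℝ), (x : ℂ) * ff c (pv t) ^ 2 * kk 2 (pv t)) + ∫ t in Ioi (0:ℝ), (x : ℂ) * ff c (pv t) ^ 2 * (Real.log (pv t) * kk 2 (pv t)) := by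
      rw [← integral_const_mul, ← integral_const_mul, ← integral_add (a2.const_mul _) b2]
      refine setIntegral_congr_fun measurableSet_Ioi fun t ht => ?_
      simp only [pv_eq t ht]
      rw [Real.log_mul hx0.ne' (ne_of_gt ht)]; push_cast; ring
    rw [k1, k2]; ring
  rw [key]
  have hl : 0 ≤ Real.log x := Real.log_nonneg (by linarith)
  refine (norm_add_le _ _).trans ?_
  rw [norm_mul, Complex.norm_real, Real.norm_of_nonneg hl]
  refine (add_le_add (mul_le_mul_of_nonneg_left hG0 hl) hD).trans_eq ?_
  ring

/-- density -/
noncomputable def p0 (t : ℝ) : ℝ := t * (2 - t) ^ 3 * Real.exp (t - 1 / 2)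

/-- complex cut-off -/
noncomputable def hc (t : ℝ) : ℂ := (hcut t : ℂ)

/-- transform -/
noncomputable def mm (y : ℝ) : ℂ := mellin hc (y * Complex.I)

theorem hc_pt (s : ℂ) (t : ℝ) (ht : 0 < t) : (t : ℂ) ^ (s - 1) • hc t = (Ioc 0 2).indicator (fun t : ℝ => (p0 t : ℂ) * (t : ℂ) ^ s) t := by
  have h0 : (t : ℂ) ≠ 0 := by exact_mod_cast ht.ne'
  unfold hc hcut p0
  by_cases h : t ≤ 2
  · rw [if_pos ⟨ht.le, h⟩, indicator_of_mem (show t ∈ Ioc 0 2 from ⟨ht, h⟩), Complex.cpow_sub _ _ h0, smul_eq_mul, Complex.cpow_one]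
    push_cast; field_simp
  · rw [if_neg (fun k => h k.2), indicator_of_notMem (fun k : t ∈ Ioc 0 2 => h k.2)]; simp

theorem pI_int (p : ℝ → ℝ) (hp : ContinuousOn p (Icc 0 2)) (y : ℝ) : IntegrableOn (fun t : ℝ => (p t : ℂ) * (t : ℂ) ^ (y * Complex.I)) (Ioc 0 2) := by
  have h1 : IntegrableOn p (Ioc 0 2) := hp.integrableOn_Icc.mono_set Ioc_subset_Icc_self
  refine h1.norm.mono' (h1.ofReal.aestronglyMeasurable.mul (Measurable.aestronglyMeasurable (by fun_prop))) ?_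
  filter_upwards [ae_restrict_mem measurableSet_Ioc] with t ht
  rw [norm_mul, Complex.norm_cpow_eq_rpow_re_of_pos ht.1]; simp

theorem p0_cont : Continuous p0 := by unfold p0; fun_prop

theorem hc_conv (y : ℝ) : MellinConvergent hc (y * Complex.I) := by
  have := (pI_int p0 p0_cont.continuousOn y)
  rw [← integrable_indicator_iff measurableSet_Ioc] at this
  exact this.integrableOn.congr_fun (fun t ht => (hc_pt _ t ht).symm) measurableSet_Ioi

theorem mm_eq (y : ℝ) : mm y = ∫ t in Ioc (0:ℝ) 2, (p0 t : ℂ) * (t : ℂ) ^ (y * Complex.I) := by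
  rw [mm, mellin, setIntegral_congr_fun measurableSet_Ioi (fun t ht => hc_pt _ t ht), setIntegral_indicator measurableSet_Ioc]
  congr 2; ext t; simp

theorem mm_cont : Continuous mm := by
  rw [show mm = _ from funext mm_eq]
  refine MeasureTheory.continuous_of_dominated (bound := fun t => ‖p0 t‖) (fun y => (pI_int p0 p0_cont.continuousOn y).aestronglyMeasurable) (fun y => ?_)
    (p0_cont.continuousOn.integrableOn_Icc.mono_set Ioc_subset_Icc_self).norm ?_
  · filter_upwards [ae_restrict_mem measurableSet_Ioc] with t ht
    rw [norm_mul, Complex.norm_cpow_eq_rpow_re_of_pos ht.1]; simp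
  · filter_upwards [ae_restrict_mem measurableSet_Ioc] with t ht
    have h0 : (t : ℂ) ≠ 0 := by exact_mod_cast ht.1.ne'
    exact continuous_const.mul (Continuous.const_cpow (by fun_prop) (Or.inl h0))

theorem FH_eq (y : ℝ) (hy : 0 < y) (h1 : y ≠ 1) : (FH 200 y : ℂ) = 1 / (2 * Real.pi) * ∫ a, (y : ℂ) ^ (-(a * Complex.I)) ∂mw := by
  have hL : Real.log y ≠ 0 := Real.log_ne_zero_of_pos_of_ne_one hy h1
  have hLc : (Real.log y : ℂ) ≠ 0 := by exact_mod_cast hL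
  have hp : (Real.pi : ℂ) ≠ 0 := by exact_mod_cast Real.pi_ne_zero
  have e : ∀ a : ℝ, (y : ℂ) ^ (-(a * Complex.I)) = Complex.exp ((-(Real.log y * Complex.I)) * a) := by
    intro a
    rw [Complex.cpow_def_of_ne_zero (by exact_mod_cast hy.ne'), ← Complex.ofReal_log hy.le]; ring_nf
  simp_rw [e]
  rw [mw, integral_Icc_eq_integral_Ioc, ← intervalIntegral.integral_of_le (by norm_num), integral_exp_mul_complex (neg_ne_zero.2 (mul_ne_zero hLc Complex.I_ne_zero)), FH]
  push_cast
  rw [Complex.sin]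
  field_simp
  ring_nf
  simp

theorem hcut_meas : Measurable hcut := Measurable.ite measurableSet_Icc (by fun_prop) measurable_const

theorem hc_meas : Measurable hc := Complex.measurable_ofReal.comp hcut_meas

theorem hH_eq (t : ℝ) (ht : 0 < t) : (hH 200 t : ℂ) = ff (fun y => 1 / (2 * Real.pi) * mm y) t := by
  have conv : MellinConvergent (fun y => hc (t / y)) 0 := by
    have := (MellinConvergent.comp_rpow (f := fun y => hc (t * y)) (s := 0) (a := -1) (by norm_num)).2 (by
      have := (MellinConvergent.comp_mul_left (f := hc) (s := (0:ℝ) * Complex.I) ht).2 (hc_conv 0)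
      simpa using this)
    simpa only [Real.rpow_neg_one, ← div_eq_mul_inv] using this
  have inner : ∀ a : ℝ, mellin (fun y => hc (t / y)) (-(a * Complex.I)) = (t : ℂ) ^ (-(a * Complex.I)) * mm a := by
    intro a
    have := mellin_comp_inv (fun y => hc (t * y)) (-(a * Complex.I))
    simp only [← div_eq_mul_inv, neg_neg] at this
    rw [this, mellin_comp_mul_left _ _ ht, smul_eq_mul, mm]
  have e1 : (hH 200 t : ℂ) = ∫ y in Ioi (0:ℝ), ∫ a, 1 / (2 * Real.pi) * ((y : ℂ) ^ (-(a * Complex.I) - 1) • hc (t / y)) ∂mw := by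
    rw [hH, ← integral_complex_ofReal]
    refine integral_congr_ae ?_
    filter_upwards [ae_restrict_mem measurableSet_Ioi, ae_restrict_of_ae (compl_mem_ae_iff.2 (measure_singleton (1:ℝ)))] with y hy h1
    have h0 : (y : ℂ) ≠ 0 := by exact_mod_cast (ne_of_gt hy : y ≠ 0)
    simp only [Complex.ofReal_div, Complex.ofReal_mul]
    rw [FH_eq y hy h1, integral_const_mul]
    simp only [Complex.cpow_sub _ _ h0, smul_eq_mul, Complex.cpow_one, hc]
    rw [integral_mul_const, integral_div]; ring
  rw [e1, integral_integral_swap]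
  · unfold ff
    refine integral_congr_ae (Eventually.of_forall fun a => ?_)
    simp only []
    rw [integral_const_mul]
    have := inner a
    rw [mellin] at this
    rw [this]; ring
  · have i1 : Integrable (fun _ : ℝ => (1 / (2 * Real.pi) : ℂ)) mw := continuous_const.continuousOn.integrableOn_Icc
    refine (Integrable.mul_prod conv i1).mono (Measurable.aestronglyMeasurable ?_) ?_
    · have := hc_meas; unfold Function.uncurry; simp only [smul_eq_mul]; fun_prop
    · have : ∀ᵐ q ∂((volume.restrict (Ioi (0:ℝ))).prod mw), q ∈ Ioi (0:ℝ) ×ˢ Icc (-200:ℝ) 200 := by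
        rw [mw, Measure.prod_restrict]; exact ae_restrict_mem (measurableSet_Ioi.prod measurableSet_Icc)
      filter_upwards [this] with q hq
      simp only [Function.uncurry, norm_mul, norm_smul, Complex.norm_cpow_eq_rpow_re_of_pos hq.1]
      simp [mul_comm]

/-- Horner evaluation -/
def hor : List ℝ → ℝ → ℝ
  | [], _ => 0
  | a :: l, t => a + t * hor l t

/-- its derivative -/
def hor' : List ℝ → ℝ → ℝ
  | [], _ => 0
  | _ :: l, t => hor l t + t * hor' l t

theorem hor_der (l : List ℝ) (t : ℝ) : HasDerivAt (hor l) (hor' l t) t := by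
  induction l with
  | nil => exact hasDerivAt_const t 0
  | cons a l ih => exact (((hasDerivAt_id t).mul ih).const_add a).congr_deriv (by simp [hor'])

theorem hor_cont (l : List ℝ) : Continuous (hor l) :=
  continuous_iff_continuousAt.2 fun t => (hor_der l t).continuousAt

theorem ibp (p q : ℝ → ℝ) (hp : ContinuousOn p (Icc 0 2)) (hq : ContinuousOn q (Icc 0 2)) (h2 : p 2 = 0)
    (hd : ∀ t ∈ Ioo (0:ℝ) 2, HasDerivAt (fun t => t * p t) (q t) t) (y : ℝ) :
    |y| * ‖∫ t in Ioc (0:ℝ) 2, (p t : ℂ) * (t : ℂ) ^ (y * Complex.I)‖ = ‖∫ t in Ioc (0:ℝ) 2, (q t : ℂ) * (t : ℂ) ^ (y * Complex.I)‖ := by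
  have ip := pI_int p hp y
  have iq := pI_int q hq y
  have hre : 0 < (1 + y * Complex.I).re := by simp
  have hF : ContinuousOn (fun t : ℝ => (p t : ℂ) * (t : ℂ) ^ (1 + y * Complex.I)) (Icc 0 2) :=
    (Complex.continuous_ofReal.comp_continuousOn hp).mul (Complex.continuous_ofReal_cpow_const hre).continuousOn
  have h := intervalIntegral.integral_eq_sub_of_hasDerivAt_of_le (by norm_num) hF
    (f' := fun t : ℝ => (q t : ℂ) * (t : ℂ) ^ (y * Complex.I) + (y * Complex.I) * ((p t : ℂ) * (t : ℂ) ^ (y * Complex.I))) (fun t ht => by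
      have h0 : (t : ℂ) ≠ 0 := by exact_mod_cast ht.1.ne'
      have hs : (t : ℂ) ∈ Complex.slitPlane := Complex.ofReal_mem_slitPlane.2 ht.1
      have a := (hd t ht).ofReal_comp.mul ((hasDerivAt_id (t : ℂ)).cpow_const (c := y * Complex.I) hs).comp_ofReal
      refine (a.congr_of_eventuallyEq ?_).congr_deriv ?_
      · filter_upwards [lt_mem_nhds ht.1] with u hu
        rw [Complex.cpow_add _ _ (by exact_mod_cast hu.ne'), Complex.cpow_one]
        simp; ring
      · simp only [id]
        rw [Complex.cpow_sub _ _ h0, Complex.cpow_one]; push_cast; field_simp)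
    ((intervalIntegrable_iff_integrableOn_Ioc_of_le (by norm_num)).2 (iq.add (ip.const_mul _)))
  rw [intervalIntegral.integral_of_le (by norm_num), integral_add iq (ip.const_mul _), integral_const_mul, h2] at h
  have e : (1 + (y:ℂ) * Complex.I) ≠ 0 := fun k => by rw [k] at hre; simp at hre
  rw [Complex.ofReal_zero, Complex.zero_cpow e] at h
  rw [show ∫ t in Ioc (0:ℝ) 2, (q t : ℂ) * (t : ℂ) ^ (y * Complex.I) = -((y * Complex.I) * ∫ t in Ioc (0:ℝ) 2, (p t : ℂ) * (t : ℂ) ^ (y * Complex.I)) by linear_combination h]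
  rw [norm_neg, norm_mul, norm_mul, Complex.norm_I, Complex.norm_real, Real.norm_eq_abs, mul_one]

theorem pI_le (p : ℝ → ℝ) (y : ℝ) : ‖∫ t in Ioc (0:ℝ) 2, (p t : ℂ) * (t : ℂ) ^ (y * Complex.I)‖ ≤ ∫ t in Ioc (0:ℝ) 2, |p t| := by
  refine (norm_integral_le_integral_norm _).trans_eq (setIntegral_congr_fun measurableSet_Ioc fun t ht => ?_)
  rw [norm_mul, Complex.norm_cpow_eq_rpow_re_of_pos ht.1]; simp

/-- polynomial times exponential -/
noncomputable def pe (l : List ℝ) (t : ℝ) : ℝ := hor l t * Real.exp (t - 1 / 2)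

theorem pe_der (l : List ℝ) (t : ℝ) : HasDerivAt (pe l) ((hor' l t + hor l t) * Real.exp (t - 1 / 2)) t :=
  ((hor_der l t).mul ((hasDerivAt_id t).sub_const (1 / 2)).exp).congr_deriv (by simp; ring)

theorem pe_cont (l : List ℝ) : Continuous (pe l) := continuous_iff_continuousAt.2 fun t => (pe_der l t).continuousAt

theorem pe_int (l m : List ℝ) (h : ∀ t, hor' l t + hor l t = hor m t) : ∫ t in Ioc (0:ℝ) 2, pe m t = (hor l 2 * Real.exp 1 ^ 2 - hor l 0) * Real.exp (-1 / 2) := by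
  rw [← intervalIntegral.integral_of_le (by norm_num), intervalIntegral.integral_eq_sub_of_hasDerivAt (f := pe l) (fun t _ => (pe_der l t).congr_deriv (by rw [h]; rfl)) ((pe_cont m).intervalIntegrable _ _)]
  rw [pe, pe, ← Real.exp_nat_mul, sub_mul, mul_assoc, ← Real.exp_add]; norm_num

theorem pe_cs (l m : List ℝ) (lam : ℝ) (hl : 0 < lam) (h : ∀ t, hor' m t + hor m t = hor l t ^ 2) :
    ∫ t in Ioc (0:ℝ) 2, |pe l t| ≤ ((hor m 2 / lam + lam) * Real.exp 1 ^ 2 - (hor m 0 / lam + lam)) * Real.exp (-1 / 2) / 2 := by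
  have hd : ∀ t, HasDerivAt (fun t => (hor m t / lam + lam) / 2 * Real.exp (t - 1 / 2)) ((hor l t ^ 2 / lam + lam) / 2 * Real.exp (t - 1 / 2)) t := fun t =>
    ((((((hor_der m t).div_const lam).add_const lam).div_const 2)).mul ((hasDerivAt_id t).sub_const (1 / 2)).exp).congr_deriv (by rw [← h]; simp; ring)
  have hc : Continuous (fun t => (hor l t ^ 2 / lam + lam) / 2 * Real.exp (t - 1 / 2)) := by
    have := hor_cont l; fun_prop
  have i := intervalIntegral.integral_eq_sub_of_hasDerivAt (a := 0) (b := 2) (fun t _ => hd t) (hc.intervalIntegrable _ _)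
  rw [intervalIntegral.integral_of_le (by norm_num)] at i
  refine le_trans (setIntegral_mono (pe_cont l).abs.integrableOn_Ioc hc.integrableOn_Ioc fun t => ?_) (i.trans ?_).le
  · simp only [pe]
    rw [abs_mul, Real.abs_exp]
    refine mul_le_mul_of_nonneg_right ?_ (Real.exp_pos _).le
    rw [le_div_iff₀ two_pos, ← sub_nonneg]
    have : hor l t ^ 2 / lam + lam - |hor l t| * 2 = (|hor l t| - lam) ^ 2 / lam := by rw [← sq_abs (hor l t)]; field_simp; ring
    rw [this]; positivity
  · rw [← Real.exp_nat_mul, show (2:ℝ) - 1 / 2 = (2:ℕ) * 1 + -1 / 2 by norm_num, Real.exp_add]; ring_nf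

theorem emh : Real.exp (-1 / 2) ≤ 0.607 := by
  have := Real.exp_one_gt_d9
  rw [← sq_le_sq₀ (Real.exp_pos _).le (by norm_num), ← Real.exp_nat_mul, show (2:ℕ) * (-1 / 2 : ℝ) = -1 by norm_num, Real.exp_neg]
  refine (inv_anti₀ (by norm_num) this.le).trans (by norm_num)

theorem e2le : Real.exp 1 ^ 2 ≤ 7.3890561002 := (pow_le_pow_left₀ (Real.exp_pos _).le Real.exp_one_lt_d9.le 2).trans (by norm_num)

theorem e2ge : 7.389 ≤ Real.exp 1 ^ 2 := le_trans (by norm_num) (pow_le_pow_left₀ (by norm_num) Real.exp_one_gt_d9.le 2)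

theorem p0_eq : p0 = pe [0, 8, -12, 6, -1] := by
  funext t; simp only [p0, pe, hor]; ring

theorem pe_ibp (l m : List ℝ) (h2 : hor l 2 = 0) (h : ∀ t, hor l t + t * (hor' l t + hor l t) = hor m t) (y : ℝ) :
    |y| * ‖∫ t in Ioc (0:ℝ) 2, (pe l t : ℂ) * (t : ℂ) ^ (y * Complex.I)‖ = ‖∫ t in Ioc (0:ℝ) 2, (pe m t : ℂ) * (t : ℂ) ^ (y * Complex.I)‖ :=
  ibp _ _ (pe_cont l).continuousOn (pe_cont m).continuousOn (by rw [pe, h2, zero_mul]) (fun t _ =>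
    ((hasDerivAt_id t).mul (pe_der l t)).congr_deriv (by simp only [pe, ← h, id]; ring)) y

theorem mm_bds (y : ℝ) : ‖mm y‖ ≤ 2.03 ∧ y ^ 2 * ‖mm y‖ ≤ 13 ∧ |y| ^ 3 * ‖mm y‖ ≤ 108 := by
  have E0 := Real.exp_pos (-1 / 2)
  have E1 := emh
  have E2 := e2le
  have E3 := e2ge
  have a0 := pI_le (pe [0, 8, -12, 6, -1]) y
  rw [setIntegral_congr_fun measurableSet_Ioc (g := pe [0, 8, -12, 6, -1]) (fun t ht => by
    refine abs_of_nonneg ?_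
    rw [← p0_eq, p0]
    have := pow_nonneg (by linarith [ht.2] : (0:ℝ) ≤ 2 - t) 3
    have := ht.1.le; positivity), pe_int [-92, 92, -42, 10, -1] _ (fun t => by simp only [hor, hor']; ring)] at a0
  have a1 := pe_ibp [0, 8, -12, 6, -1] [0, 16, -28, 12, 1, -1] (by norm_num [hor]) (fun t => by simp only [hor, hor']; ring) y
  have a2 := pe_ibp [0, 16, -28, 12, 1, -1] [0, 32, -68, 20, 17, -5, -1] (by norm_num [hor]) (fun t => by simp only [hor, hor']; ring) y
  have a3 := pe_ibp [0, 32, -68, 20, 17, -5, -1] [0, 64, -172, 12, 105, -13, -12, -1] (by norm_num [hor]) (fun t => by simp only [hor, hor']; ring) y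
  have b2 := (pI_le _ y).trans (pe_cs [0, 32, -68, 20, 17, -5, -1] [124678016, -124678016, 62339008, -20779328, 5193744, -1037568, 172656, -24984, 3285, -340, 13, -2, 1] 3.3 (by norm_num) (fun t => by simp only [hor, hor']; ring))
  have b3 := (pI_le _ y).trans (pe_cs [0, 64, -172, 12, 105, -13, -12, -1] [7978890368, -7978890368, 3989445184, -1329813696, 332447920, -66483360, 11082112, -1588536, 199249, -20504, 1783, -378, 40, 10, 1] 27.6 (by norm_num) (fun t => by simp only [hor, hor']; ring))
  rw [mm_eq, p0_eq]
  norm_num [hor] at a0 b2 b3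
  refine ⟨a0.trans ?_, ?_, ?_⟩
  · norm_num at E1 E2 E3 ⊢; nlinarith
  · rw [← sq_abs, sq, mul_assoc, a1, a2]; refine b2.trans ?_
    norm_num at E1 E2 E3 ⊢; nlinarith
  · rw [pow_succ, sq, mul_assoc, mul_assoc, a1, a2, a3]; refine b3.trans ?_
    norm_num at E1 E2 E3 ⊢; nlinarith

theorem maj (f : ℝ → ℂ) (hf : AEStronglyMeasurable f volume) (a b C k : ℝ) (ha : 0 < a) (hb : 0 ≤ b) (hC : 0 < C) (hk : 1 < k)
    (h1 : ∀ y, |y| ≤ a → ‖f y‖ ≤ b) (h2 : ∀ y, a < |y| → |y| ^ k * ‖f y‖ ≤ C) :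
    Integrable f ∧ ∫ y, ‖f y‖ ≤ 2 * (b * a + C * a ^ (1 - k) / (k - 1)) := by
  obtain ⟨φ, hφ⟩ : ∃ φ : ℝ → ℝ, φ = fun u => if u ≤ a then b else C * u ^ (-k) := ⟨_, rfl⟩
  have i1 : EqOn φ (fun _ => b) (Ioc 0 a) := fun u hu => by rw [hφ]; exact if_pos hu.2
  have i2 : EqOn φ (fun u => C * u ^ (-k)) (Ioi a) := fun u hu => by rw [hφ]; exact if_neg (not_le.2 hu)
  have S : ∫ u in Ioi 0, φ u = b * a + C * a ^ (1 - k) / (k - 1) := by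
    rw [← Ioc_union_Ioi_eq_Ioi ha.le, setIntegral_union (Ioc_disjoint_Ioi le_rfl) measurableSet_Ioi, setIntegral_congr_fun measurableSet_Ioc i1, setIntegral_congr_fun measurableSet_Ioi i2,
      integral_const_mul, integral_Ioi_rpow_of_lt (by linarith) ha]
    · have : k - 1 ≠ 0 := by linarith
      have : -k + 1 ≠ 0 := by linarith
      rw [show -k + 1 = -(k - 1) by ring, show 1 - k = -(k - 1) by ring, neg_div_neg_eq]
      simp [ha.le]; ring
    · exact (continuousOn_const.integrableOn_Icc.mono_set Ioc_subset_Icc_self).congr_fun i1.symm measurableSet_Ioc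
    · exact IntegrableOn.congr_fun ((integrableOn_Ioi_rpow_of_lt (by linarith) ha).const_mul C) i2.symm measurableSet_Ioi
  have hS : ∫ u, φ |u| = 2 * (b * a + C * a ^ (1 - k) / (k - 1)) := by rw [integral_comp_abs, S]
  have hpos : 0 < 2 * (b * a + C * a ^ (1 - k) / (k - 1)) := by
    have := Real.rpow_pos_of_pos ha (1 - k)
    have : 0 < k - 1 := by linarith
    positivity
  have hi : Integrable (fun u => φ |u|) := Integrable.of_integral_ne_zero (by rw [hS]; exact hpos.ne')
  have hle : ∀ y, ‖f y‖ ≤ φ |y| := by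
    intro y
    rw [hφ]; simp only []
    split_ifs with h
    · exact h1 y h
    · have h' := not_le.1 h
      have p := Real.rpow_pos_of_pos (ha.trans h') k
      rw [Real.rpow_neg (ha.trans h').le, ← div_eq_mul_inv, le_div_iff₀ p, mul_comm]; exact h2 y h'
  have hf' := hi.mono' hf (Eventually.of_forall hle)
  exact ⟨hf', (integral_mono hf'.norm hi hle).trans_eq hS⟩

theorem mm_int : Integrable mm ∧ ∫ y, ‖mm y‖ ≤ 20.55 := by
  obtain ⟨h, h'⟩ := maj mm mm_cont.aestronglyMeasurable 2.5 2.03 13 2 (by norm_num) (by norm_num) (by norm_num) (by norm_num) (fun y _ => (mm_bds y).1)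
    (fun y _ => by rw [Real.rpow_two, sq_abs]; exact (mm_bds y).2.1)
  refine ⟨h, h'.trans ?_⟩
  rw [show (1:ℝ) - 2 = -1 by norm_num, Real.rpow_neg_one]; norm_num

theorem A_bd : ∫ a, ‖(1 / (2 * Real.pi) : ℂ) * mm a‖ ∂mw ≤ 3.3 := by
  have hp := Real.pi_gt_d2
  simp only [norm_mul]
  rw [integral_const_mul]
  have : ∫ a, ‖mm a‖ ∂mw ≤ 20.55 := (setIntegral_le_integral mm_int.1.norm (Eventually.of_forall fun _ => norm_nonneg _)).trans mm_int.2
  have e : ‖(1 / (2 * Real.pi) : ℂ)‖ = 1 / (2 * Real.pi) := by simp [abs_of_pos Real.pi_pos]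
  rw [e, div_mul_eq_mul_div, div_le_iff₀ (by positivity)]
  linarith

theorem hc_inv (t : ℝ) (ht : 0 < t) : hc t = 1 / (2 * Real.pi) * ∫ y : ℝ, (t : ℂ) ^ (-(y * Complex.I)) * mm y := by
  have e : ∀ y : ℝ, ((0:ℝ) : ℂ) + y * Complex.I = y * Complex.I := fun y => by simp
  have hcont : Continuous hcut := by
    unfold hcut
    refine Continuous.if (fun t h => ?_) (by fun_prop) continuous_const
    rw [Set.ofPred_mem_eq, frontier_Icc (by norm_num)] at h
    rcases h with rfl | h
    · norm_num
    · rw [mem_singleton_iff] at h; subst h; norm_num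
  have := mellinInv_mellin_eq 0 hc ht (by simpa using hc_conv 0) (by
    unfold Complex.VerticalIntegrable; simp only [e]; exact mm_int.1) (Complex.continuous_ofReal.comp hcont).continuousAt
  rw [← this, mellinInv]
  simp only [e, smul_eq_mul, mm, Complex.real_smul]
  push_cast; rfl

theorem be5 (k : ℕ) : (∫ u in (-1:ℝ)..1, (1-u^2)^5 * (u^2)^k) = 2/(2*(k:ℝ)+1) - 10/(2*k+3) + 20/(2*k+5) - 20/(2*k+7) + 10/(2*k+9) - 2/(2*k+11) := by
  have h : ∀ u : ℝ, (1-u^2)^5 * (u^2)^k = u^(2*k) - 5*u^(2*k+2) + 10*u^(2*k+4) - 10*u^(2*k+6) + 5*u^(2*k+8) - u^(2*k+10) := by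
    intro u; ring
  simp_rw [h]
  have hi : ∀ c : ℝ, ∀ m : ℕ, IntervalIntegrable (fun u : ℝ => c * u^m) volume (-1) 1 := fun c m => (by fun_prop : Continuous fun u : ℝ => c*u^m).intervalIntegrable _ _
  have hi' : ∀ m : ℕ, IntervalIntegrable (fun u : ℝ => u^m) volume (-1) 1 := fun m => (by fun_prop : Continuous fun u : ℝ => u^m).intervalIntegrable _ _
  have e : ∀ m : ℕ, (-1:ℝ)^(2*k+2*m+1) = -1 := fun m => by rw [show 2*k+2*m+1 = 2*(k+m)+1 by ring, pow_succ, pow_mul]; norm_num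
  have e0 := e 0
  have e1 := e 1
  have e2 := e 2
  have e3 := e 3
  have e4 := e 4
  have e5 := e 5
  norm_num at e0 e1 e2 e3 e4 e5
  rw [intervalIntegral.integral_sub (((((hi' _).sub (hi _ _)).add (hi _ _)).sub (hi _ _)).add (hi _ _)) (hi' _), intervalIntegral.integral_add ((((hi' _).sub (hi _ _)).add (hi _ _)).sub (hi _ _)) (hi _ _), intervalIntegral.integral_sub (((hi' _).sub (hi _ _)).add (hi _ _)) (hi _ _), intervalIntegral.integral_add ((hi' _).sub (hi _ _)) (hi _ _), intervalIntegral.integral_sub (hi' _) (hi _ _)]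
  simp only [intervalIntegral.integral_const_mul, integral_pow, one_pow, e0, e1, e2, e3, e4, e5]
  push_cast
  have q : ∀ m : ℝ, 2*(k:ℝ)+m+1 = 2*k+(m+1) := fun m => by ring
  simp only [q]
  norm_num
  ring

noncomputable def be (k : ℕ) : ℝ := (2/(2*k+1) - 10/(2*k+3) + 20/(2*k+5) - 20/(2*k+7) + 10/(2*k+9) - 2/(2*k+11)) - (2/(2*k+3) - 10/(2*k+5) + 20/(2*k+7) - 20/(2*k+9) + 10/(2*k+11) - 2/(2*k+13))

theorem be6 (k : ℕ) : (∫ u in (-1:ℝ)..1, (1-u^2)^6 * (u^2)^k) = be k := by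
  have h : ∀ u : ℝ, (1-u^2)^6 * (u^2)^k = (1-u^2)^5*(u^2)^k - (1-u^2)^5*(u^2)^(k+1) := by intro u; ring
  simp_rw [h]
  rw [intervalIntegral.integral_sub ((by fun_prop : Continuous fun u : ℝ => (1-u^2)^5*(u^2)^k).intervalIntegrable _ _) ((by fun_prop : Continuous fun u : ℝ => (1-u^2)^5*(u^2)^(k+1)).intervalIntegrable _ _), be5, be5, be]
  push_cast
  have q : ∀ m : ℝ, 2*((k:ℝ)+1)+m = 2*k+(2+m) := fun m => by ring
  simp only [q]
  norm_num

theorem I0 : |(∫ u in (-1:ℝ)..1, (1-u^2)^6 * Real.exp (-u^2)) - 0.640206| ≤ 1e-8 := by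
  set P : ℝ → ℝ := fun u => (1-u^2)^6 * ∑ m ∈ Finset.range 9, (-u^2)^m/(m.factorial:ℝ) with hP
  have hPi : ∫ u in (-1:ℝ)..1, P u = ∑ m ∈ Finset.range 9, (-1)^m/(m.factorial:ℝ) * be m := by
    have : ∀ u, P u = ∑ m ∈ Finset.range 9, (-1)^m/(m.factorial:ℝ) * ((1-u^2)^6*(u^2)^m) := by
      intro u; simp only [hP]; rw [Finset.mul_sum]; refine Finset.sum_congr rfl fun m _ => ?_
      rw [neg_pow]; ring
    simp_rw [this]
    rw [intervalIntegral.integral_finsetSum (fun i _ => (by fun_prop : Continuous _).intervalIntegrable _ _)]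
    simp only [intervalIntegral.integral_const_mul, be6]
  have c1 : Continuous fun u : ℝ => (1-u^2)^6 * Real.exp (-u^2) := by fun_prop
  have c2 : Continuous P := by simp only [hP]; fun_prop
  have hd : |(∫ u in (-1:ℝ)..1, (1-u^2)^6 * Real.exp (-u^2)) - ∫ u in (-1:ℝ)..1, P u| ≤ ∫ u in (-1:ℝ)..1, (10/(362880*9):ℝ) * ((1-u^2)^6*(u^2)^9) := by
    rw [← intervalIntegral.integral_sub (c1.intervalIntegrable _ _) (c2.intervalIntegrable _ _), ← Real.norm_eq_abs]
    refine intervalIntegral.norm_integral_le_of_norm_le (by norm_num) (ae_of_all _ fun u hu => ?_) ((by fun_prop : Continuous _).intervalIntegrable _ _)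
    have hu1 : u^2 ≤ 1 := by nlinarith [hu.1, hu.2]
    have hb := Real.exp_bound (x := -u^2) (by rw [abs_neg, abs_of_nonneg (sq_nonneg u)]; exact hu1) (n := 9) (by norm_num)
    have e : (1-u^2)^6 * Real.exp (-u^2) - P u = (1-u^2)^6*(Real.exp (-u^2) - ∑ m ∈ Finset.range 9, (-u^2)^m/(m.factorial:ℝ)) := by simp only [hP]; ring
    rw [e, norm_mul, Real.norm_eq_abs, Real.norm_eq_abs, abs_of_nonneg (by positivity)]
    rw [abs_neg, abs_of_nonneg (sq_nonneg u)] at hb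
    have := mul_le_mul_of_nonneg_left hb (by positivity : (0:ℝ) ≤ (1-u^2)^6)
    refine this.trans (le_of_eq ?_)
    norm_num [Nat.factorial]; ring
  rw [intervalIntegral.integral_const_mul, be6, hPi] at hd
  simp only [Finset.sum_range_succ, Finset.sum_range_zero, be] at hd
  norm_num [Nat.factorial] at hd
  rw [abs_le] at hd ⊢
  constructor <;> linarith [hd.1, hd.2]

noncomputable def jw (u : ℝ) : ℝ := (1-u^2)^6 * Real.exp (-u^2)

theorem jlog_i (s : ℝ) (hs : s = 1 ∨ s = -1) : IntervalIntegrable (fun u => jw u * Real.log (1+s*u)) volume (-1) 1 := by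
  refine Continuous.intervalIntegrable ?_ _ _
  have e : (fun u => jw u * Real.log (1+s*u)) = fun u => (1+s*u)^5*(1-s*u)^6 * Real.exp (-u^2) * ((1+s*u)*Real.log (1+s*u)) := by
    funext u
    have : 1-u^2 = (1+s*u)*(1-s*u) := by rcases hs with rfl|rfl <;> ring
    rw [jw, this]; ring
  rw [e]
  have := Real.continuous_mul_log.comp (by fun_prop : Continuous fun u : ℝ => 1+s*u)
  exact (by fun_prop : Continuous fun u : ℝ => (1+s*u)^5*(1-s*u)^6 * Real.exp (-u^2)).mul this

theorem J_sym : (∫ u in (-1:ℝ)..1, jw u * Real.log (1+u)) = 1/2 * ∫ u in (-1:ℝ)..1, jw u * Real.log (1-u^2) := by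
  have i1 := jlog_i 1 (Or.inl rfl)
  have i2 := jlog_i (-1) (Or.inr rfl)
  have h : (∫ u in (-1:ℝ)..1, jw u * Real.log (1+(-1)*u)) = ∫ u in (-1:ℝ)..1, jw u * Real.log (1+1*u) := by
    have := intervalIntegral.integral_comp_neg (a := -1) (b := 1) (fun u => jw u * Real.log (1+1*u))
    rw [neg_neg] at this
    rw [← this]
    refine intervalIntegral.integral_congr fun u _ => ?_
    simp only [jw]; ring_nf
  have h2 : (∫ u in (-1:ℝ)..1, jw u * Real.log (1-u^2)) = ∫ u in (-1:ℝ)..1, (jw u * Real.log (1+1*u) + jw u * Real.log (1+(-1)*u)) := by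
    refine intervalIntegral.integral_congr fun u _ => ?_
    by_cases h1 : 1 + u = 0
    · have : u = -1 := by linarith
      subst this; simp [jw]
    by_cases h2 : 1 - u = 0
    · have : u = 1 := by linarith
      subst this; simp [jw]
    rw [← mul_add, show 1+(-1)*u = 1-u by ring, one_mul, ← Real.log_mul h1 h2]; ring_nf
  rw [h2, intervalIntegral.integral_add i1 i2, h]
  simp only [one_mul]; ring

theorem J0 : |(∫ u in (-1:ℝ)..1, jw u * Real.log (1+u)) + 0.021095| ≤ 2e-5 := by
  rw [J_sym]
  set P : ℝ → ℝ := fun u => ∑ m ∈ Finset.range 7, ∑ i ∈ Finset.range 10, -((-1)^m/(m.factorial:ℝ)/((i:ℝ)+1)) * ((1-u^2)^6*(u^2)^(m+i+1)) with hP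
  have hPi : ∫ u in (-1:ℝ)..1, P u = ∑ m ∈ Finset.range 7, ∑ i ∈ Finset.range 10, -((-1)^m/(m.factorial:ℝ)/((i:ℝ)+1)) * be (m+i+1) := by
    simp only [hP]
    rw [intervalIntegral.integral_finsetSum (fun i _ => (by fun_prop : Continuous _).intervalIntegrable _ _)]
    refine Finset.sum_congr rfl fun m _ => ?_
    rw [intervalIntegral.integral_finsetSum (fun i _ => (by fun_prop : Continuous _).intervalIntegrable _ _)]
    simp only [intervalIntegral.integral_const_mul, be6]
  have hPe : ∀ u, P u = (1-u^2)^6 * (∑ m ∈ Finset.range 7, (-u^2)^m/(m.factorial:ℝ)) * -(∑ i ∈ Finset.range 10, (u^2)^(i+1)/((i:ℝ)+1)) := by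
    intro u
    simp only [hP]
    rw [mul_assoc, mul_neg, Finset.sum_mul_sum, mul_neg, Finset.mul_sum, ← Finset.sum_neg_distrib]
    refine Finset.sum_congr rfl fun m _ => ?_
    rw [Finset.mul_sum, ← Finset.sum_neg_distrib]
    refine Finset.sum_congr rfl fun i _ => ?_
    rw [neg_pow (u^2) m]
    have : (i:ℝ)+1 ≠ 0 := by positivity
    have : (m.factorial:ℝ) ≠ 0 := by positivity
    field_simp; ring
  have c2 : Continuous P := by simp only [hP]; fun_prop
  have c1 : IntervalIntegrable (fun u => jw u * Real.log (1-u^2)) volume (-1) 1 := by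
    refine Continuous.intervalIntegrable ?_ _ _
    have e : (fun u => jw u * Real.log (1-u^2)) = fun u => (1-u^2)^5 * Real.exp (-u^2) * ((1-u^2)*Real.log (1-u^2)) := by
      funext u; rw [jw]; ring
    rw [e]
    have := Real.continuous_mul_log.comp (by fun_prop : Continuous fun u : ℝ => 1-u^2)
    exact (by fun_prop : Continuous fun u : ℝ => (1-u^2)^5 * Real.exp (-u^2)).mul this
  have hd : |(∫ u in (-1:ℝ)..1, jw u * Real.log (1-u^2)) - ∫ u in (-1:ℝ)..1, P u| ≤ ∫ u in (-1:ℝ)..1, ((1-u^2)^5*(u^2)^11 + (8/(5040*7):ℝ) * 3 * ((1-u^2)^6*(u^2)^7)) := by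
    rw [← intervalIntegral.integral_sub c1 (c2.intervalIntegrable _ _), ← Real.norm_eq_abs]
    refine intervalIntegral.norm_integral_le_of_norm_le (by norm_num) (ae_of_all _ fun u hu => ?_) ((by fun_prop : Continuous _).intervalIntegrable _ _)
    rw [hPe, Real.norm_eq_abs, jw]
    have hu1 : u^2 ≤ 1 := by nlinarith [hu.1, hu.2]
    have hu0 := sq_nonneg u
    have hE : Real.exp (-u^2) ≤ 1 := Real.exp_le_one_iff.2 (by linarith)
    have hE0 := Real.exp_pos (-u^2)
    have hb := Real.exp_bound (x := -u^2) (by rw [abs_neg, abs_of_nonneg hu0]; exact hu1) (n := 7) (by norm_num)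
    rw [abs_neg, abs_of_nonneg hu0] at hb
    set w := u^2
    rcases hu1.eq_or_lt with h1 | h1
    · rw [h1]; norm_num
    have hl := Real.abs_log_sub_add_sum_range_le (x := w) (by rwa [abs_of_nonneg hu0]) 10
    rw [abs_of_nonneg hu0] at hl
    have hT : |∑ i ∈ Finset.range 10, w^(i+1)/((i:ℝ)+1)| ≤ 3 := by
      rw [abs_of_nonneg (by positivity)]
      calc _ ≤ ∑ i ∈ Finset.range 10, 1/((i:ℝ)+1) := by
            refine Finset.sum_le_sum fun i _ => ?_
            gcongr; exact pow_le_one₀ hu0 hu1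
        _ ≤ 3 := by norm_num [Finset.sum_range_succ]
    norm_num only [Nat.factorial] at hb
    set S := ∑ m ∈ Finset.range 7, (-w)^m/(m.factorial:ℝ)
    set T := ∑ i ∈ Finset.range 10, w^(i+1)/((i:ℝ)+1)
    have e : (1-w)^6 * Real.exp (-w) * Real.log (1-w) - (1-w)^6*S*-T = (1-w)^6*(Real.exp (-w)*(T+Real.log (1-w))) - (1-w)^6*((Real.exp (-w)-S)*T) := by ring
    rw [e]
    have hw : 0 < 1-w := by linarith
    refine (abs_sub _ _).trans (add_le_add ?_ ?_)
    · rw [abs_mul, abs_mul, abs_of_nonneg (by positivity : (0:ℝ) ≤ (1-w)^6), abs_of_pos hE0]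
      calc _ ≤ (1-w)^6*(1*(w^11/(1-w))) := by gcongr
        _ = _ := by field_simp
    · rw [abs_mul, abs_mul, abs_of_nonneg (by positivity : (0:ℝ) ≤ (1-w)^6)]
      calc _ ≤ (1-w)^6*(w^7*(8/(5040*7))*3) := by
            gcongr; exact hb.trans (le_of_eq (by norm_num))
        _ = _ := by ring
  rw [intervalIntegral.integral_add ((by fun_prop : Continuous fun u : ℝ => (1-u^2)^5*(u^2)^11).intervalIntegrable _ _) ((by fun_prop : Continuous fun u : ℝ => (8/(5040*7):ℝ) * 3 * ((1-u^2)^6*(u^2)^7)).intervalIntegrable _ _), intervalIntegral.integral_const_mul, be5, be6, hPi] at hd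
  simp only [Finset.sum_range_succ, Finset.sum_range_zero, be] at hd
  norm_num [Nat.factorial] at hd
  rw [abs_le] at hd ⊢
  constructor <;> linarith [hd.1, hd.2]

theorem hor_cs (l m : List ℝ) (c : ℝ) (hc : 0 < c) (h : ∀ t, hor' m t = hor l t ^ 2) :
    ∫ t in Ioc (0:ℝ) 2, |hor l t| ≤ ((hor m 2 - hor m 0) / c + 2 * c) / 2 := by
  have hd : ∀ t, HasDerivAt (fun t => (hor m t / c + c * t) / 2) ((hor l t ^ 2 / c + c) / 2) t := fun t =>
    ((((hor_der m t).div_const c).add ((hasDerivAt_id t).const_mul c)).div_const 2).congr_deriv (by rw [← h]; simp)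
  have hcc : Continuous (fun t => (hor l t ^ 2 / c + c) / 2) := by
    have := hor_cont l; fun_prop
  have i := intervalIntegral.integral_eq_sub_of_hasDerivAt (a := 0) (b := 2) (fun t _ => hd t) (hcc.intervalIntegrable _ _)
  rw [intervalIntegral.integral_of_le (by norm_num)] at i
  refine le_trans (setIntegral_mono (hor_cont l).abs.integrableOn_Ioc hcc.integrableOn_Ioc fun t => ?_) (i.trans ?_).le
  · rw [le_div_iff₀ two_pos, ← sub_nonneg]
    have : hor l t ^ 2 / c + c - |hor l t| * 2 = (|hor l t| - c) ^ 2 / c := by rw [← sq_abs (hor l t)]; field_simp; ring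
    rw [this]; positivity
  · ring

/-- weight with log -/
noncomputable def pq (l m : List ℝ) (r t : ℝ) : ℝ := Real.exp (t - 1 / 2 - t^2) * (hor l t * (t + r * (t * Real.log t)) + r * hor m t)

theorem pq_cont (l m : List ℝ) (r : ℝ) : Continuous (pq l m r) := by
  have a := hor_cont l
  have b := hor_cont m
  have c := Real.continuous_mul_log
  unfold pq
  fun_prop

theorem pq_ibp (l m l1 m1 : List ℝ) (r : ℝ) (hl : ∀ t, hor l1 t = (2 + t - 2 * t^2) * hor l t + t * hor' l t)
    (hm : ∀ t, hor m1 t = (1 + t - 2 * t^2) * hor m t + t * hor' m t + t * hor l t) (h2 : hor l 2 = 0) (h3 : hor m 2 = 0) (y : ℝ) :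
    |y| * ‖∫ t in Ioc (0:ℝ) 2, (pq l m r t : ℂ) * (t : ℂ) ^ (y * Complex.I)‖ = ‖∫ t in Ioc (0:ℝ) 2, (pq l1 m1 r t : ℂ) * (t : ℂ) ^ (y * Complex.I)‖ := by
  refine ibp _ _ (pq_cont ..).continuousOn (pq_cont ..).continuousOn (by rw [pq, h2, h3]; ring) (fun t ht => ?_) y
  have d1 : HasDerivAt (fun t : ℝ => Real.exp (t - 1 / 2 - t^2)) (Real.exp (t - 1 / 2 - t^2) * (1 - 2 * t)) t :=
    (((hasDerivAt_id t).sub_const (1/2)).sub (hasDerivAt_pow 2 t)).exp.congr_deriv (by simp)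
  have d2 := (hasDerivAt_id t).add ((Real.hasDerivAt_mul_log ht.1.ne').const_mul r)
  have d3 := d1.mul (((hor_der l t).mul d2).add ((hor_der m t).const_mul r))
  refine ((hasDerivAt_id t).mul d3).congr_deriv ?_
  simp only [pq, hl, hm, id, Pi.add_apply, Pi.mul_apply]
  ring

theorem g_bd (r : ℝ) (h0 : 0 ≤ r) (h1 : r ≤ 0.0363) (y : ℝ) : y^2 * ‖∫ t in Ioc (0:ℝ) 2, (pq [0,0,0,8,-12,6,-1] [] r t : ℂ) * (t : ℂ) ^ (y * Complex.I)‖ ≤ 39 := by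
  have a1 := pq_ibp [0,0,0,8,-12,6,-1] [] [0,0,0,40,-64,14,22,-13,2] [0,0,0,0,8,-12,6,-1] r (fun t => by simp only [hor, hor']; ring) (fun t => by simp only [hor, hor']; ring) (by norm_num [hor]) (by norm_num [hor]) y
  have a2 := pq_ibp [0,0,0,40,-64,14,22,-13,2] [0,0,0,0,8,-12,6,-1] [0,0,0,200,-344,-46,318,-123,-37,28,-4] [0,0,0,0,80,-128,28,44,-26,4] r (fun t => by simp only [hor, hor']; ring) (fun t => by simp only [hor, hor']; ring) (by norm_num [hor]) (by norm_num [hor]) y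
  have b1 := hor_cs [0,0,0,200,-344,-46,318,-123,-37,28,-4] [0, 0, 0, 0, 0, 0, 0, 40000/7, -17200, 11104, 79424/5, -265868/11, 10142/3, 149096/13, -47844/7, -8227/15, 13639/8, -8063/17, -544/9, 1080/19, -56/5, 16/21] 9.247 (by norm_num) (fun t => by simp only [hor, hor']; ring)
  have b2 := hor_cs [0,0,0,0,80,-128,28,44,-26,4] [0, 0, 0, 0, 0, 0, 0, 0, 0, 6400/9, -2048, 20864/11, -32/3, -14640/13, 4880/7, -544/15, -129, 1028/17, -104/9, 16/19] 4.294 (by norm_num) (fun t => by simp only [hor, hor']; ring)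
  rw [← sq_abs, sq, mul_assoc, a1, a2]
  refine (pI_le _ y).trans ?_
  clear a1 a2
  obtain ⟨l, hl⟩ : ∃ l : List ℝ, l = [0,0,0,200,-344,-46,318,-123,-37,28,-4] := ⟨_, rfl⟩
  obtain ⟨m, hm⟩ : ∃ m : List ℝ, m = [0,0,0,0,80,-128,28,44,-26,4] := ⟨_, rfl⟩
  rw [← hl] at b1 ⊢
  rw [← hm] at b2 ⊢
  have k : ∫ t in Ioc (0:ℝ) 2, |pq l m r t| ≤ ∫ t in Ioc (0:ℝ) 2, (2.08 * |hor l t| + 0.0363 * |hor m t|) := by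
    have c1 := hor_cont l
    have c2 := hor_cont m
    refine setIntegral_mono_on (pq_cont ..).abs.integrableOn_Ioc (by fun_prop : Continuous _).integrableOn_Ioc measurableSet_Ioc fun t ht => ?_
    have hX : Real.exp (t - 1 / 2 - t^2) ≤ 1 := Real.exp_le_one_iff.2 (by nlinarith [sq_nonneg (t - 1/2)])
    have hu : t * Real.log t ≤ 2 := by
      have := mul_le_mul_of_nonneg_left (Real.log_le_sub_one_of_pos ht.1) ht.1.le
      nlinarith [ht.1, ht.2]
    have hlo : -1 ≤ t * Real.log t := by
      have := mul_le_mul_of_nonneg_left (Real.one_sub_inv_le_log_of_pos ht.1) ht.1.le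
      rw [mul_sub, mul_inv_cancel₀ ht.1.ne'] at this
      linarith [ht.1]
    have hz : |t + r * (t * Real.log t)| ≤ 2.08 := by
      have a1 := mul_le_mul_of_nonneg_left hu h0
      have a2 := mul_le_mul_of_nonneg_left hlo h0
      norm_num at h1 ⊢
      rw [abs_le]; constructor <;> linarith [ht.1, ht.2]
    rw [pq, abs_mul, Real.abs_exp]
    refine (mul_le_mul_of_nonneg_right hX (abs_nonneg _)).trans ?_
    rw [one_mul]
    refine (abs_add_le _ _).trans ?_
    rw [abs_mul, abs_mul, abs_of_nonneg h0, mul_comm]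
    gcongr
  rw [integral_add ((hor_cont l).abs.integrableOn_Ioc.const_mul _) ((hor_cont m).abs.integrableOn_Ioc.const_mul _), integral_const_mul, integral_const_mul] at k
  norm_num [hor] at b1 b2 k
  linarith

/-- tail -/
noncomputable def tm : ℝ → ℂ := (Icc (-200:ℝ) 200)ᶜ.indicator (fun y => 1 / (2 * Real.pi) * mm y)

theorem tm_meas : AEStronglyMeasurable tm volume :=
  ((continuous_const.mul mm_cont).measurable.indicator measurableSet_Icc.compl).aestronglyMeasurable

theorem tm_0 (y : ℝ) (h : |y| ≤ 200) : tm y = 0 := indicator_of_notMem (fun k : y ∈ (Icc (-200:ℝ) 200)ᶜ => k (abs_le.1 h)) _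

theorem tm_3 (y : ℝ) : |y|^3 * ‖tm y‖ ≤ 17.2 := by
  have e : ‖(1 / (2 * Real.pi) : ℂ)‖ = 1 / (2 * Real.pi) := by simp [abs_of_pos Real.pi_pos]
  have hp := Real.pi_gt_d2
  have h1 : ‖tm y‖ ≤ ‖1 / (2 * Real.pi) * mm y‖ := norm_indicator_le_norm_self _ _
  rw [norm_mul, e] at h1
  calc _ ≤ |y|^3 * (1 / (2 * Real.pi) * ‖mm y‖) := by gcongr
    _ = 1 / (2 * Real.pi) * (|y|^3 * ‖mm y‖) := by ring
    _ ≤ 1 / (2 * Real.pi) * 108 := by gcongr; exact (mm_bds y).2.2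
    _ ≤ 17.2 := by
      rw [div_mul_eq_mul_div, div_le_iff₀ (by positivity)]; norm_num at hp ⊢; linarith

theorem tm_int : Integrable tm ∧ ∫ y, ‖tm y‖ ≤ 4.4e-4 := by
  obtain ⟨h, h'⟩ := maj tm tm_meas 200 0 17.2 3 (by norm_num) (by norm_num) (by norm_num) (by norm_num) (fun y h => by rw [tm_0 y h, norm_zero])
    (fun y _ => by have := tm_3 y; rwa [← Real.rpow_natCast] at this)
  refine ⟨h, h'.trans ?_⟩
  rw [show (1:ℝ) - 3 = -(2:ℕ) by norm_num, Real.rpow_neg (by norm_num), Real.rpow_natCast]; norm_num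

theorem cp_meas (t : ℝ) (ht : 0 < t) : Continuous fun y : ℝ => (t : ℂ) ^ (-(y * Complex.I)) :=
  Continuous.const_cpow (by fun_prop) (Or.inl (by exact_mod_cast ht.ne'))

theorem e_eq (t : ℝ) (ht : 0 < t) : ((hcut t - hH 200 t : ℝ) : ℂ) = ∫ y : ℝ, (t : ℂ) ^ (-(y * Complex.I)) * tm y := by
  have hi : Integrable fun y : ℝ => 1 / (2 * Real.pi) * mm y * (t : ℂ) ^ (-(y * Complex.I)) := by
    refine (mm_int.1.const_mul (1 / (2 * Real.pi) : ℂ)).mul_bdd (c := 1) (cp_meas t ht).aestronglyMeasurable (Eventually.of_forall fun y => ?_)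
    rw [n1 t y ht]
  have h := hc_inv t ht
  rw [← integral_const_mul] at h
  rw [Complex.ofReal_sub, hH_eq t ht]
  change hc t - _ = _
  rw [h, ff, mw, integral_congr_ae (Eventually.of_forall fun y => (by ring : _ = 1 / (2 * Real.pi) * mm y * (t : ℂ) ^ (-(y * Complex.I)))), ← integral_add_compl measurableSet_Icc hi, add_sub_cancel_left, ← integral_indicator measurableSet_Icc.compl]
  refine integral_congr_ae (Eventually.of_forall fun y => ?_)
  by_cases hy : y ∈ (Icc (-200:ℝ) 200)ᶜ
  · simp only [tm, indicator_of_mem hy]; ring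
  · simp only [tm, indicator_of_notMem hy, mul_zero]

theorem e_bd (t : ℝ) (ht : 0 < t) : |hcut t - hH 200 t| ≤ 4.4e-4 := by
  rw [← Real.norm_eq_abs, ← Complex.norm_real, e_eq t ht]
  refine (norm_integral_le_integral_norm _).trans (le_trans (le_of_eq ?_) tm_int.2)
  refine integral_congr_ae (Eventually.of_forall fun y => ?_)
  simp only [norm_mul]; rw [n1 t y ht, one_mul]

theorem lin_bd (r : ℝ) (h0 : 0 ≤ r) (h1 : r ≤ 0.0363) : |∫ t in Ioc (0:ℝ) 2, pq [0,0,0,8,-12,6,-1] [] r t * (hcut t - hH 200 t)| ≤ 2.2e-7 := by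
  have gb := g_bd r h0 h1
  have pc := pq_cont [0,0,0,8,-12,6,-1] [] r
  obtain ⟨p, hp⟩ : ∃ p, p = pq [0,0,0,8,-12,6,-1] [] r := ⟨_, rfl⟩
  rw [← hp] at gb pc ⊢
  have hI : Integrable (fun q : ℝ × ℝ => (p q.1 : ℂ) * tm q.2 * (q.1 : ℂ) ^ (-(q.2 * Complex.I))) ((volume.restrict (Ioc (0:ℝ) 2)).prod volume) := by
    refine (Integrable.mul_prod (f := fun t => (p t : ℂ)) pc.integrableOn_Ioc.ofReal tm_int.1).mul_bdd (c := 1) (Measurable.aestronglyMeasurable (by fun_prop)) ?_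
    have : ∀ᵐ q ∂((volume.restrict (Ioc (0:ℝ) 2)).prod volume), q ∈ Ioc (0:ℝ) 2 ×ˢ (univ : Set ℝ) := by
      rw [← Measure.restrict_univ (μ := (volume : Measure ℝ)), Measure.restrict_restrict measurableSet_Ioc, inter_univ, Measure.prod_restrict]
      exact ae_restrict_mem (measurableSet_Ioc.prod MeasurableSet.univ)
    filter_upwards [this] with q hq
    rw [n1 _ _ hq.1.1]
  have e1 : ((∫ t in Ioc (0:ℝ) 2, p t * (hcut t - hH 200 t) : ℝ) : ℂ) = ∫ y : ℝ, ∫ t in Ioc (0:ℝ) 2, (p t : ℂ) * tm y * (t : ℂ) ^ (-(y * Complex.I)) := by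
    rw [← integral_integral_swap (f := fun t y => (p t : ℂ) * tm y * (t : ℂ) ^ (-(y * Complex.I))) hI, ← integral_complex_ofReal]
    refine setIntegral_congr_fun measurableSet_Ioc fun t ht => ?_
    rw [Complex.ofReal_mul, e_eq t ht.1, ← integral_const_mul]
    refine integral_congr_ae (Eventually.of_forall fun y => ?_)
    simp only []
    ring
  rw [← Real.norm_eq_abs, ← Complex.norm_real, e1]
  have e2 : ∀ y : ℝ, ‖∫ t in Ioc (0:ℝ) 2, (p t : ℂ) * tm y * (t : ℂ) ^ (-(y * Complex.I))‖ = ‖tm y‖ * ‖∫ t in Ioc (0:ℝ) 2, (p t : ℂ) * (t : ℂ) ^ ((-y : ℝ) * Complex.I)‖ := by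
    intro y
    rw [← norm_mul, ← integral_const_mul]
    congr 2; funext t; push_cast; ring_nf
  refine (norm_integral_le_integral_norm _).trans ?_
  refine (maj _ hI.integral_prod_right.aestronglyMeasurable 200 0 (17.2 * 39) 5 (by norm_num) (by norm_num) (by norm_num) (by norm_num) (fun y h => ?_) (fun y _ => ?_)).2.trans ?_
  · rw [e2, tm_0 y h, norm_zero, zero_mul]
  · simp only []
    rw [e2]
    have a := tm_3 y
    have b := gb (-y)
    rw [neg_sq, ← sq_abs] at b
    calc _ = (|y|^3 * ‖tm y‖) * (|y|^2 * ‖∫ t in Ioc (0:ℝ) 2, (p t : ℂ) * (t : ℂ) ^ ((-y : ℝ) * Complex.I)‖) := by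
          rw [show (5:ℝ) = ((5:ℕ):ℝ) by norm_num, Real.rpow_natCast]; ring
      _ ≤ _ := by gcongr
  · rw [show (1:ℝ) - 5 = -(4:ℕ) by norm_num, Real.rpow_neg (by norm_num), Real.rpow_natCast]; norm_num

theorem e_meas : AEStronglyMeasurable (fun t => hcut t - hH 200 t) (volume.restrict (Ioi (0:ℝ))) := by
  have h := (hcut_meas.sub (Complex.measurable_re.comp (ff_meas (fun y => 1 / (2 * Real.pi) * mm y) (continuous_const.mul mm_cont)))).aestronglyMeasurable (μ := volume.restrict (Ioi (0:ℝ)))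
  refine h.congr ?_
  filter_upwards [ae_restrict_mem measurableSet_Ioi] with t ht
  simp only [Pi.sub_apply, Function.comp_apply]
  rw [← hH_eq t ht, Complex.ofReal_re]

theorem A_int (r : ℝ) : Continuous (fun t => jw (t - 1) * (1 + r * Real.log t)) ∧
    ∫ t in Ioc (0:ℝ) 2, jw (t - 1) * (1 + r * Real.log t) = (∫ u in (-1:ℝ)..1, jw u) + r * ∫ u in (-1:ℝ)..1, jw u * Real.log (1 + u) := by
  have hj : Continuous jw := by unfold jw; fun_prop
  constructor
  · have e : (fun t => jw (t - 1) * (1 + r * Real.log t)) = fun t => t^5 * (2 - t)^6 * Real.exp (-(t-1)^2) * (t + r * (t * Real.log t)) := by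
      funext t; rw [jw]; ring
    rw [e]
    have := Real.continuous_mul_log
    fun_prop
  · rw [← intervalIntegral.integral_of_le (by norm_num)]
    have := intervalIntegral.integral_comp_sub_right (a := 0) (b := 2) (fun u => jw u * (1 + r * Real.log (1 + u))) 1
    norm_num at this
    rw [this, ← intervalIntegral.integral_const_mul, ← intervalIntegral.integral_add (hj.intervalIntegrable _ _) ((by simpa using jlog_i 1 (Or.inl rfl) : IntervalIntegrable (fun u => jw u * Real.log (1+u)) volume (-1) 1).const_mul r)]
    refine intervalIntegral.integral_congr fun u _ => ?_
    ring

/-- weight -/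
noncomputable def VV (r t : ℝ) : ℝ := t^2 * Real.exp (-t^2) * (1 + r * Real.log t)

theorem VV_bd (r : ℝ) (h0 : 0 ≤ r) : IntegrableOn (VV r) (Ioi 0) ∧ ∫ t in Ioi (0:ℝ), |VV r t| ≤ 1/2 + r := by
  have i1 := integrableOn_rpow_mul_exp_neg_rpow (p := 2) (s := 1) (by norm_num) (by norm_num)
  have i3 := integrableOn_rpow_mul_exp_neg_rpow (p := 2) (s := 3) (by norm_num) (by norm_num)
  have v1 := integral_rpow_mul_exp_neg_rpow (p := 2) (q := 1) (by norm_num) (by norm_num)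
  have v3 := integral_rpow_mul_exp_neg_rpow (p := 2) (q := 3) (by norm_num) (by norm_num)
  norm_num at v1 v3 i1 i3
  have hm : Measurable (VV r) := by unfold VV; fun_prop
  have hb : ∀ t ∈ Ioi (0:ℝ), ‖VV r t‖ ≤ (1/2 + r) * (t * Real.exp (-t^2) + t^3 * Real.exp (-t^2)) := by
    intro t ht
    have ht : 0 < t := ht
    have hE := Real.exp_pos (-t^2)
    have hl : t * |Real.log t| ≤ 1 + t^2 := by
      have a := mul_le_mul_of_nonneg_left (Real.log_le_sub_one_of_pos ht) ht.le
      have b := mul_le_mul_of_nonneg_left (Real.one_sub_inv_le_log_of_pos ht) ht.le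
      rw [mul_sub, mul_inv_cancel₀ ht.ne'] at b
      rw [← abs_of_pos ht, ← abs_mul, abs_of_pos ht, abs_le]
      constructor <;> nlinarith
    rw [VV, Real.norm_eq_abs, abs_mul, abs_of_pos (by positivity)]
    have h2 : |1 + r * Real.log t| ≤ 1 + r * |Real.log t| := by
      refine (abs_add_le _ _).trans ?_
      rw [abs_mul, abs_of_nonneg h0, abs_one]
    calc _ ≤ t^2 * Real.exp (-t^2) * (1 + r * |Real.log t|) := by gcongr
      _ = t * Real.exp (-t^2) * (t + r * (t * |Real.log t|)) := by ring
      _ ≤ t * Real.exp (-t^2) * ((1 + t^2) / 2 + r * (1 + t^2)) := by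
        gcongr; nlinarith [sq_nonneg (t - 1)]
      _ = _ := by ring
  have ii := (i1.add i3).const_mul (1/2 + r)
  have hi : IntegrableOn (VV r) (Ioi 0) := Integrable.mono' ii hm.aestronglyMeasurable (by
    filter_upwards [ae_restrict_mem measurableSet_Ioi] with t ht using hb t ht)
  refine ⟨hi, (setIntegral_mono_on hi.norm ii measurableSet_Ioi hb).trans ?_⟩
  simp only [Pi.add_apply]
  rw [integral_const_mul, integral_add i1 i3, v1, v3]
  norm_num

theorem H_main (r : ℝ) (h0 : 0 ≤ r) (h1 : r ≤ 0.0363) :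
    |(∫ t in Ioi (0:ℝ), etaPlus 200 t ^ 2 * (1 + r * Real.log t)) - (0.640206 - 0.021095 * r)| ≤ 1.9e-6 := by
  obtain ⟨e, he⟩ : ∃ e : ℝ → ℝ, e = fun t => hcut t - hH 200 t := ⟨_, rfl⟩
  have em := e_meas
  rw [← he] at em
  have eb : ∀ᵐ t ∂(volume.restrict (Ioi (0:ℝ))), ‖e t‖ ≤ 4.4e-4 := by
    filter_upwards [ae_restrict_mem measurableSet_Ioi] with t ht
    rw [he]; exact e_bd t ht
  have L := lin_bd r h0 h1
  obtain ⟨p, hp⟩ : ∃ p, p = pq [0,0,0,8,-12,6,-1] [] r := ⟨_, rfl⟩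
  have pc := pq_cont [0,0,0,8,-12,6,-1] [] r
  rw [← hp] at pc
  have L' : |∫ t in Ioc (0:ℝ) 2, p t * e t| ≤ 2.2e-7 := by rw [hp, he]; exact L
  obtain ⟨ac, ai⟩ := A_int r
  obtain ⟨vi, vb⟩ := VV_bd r h0
  have sub : Ioc (0:ℝ) 2 ⊆ Ioi 0 := Ioc_subset_Ioi_self
  have iA : IntegrableOn ((Ioc (0:ℝ) 2).indicator fun t => jw (t - 1) * (1 + r * Real.log t)) (Ioi 0) :=
    ((integrable_indicator_iff measurableSet_Ioc).2 ac.integrableOn_Ioc).integrableOn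
  have iB : IntegrableOn ((Ioc (0:ℝ) 2).indicator fun t => p t * e t) (Ioi 0) :=
    ((integrable_indicator_iff measurableSet_Ioc).2 (Integrable.mul_bdd (c := 4.4e-4) pc.integrableOn_Ioc (em.mono_measure (Measure.restrict_mono sub le_rfl)) (ae_restrict_of_ae_restrict_of_subset sub eb))).integrableOn
  have iQ : IntegrableOn (fun t => VV r t * e t^2) (Ioi 0) := Integrable.mul_bdd (c := 4.4e-4^2) vi (em.pow 2) (by
    filter_upwards [eb] with t ht
    rw [norm_pow]; gcongr)
  have key : ∫ t in Ioi (0:ℝ), etaPlus 200 t ^ 2 * (1 + r * Real.log t) = ∫ t in Ioi (0:ℝ), ((Ioc (0:ℝ) 2).indicator (fun t => jw (t - 1) * (1 + r * Real.log t)) t - 2 * (Ioc (0:ℝ) 2).indicator (fun t => p t * e t) t + VV r t * e t^2) := by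
    refine setIntegral_congr_fun measurableSet_Ioi fun t ht => ?_
    have ht : 0 < t := ht
    have hh : hH 200 t = hcut t - e t := by rw [he]; ring
    have hE : Real.exp (-t^2/2)^2 = Real.exp (-t^2) := by rw [← Real.exp_nat_mul]; congr 1; push_cast; ring
    rw [etaPlus, hh, mul_pow, mul_pow, hE, VV]
    by_cases h2 : t ≤ 2
    · have hm : t ∈ Ioc 0 2 := ⟨ht, h2⟩
      have x1 : Real.exp (t - 1/2 - t^2) = Real.exp (t - 1/2) * Real.exp (-t^2) := by rw [← Real.exp_add]; ring_nf
      have x2 : Real.exp (-(t-1)^2) = Real.exp (t - 1/2)^2 * Real.exp (-t^2) := by rw [← Real.exp_nat_mul, ← Real.exp_add]; ring_nf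
      rw [indicator_of_mem hm, indicator_of_mem hm, hp, pq, jw, hcut, if_pos ⟨ht.le, h2⟩, x1, x2]
      simp only [hor]
      ring
    · rw [indicator_of_notMem (fun k => h2 k.2), indicator_of_notMem (fun k => h2 k.2), hcut, if_neg (fun k => h2 k.2)]
      ring
  have iAB : IntegrableOn (fun t => (Ioc (0:ℝ) 2).indicator (fun t => jw (t - 1) * (1 + r * Real.log t)) t - 2 * (Ioc (0:ℝ) 2).indicator (fun t => p t * e t) t) (Ioi 0) := iA.sub (iB.const_mul 2)
  rw [key, integral_add iAB iQ, integral_sub iA (iB.const_mul 2), integral_const_mul, setIntegral_indicator measurableSet_Ioc, setIntegral_indicator measurableSet_Ioc, inter_eq_self_of_subset_right sub, ai]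
  have hQ : |∫ t in Ioi (0:ℝ), VV r t * e t^2| ≤ 4.4e-4^2 * (1/2 + r) := by
    rw [← Real.norm_eq_abs]
    refine (norm_integral_le_integral_norm _).trans (le_trans (integral_mono_ae iQ.norm (vi.norm.const_mul (4.4e-4^2)) ?_) ?_)
    · filter_upwards [eb] with t ht
      rw [norm_mul, norm_pow, mul_comm]; gcongr
    · rw [integral_const_mul]; gcongr; exact vb
  have hI := I0
  change |(∫ u in (-1:ℝ)..1, jw u) - _| ≤ _ at hI
  have hJ := J0
  have hJr : |r * ((∫ u in (-1:ℝ)..1, jw u * Real.log (1+u)) + 0.021095)| ≤ 0.0363 * 2e-5 := by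
    rw [abs_mul, abs_of_nonneg h0]; gcongr
  have hQ' : 4.4e-4^2 * (1/2 + r) ≤ 1.1e-7 := by norm_num at h1 ⊢; linarith
  rw [abs_le] at *
  norm_num at hI hJr hQ hQ' L' ⊢
  constructor <;> linarith [hI.1, hI.2, hJr.1, hJr.2, hQ.1, hQ.2, L'.1, L'.2]

theorem eta_c (t : ℝ) (ht : 0 < t) : ((etaPlus 200 t ^ 2 : ℝ) : ℂ) = ff (fun y => 1 / (2 * Real.pi) * mm y) t ^ 2 * kk 2 t := by
  have hE : Real.exp (-t^2/2)^2 = Real.exp (-t^2) := by rw [← Real.exp_nat_mul]; congr 1; push_cast; ring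
  rw [← hH_eq t ht, kk, etaPlus, mul_pow, mul_pow, hE, Real.rpow_two]
  push_cast
  have : (t:ℂ)^(2:ℂ) = (t:ℂ)^2 := by exact_mod_cast Complex.cpow_natCast (t:ℂ) 2
  rw [this]

theorem E1_main (x : ℝ) (hx : (10:ℝ)^12 ≤ x) :
    |(∑' n : ℕ, ArithmeticFunction.vonMangoldt n * Real.log n * (etaPlus 200 (n / x))^2) - x * ∫ t in Ioi (0:ℝ), (etaPlus 200 t)^2 * Real.log (x * t)|
      ≤ 3.3^2 * (Real.log x + 1/0.24) * (13.84 * √x + 5.4e-17 * x) := by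
  have hx0 : 0 < x := lt_of_lt_of_le (by norm_num) hx
  have B := B_main (fun y => 1 / (2 * Real.pi) * mm y) (continuous_const.mul mm_cont) x 3.3 (by norm_num at hx ⊢; exact hx) A_bd
  rw [← Real.norm_eq_abs, ← Complex.norm_real]
  refine le_trans (le_of_eq ?_) B
  congr 1
  rw [Complex.ofReal_sub, Complex.ofReal_mul, Complex.ofReal_tsum, ← integral_complex_ofReal]
  congr 1
  · refine tsum_congr fun n => ?_
    rcases Nat.eq_zero_or_pos n with rfl | hn
    · simp
    · rw [← eta_c (n/x) (by positivity)]; push_cast; rfl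
  · congr 1
    refine setIntegral_congr_fun measurableSet_Ioi fun t ht => ?_
    rw [← eta_c t ht]; push_cast; rfl

theorem logx (x : ℝ) (hx : (10:ℝ)^12 ≤ x) : 27.6 ≤ Real.log x := by
  have h2 : Real.log ((10:ℝ)^12) ≤ Real.log x := Real.log_le_log (by norm_num) hx
  have h10 : (2.3:ℝ) ≤ Real.log 10 := by
    rw [Real.le_log_iff_exp_le (by norm_num)]
    have : Real.exp 2.3 = Real.exp 1 ^ 2 * Real.exp 0.3 := by rw [← Real.exp_nat_mul, ← Real.exp_add]; norm_num
    rw [this]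
    have a := e2le
    have b := Real.exp_bound' (x := 0.3) (by norm_num) (by norm_num) (n := 6) (by norm_num)
    norm_num [Finset.sum_range_succ, Nat.factorial] at a b ⊢
    calc _ ≤ _ := mul_le_mul a b (Real.exp_pos _).le (by norm_num)
      _ ≤ _ := by norm_num
  rw [Real.log_pow] at h2
  norm_num at h2 h10 ⊢
  linarith

theorem etaPlus_sq_log_sum (x : ℝ) (hx : (10:ℝ)^12 ≤ x) :
    ∃ E₁ E₂ : ℝ,
      (∑' n : ℕ, ArithmeticFunction.vonMangoldt n * Real.log n * (etaPlus 200 (n / x))^2)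
        = x * (∫ t in Set.Ioi (0:ℝ), (etaPlus 200 t)^2 * Real.log (x * t))
          + E₁ * (x * Real.log x) ∧
      (∑' n : ℕ, ArithmeticFunction.vonMangoldt n * Real.log n * (etaPlus 200 (n / x))^2)
        = 0.640206 * (x * Real.log x) - 0.021095 * x + E₂ * (x * Real.log x) ∧
      |E₁| ≤ 1.536e-15 + 310.84 / Real.sqrt x ∧
      |E₂| ≤ 2e-6 + 310.84 / Real.sqrt x := by
  have hx0 : 0 < x := lt_of_lt_of_le (by norm_num) hx
  have hl := logx x hx
  have hl0 : 0 < Real.log x := lt_of_lt_of_le (by norm_num) hl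
  have B := E1_main x hx
  have Hm := H_main (1 / Real.log x) (by positivity) (by
    rw [div_le_iff₀ hl0]; norm_num at hl ⊢; linarith)
  have hS : ∫ t in Ioi (0:ℝ), (etaPlus 200 t)^2 * Real.log (x * t) = Real.log x * ∫ t in Ioi (0:ℝ), etaPlus 200 t ^ 2 * (1 + 1 / Real.log x * Real.log t) := by
    rw [← integral_const_mul]
    refine setIntegral_congr_fun measurableSet_Ioi fun t ht => ?_
    rw [Real.log_mul hx0.ne' (ne_of_gt ht)]
    field_simp
  rw [hS] at B ⊢
  obtain ⟨S, hSS⟩ : ∃ S, S = ∑' n : ℕ, ArithmeticFunction.vonMangoldt n * Real.log n * (etaPlus 200 (n / x))^2 := ⟨_, rfl⟩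
  obtain ⟨I, hI⟩ : ∃ I, I = ∫ t in Ioi (0:ℝ), etaPlus 200 t ^ 2 * (1 + 1 / Real.log x * Real.log t) := ⟨_, rfl⟩
  rw [← hSS, ← hI] at B ⊢
  rw [← hI] at Hm
  clear hS hSS hI
  generalize Real.log x = l at *
  have hs0 : 0 < √x := Real.sqrt_pos.2 hx0
  have hE1 : |(S - x * (l * I)) / (x * l)| ≤ 1.536e-15 + 310.84 / √x := by
    rw [abs_div, abs_of_pos (by positivity : 0 < x * l), div_le_iff₀ (by positivity)]
    refine B.trans ?_
    have e : (1.536e-15 + 310.84 / √x) * (x * l) = l * (310.84 * √x + 1.536e-15 * x) := by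
      have : x = √x * √x := (Real.mul_self_sqrt hx0.le).symm
      field_simp
      linear_combination 310.84 * this
    rw [e]
    have h3 : (3.3:ℝ)^2 * (l + 1/0.24) ≤ l * 13 := by norm_num at hl ⊢; linarith
    calc _ ≤ l * 13 * (13.84 * √x + 5.4e-17 * x) := by gcongr
      _ = l * (13 * (13.84 * √x + 5.4e-17 * x)) := by ring
      _ ≤ _ := by gcongr; norm_num; nlinarith
  refine ⟨(S - x * (l * I)) / (x * l), (S - x * (l * I)) / (x * l) + (I - (0.640206 - 0.021095 * (1 / l))), ?_, ?_, hE1, ?_⟩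
  · field_simp; ring
  · field_simp; ring
  · refine (abs_add_le _ _).trans ((add_le_add hE1 Hm).trans ?_)
    norm_num
    linarith
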